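/- Let K be a global function field of characteristic p, let q ≠ p be a prime, let 𝐊 be a q-bounded (possibly infinite) algebraic extension of K, and let S be a nonempty finite set of primes of K. If either (1) every prime in S is uniformly q-bounded in 𝐊, or (2) 𝐊 is a Galois extension of K, then the ring O_{𝐊,S} of S-integral functions is first-order definable over 𝐊 in the language of rings with parameters from 𝐊. -/

import Mathlib

noncomputable section

structure FFPrime (K : Type) [Field K] where
  ord : K → WithTop ℤ
  ord_zero : ord 0 = ⊤
  ord_ne_top : ∀ x : K, x ≠ 0 → ord x ≠ ⊤
  ord_one : ord 1 = 0
  ord_mul : ∀ x y : K, ord (x * y) = ord x + ord y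
  ord_add : ∀ x y : K, min (ord x) (ord y) ≤ ord (x + y)
  ord_surj : ∀ n : ℤ, ∃ x : K, ord x = (n : WithTop ℤ)

namespace FFPrime

variable {K L : Type} [Field K] [Field L]

def LiesOverWith (w : FFPrime L) (v : FFPrime K) (φ : K →+* L) (e : ℕ) : Prop :=
  0 < e ∧ ∀ x : K, w.ord (φ x) = ((e : ℤ) : WithTop ℤ) * v.ord x

def LiesOver (w : FFPrime L) (v : FFPrime K) (φ : K →+* L) : Prop :=
  ∃ e : ℕ, w.LiesOverWith v φ e

open Classical in
noncomputable def ramIdx (w : FFPrime L) (v : FFPrime K) (φ : K →+* L) : ℕ :=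
  if h : ∃ e : ℕ, w.LiesOverWith v φ e then h.choose else 0

def HasResidueCard (v : FFPrime K) (n : ℕ) : Prop :=
  ∃ s : Finset K, s.card = n ∧ (∀ x ∈ s, 0 ≤ v.ord x) ∧
    (∀ x ∈ s, ∀ y ∈ s, x ≠ y → ¬ 0 < v.ord (x - y)) ∧
    (∀ z : K, 0 ≤ v.ord z → ∃ x ∈ s, 0 < v.ord (z - x))

open Classical in
noncomputable def resDeg (w : FFPrime L) (v : FFPrime K) : ℕ :=
  if h : ∃ f : ℕ, 0 < f ∧ ∃ m n : ℕ, 1 < m ∧ v.HasResidueCard m ∧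
      w.HasResidueCard n ∧ n = m ^ f then h.choose else 0

def SplitsCompletely (v : FFPrime K) (φ : K →+* L) : Prop :=
  ∀ w : FFPrime L, w.LiesOver v φ → w.ramIdx v φ = 1 ∧ w.resDeg v = 1

def IsInert (v : FFPrime K) (M : Type) [Field M] [Algebra K M] : Prop :=
  (∃! w : FFPrime M, w.LiesOver v (algebraMap K M)) ∧
    ∀ w : FFPrime M, w.LiesOver v (algebraMap K M) →
      w.ramIdx v (algebraMap K M) = 1 ∧ w.resDeg v = Module.finrank K M

def Ramifies (v : FFPrime K) (φ : K →+* L) : Prop :=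
  ∃ w : FFPrime L, w.LiesOver v φ ∧ 2 ≤ w.ramIdx v φ

def OrdDvd (v : FFPrime K) (q : ℕ) (z : K) : Prop :=
  ∃ n : ℤ, v.ord z = (((q : ℤ) * n : ℤ) : WithTop ℤ)

end FFPrime

structure FFVal (B : Type) [Field B] where
  ord : B → WithTop ℚ
  ord_zero : ord 0 = ⊤
  ord_ne_top : ∀ x : B, x ≠ 0 → ord x ≠ ⊤
  ord_one : ord 1 = 0
  ord_mul : ∀ x y : B, ord (x * y) = ord x + ord y
  ord_add : ∀ x y : B, min (ord x) (ord y) ≤ ord (x + y)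
  nontrivial : ∃ x : B, ord x ≠ 0 ∧ ord x ≠ ⊤

def FFVal.RestrictsTo {K B : Type} [Field K] [Field B] (V : FFVal B) (v : FFPrime K)
    (φ : K →+* B) : Prop :=
  ∃ c : ℚ, 0 < c ∧
    ∀ x : K, V.ord (φ x) = ((c : ℚ) : WithTop ℚ) * WithTop.map (fun n : ℤ => (n : ℚ)) (v.ord x)

def IsQBounded (q : ℕ) (F0 B : Type) [Field F0] [Field B] [Algebra F0 B] : Prop :=
  ∀ V : FFVal B, ∃ C : ℕ,
    ∀ L : IntermediateField F0 B, FiniteDimensional F0 L →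
      ∀ v0 : FFPrime F0, ∀ vL : FFPrime L,
        V.RestrictsTo v0 (algebraMap F0 B) →
        V.RestrictsTo vL L.val.toRingHom →
        padicValNat q (vL.ramIdx v0 (algebraMap F0 L)) ≤ C ∧
        padicValNat q (vL.resDeg v0) ≤ C

def UnifQBoundedRam (q : ℕ) {K : Type} [Field K] (B : Type) [Field B] [Algebra K B]
    (v : FFPrime K) : Prop :=
  ∃ C : ℕ, ∀ F : IntermediateField K B, FiniteDimensional K F →
    ∀ w : FFPrime F, w.LiesOver v (algebraMap K F) →
      padicValNat q (w.ramIdx v (algebraMap K F)) ≤ C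

def UnifAbsBoundedRam {K : Type} [Field K] (B : Type) [Field B] [Algebra K B]
    (v : FFPrime K) : Prop :=
  ∃ C : ℕ, ∀ F : IntermediateField K B, FiniteDimensional K F →
    ∀ w : FFPrime F, w.LiesOver v (algebraMap K F) →
      w.ramIdx v (algebraMap K F) ≤ C

def UnifQBoundedRes (q : ℕ) {K : Type} [Field K] (B : Type) [Field B] [Algebra K B]
    (v : FFPrime K) : Prop :=
  ∃ C : ℕ, ∀ F : IntermediateField K B, FiniteDimensional K F →
    ∀ w : FFPrime F, w.LiesOver v (algebraMap K F) →
      padicValNat q (w.resDeg v) ≤ C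

def UniformlyQBoundedAt (q : ℕ) {K : Type} [Field K] (B : Type) [Field B] [Algebra K B]
    (v : FFPrime K) : Prop :=
  UnifQBoundedRam q B v ∧ UnifQBoundedRes q B v

def valIntegralClosure {K : Type} [Field K] (v : FFPrime K) (B : Type) [Field B]
    [Algebra K B] : Set B :=
  {x : B | ∃ P : Polynomial K, P.Monic ∧ (∀ n : ℕ, 0 ≤ v.ord (P.coeff n)) ∧
    Polynomial.aeval x P = 0}

def sIntegralClosure {K : Type} [Field K] (S : Set (FFPrime K)) (B : Type) [Field B]
    [Algebra K B] : Set B :=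
  {x : B | ∃ P : Polynomial K, P.Monic ∧
    (∀ n : ℕ, ∀ v : FFPrime K, v ∉ S → 0 ≤ v.ord (P.coeff n)) ∧
    Polynomial.aeval x P = 0}

def unitsAtS {K : Type} [Field K] (S : Set (FFPrime K)) (B : Type) [Field B]
    [Algebra K B] : Set B :=
  {x : B | ∀ V : FFVal B, (∃ v ∈ S, V.RestrictsTo v (algebraMap K B)) → V.ord x = 0}

def onesAtS {K : Type} [Field K] (S : Set (FFPrime K)) (B : Type) [Field B]
    [Algebra K B] : Set B :=
  {x : B | ∀ V : FFVal B, (∃ v ∈ S, V.RestrictsTo v (algebraMap K B)) → 0 < V.ord (x - 1)}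

def FODefinable {R : Type} [CommRing R] (X : Set R) : Prop :=
  letI : FirstOrder.Ring.CompatibleRing R := FirstOrder.Ring.compatibleRingOfRing R
  Set.Definable₁ (Set.univ : Set R) FirstOrder.Language.ring X

def ExistDefinable {R : Type} [CommRing R] (X : Set R) : Prop :=
  ∃ (k m : ℕ) (P : Fin m → MvPolynomial (Fin (k + 1)) R),
    ∀ x : R, x ∈ X ↔ ∃ y : Fin k → R, ∀ i : Fin m,
      MvPolynomial.eval (Fin.cons x y) (P i) = 0

def NormTower2Solvable (q : ℕ) (F : Type) [Field F] (a b x : F) : Prop :=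
  ∀ (M1 : Type) [Field M1] [Algebra F M1] (α1 : M1),
    α1 ^ q = algebraMap F M1 (1 + (b * x ^ q + b ^ q)⁻¹) →
    IntermediateField.adjoin F {α1} = ⊤ →
    ∀ (M2 : Type) [Field M2] [Algebra M1 M2] (α2 : M2),
      α2 ^ q = algebraMap M1 M2 (algebraMap F M1 (1 + (a + a⁻¹) * b⁻¹)) →
      IntermediateField.adjoin M1 {α2} = ⊤ →
      ∀ (M3 : Type) [Field M3] [Algebra M2 M3] (α3 : M3),
        α3 ^ q = algebraMap M2 M3 (algebraMap M1 M2 (algebraMap F M1 a)) →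
        IntermediateField.adjoin M2 {α3} = ⊤ →
        ∃ y : M3, Algebra.norm M2 y = algebraMap M1 M2 (algebraMap F M1 (b * x ^ q + b ^ q))

def NormTower4Solvable (q : ℕ) (F : Type) [Field F] (a b x : F) : Prop :=
  ∀ (M1 : Type) [Field M1] [Algebra F M1] (α1 : M1),
    α1 ^ q = algebraMap F M1 (1 + (b * x ^ q + b ^ q)⁻¹) →
    IntermediateField.adjoin F {α1} = ⊤ →
    ∀ (M3 : Type) [Field M3] [Algebra M1 M3] (α3 : M3),
      α3 ^ q = algebraMap M1 M3 (algebraMap F M1 (1 + x⁻¹)) →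
      IntermediateField.adjoin M1 {α3} = ⊤ →
      ∀ (M4 : Type) [Field M4] [Algebra M3 M4] (α4 : M4),
        α4 ^ q = algebraMap M3 M4 (algebraMap M1 M3 (algebraMap F M1 (1 + (a + a⁻¹) * x⁻¹))) →
        IntermediateField.adjoin M3 {α4} = ⊤ →
        ∀ (M5 : Type) [Field M5] [Algebra M4 M5] (α5 : M5),
          α5 ^ q = algebraMap M4 M5 (algebraMap M3 M4 (algebraMap M1 M3 (algebraMap F M1 a))) →
          IntermediateField.adjoin M4 {α5} = ⊤ →
          ∃ y : M5, Algebra.norm M4 y =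
            algebraMap M3 M4 (algebraMap M1 M3 (algebraMap F M1 (b * x ^ q + b ^ q)))

def NormTower4Unsolvable (q : ℕ) (F : Type) [Field F] (a b x : F) : Prop :=
  ∀ (M1 : Type) [Field M1] [Algebra F M1] (α1 : M1),
    α1 ^ q = algebraMap F M1 (1 + (b * x ^ q + b ^ q)⁻¹) →
    IntermediateField.adjoin F {α1} = ⊤ →
    ∀ (M3 : Type) [Field M3] [Algebra M1 M3] (α3 : M3),
      α3 ^ q = algebraMap M1 M3 (algebraMap F M1 (1 + x⁻¹)) →
      IntermediateField.adjoin M1 {α3} = ⊤ →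
      ∀ (M4 : Type) [Field M4] [Algebra M3 M4] (α4 : M4),
        α4 ^ q = algebraMap M3 M4 (algebraMap M1 M3 (algebraMap F M1 (1 + (a + a⁻¹) * x⁻¹))) →
        IntermediateField.adjoin M3 {α4} = ⊤ →
        ∀ (M5 : Type) [Field M5] [Algebra M4 M5] (α5 : M5),
          α5 ^ q = algebraMap M4 M5 (algebraMap M3 M4 (algebraMap M1 M3 (algebraMap F M1 a))) →
          IntermediateField.adjoin M4 {α5} = ⊤ →
          ¬ ∃ y : M5, Algebra.norm M4 y =
            algebraMap M3 M4 (algebraMap M1 M3 (algebraMap F M1 (b * x ^ q + b ^ q)))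

open Finset (induction_on sum_insert mem_image_of_mem mem_erase mem_singleton range mem_range mul_sum sum_congr sum_le_sum single_le_sum mem_univ Icc sum_filter mem_filter sum_eq_zero sum_const mem_Icc sum_comm sum_mul sum_sub_distrib mem_image sum_image sum_nonneg univ card_univ mem_insert_of_mem prod_congr sum_eq_single)
open Finsupp (single single_apply mem_support_iff)
open Polynomial (aeval_def eval_map coeff_coe IsRoot)
open Module (finrank Basis)
open QuotientAddGroup (mk_nsmul mk_add mk_surjective eq_zero_iff)
open IntermediateField (adjoin subset_adjoin finiteDimensional_adjoin)
open Algebra (trdeg EssFiniteType smul_def trace)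
open RingHom (comp_apply)
open Nat (card one_lt_pow)
open AddSubgroup (mem_closure_singleton relIndex_self mem_sup relIndex_mul_relIndex relIndex_bot_left)
open Subgroup (zpowers)
open IsScalarTower (toAlgHom of_algebraMap_eq algebraMap_eq)
open IsPrimitiveRoot (of_map_of_injective)
open WithTop (coe_lt_top coe_le_coe coe_lt_coe)
open AlgEquiv (commutes)
open ZMod (val_lt)
open Complex (nonneg_iff ofReal_re)
open Function (Injective)

abbrev FDiv (X : Type) [Field X] := FFPrime X →₀ ℤ

namespace FFPrime

section basic
variable {X : Type} [Field X] (v : FFPrime X)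

def val (x : X) : ℤ := (v.ord x).untopD 0

lemma ord_eq {x : X} (hx : x ≠ 0) : v.ord x = (v.val x : WithTop ℤ) := by
  obtain ⟨n, hn⟩ := WithTop.ne_top_iff_exists.mp (v.ord_ne_top x hx)
  simp [val, ← hn]

lemma val_eq_of_ord {x : X} {n : ℤ} (h : v.ord x = n) : v.val x = n := by simp [val, h]

lemma ne_zero_of_ord {x : X} {n : ℤ} (h : v.ord x = n) : x ≠ 0 := by
  rintro rfl
  rw [v.ord_zero] at h
  exact WithTop.top_ne_coe h

lemma val_one : v.val 1 = 0 := by simp [val, v.ord_one]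

lemma val_mul {x y : X} (hx : x ≠ 0) (hy : y ≠ 0) : v.val (x * y) = v.val x + v.val y := by
  apply v.val_eq_of_ord
  rw [v.ord_mul, v.ord_eq hx, v.ord_eq hy]; rfl

lemma val_pow {x : X} (hx : x ≠ 0) (n : ℕ) : v.val (x ^ n) = n * v.val x := by
  induction n with
  | zero => simp [val_one]
  | succ n ih => rw [pow_succ, v.val_mul (pow_ne_zero _ hx) hx, ih]; push_cast; ring

lemma val_inv {x : X} (hx : x ≠ 0) : v.val x⁻¹ = - v.val x := by
  have := v.val_mul hx (inv_ne_zero hx)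
  rw [mul_inv_cancel₀ hx, val_one] at this; omega

lemma val_div {x y : X} (hx : x ≠ 0) (hy : y ≠ 0) : v.val (x / y) = v.val x - v.val y := by
  rw [div_eq_mul_inv, v.val_mul hx (inv_ne_zero hy), v.val_inv hy]; ring

lemma val_zpow {x : X} (hx : x ≠ 0) (n : ℤ) : v.val (x ^ n) = n * v.val x := by
  cases n with
  | ofNat n => simpa using v.val_pow hx n
  | negSucc n =>
    rw [zpow_negSucc, v.val_inv (pow_ne_zero _ hx), v.val_pow hx, Int.negSucc_eq]; push_cast; ring

lemma val_eq_zero_of_pow {x : X} {n : ℕ} (hn : n ≠ 0) (h : x ^ n = 1) : v.val x = 0 := by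
  have hx : x ≠ 0 := by rintro rfl; simp [hn] at h
  have := v.val_pow hx n
  rw [h, val_one] at this
  have hn' : (n : ℤ) ≠ 0 := by exact_mod_cast hn
  rcases mul_eq_zero.mp this.symm with h | h
  · exact absurd h hn'
  · exact h

lemma val_neg (x : X) : v.val (-x) = v.val x := by
  by_cases hx : x = 0
  · simp [hx]
  rw [← neg_one_mul, v.val_mul (by simp) hx, v.val_eq_zero_of_pow (n := 2) (by simp) (by simp), zero_add]

lemma ord_neg (x : X) : v.ord (-x) = v.ord x := by
  by_cases hx : x = 0
  · simp [hx]
  rw [v.ord_eq hx, v.ord_eq (neg_ne_zero.mpr hx), val_neg]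

lemma ord_sub (x y : X) : min (v.ord x) (v.ord y) ≤ v.ord (x - y) := by
  rw [sub_eq_add_neg, ← v.ord_neg y]; exact v.ord_add _ _

lemma ord_sub_comm (x y : X) : v.ord (x - y) = v.ord (y - x) := by rw [← v.ord_neg, neg_sub]

lemma le_ord_add {x y : X} {n : WithTop ℤ} (hx : n ≤ v.ord x) (hy : n ≤ v.ord y) : n ≤ v.ord (x + y) := (le_min hx hy).trans (v.ord_add _ _)

lemma le_ord_sub {x y : X} {n : WithTop ℤ} (hx : n ≤ v.ord x) (hy : n ≤ v.ord y) : n ≤ v.ord (x - y) := (le_min hx hy).trans (v.ord_sub _ _)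

lemma lt_ord_add {x y : X} {n : WithTop ℤ} (hx : n < v.ord x) (hy : n < v.ord y) : n < v.ord (x + y) := (lt_min hx hy).trans_le (v.ord_add _ _)

lemma lt_ord_sub {x y : X} {n : WithTop ℤ} (hx : n < v.ord x) (hy : n < v.ord y) : n < v.ord (x - y) := (lt_min hx hy).trans_le (v.ord_sub _ _)

lemma le_ord_sum {ι : Type*} (s : Finset ι) (f : ι → X) {n : WithTop ℤ} (h : ∀ i ∈ s, n ≤ v.ord (f i)) : n ≤ v.ord (∑ i ∈ s, f i) := by
  classical
  induction s using induction_on with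
  | empty => simp [v.ord_zero]
  | insert a s ha ih =>
    rw [sum_insert ha]
    exact v.le_ord_add (h _ (by simp)) (ih fun i hi => h i (by simp [hi]))

lemma lt_ord_sum {ι : Type*} (s : Finset ι) (f : ι → X) {n : WithTop ℤ} (hn : n < ⊤) (h : ∀ i ∈ s, n < v.ord (f i)) : n < v.ord (∑ i ∈ s, f i) := by
  classical
  induction s using induction_on with
  | empty => simpa [v.ord_zero] using hn
  | insert a s ha ih =>
    rw [sum_insert ha]
    exact v.lt_ord_add (h _ (by simp)) (ih fun i hi => h i (by simp [hi]))

lemma ord_add_eq_left {x y : X} (h : v.ord x < v.ord y) : v.ord (x + y) = v.ord x := by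
  apply le_antisymm
  · by_contra hlt
    rw [not_le] at hlt
    have h2 : v.ord x < v.ord ((x + y) - y) := v.lt_ord_sub hlt h
    simp at h2
  · exact v.le_ord_add le_rfl h.le

lemma ord_add_eq_right {x y : X} (h : v.ord y < v.ord x) : v.ord (x + y) = v.ord y := by
  rw [add_comm]; exact v.ord_add_eq_left h

lemma ord_mul_nonneg {x y : X} (hx : 0 ≤ v.ord x) (hy : 0 ≤ v.ord y) : 0 ≤ v.ord (x * y) := by
  rw [v.ord_mul]; exact add_nonneg hx hy

lemma ord_pow_nonneg {x : X} (hx : 0 ≤ v.ord x) (n : ℕ) : 0 ≤ v.ord (x ^ n) := by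
  induction n with
  | zero => simp [v.ord_one]
  | succ n ih => rw [pow_succ]; exact v.ord_mul_nonneg ih hx

lemma le_ord_iff {x : X} (hx : x ≠ 0) {n : ℤ} : (n : WithTop ℤ) ≤ v.ord x ↔ n ≤ v.val x := by
  rw [v.ord_eq hx]; norm_cast

lemma lt_ord_iff {x : X} (hx : x ≠ 0) {n : ℤ} : (n : WithTop ℤ) < v.ord x ↔ n < v.val x := by
  rw [v.ord_eq hx]; norm_cast

lemma ord_le_iff {x : X} (hx : x ≠ 0) {n : ℤ} : v.ord x ≤ n ↔ v.val x ≤ n := by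
  rw [v.ord_eq hx]; norm_cast

lemma ord_lt_iff {x : X} (hx : x ≠ 0) {n : ℤ} : v.ord x < n ↔ v.val x < n := by
  rw [v.ord_eq hx]; norm_cast

lemma ord_nonneg_iff {x : X} (hx : x ≠ 0) : 0 ≤ v.ord x ↔ 0 ≤ v.val x := v.le_ord_iff hx (n := 0)
lemma ord_pos_iff {x : X} (hx : x ≠ 0) : 0 < v.ord x ↔ 0 < v.val x := v.lt_ord_iff hx (n := 0)
lemma ord_neg_iff {x : X} (hx : x ≠ 0) : v.ord x < 0 ↔ v.val x < 0 := v.ord_lt_iff hx (n := 0)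

lemma ord_pos_iff_one_le {x : X} : 0 < v.ord x ↔ ((1 : ℤ) : WithTop ℤ) ≤ v.ord x := by
  by_cases hx : x = 0
  · simp [hx, v.ord_zero]
  rw [v.ord_pos_iff hx, v.le_ord_iff hx]; omega

lemma ord_inv_nonneg_of_le {x : X} (hx : v.ord x ≤ 0) : 0 ≤ v.ord x⁻¹ := by
  have h0 : x ≠ 0 := by rintro rfl; rw [v.ord_zero] at hx; simp at hx
  rw [v.ord_nonneg_iff (inv_ne_zero h0), v.val_inv h0]
  have := (v.ord_le_iff h0 (n := 0)).mp hx
  omega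

lemma exists_val_eq (n : ℤ) : ∃ x : X, x ≠ 0 ∧ v.val x = n := by
  obtain ⟨x, hx⟩ := v.ord_surj n
  exact ⟨x, v.ne_zero_of_ord hx, v.val_eq_of_ord hx⟩

lemma ext_ord {v w : FFPrime X} (h : ∀ x, v.ord x = w.ord x) : v = w := by
  cases v; cases w; congr; exact funext h

lemma ext_val {v w : FFPrime X} (h : ∀ x ≠ 0, v.val x = w.val x) : v = w := by
  apply ext_ord
  intro x
  by_cases hx : x = 0
  · rw [hx, v.ord_zero, w.ord_zero]
  · rw [v.ord_eq hx, w.ord_eq hx, h x hx]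


variable {v} {w : FFPrime X}

lemma approx1 (h : v ≠ w) : ∃ x : X, 0 ≤ v.ord x ∧ w.ord x < 0 := by
  by_contra hcon
  push Not at hcon
  apply h
  have h0 : ∀ x : X, x ≠ 0 → v.val x = 0 → w.val x = 0 := by
    intro x hx hv
    have h1 := hcon x ((v.ord_nonneg_iff hx).mpr hv.ge)
    have h2 := hcon x⁻¹ ((v.ord_nonneg_iff (inv_ne_zero hx)).mpr (by rw [v.val_inv hx]; omega))
    rw [w.ord_nonneg_iff hx] at h1
    rw [w.ord_nonneg_iff (inv_ne_zero hx), w.val_inv hx] at h2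
    omega
  obtain ⟨π, hπ, hπv⟩ := v.exists_val_eq 1
  have hall : ∀ x ≠ 0, w.val x = v.val x * w.val π := by
    intro x hx
    have := h0 (x / π ^ (v.val x)) (div_ne_zero hx (zpow_ne_zero _ hπ))
      (by rw [v.val_div hx (zpow_ne_zero _ hπ), v.val_zpow hπ, hπv]; ring)
    rw [w.val_div hx (zpow_ne_zero _ hπ), w.val_zpow hπ] at this
    omega
  have he : 0 ≤ w.val π := (w.ord_nonneg_iff hπ).mp
    (hcon π ((v.ord_nonneg_iff hπ).mpr (by omega)))
  obtain ⟨y, hy, hy1⟩ := w.exists_val_eq 1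
  have h1 := hall y hy
  rw [hy1] at h1
  have he1 : w.val π = 1 := by
    have : w.val π ∣ 1 := ⟨v.val y, by rw [h1]; ring⟩
    exact Int.eq_one_of_dvd_one he this
  exact ext_val fun x hx => by rw [hall x hx, he1, mul_one]

lemma approx2 (h : v ≠ w) : ∃ x : X, x ≠ 0 ∧ 0 < v.val x ∧ w.val x < 0 := by
  obtain ⟨a, ha, ha'⟩ := approx1 h
  obtain ⟨b, hb, hb'⟩ := approx1 h.symm
  have ha0 : a ≠ 0 := by rintro rfl; rw [w.ord_zero] at ha'; simp at ha'
  have hb0 : b ≠ 0 := by rintro rfl; rw [v.ord_zero] at hb'; simp at hb'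
  rw [v.ord_nonneg_iff ha0] at ha
  rw [w.ord_neg_iff ha0] at ha'
  rw [w.ord_nonneg_iff hb0] at hb
  rw [v.ord_neg_iff hb0] at hb'
  exact ⟨a / b, div_ne_zero ha0 hb0, by rw [v.val_div ha0 hb0]; omega, by rw [w.val_div ha0 hb0]; omega⟩

lemma approx3 (v : FFPrime X) (T : Finset (FFPrime X)) (hT : v ∉ T) : ∃ x : X, x ≠ 0 ∧ 0 < v.val x ∧ ∀ w ∈ T, w.val x < 0 := by
  classical
  induction T using induction_on with
  | empty =>
    obtain ⟨x, hx, h⟩ := v.exists_val_eq 1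
    exact ⟨x, hx, by omega, by simp⟩
  | insert u T hu ih =>
    simp only [Finset.mem_insert, not_or] at hT
    obtain ⟨x, hx, hvx, hTx⟩ := ih hT.2
    obtain ⟨y, hy, hvy, huy⟩ := approx2 hT.1
    by_cases hux : u.val x < 0
    · exact ⟨x, hx, hvx, by simpa [hux] using hTx⟩
    push Not at hux
    obtain ⟨m, hm⟩ : ∃ m : ℕ, ∀ w ∈ T, -w.val x < m := by
      obtain ⟨m, hm⟩ := (T.image fun w => (-w.val x).toNat).exists_le
      refine ⟨m + 1, fun w hw => ?_⟩
      have := hm _ (mem_image_of_mem (fun w => (-w.val x).toNat) hw)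
      omega
    have hm1 : ∀ w ∈ T, w.ord (x + y ^ (m+1)) < 0 := by
      intro w hw
      have h1 := hTx w hw
      have h2 := hm w hw
      rcases lt_or_ge (w.val y) 0 with h3 | h3
      · have hlt : w.ord (y ^ (m+1)) < w.ord x := by
          rw [w.ord_eq (pow_ne_zero _ hy), w.ord_eq hx, w.val_pow hy]
          norm_cast
          push_cast
          nlinarith
        rw [w.ord_add_eq_right hlt, w.ord_neg_iff (pow_ne_zero _ hy), w.val_pow hy]
        push_cast; nlinarith
      · have hlt : w.ord x < w.ord (y ^ (m+1)) := by
          rw [w.ord_eq (pow_ne_zero _ hy), w.ord_eq hx, w.val_pow hy]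
          norm_cast
          push_cast
          nlinarith
        rw [w.ord_add_eq_left hlt, w.ord_neg_iff hx]; exact h1
    have hu1 : u.ord (x + y ^ (m+1)) < 0 := by
      have hlt : u.ord (y ^ (m+1)) < u.ord x := by
        rw [u.ord_eq (pow_ne_zero _ hy), u.ord_eq hx, u.val_pow hy]
        norm_cast
        push_cast
        nlinarith
      rw [u.ord_add_eq_right hlt, u.ord_neg_iff (pow_ne_zero _ hy), u.val_pow hy]
      push_cast; nlinarith
    have hz : x + y ^ (m+1) ≠ 0 := by
      intro h; rw [h, u.ord_zero] at hu1; simp at hu1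
    refine ⟨x + y ^ (m+1), hz, ?_, ?_⟩
    · rw [← v.ord_pos_iff hz]
      refine v.lt_ord_add ((v.ord_pos_iff hx).mpr hvx) ?_
      rw [v.ord_pos_iff (pow_ne_zero _ hy), v.val_pow hy]; positivity
    · intro w hw
      rw [← w.ord_neg_iff hz]
      rcases Finset.mem_insert.mp hw with rfl | hw
      · exact hu1
      · exact hm1 w hw

lemma approx4 (v : FFPrime X) (T : Finset (FFPrime X)) (hT : v ∉ T) (n : ℕ) : ∃ e : X, (n : ℤ) ≤ v.ord (e - 1) ∧ ∀ w ∈ T, (n : ℤ) ≤ w.ord e := by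
  obtain ⟨x, hx, hv, hw⟩ := approx3 v T hT
  have hxn : x ^ (n+1) ≠ 0 := pow_ne_zero _ hx
  have h1 : v.ord (1 + x ^ (n+1)) = 0 := by
    rw [v.ord_add_eq_left, v.ord_one]
    rw [v.ord_one, v.ord_pos_iff hxn, v.val_pow hx]; positivity
  have h0 : 1 + x ^ (n+1) ≠ 0 := v.ne_zero_of_ord (n := 0) h1
  refine ⟨(1 + x ^ (n+1))⁻¹, ?_, fun w hwT => ?_⟩
  · have : (1 + x ^ (n+1))⁻¹ - 1 = - (x ^ (n+1) / (1 + x ^ (n+1))) := by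
      field_simp; ring
    rw [this, v.ord_neg, v.le_ord_iff (div_ne_zero hxn h0), v.val_div hxn h0, v.val_pow hx, v.val_eq_of_ord (n := 0) h1]
    push_cast; nlinarith
  · have hwx := hw w hwT
    have hlt : w.ord (x ^ (n+1)) < w.ord 1 := by
      rw [w.ord_one, w.ord_neg_iff hxn, w.val_pow hx]; push_cast; nlinarith
    have h2 := w.ord_add_eq_right hlt
    rw [w.ord_eq hxn] at h2
    rw [w.le_ord_iff (inv_ne_zero h0), w.val_inv h0, w.val_eq_of_ord h2, w.val_pow hx]
    push_cast; nlinarith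

lemma approx (T : Finset (FFPrime X)) (a : FFPrime X → X) (n : ℤ) : ∃ x : X, ∀ v ∈ T, (n : WithTop ℤ) ≤ v.ord (x - a v) := by
  classical
  obtain ⟨N, hN⟩ : ∃ N : ℕ, ∀ w ∈ T, ∀ u ∈ T, n - w.val (a u) ≤ N := by
    obtain ⟨N, hN⟩ := ((T ×ˢ T).image fun w => (n - w.1.val (a w.2)).toNat).exists_le
    refine ⟨N, fun w hw u hu => ?_⟩
    have := hN _ (mem_image_of_mem (fun w : FFPrime X × FFPrime X =>
      (n - w.1.val (a w.2)).toNat) (Finset.mk_mem_product hw hu))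
    dsimp only at this
    omega
  have hN' : ∀ w ∈ T, ∀ u ∈ T, ∀ z : X, (N : ℤ) ≤ w.ord z → (n : WithTop ℤ) ≤ w.ord (z * a u) := by
    intro w hw u hu z hz
    by_cases h0 : z * a u = 0
    · rw [h0, w.ord_zero]; exact le_top
    · obtain ⟨h1, h2⟩ := mul_ne_zero_iff.mp h0
      have := hN w hw u hu
      rw [w.le_ord_iff h1] at hz
      rw [w.le_ord_iff h0, w.val_mul h1 h2]; omega
  choose e he1 he2 using fun v : FFPrime X => approx4 v (T.erase v) (by simp) N
  refine ⟨∑ u ∈ T, e u * a u, fun v hv => ?_⟩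
  have : ∑ u ∈ T, e u * a u - a v = (e v - 1) * a v + ∑ u ∈ T.erase v, e u * a u := by
    rw [← Finset.add_sum_erase _ _ hv]; ring
  rw [this]
  refine v.le_ord_add (hN' v hv v hv _ (he1 v)) (v.le_ord_sum _ _ fun u hu => ?_)
  have hu' := mem_erase.mp hu
  exact hN' v hv u hu'.2 _ (he2 u v (mem_erase.mpr ⟨hu'.1.symm, hv⟩))

lemma approx_val (T : Finset (FFPrime X)) (n : FFPrime X → ℤ) (hT : T.Nonempty) : ∃ x : X, x ≠ 0 ∧ ∀ v ∈ T, v.val x = n v := by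
  classical
  choose a ha hav using fun v : FFPrime X => v.exists_val_eq (n v)
  obtain ⟨N, hN⟩ : ∃ N : ℤ, ∀ v ∈ T, n v < N := by
    obtain ⟨N, hN⟩ := (T.image n).exists_le
    exact ⟨N + 1, fun v hv => by have := hN _ (mem_image_of_mem n hv); omega⟩
  obtain ⟨x, hx⟩ := approx T a N
  have key : ∀ v ∈ T, v.ord x = n v := by
    intro v hv
    have h1 : v.ord (a v) = n v := by rw [v.ord_eq (ha v), hav]
    have h2 : v.ord (a v) < v.ord (x - a v) := by
      rw [h1]; exact lt_of_lt_of_le (by exact_mod_cast hN v hv) (hx v hv)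
    have := v.ord_add_eq_left h2
    rw [← h1, ← this]; congr 1; ring
  obtain ⟨v, hv⟩ := hT
  exact ⟨x, v.ne_zero_of_ord (key v hv), fun v hv => v.val_eq_of_ord (key v hv)⟩

end basic

end FFPrime

namespace FFVal

section basic
variable {X : Type} [Field X] (v : FFVal X)

def val (x : X) : ℚ := (v.ord x).untopD 0

lemma ord_eq {x : X} (hx : x ≠ 0) : v.ord x = (v.val x : WithTop ℚ) := by
  obtain ⟨n, hn⟩ := WithTop.ne_top_iff_exists.mp (v.ord_ne_top x hx)
  simp [val, ← hn]

lemma val_eq_of_ord {x : X} {n : ℚ} (h : v.ord x = n) : v.val x = n := by simp [val, h]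

lemma ne_zero_of_ord {x : X} {n : ℚ} (h : v.ord x = n) : x ≠ 0 := by
  rintro rfl
  rw [v.ord_zero] at h
  exact WithTop.top_ne_coe h

lemma val_one : v.val 1 = 0 := by simp [val, v.ord_one]

lemma val_mul {x y : X} (hx : x ≠ 0) (hy : y ≠ 0) : v.val (x * y) = v.val x + v.val y := by
  apply v.val_eq_of_ord
  rw [v.ord_mul, v.ord_eq hx, v.ord_eq hy]; rfl

lemma val_pow {x : X} (hx : x ≠ 0) (n : ℕ) : v.val (x ^ n) = n * v.val x := by
  induction n with
  | zero => simp [val_one]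
  | succ n ih => rw [pow_succ, v.val_mul (pow_ne_zero _ hx) hx, ih]; push_cast; ring

lemma val_inv {x : X} (hx : x ≠ 0) : v.val x⁻¹ = - v.val x := by
  have := v.val_mul hx (inv_ne_zero hx)
  rw [mul_inv_cancel₀ hx, val_one] at this; linarith

lemma val_div {x y : X} (hx : x ≠ 0) (hy : y ≠ 0) : v.val (x / y) = v.val x - v.val y := by
  rw [div_eq_mul_inv, v.val_mul hx (inv_ne_zero hy), v.val_inv hy]; ring

lemma val_zpow {x : X} (hx : x ≠ 0) (n : ℤ) : v.val (x ^ n) = n * v.val x := by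
  cases n with
  | ofNat n => simpa using v.val_pow hx n
  | negSucc n =>
    rw [zpow_negSucc, v.val_inv (pow_ne_zero _ hx), v.val_pow hx, Int.negSucc_eq]; push_cast; ring

lemma val_eq_zero_of_pow {x : X} {n : ℕ} (hn : n ≠ 0) (h : x ^ n = 1) : v.val x = 0 := by
  have hx : x ≠ 0 := by rintro rfl; simp [hn] at h
  have := v.val_pow hx n
  rw [h, val_one] at this
  have hn' : (n : ℚ) ≠ 0 := by exact_mod_cast hn
  rcases mul_eq_zero.mp this.symm with h | h
  · exact absurd h hn'
  · exact h

lemma val_neg (x : X) : v.val (-x) = v.val x := by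
  by_cases hx : x = 0
  · simp [hx]
  rw [← neg_one_mul, v.val_mul (by simp) hx, v.val_eq_zero_of_pow (n := 2) (by simp) (by simp), zero_add]

lemma ord_neg (x : X) : v.ord (-x) = v.ord x := by
  by_cases hx : x = 0
  · simp [hx]
  rw [v.ord_eq hx, v.ord_eq (neg_ne_zero.mpr hx), val_neg]

lemma ord_sub (x y : X) : min (v.ord x) (v.ord y) ≤ v.ord (x - y) := by
  rw [sub_eq_add_neg, ← v.ord_neg y]; exact v.ord_add _ _

lemma ord_sub_comm (x y : X) : v.ord (x - y) = v.ord (y - x) := by rw [← v.ord_neg, neg_sub]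

lemma le_ord_add {x y : X} {n : WithTop ℚ} (hx : n ≤ v.ord x) (hy : n ≤ v.ord y) : n ≤ v.ord (x + y) := (le_min hx hy).trans (v.ord_add _ _)

lemma le_ord_sub {x y : X} {n : WithTop ℚ} (hx : n ≤ v.ord x) (hy : n ≤ v.ord y) : n ≤ v.ord (x - y) := (le_min hx hy).trans (v.ord_sub _ _)

lemma lt_ord_add {x y : X} {n : WithTop ℚ} (hx : n < v.ord x) (hy : n < v.ord y) : n < v.ord (x + y) := (lt_min hx hy).trans_le (v.ord_add _ _)

lemma lt_ord_sub {x y : X} {n : WithTop ℚ} (hx : n < v.ord x) (hy : n < v.ord y) : n < v.ord (x - y) := (lt_min hx hy).trans_le (v.ord_sub _ _)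

lemma le_ord_sum {ι : Type*} (s : Finset ι) (f : ι → X) {n : WithTop ℚ} (h : ∀ i ∈ s, n ≤ v.ord (f i)) : n ≤ v.ord (∑ i ∈ s, f i) := by
  classical
  induction s using induction_on with
  | empty => simp [v.ord_zero]
  | insert a s ha ih =>
    rw [sum_insert ha]
    exact v.le_ord_add (h _ (by simp)) (ih fun i hi => h i (by simp [hi]))

lemma lt_ord_sum {ι : Type*} (s : Finset ι) (f : ι → X) {n : WithTop ℚ} (hn : n < ⊤) (h : ∀ i ∈ s, n < v.ord (f i)) : n < v.ord (∑ i ∈ s, f i) := by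
  classical
  induction s using induction_on with
  | empty => simpa [v.ord_zero] using hn
  | insert a s ha ih =>
    rw [sum_insert ha]
    exact v.lt_ord_add (h _ (by simp)) (ih fun i hi => h i (by simp [hi]))

lemma ord_add_eq_left {x y : X} (h : v.ord x < v.ord y) : v.ord (x + y) = v.ord x := by
  apply le_antisymm
  · by_contra hlt
    rw [not_le] at hlt
    have h2 : v.ord x < v.ord ((x + y) - y) := v.lt_ord_sub hlt h
    simp at h2
  · exact v.le_ord_add le_rfl h.le

lemma ord_add_eq_right {x y : X} (h : v.ord y < v.ord x) : v.ord (x + y) = v.ord y := by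
  rw [add_comm]; exact v.ord_add_eq_left h

lemma ord_mul_nonneg {x y : X} (hx : 0 ≤ v.ord x) (hy : 0 ≤ v.ord y) : 0 ≤ v.ord (x * y) := by
  rw [v.ord_mul]; exact add_nonneg hx hy

lemma ord_pow_nonneg {x : X} (hx : 0 ≤ v.ord x) (n : ℕ) : 0 ≤ v.ord (x ^ n) := by
  induction n with
  | zero => simp [v.ord_one]
  | succ n ih => rw [pow_succ]; exact v.ord_mul_nonneg ih hx

lemma le_ord_iff {x : X} (hx : x ≠ 0) {n : ℚ} : (n : WithTop ℚ) ≤ v.ord x ↔ n ≤ v.val x := by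
  rw [v.ord_eq hx]; norm_cast

lemma lt_ord_iff {x : X} (hx : x ≠ 0) {n : ℚ} : (n : WithTop ℚ) < v.ord x ↔ n < v.val x := by
  rw [v.ord_eq hx]; norm_cast

lemma ord_le_iff {x : X} (hx : x ≠ 0) {n : ℚ} : v.ord x ≤ n ↔ v.val x ≤ n := by
  rw [v.ord_eq hx]; norm_cast

lemma ord_lt_iff {x : X} (hx : x ≠ 0) {n : ℚ} : v.ord x < n ↔ v.val x < n := by
  rw [v.ord_eq hx]; norm_cast

lemma ord_nonneg_iff {x : X} (hx : x ≠ 0) : 0 ≤ v.ord x ↔ 0 ≤ v.val x := v.le_ord_iff hx (n := 0)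
lemma ord_pos_iff {x : X} (hx : x ≠ 0) : 0 < v.ord x ↔ 0 < v.val x := v.lt_ord_iff hx (n := 0)
lemma ord_neg_iff {x : X} (hx : x ≠ 0) : v.ord x < 0 ↔ v.val x < 0 := v.ord_lt_iff hx (n := 0)

lemma ord_inv_nonneg_of_le {x : X} (hx : v.ord x ≤ 0) : 0 ≤ v.ord x⁻¹ := by
  have h0 : x ≠ 0 := by rintro rfl; rw [v.ord_zero] at hx; simp at hx
  rw [v.ord_nonneg_iff (inv_ne_zero h0), v.val_inv h0]
  have := (v.ord_le_iff h0 (n := 0)).mp hx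
  linarith

end basic

end FFVal

def FFPrime.vring {X : Type} [Field X] (v : FFPrime X) : Subring X where
  carrier := {x | 0 ≤ v.ord x}
  zero_mem' := by simp [v.ord_zero]
  one_mem' := by simp [v.ord_one]
  add_mem' := fun ha hb => v.le_ord_add ha hb
  mul_mem' := fun ha hb => v.ord_mul_nonneg ha hb
  neg_mem' := fun {a} ha => by simpa [v.ord_neg] using ha

lemma exists_valuationSubring_aux {B : Type} [Field B] (R0 : Subring B) (x : B) (hx : ¬ IsIntegral R0 x) : ∃ A : ValuationSubring B, R0 ≤ A.toSubring ∧ x ∉ A := by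
  let R : Subring B := (integralClosure R0 B).toSubring
  have hR0 : R0 ≤ R := fun y hy => (isIntegral_algebraMap (x := (⟨y, hy⟩ : R0)) : IsIntegral R0 y)
  have hcl : IsIntegrallyClosedIn R B := by
    rw [isIntegrallyClosedIn_iff]
    refine ⟨Subtype.val_injective, fun {y} hy => ?_⟩
    have : IsIntegral (integralClosure R0 B) y := hy
    exact ⟨⟨y, isIntegral_trans (R := R0) y this⟩, rfl⟩
  obtain ⟨A, hA, hxA⟩ := Subring.exists_le_valuationSubring_of_isIntegrallyClosedIn
    (R := R) (x := x) hx
  exact ⟨A, hR0.trans hA, hxA⟩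

lemma zpow_le_zpow_iff_aux {Γ : Type*} [LinearOrderedCommGroupWithZero Γ] {γ : Γ} (h0 : γ ≠ 0) (h1 : γ < 1) (m n : ℤ) : γ ^ m ≤ γ ^ n ↔ n ≤ m :=
  zpow_le_zpow_iff_right_of_lt_one₀ (zero_lt_iff.mpr h0) h1

lemma two_equal_of_sum_zero {B Γ : Type*} [Field B] [LinearOrderedCommGroupWithZero Γ] (u : Valuation B Γ) {ι : Type*} [DecidableEq ι] (s : Finset ι) (hs : s.Nonempty) (f : ι → B)
    (hf : ∀ i ∈ s, f i ≠ 0) (h : ∑ i ∈ s, f i = 0) : ∃ i ∈ s, ∃ j ∈ s, i ≠ j ∧ u (f i) = u (f j) := by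
  obtain ⟨j, hj, hmax⟩ := s.exists_max_image (fun i => u (f i)) hs
  by_contra hcon
  push Not at hcon
  have := Valuation.map_sum_eq_of_lt u (f := f) hj (fun i hi => by
    rw [Finset.mem_sdiff, mem_singleton] at hi
    exact lt_of_le_of_ne (hmax i hi.1) (hcon i hi.1 j hj hi.2))
  rw [h, map_zero] at this
  exact hf j hj (u.zero_iff.mp this.symm)

section ext
variable {K B : Type} [Field K] [Field B] [Algebra K B] [Algebra.IsAlgebraic K B]

lemma exists_ext (v : FFPrime K) (x : B) (hx : x ∉ valIntegralClosure v B) : ∃ V : FFVal B, (∀ k : K, V.ord (algebraMap K B k) = WithTop.map (fun n : ℤ => (n : ℚ)) (v.ord k))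
      ∧ V.ord x < 0 := by
  classical
  have hx' : ¬ IsIntegral (v.vring.map (algebraMap K B)) x := by
    rintro ⟨P, hP, hPx⟩
    apply hx
    have hPmem : P.map (Subring.subtype _) ∈ Polynomial.lifts (algebraMap K B) := by
      rw [Polynomial.lifts_iff_coeff_lifts]
      intro n
      rw [Polynomial.coeff_map]
      obtain ⟨k, hk, hk'⟩ := (P.coeff n).2
      exact ⟨k, hk'⟩
    obtain ⟨Q, hQ, hdeg, hQm⟩ := Polynomial.lifts_and_degree_eq_and_monic hPmem (hP.map _)
    refine ⟨Q, hQm, fun n => ?_, ?_⟩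
    · have h1 : algebraMap K B (Q.coeff n) = (P.coeff n : B) := by
        rw [← Polynomial.coeff_map, hQ, Polynomial.coeff_map]; rfl
      obtain ⟨k, hk, hk'⟩ := (P.coeff n).2
      have : k = Q.coeff n := (algebraMap K B).injective (by rw [h1, hk'])
      rw [← this]; exact hk
    · rw [aeval_def, ← eval_map, hQ, eval_map]
      exact hPx
  obtain ⟨A, hA, hxA⟩ := exists_valuationSubring_aux _ x hx'
  have hA1 : ∀ k : K, 0 ≤ v.ord k → algebraMap K B k ∈ A := fun k hk => hA ⟨k, hk, rfl⟩
  have hnot : ¬ ∀ k : K, algebraMap K B k ∈ A := by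
    intro hall
    apply hxA
    have hInt : IsIntegral K x := (Algebra.IsAlgebraic.isAlgebraic x).isIntegral
    have hInt' : IsIntegral A x := by
      let φ : K →+* A := (algebraMap K B).codRestrict A.toSubring hall
      obtain ⟨P, hP, hPx⟩ := hInt
      refine ⟨P.map φ, hP.map _, ?_⟩
      rw [Polynomial.eval₂_map]; exact hPx
    obtain ⟨y, hy⟩ := (IsIntegrallyClosed.isIntegral_iff (R := A) (K := B)).mp hInt'
    rw [← hy]; exact y.2
  obtain ⟨π, hπ, hπ1⟩ := v.exists_val_eq 1
  set u := A.valuation with hu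
  have hunit : ∀ k : K, k ≠ 0 → v.val k = 0 → u (algebraMap K B k) = 1 := by
    intro k hk hv
    have h1 : u (algebraMap K B k) ≤ 1 := (A.valuation_le_one_iff _).mpr
      (hA1 k ((v.ord_nonneg_iff hk).mpr hv.ge))
    have h2 : u (algebraMap K B k⁻¹) ≤ 1 := (A.valuation_le_one_iff _).mpr
      (hA1 _ ((v.ord_nonneg_iff (inv_ne_zero hk)).mpr (by rw [v.val_inv hk, hv]; simp)))
    rw [map_inv₀, map_inv₀] at h2
    have h0 : u (algebraMap K B k) ≠ 0 := by simpa using hk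
    exact le_antisymm h1 ((inv_le_one₀ (zero_lt_iff.mpr h0)).mp h2)
  have hpow : ∀ k : K, k ≠ 0 → u (algebraMap K B k) = u (algebraMap K B π) ^ v.val k := by
    intro k hk
    have := hunit (k / π ^ v.val k) (div_ne_zero hk (zpow_ne_zero _ hπ))
      (by rw [v.val_div hk (zpow_ne_zero _ hπ), v.val_zpow hπ, hπ1]; ring)
    rw [map_div₀, map_div₀, map_zpow₀, map_zpow₀] at this
    have h0 : u (algebraMap K B π) ^ v.val k ≠ 0 := zpow_ne_zero _ (by simpa using hπ)
    rwa [div_eq_one_iff_eq h0] at this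
  set γ := u (algebraMap K B π) with hγ
  have hγ0 : γ ≠ 0 := by simpa [hγ] using hπ
  have hγ1 : γ < 1 := by
    by_contra hcon
    rw [not_lt] at hcon
    have hγe : γ = 1 := le_antisymm ((A.valuation_le_one_iff _).mpr
      (hA1 π ((v.ord_nonneg_iff hπ).mpr (by omega)))) hcon
    apply hnot
    intro k
    by_cases hk : k = 0
    · simp [hk, A.zero_mem]
    · rw [← A.valuation_le_one_iff, ← hu, hpow k hk, hγe, one_zpow]
  have hex : ∀ b : B, b ≠ 0 → ∃ (m : ℕ) (n : ℤ), 0 < m ∧ u b ^ m = γ ^ n := by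
    intro b hb
    obtain ⟨P, hP0, hP⟩ := Algebra.IsAlgebraic.isAlgebraic (R := K) b
    have hsum : ∑ i ∈ P.support, algebraMap K B (P.coeff i) * b ^ i = 0 := by
      rw [aeval_def, Polynomial.eval₂_eq_sum, Polynomial.sum_def] at hP
      exact hP
    obtain ⟨i, hi, j, hj, hij, he⟩ := two_equal_of_sum_zero u P.support
      (by simpa [Finset.nonempty_iff_ne_empty] using hP0) _
      (fun i hi => mul_ne_zero (by simpa using hi) (pow_ne_zero _ hb)) hsum
    rw [Polynomial.mem_support_iff] at hi hj
    wlog hlt : i < j generalizing i j with H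
    · exact H j hj i hi hij.symm he.symm (by omega)
    refine ⟨j - i, v.val (P.coeff i) - v.val (P.coeff j), by omega, ?_⟩
    rw [map_mul, map_mul, map_pow, map_pow, hpow _ hi, hpow _ hj] at he
    have hub : u b ≠ 0 := by simpa using hb
    rw [pow_sub₀ _ hub hlt.le, zpow_sub₀ hγ0]
    rw [← div_eq_mul_inv, div_eq_div_iff (pow_ne_zero _ hub) (zpow_ne_zero _ hγ0), mul_comm, ← he]
  choose! m n hm hmn using hex
  let r : B → ℚ := fun b => n b / m b
  have hle : ∀ a b : B, a ≠ 0 → b ≠ 0 → (u a ≤ u b ↔ r b ≤ r a) := by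
    intro a b ha hb
    have h1 : u a ^ (m a * m b) = γ ^ (n a * m b) := by rw [pow_mul, hmn a ha, zpow_mul, zpow_natCast]
    have h2 : u b ^ (m a * m b) = γ ^ (n b * m a) := by rw [mul_comm, pow_mul, hmn b hb, zpow_mul, zpow_natCast]
    have hpos : m a * m b ≠ 0 := (Nat.mul_pos (hm a ha) (hm b hb)).ne'
    rw [← pow_le_pow_iff_left₀ zero_le zero_le hpos, h1, h2, zpow_le_zpow_iff_aux hγ0 hγ1]
    have hma : (0:ℚ) < m a := by exact_mod_cast hm a ha
    have hmb : (0:ℚ) < m b := by exact_mod_cast hm b hb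
    rw [div_le_div_iff₀ hmb hma]
    norm_cast
  have hchar : ∀ (b : B) (m' : ℕ) (n' : ℤ), b ≠ 0 → 0 < m' → u b ^ m' = γ ^ n' → r b = n' / m' := by
    intro b m' n' hb hm' h
    have h1 : γ ^ (n b * m') = γ ^ (n' * m b) := by rw [zpow_mul, ← hmn b hb, zpow_natCast, ← pow_mul, mul_comm, pow_mul, h, zpow_mul, zpow_natCast]
    have h2 : n b * m' = n' * m b := le_antisymm
      ((zpow_le_zpow_iff_aux hγ0 hγ1 _ _).mp h1.ge) ((zpow_le_zpow_iff_aux hγ0 hγ1 _ _).mp h1.le)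
    have hma : (0:ℚ) < m b := by exact_mod_cast hm b hb
    have hmb : (0:ℚ) < m' := by exact_mod_cast hm'
    change (n b : ℚ) / m b = _
    rw [div_eq_div_iff hma.ne' hmb.ne']
    exact_mod_cast h2
  have hmul : ∀ a b : B, a ≠ 0 → b ≠ 0 → r (a * b) = r a + r b := by
    intro a b ha hb
    have hma : (0:ℚ) < m a := by exact_mod_cast hm a ha
    have hmb : (0:ℚ) < m b := by exact_mod_cast hm b hb
    rw [hchar (a * b) (m a * m b) (n a * m b + n b * m a) (mul_ne_zero ha hb)
      (Nat.mul_pos (hm a ha) (hm b hb))]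
    · change _ = (n a : ℚ) / m a + n b / m b
      field_simp
      push_cast; ring
    · rw [map_mul, mul_pow, zpow_add₀ hγ0, zpow_mul, zpow_mul, ← hmn a ha, ← hmn b hb]
      simp only [zpow_natCast, ← pow_mul]
      rw [mul_comm (m b)]
  have hK : ∀ k : K, k ≠ 0 → r (algebraMap K B k) = v.val k := by
    intro k hk
    rw [hchar _ 1 (v.val k) (by simpa using hk) one_pos (by rw [pow_one, hpow k hk])]
    simp
  have hr1 : r 1 = 0 := by simpa [v.val_one] using hK 1 one_ne_zero
  refine ⟨⟨fun b => if b = 0 then ⊤ else (r b : WithTop ℚ), by simp, ?_, ?_, ?_, ?_, ?_⟩, ?_, ?_⟩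
  · intro x hx; simp [hx]
  · simp [hr1]
  · intro a b
    by_cases ha : a = 0
    · simp [ha]
    by_cases hb : b = 0
    · simp [hb]
    simp only [ha, hb, mul_eq_zero, or_self, if_false, hmul a b ha hb]; rfl
  · intro a b
    by_cases ha : a = 0
    · simp [ha]
    by_cases hb : b = 0
    · simp [hb]
    by_cases hab : a + b = 0
    · simp [hab]
    simp only [ha, hb, hab, if_false]
    rw [min_le_iff]
    norm_cast
    rcases le_total (u a) (u b) with h | h
    · right
      rw [← hle _ _ hab hb]
      simpa [h] using u.map_add a b
    · left
      rw [← hle _ _ hab ha]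
      simpa [h] using u.map_add a b
  · refine ⟨algebraMap K B π, ?_⟩
    have : algebraMap K B π ≠ 0 := by simpa using hπ
    simp [this, hK π hπ, hπ1]
  · intro k
    by_cases hk : k = 0
    · simp [hk, v.ord_zero]
    · have : algebraMap K B k ≠ 0 := by simpa using hk
      simp only [this, if_false, hK k hk, v.ord_eq hk]; rfl
  · have hx0 : x ≠ 0 := by rintro rfl; exact hxA A.zero_mem
    simp only [hx0, if_false]
    rw [← not_le]
    intro hcon
    have h1 : 0 ≤ r x := by exact_mod_cast hcon
    rw [← hr1, ← hle _ _ hx0 one_ne_zero, map_one] at h1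
    exact hxA ((A.valuation_le_one_iff _).mp h1)

end ext

section restrict
variable {K L B : Type} [Field K] [Field L] [Field B]

lemma FFVal.restrictsTo_iff {V : FFVal B} {v : FFPrime K} {φ : K →+* B} : V.RestrictsTo v φ ↔ ∃ c : ℚ, 0 < c ∧ ∀ x : K, x ≠ 0 → V.val (φ x) = c * v.val x := by
  constructor
  · rintro ⟨c, hc, h⟩
    refine ⟨c, hc, fun x hx => V.val_eq_of_ord ?_⟩
    rw [h x, v.ord_eq hx]; rfl
  · rintro ⟨c, hc, h⟩
    refine ⟨c, hc, fun x => ?_⟩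
    by_cases hx : x = 0
    · rw [hx, map_zero, V.ord_zero, v.ord_zero, WithTop.map_top, WithTop.mul_top]
      exact_mod_cast hc.ne'
    · rw [V.ord_eq ((map_ne_zero φ).mpr hx), h x hx, v.ord_eq hx]; rfl

lemma FFPrime.liesOverWith_iff {w : FFPrime L} {v : FFPrime K} {φ : K →+* L} {e : ℕ} : w.LiesOverWith v φ e ↔ 0 < e ∧ ∀ x : K, x ≠ 0 → w.val (φ x) = e * v.val x := by
  constructor
  · rintro ⟨hc, h⟩
    refine ⟨hc, fun x hx => w.val_eq_of_ord ?_⟩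
    rw [h x, v.ord_eq hx]; rfl
  · rintro ⟨hc, h⟩
    refine ⟨hc, fun x => ?_⟩
    by_cases hx : x = 0
    · rw [hx, map_zero, w.ord_zero, v.ord_zero, WithTop.mul_top]
      exact_mod_cast hc.ne'
    · rw [w.ord_eq ((map_ne_zero φ).mpr hx), h x hx, v.ord_eq hx]; rfl

def FFPrime.toFFVal (v : FFPrime K) : FFVal K where
  ord x := WithTop.map (fun n : ℤ => (n : ℚ)) (v.ord x)
  ord_zero := by simp [v.ord_zero]
  ord_ne_top x hx := by simp [v.ord_eq hx]
  ord_one := by simp [v.ord_one]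
  ord_mul x y := by
    by_cases hx : x = 0
    · simp [hx, v.ord_zero]
    by_cases hy : y = 0
    · simp [hy, v.ord_zero]
    rw [v.ord_eq hx, v.ord_eq hy, v.ord_eq (mul_ne_zero hx hy), v.val_mul hx hy]
    simp only [WithTop.map_coe]; norm_cast
  ord_add x y := by
    by_cases hx : x = 0
    · simp [hx, v.ord_zero]
    by_cases hy : y = 0
    · simp [hy, v.ord_zero]
    by_cases hxy : x + y = 0
    · simp [hxy, v.ord_zero]
    have := v.ord_add x y
    rw [v.ord_eq hx, v.ord_eq hy, v.ord_eq hxy] at this ⊢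
    simp only [WithTop.map_coe]
    norm_cast at this ⊢
  nontrivial := by
    obtain ⟨x, hx⟩ := v.ord_surj 1
    refine ⟨x, ?_⟩
    rw [hx]; simp

lemma FFPrime.toFFVal_val (v : FFPrime K) {x : K} (hx : x ≠ 0) : v.toFFVal.val x = v.val x := by
  apply FFVal.val_eq_of_ord
  change WithTop.map _ (v.ord x) = _
  rw [v.ord_eq hx]; rfl

lemma FFVal.exists_restrictsTo_of_discrete (V : FFVal B) (φ : K →+* B) (d : ℚ) (hd : 0 < d) (h : ∀ x : K, x ≠ 0 → ∃ n : ℤ, V.val (φ x) = n * d)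
    (hnt : ∃ x : K, x ≠ 0 ∧ V.val (φ x) ≠ 0) : ∃ v : FFPrime K, V.RestrictsTo v φ := by
  have hφ : ∀ {x : K}, x ≠ 0 → φ x ≠ 0 := fun hx => (map_ne_zero φ).mpr hx
  let H : AddSubgroup ℤ :=
    { carrier := {n | ∃ x : K, x ≠ 0 ∧ V.val (φ x) = n * d}
      zero_mem' := ⟨1, one_ne_zero, by simp [V.val_one]⟩
      add_mem' := by
        rintro a b ⟨x, hx, hx'⟩ ⟨y, hy, hy'⟩
        refine ⟨x * y, mul_ne_zero hx hy, ?_⟩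
        rw [map_mul, V.val_mul (hφ hx) (hφ hy), hx', hy']; push_cast; ring
      neg_mem' := by
        rintro a ⟨x, hx, hx'⟩
        refine ⟨x⁻¹, inv_ne_zero hx, ?_⟩
        rw [map_inv₀, V.val_inv (hφ hx), hx']; push_cast; ring }
  obtain ⟨g, hg⟩ := Int.subgroup_cyclic H
  wlog hgpos : 0 ≤ g generalizing g with HW
  · exact HW (-g) (by rw [hg]; simp) (by omega)
  have hg' : ∀ n : ℤ, n ∈ H ↔ ∃ k : ℤ, n = k * g := by
    intro n
    rw [hg, mem_closure_singleton]
    simp [eq_comm]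
  have hg0 : g ≠ 0 := by
    rintro rfl
    obtain ⟨x, hx, hx'⟩ := hnt
    obtain ⟨n, hn⟩ := h x hx
    obtain ⟨k, hk⟩ := (hg' n).mp ⟨x, hx, hn⟩
    apply hx'
    rw [hn, hk]; simp
  have hgq : (0:ℚ) < g := by exact_mod_cast lt_of_le_of_ne hgpos hg0.symm
  have hex : ∀ x : K, x ≠ 0 → ∃ k : ℤ, V.val (φ x) = k * (g * d) := by
    intro x hx
    obtain ⟨n, hn⟩ := h x hx
    obtain ⟨k, hk⟩ := (hg' n).mp ⟨x, hx, hn⟩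
    exact ⟨k, by rw [hn, hk]; push_cast; ring⟩
  choose! r hr using hex
  have hgd : 0 < g * d := mul_pos hgq hd
  have hrc : ∀ x : K, x ≠ 0 → ∀ k : ℤ, V.val (φ x) = k * (g * d) → r x = k := by
    intro x hx k hk
    rw [hr x hx] at hk
    exact_mod_cast mul_right_cancel₀ hgd.ne' hk
  have hmul : ∀ a b : K, a ≠ 0 → b ≠ 0 → r (a * b) = r a + r b := by
    intro a b ha hb
    apply hrc _ (mul_ne_zero ha hb)
    rw [map_mul, V.val_mul (hφ ha) (hφ hb), hr a ha, hr b hb]; push_cast; ring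
  classical
  refine ⟨⟨fun b => if b = 0 then ⊤ else (r b : WithTop ℤ), by simp, ?_, ?_, ?_, ?_, ?_⟩, ?_⟩
  · intro x hx; simp [hx]
  · have : r 1 = 0 := hrc 1 one_ne_zero 0 (by simp [V.val_one])
    simp [this]
  · intro a b
    by_cases ha : a = 0
    · simp [ha]
    by_cases hb : b = 0
    · simp [hb]
    simp only [ha, hb, mul_eq_zero, or_self, if_false, hmul a b ha hb]; rfl
  · intro a b
    by_cases ha : a = 0
    · simp [ha]
    by_cases hb : b = 0
    · simp [hb]
    by_cases hab : a + b = 0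
    · simp [hab]
    simp only [ha, hb, hab, if_false]
    rw [min_le_iff]
    have := V.ord_add (φ a) (φ b)
    rw [← map_add, V.ord_eq (hφ ha), V.ord_eq (hφ hb), V.ord_eq (hφ hab), hr a ha, hr b hb, hr _ hab, min_le_iff] at this
    norm_cast at this ⊢
    rw [mul_le_mul_iff_left₀ hgd, mul_le_mul_iff_left₀ hgd] at this
    exact_mod_cast this
  · intro n
    obtain ⟨x, hx, hx'⟩ : g ∈ H := (hg' g).mpr ⟨1, by simp⟩
    have : r x = 1 := hrc x hx 1 (by rw [hx']; simp)
    have hz : x ^ n ≠ 0 := zpow_ne_zero _ hx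
    refine ⟨x ^ n, ?_⟩
    simp only [hz, if_false]
    rw [hrc _ hz n]
    rw [map_zpow₀, V.val_zpow (hφ hx), hr x hx, this]; simp
  · rw [FFVal.restrictsTo_iff]
    refine ⟨g * d, hgd, fun x hx => ?_⟩
    rw [hr x hx, mul_comm]
    congr 2
    simp [FFPrime.val, hx]

lemma FFVal.liesOver_of_restrictsTo {V : FFVal B} {ψ : L →+* B} {φ : K →+* L} {w : FFPrime L} {v : FFPrime K} (hw : V.RestrictsTo w ψ) (hv : V.RestrictsTo v (ψ.comp φ)) :
    w.LiesOver v φ := by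
  obtain ⟨c, hc, h⟩ := FFVal.restrictsTo_iff.mp hw
  obtain ⟨c', hc', h'⟩ := FFVal.restrictsTo_iff.mp hv
  obtain ⟨π, hπ, hπ1⟩ := v.exists_val_eq 1
  have hφ : ∀ {x : K}, x ≠ 0 → φ x ≠ 0 := fun hx => (map_ne_zero φ).mpr hx
  have h1 : c * w.val (φ π) = c' := by
    rw [← h _ (hφ hπ), ← comp_apply, h' _ hπ, hπ1]; simp
  have hpos : 0 < w.val (φ π) := by
    have : (0:ℚ) < w.val (φ π) := by
      rw [← h1] at hc'; exact (mul_pos_iff_of_pos_left hc).mp hc'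
    exact_mod_cast this
  refine ⟨(w.val (φ π)).toNat, FFPrime.liesOverWith_iff.mpr ⟨by omega, fun x hx => ?_⟩⟩
  have h2 : c * w.val (φ x) = c' * v.val x := by rw [← h _ (hφ hx), ← comp_apply, h' _ hx]
  rw [← h1, mul_assoc] at h2
  have h3 := mul_left_cancel₀ hc.ne' h2
  rw [Int.toNat_of_nonneg hpos.le]
  exact_mod_cast h3

lemma FFPrime.toFFVal_restrictsTo_self (w : FFPrime L) : w.toFFVal.RestrictsTo w (RingHom.id L) :=
  FFVal.restrictsTo_iff.mpr ⟨1, one_pos, fun x hx => by rw [RingHom.id_apply, w.toFFVal_val hx, one_mul]⟩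

lemma FFPrime.LiesOver.unique {w : FFPrime L} {v v' : FFPrime K} {φ : K →+* L} (h : w.LiesOver v φ) (h' : w.LiesOver v' φ) : v = v' := by
  by_contra hne
  obtain ⟨x, hx, h1, h2⟩ := FFPrime.approx2 hne
  obtain ⟨e, he⟩ := h
  obtain ⟨e', he'⟩ := h'
  rw [FFPrime.liesOverWith_iff] at he he'
  have h3 := he.2 x hx
  rw [he'.2 x hx] at h3
  have := he.1
  have := he'.1
  have h4 : (0:ℤ) < e * v.val x := by positivity
  have h5 : (e' : ℤ) * v'.val x < 0 := mul_neg_of_pos_of_neg (by positivity) h2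
  omega

lemma FFPrime.LiesOverWith.unique {w : FFPrime L} {v : FFPrime K} {φ : K →+* L} {e e' : ℕ} (h : w.LiesOverWith v φ e) (h' : w.LiesOverWith v φ e') : e = e' := by
  obtain ⟨π, hπ, hπ1⟩ := v.exists_val_eq 1
  rw [FFPrime.liesOverWith_iff] at h h'
  have h3 := h.2 π hπ
  rw [h'.2 π hπ, hπ1] at h3
  omega

lemma FFPrime.LiesOverWith.comp {w : FFPrime B} {u : FFPrime L} {v : FFPrime K} {φ : K →+* L} {ψ : L →+* B} {e e' : ℕ} (h : w.LiesOverWith u ψ e) (h' : u.LiesOverWith v φ e') :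
    w.LiesOverWith v (ψ.comp φ) (e * e') := by
  rw [FFPrime.liesOverWith_iff] at *
  refine ⟨Nat.mul_pos h.1 h'.1, fun x hx => ?_⟩
  rw [comp_apply, h.2 _ ((map_ne_zero φ).mpr hx), h'.2 x hx]; push_cast; ring

lemma FFPrime.LiesOver.ramIdx_spec {w : FFPrime L} {v : FFPrime K} {φ : K →+* L} (h : w.LiesOver v φ) : w.LiesOverWith v φ (w.ramIdx v φ) := by
  have h' : ∃ e : ℕ, w.LiesOverWith v φ e := h
  rw [FFPrime.ramIdx, dif_pos h']
  exact h'.choose_spec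

lemma FFPrime.LiesOver.ord_nonneg {w : FFPrime L} {v : FFPrime K} {φ : K →+* L} (h : w.LiesOver v φ) {x : K} : 0 ≤ w.ord (φ x) ↔ 0 ≤ v.ord x := by
  obtain ⟨e, he⟩ := h
  rw [FFPrime.liesOverWith_iff] at he
  by_cases hx : x = 0
  · simp [hx, v.ord_zero, w.ord_zero]
  · rw [v.ord_nonneg_iff hx, w.ord_nonneg_iff ((map_ne_zero φ).mpr hx), he.2 x hx]
    have := he.1
    exact mul_nonneg_iff_of_pos_left (by positivity)

lemma FFPrime.LiesOver.ord_pos {w : FFPrime L} {v : FFPrime K} {φ : K →+* L} (h : w.LiesOver v φ) {x : K} : 0 < w.ord (φ x) ↔ 0 < v.ord x := by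
  obtain ⟨e, he⟩ := h
  rw [FFPrime.liesOverWith_iff] at he
  by_cases hx : x = 0
  · simp [hx, v.ord_zero, w.ord_zero]
  · rw [v.ord_pos_iff hx, w.ord_pos_iff ((map_ne_zero φ).mpr hx), he.2 x hx]
    have := he.1
    exact mul_pos_iff_of_pos_left (by positivity)

variable [Algebra K L]

lemma FFVal.two_equal (V : FFVal B) {ι : Type*} [DecidableEq ι] (s : Finset ι) (hs : s.Nonempty) (f : ι → B) (hf : ∀ i ∈ s, f i ≠ 0) (h : ∑ i ∈ s, f i = 0) :
    ∃ i ∈ s, ∃ j ∈ s, i ≠ j ∧ V.val (f i) = V.val (f j) := by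
  obtain ⟨j, hj, hmin⟩ := s.exists_min_image (fun i => V.val (f i)) hs
  by_contra hcon
  push Not at hcon
  have h1 : V.ord (f j) < V.ord (∑ i ∈ s.erase j, f i) := by
    refine V.lt_ord_sum _ _ (by rw [V.ord_eq (hf j hj)]; exact coe_lt_top _) fun i hi => ?_
    obtain ⟨hij, hi⟩ := mem_erase.mp hi
    rw [V.ord_eq (hf j hj), V.ord_eq (hf i hi)]
    exact_mod_cast lt_of_le_of_ne (hmin i hi) (hcon j hj i hi hij.symm)
  have h2 := V.ord_add_eq_left h1
  rw [Finset.add_sum_erase _ _ hj, h, V.ord_zero] at h2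
  exact V.ord_ne_top _ (hf j hj) h2.symm

lemma FFVal.exists_multiple (V : FFVal B) (ψ : L →+* B) {x : L} (hx : x ≠ 0) (hInt : IsIntegral K x) : ∃ (m : ℕ) (k : K), 0 < m ∧ m ≤ (minpoly K x).natDegree ∧ k ≠ 0 ∧
      m * V.val (ψ x) = V.val (ψ (algebraMap K L k)) := by
  classical
  have hφ : ∀ {x : K}, x ≠ 0 → ψ (algebraMap K L x) ≠ 0 := fun hx =>
    (map_ne_zero ψ).mpr ((map_ne_zero _).mpr hx)
  set P := minpoly K x with hPdef
  have hP : P.aeval x = 0 := minpoly.aeval K x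
  rw [aeval_def, Polynomial.eval₂_eq_sum, Polynomial.sum_def] at hP
  have hP' := congrArg ψ hP
  rw [map_sum, map_zero] at hP'
  have hψx : ψ x ≠ 0 := (map_ne_zero ψ).mpr hx
  obtain ⟨i, hi, j, hj, hij, he⟩ := V.two_equal P.support
      (by simpa [Finset.nonempty_iff_ne_empty] using (minpoly.ne_zero hInt)) _
      (fun i hi => (map_ne_zero ψ).mpr (mul_ne_zero (by simpa using hi) (pow_ne_zero _ hx))) hP'
  have hi' := Polynomial.le_natDegree_of_mem_supp _ hi
  have hj' := Polynomial.le_natDegree_of_mem_supp _ hj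
  rw [Polynomial.mem_support_iff] at hi hj
  wlog hlt : i < j generalizing i j with H
  · exact H j hj i hi hij.symm he.symm hj' hi' (by omega)
  refine ⟨j - i, P.coeff i / P.coeff j, by omega, by omega, div_ne_zero hi hj, ?_⟩
  rw [map_mul, map_mul, map_pow, map_pow, V.val_mul (hφ hi) (pow_ne_zero _ hψx),
    V.val_mul (hφ hj) (pow_ne_zero _ hψx), V.val_pow hψx, V.val_pow hψx] at he
  rw [map_div₀, map_div₀, V.val_div (hφ hi) (hφ hj), Nat.cast_sub hlt.le]
  linarith

lemma FFVal.exists_restrictsTo_up [FiniteDimensional K L] (V : FFVal B) (ψ : L →+* B) (v : FFPrime K) (hv : V.RestrictsTo v (ψ.comp (algebraMap K L))) :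
    ∃ w : FFPrime L, V.RestrictsTo w ψ := by
  obtain ⟨c, hc, h⟩ := FFVal.restrictsTo_iff.mp hv
  set d := finrank K L
  have hdpos : (0:ℚ) < d.factorial := by exact_mod_cast d.factorial_pos
  refine V.exists_restrictsTo_of_discrete ψ (c / d.factorial) (by positivity) ?_ ?_
  · intro x hx
    obtain ⟨m, k, hm, hmd, hk, hmk⟩ := V.exists_multiple (K := K) ψ hx
      (Algebra.IsIntegral.isIntegral x)
    have hmd' : m ≤ d := hmd.trans (minpoly.natDegree_le x)
    obtain ⟨a, ha⟩ := Nat.dvd_factorial hm hmd'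
    have h2 := h k hk
    rw [comp_apply, ← hmk] at h2
    refine ⟨a * v.val k, ?_⟩
    have hm0 : (m:ℚ) ≠ 0 := by exact_mod_cast hm.ne'
    have ha' : (d.factorial : ℚ) = m * a := by exact_mod_cast ha
    have ha0 : (a:ℚ) ≠ 0 := by rintro h0; rw [h0, mul_zero] at ha'; exact hdpos.ne' ha'
    rw [ha']
    field_simp
    push_cast
    linear_combination (a:ℚ) * h2
  · obtain ⟨π, hπ, hπ1⟩ := v.exists_val_eq 1
    refine ⟨algebraMap K L π, (map_ne_zero _).mpr hπ, ?_⟩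
    have := h π hπ
    rw [comp_apply] at this
    rw [this, hπ1]; simpa using hc.ne'

lemma FFVal.exists_restrictsTo_down [Algebra.IsAlgebraic K L] (V : FFVal B) (ψ : L →+* B) (w : FFPrime L) (hw : V.RestrictsTo w ψ) :
    ∃ v : FFPrime K, V.RestrictsTo v (ψ.comp (algebraMap K L)) := by
  obtain ⟨c, hc, h⟩ := FFVal.restrictsTo_iff.mp hw
  refine V.exists_restrictsTo_of_discrete _ c hc (fun x hx => ?_) ?_
  · exact ⟨w.val (algebraMap K L x), by rw [comp_apply, h _ ((map_ne_zero _).mpr hx), mul_comm]⟩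
  · obtain ⟨π, hπ, hπ1⟩ := w.exists_val_eq 1
    obtain ⟨m, k, hm, hmd, hk, hmk⟩ := V.exists_multiple (K := K) ψ hπ
      (Algebra.IsAlgebraic.isAlgebraic π).isIntegral
    refine ⟨k, hk, ?_⟩
    rw [comp_apply, ← hmk, h π hπ, hπ1]
    have : (m:ℚ) ≠ 0 := by exact_mod_cast hm.ne'
    simp [this, hc.ne']

lemma FFPrime.exists_under [Algebra.IsAlgebraic K L] (w : FFPrime L) : ∃ v : FFPrime K, w.LiesOver v (algebraMap K L) := by
  obtain ⟨v, hv⟩ := w.toFFVal.exists_restrictsTo_down (K := K) _ w w.toFFVal_restrictsTo_self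
  exact ⟨v, FFVal.liesOver_of_restrictsTo w.toFFVal_restrictsTo_self hv⟩

lemma FFVal.restrictsTo_of_ext {V : FFVal B} [Algebra K B] {v : FFPrime K} (h : ∀ k : K, V.ord (algebraMap K B k) = WithTop.map (fun n : ℤ => (n : ℚ)) (v.ord k)) :
    V.RestrictsTo v (algebraMap K B) := by
  refine ⟨1, one_pos, fun x => ?_⟩
  rw [h]
  by_cases hx : x = 0
  · simp [hx, v.ord_zero]
  · rw [v.ord_eq hx]
    simp only [WithTop.map_coe]
    norm_cast; simp

lemma FFPrime.exists_over_neg [FiniteDimensional K L] (v : FFPrime K) (x : L) (hx : x ∉ valIntegralClosure v L) : ∃ w : FFPrime L, w.LiesOver v (algebraMap K L) ∧ w.ord x < 0 := by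
  obtain ⟨V, hV, hVx⟩ := exists_ext v x hx
  have hVv := FFVal.restrictsTo_of_ext hV
  obtain ⟨w, hw⟩ := V.exists_restrictsTo_up (K := K) (RingHom.id L) v hVv
  refine ⟨w, FFVal.liesOver_of_restrictsTo hw hVv, ?_⟩
  obtain ⟨c, hc, h⟩ := FFVal.restrictsTo_iff.mp hw
  have hx0 : x ≠ 0 := by rintro rfl; rw [V.ord_zero] at hVx; simp at hVx
  have h1 := h x hx0
  rw [V.ord_neg_iff hx0] at hVx
  rw [RingHom.id_apply] at h1
  rw [h1] at hVx
  rw [w.ord_neg_iff hx0]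
  have : (w.val x : ℚ) < 0 := by
    by_contra hcon
    push Not at hcon
    have := mul_nonneg hc.le hcon
    linarith
  exact_mod_cast this

lemma FFVal.nonneg_of_integral (V : FFVal B) {x : B} (P : Polynomial B) (hP : P.Monic) (h : ∀ n, 0 ≤ V.ord (P.coeff n)) (hx : P.eval x = 0) : 0 ≤ V.ord x := by
  by_contra hcon
  rw [not_le] at hcon
  have hx0 : x ≠ 0 := by rintro rfl; rw [V.ord_zero] at hcon; simp at hcon
  rw [V.ord_neg_iff hx0] at hcon
  rw [Polynomial.eval_eq_sum_range, Finset.sum_range_succ, hP.coeff_natDegree, one_mul] at hx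
  have hlt : V.ord (x ^ P.natDegree) < V.ord (∑ i ∈ range P.natDegree, P.coeff i * x ^ i) := by
    refine V.lt_ord_sum _ _ (by rw [V.ord_eq (pow_ne_zero _ hx0)]; exact coe_lt_top _)
      fun i hi => ?_
    by_cases h0 : P.coeff i = 0
    · rw [h0, zero_mul, V.ord_zero, V.ord_eq (pow_ne_zero _ hx0)]; exact coe_lt_top _
    have hi := mem_range.mp hi
    have h1 := h i
    rw [V.ord_nonneg_iff h0] at h1
    rw [V.ord_eq (pow_ne_zero _ hx0), V.lt_ord_iff (mul_ne_zero h0 (pow_ne_zero _ hx0)),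
      V.val_mul h0 (pow_ne_zero _ hx0), V.val_pow hx0, V.val_pow hx0]
    have : (i:ℚ) < P.natDegree := by exact_mod_cast hi
    nlinarith
  have h2 := V.ord_add_eq_right hlt
  rw [hx, V.ord_zero] at h2
  exact V.ord_ne_top _ (pow_ne_zero _ hx0) h2.symm

lemma FFPrime.toFFVal_nonneg {v : FFPrime K} {x : K} : 0 ≤ v.toFFVal.ord x ↔ 0 ≤ v.ord x := by
  by_cases hx : x = 0
  · rw [hx, v.ord_zero, v.toFFVal.ord_zero]; simp
  · rw [v.toFFVal.ord_nonneg_iff hx, v.ord_nonneg_iff hx, v.toFFVal_val hx]; norm_cast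

lemma FFPrime.nonneg_of_integral (v : FFPrime L) {x : L} (P : Polynomial L) (hP : P.Monic) (h : ∀ n, 0 ≤ v.ord (P.coeff n)) (hx : P.eval x = 0) : 0 ≤ v.ord x :=
  FFPrime.toFFVal_nonneg.mp (v.toFFVal.nonneg_of_integral P hP
    (fun n => FFPrime.toFFVal_nonneg.mpr (h n)) hx)

lemma FFPrime.exists_over [FiniteDimensional K L] (v : FFPrime K) : ∃ w : FFPrime L, w.LiesOver v (algebraMap K L) := by
  obtain ⟨π, hπ, hπ1⟩ := v.exists_val_eq (-1)
  obtain ⟨w, hw, _⟩ := v.exists_over_neg (L := L) (algebraMap K L π) (by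
    rintro ⟨P, hP, hPn, hPx⟩
    rw [Polynomial.aeval_algebraMap_apply, map_eq_zero] at hPx
    have := v.nonneg_of_integral P hP hPn hPx
    rw [v.ord_nonneg_iff hπ] at this; omega)
  exact ⟨w, hw⟩

end restrict

lemma trdeg_ratFunc (F : Type) [Field F] : trdeg F (RatFunc F) = 1 := by
  have h := trdeg_add_eq F (Polynomial F) (A := RatFunc F)
  rw [Polynomial.trdeg_of_isDomain] at h
  have : Algebra.IsAlgebraic (Polynomial F) (RatFunc F) := IsLocalization.isAlgebraic _ (nonZeroDivisors (Polynomial F))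
  rw [← h, trdeg_eq_zero, add_zero]

lemma finite_of_ringHom {F X : Type} [Field F] [Field X] [Algebra F X] (φ ψ : RatFunc F →ₐ[F] X) (hφ : φ.toRingHom.Finite) : ψ.toRingHom.Finite := by
  have h1 : trdeg F X = 1 := by
    let _ := φ.toRingHom.toAlgebra
    have : IsScalarTower F (RatFunc F) X := .of_algHom φ
    have : Module.Finite (RatFunc F) X := hφ
    have h := trdeg_add_eq F (RatFunc F) (A := X)
    rw [← h, trdeg_ratFunc,  trdeg_eq_zero, add_zero]
  have h2 : EssFiniteType F X := by
    let _ := φ.toRingHom.toAlgebra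
    have : IsScalarTower F (RatFunc F) X := .of_algHom φ
    have : Module.Finite (RatFunc F) X := hφ
    have : EssFiniteType (Polynomial F) (RatFunc F) := EssFiniteType.of_isLocalization _ (nonZeroDivisors (Polynomial F))
    have : EssFiniteType F (RatFunc F) := EssFiniteType.comp F (Polynomial F) (RatFunc F)
    exact EssFiniteType.comp F (RatFunc F) X
  let _ := ψ.toRingHom.toAlgebra
  have : IsScalarTower F (RatFunc F) X := .of_algHom ψ
  have : EssFiniteType (RatFunc F) X := EssFiniteType.of_comp F _ _
  have h3 := trdeg_add_eq F (RatFunc F) (A := X)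
  rw [h1, trdeg_ratFunc] at h3
  have h4 : trdeg (RatFunc F) X = 0 := by
    rw [add_comm] at h3
    exact Cardinal.add_one_inj.mp (h3.trans (zero_add 1).symm)
  have h5 : Algebra.IsAlgebraic (RatFunc F) X := trdeg_eq_zero_iff.mp h4
  change Module.Finite (RatFunc F) X
  exact Algebra.finite_of_essFiniteType_of_isAlgebraic

class IsFF (p : ℕ) [Fact p.Prime] (X : Type) [Field X] : Prop where
  ex : ∃ φ : RatFunc (ZMod p) →+* X, φ.Finite
  ne : Nonempty (FFPrime X)

section
variable (p : ℕ) [Fact p.Prime] {X : Type} [Field X]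

lemma IsFF.charP [h : IsFF p X] : CharP X p := by
  obtain ⟨φ, _⟩ := h.ex
  have : CharP (RatFunc (ZMod p)) p := by exact charP_of_injective_algebraMap (algebraMap (ZMod p) (RatFunc (ZMod p))).injective p
  exact (RingHom.charP_iff φ φ.injective p).mp this

lemma IsFF.finite_hom [h : IsFF p X] (ψ : RatFunc (ZMod p) →+* X) : ψ.Finite := by
  have := IsFF.charP p (X := X)
  let _ := ZMod.algebra X p
  obtain ⟨φ, hφ⟩ := h.ex
  let φ' : RatFunc (ZMod p) →ₐ[ZMod p] X := ⟨φ, fun r => by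
    exact congrArg (fun f : ZMod p →+* X => f r) (Subsingleton.elim (φ.comp (algebraMap _ _)) (algebraMap _ _))⟩
  let ψ' : RatFunc (ZMod p) →ₐ[ZMod p] X := ⟨ψ, fun r => by
    exact congrArg (fun f : ZMod p →+* X => f r) (Subsingleton.elim (ψ.comp (algebraMap _ _)) (algebraMap _ _))⟩
  exact finite_of_ringHom φ' ψ' hφ

lemma IsFF.of_finite [h : IsFF p X] (Y : Type) [Field Y] [Algebra X Y] [FiniteDimensional X Y] : IsFF p Y := by
  obtain ⟨φ, hφ⟩ := h.ex
  obtain ⟨v⟩ := h.ne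
  obtain ⟨w, _⟩ := v.exists_over (L := Y)
  exact ⟨⟨(algebraMap X Y).comp φ, RingHom.Finite.comp
    (RingHom.finite_algebraMap.mpr inferInstance) hφ⟩, ⟨w⟩⟩

lemma FFPrime.nonneg_natCast (v : FFPrime X) (n : ℕ) : 0 ≤ v.ord (n : X) := by
  induction n with
  | zero => simp [v.ord_zero]
  | succ n ih => push_cast; exact v.le_ord_add ih v.ord_one.ge

lemma FFPrime.nonneg_zmod [Algebra (ZMod p) X] (v : FFPrime X) (c : ZMod p) : 0 ≤ v.ord (algebraMap (ZMod p) X c) := by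
  have : c = ((c.val : ℕ) : ZMod p) := by simp
  rw [this, map_natCast]; exact v.nonneg_natCast _

lemma FFPrime.eq_zero_zmod [Algebra (ZMod p) X] (v : FFPrime X) {c : ZMod p} (hc : c ≠ 0) : v.ord (algebraMap (ZMod p) X c) = 0 := by
  have h1 := v.nonneg_zmod p c
  have h2 := v.nonneg_zmod p c⁻¹
  have h0 : algebraMap (ZMod p) X c ≠ 0 := (map_ne_zero _).mpr hc
  rw [map_inv₀, v.ord_nonneg_iff (inv_ne_zero h0), v.val_inv h0] at h2
  rw [v.ord_nonneg_iff h0] at h1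
  rw [v.ord_eq h0]
  norm_cast; omega

lemma transcendental_of_val_ne [Algebra (ZMod p) X] (v : FFPrime X) {x : X} (hx : x ≠ 0) (hv : v.val x ≠ 0) : Transcendental (ZMod p) x := by
  intro halg
  have key : ∀ y : X, y ≠ 0 → IsAlgebraic (ZMod p) y → 0 ≤ v.val y := by
    intro y hy hay
    obtain ⟨P, hP, hPx⟩ := hay.isIntegral
    rw [← v.ord_nonneg_iff hy]
    refine v.nonneg_of_integral (P.map (algebraMap _ _)) (hP.map _) (fun n => ?_) (by
      rw [eval_map]; exact hPx)
    rw [Polynomial.coeff_map]; exact v.nonneg_zmod p _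
  have h1 := key x hx halg
  have h2 := key x⁻¹ (inv_ne_zero hx) halg.inv
  rw [v.val_inv hx] at h2
  omega

lemma exists_ratFunc_hom [Algebra (ZMod p) X] {x : X} (hx : Transcendental (ZMod p) x) : ∃ φ : RatFunc (ZMod p) →ₐ[ZMod p] X, φ RatFunc.X = x :=
  ⟨(IntermediateField.val _).comp (RatFunc.algEquivOfTranscendental x hx).toAlgHom, by simp⟩
end

section general
variable {X : Type} [Field X]

def GG (T : Set (FFPrime X)) (n : FFPrime X → ℤ) : AddSubgroup X where
  carrier := {y | ∀ v ∈ T, (n v : WithTop ℤ) ≤ v.ord y}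
  zero_mem' := fun v _ => by rw [v.ord_zero]; exact le_top
  add_mem' := fun ha hb v hv => v.le_ord_add (ha v hv) (hb v hv)
  neg_mem' := fun ha v hv => by rw [v.ord_neg]; exact ha v hv

lemma mem_GG {T : Set (FFPrime X)} {n : FFPrime X → ℤ} {y : X} : y ∈ GG T n ↔ ∀ v ∈ T, (n v : WithTop ℤ) ≤ v.ord y := Iff.rfl

def UU (v : FFPrime X) (n : ℤ) : AddSubgroup X := GG {v} (fun _ => n)

lemma mem_UU {v : FFPrime X} {n : ℤ} {y : X} : y ∈ UU v n ↔ (n : WithTop ℤ) ≤ v.ord y := by simp [UU, mem_GG]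

def FFPrime.rc (v : FFPrime X) : ℕ := (UU v 1).relIndex (UU v 0)

lemma GG_map_mul (T : Set (FFPrime X)) (n : FFPrime X → ℤ) {a : X} (ha : a ≠ 0) : (GG T n).map (AddMonoidHom.mulLeft a) = GG T (fun v => n v + v.val a) := by
  ext y
  simp only [AddSubgroup.mem_map, AddMonoidHom.coe_mulLeft]
  constructor
  · rintro ⟨z, hz, rfl⟩ v hv
    have := hz v hv
    by_cases h0 : z = 0
    · simp [h0, v.ord_zero]
    rw [v.le_ord_iff h0] at this
    rw [v.le_ord_iff (mul_ne_zero ha h0), v.val_mul ha h0]; dsimp only; omega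
  · intro hy
    refine ⟨a⁻¹ * y, fun v hv => ?_, by field_simp⟩
    have := hy v hv
    by_cases h0 : y = 0
    · simp [h0, v.ord_zero]
    rw [v.le_ord_iff h0] at this
    rw [v.le_ord_iff (mul_ne_zero (inv_ne_zero ha) h0), v.val_mul (inv_ne_zero ha) h0, v.val_inv ha]; dsimp only at this; omega

lemma mulLeft_inj {a : X} (ha : a ≠ 0) : Injective (AddMonoidHom.mulLeft a) := mul_right_injective₀ ha

lemma relIndex_GG_shift (T : Set (FFPrime X)) (m n : FFPrime X → ℤ) {a : X} (ha : a ≠ 0) : (GG T (fun v => m v + v.val a)).relIndex (GG T (fun v => n v + v.val a)) =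
      (GG T m).relIndex (GG T n) := by
  rw [← GG_map_mul T m ha, ← GG_map_mul T n ha]
  exact AddSubgroup.relIndex_map_map_of_injective _ _ (mulLeft_inj ha)

lemma relIndex_UU (v : FFPrime X) (n : ℤ) : (UU v (n + 1)).relIndex (UU v n) = v.rc := by
  obtain ⟨a, ha, han⟩ := v.exists_val_eq n
  have := relIndex_GG_shift {v} (fun _ => 1) (fun _ => 0) ha
  change _ = (GG {v} fun x => 1).relIndex (GG {v} fun x => 0)
  rw [← this]
  congr 1 <;> · ext y; simp [UU, mem_GG, han, add_comm]

lemma GG_step_eq (T : Set (FFPrime X)) (n : FFPrime X → ℤ) {v0 : FFPrime X} (h : v0 ∈ T) : GG T (fun v => n v + (single v0 1 : FFPrime X →₀ ℕ) v) =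
      GG T n ⊓ UU v0 (n v0 + 1) := by
  ext y
  simp only [AddSubgroup.mem_inf, mem_GG, mem_UU]
  constructor
  · intro H
    refine ⟨fun v hv => le_trans ?_ (H v hv), ?_⟩
    · norm_cast; omega
    · simpa using H v0 h
  · rintro ⟨H1, H2⟩ v hv
    by_cases hvv : v0 = v
    · subst hvv; simpa using H2
    · simpa [single_apply, hvv] using H1 v hv

lemma GG_step_eq' (T : Set (FFPrime X)) (n : FFPrime X → ℤ) {v0 : FFPrime X} (h : v0 ∉ T) : GG T (fun v => n v + (single v0 1 : FFPrime X →₀ ℕ) v) = GG T n := by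
  ext y
  simp only [mem_GG]
  refine forall₂_congr fun v hv => ?_
  have : v0 ≠ v := by rintro rfl; exact h hv
  simp [single_apply, this]

lemma GG_le_UU (T : Set (FFPrime X)) (n : FFPrime X → ℤ) {v0 : FFPrime X} (h : v0 ∈ T) : GG T n ≤ UU v0 (n v0) := fun y hy => mem_UU.mpr (hy v0 h)

lemma relIndex_GG_step (T : Set (FFPrime X)) (n : FFPrime X → ℤ) {v0 : FFPrime X} (hv0 : v0.rc ≠ 0) : (GG T (fun v => n v + (single v0 1 : FFPrime X →₀ ℕ) v)).relIndex (GG T n) ≠ 0 ∧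
    (GG T (fun v => n v + (single v0 1 : FFPrime X →₀ ℕ) v)).relIndex (GG T n) ≤ v0.rc := by
  by_cases h : v0 ∈ T
  · rw [GG_step_eq T n h, AddSubgroup.inf_relIndex_left]
    rw [← relIndex_UU v0 (n v0)] at hv0 ⊢
    exact ⟨fun h0 => hv0 (AddSubgroup.relIndex_eq_zero_of_le_right (GG_le_UU T n h) h0), AddSubgroup.relIndex_le_of_le_right (GG_le_UU T n h) hv0⟩
  · rw [GG_step_eq' T n h, relIndex_self]
    exact ⟨one_ne_zero, Nat.one_le_iff_ne_zero.mpr hv0⟩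

lemma relIndex_GG_step_eq (T : Finset (FFPrime X)) (n : FFPrime X → ℤ) {v0 : FFPrime X} (h : v0 ∈ T) :
    (GG (T : Set (FFPrime X)) (fun v => n v + (single v0 1 : FFPrime X →₀ ℕ) v)).relIndex
      (GG (T : Set (FFPrime X)) n) = v0.rc := by
  classical
  rw [GG_step_eq _ n (by exact_mod_cast h), AddSubgroup.inf_relIndex_left, ← relIndex_UU v0 (n v0), ← AddSubgroup.relIndex_sup_right]
  congr 1
  apply le_antisymm
  · refine sup_le (GG_le_UU _ n (by exact_mod_cast h)) fun y hy => ?_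
    rw [mem_UU] at hy ⊢
    refine le_trans ?_ hy
    norm_cast; omega
  · intro y hy
    rw [mem_UU] at hy
    obtain ⟨N, hN⟩ : ∃ N : ℤ, ∀ v ∈ T, n v + 1 ≤ N := by
      obtain ⟨N, hN⟩ := (T.image (fun v => n v + 1)).bddAbove
      exact ⟨N, fun v hv => hN (by simpa using ⟨v, hv, rfl⟩)⟩
    obtain ⟨x, hx⟩ := FFPrime.approx T (fun v => if v = v0 then y else 0) N
    rw [mem_sup]
    refine ⟨x, fun v hv => ?_, y - x, ?_, by ring⟩
    · have h1 := hx v hv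
      have h2 : (n v : WithTop ℤ) ≤ v.ord (x - if v = v0 then y else 0) := le_trans (by have := hN v hv; norm_cast; omega) h1
      have h3 : (n v : WithTop ℤ) ≤ v.ord (if v = v0 then y else 0) := by
        split_ifs with hv'
        · subst hv'; exact hy
        · rw [v.ord_zero]; exact le_top
      simpa using v.le_ord_add h2 h3
    · rw [mem_UU, v0.ord_sub_comm]
      have h1 := hx v0 h
      simp only [if_true] at h1
      refine le_trans ?_ h1
      have := hN v0 h; norm_cast

lemma GG_anti (T : Set (FFPrime X)) {m n : FFPrime X → ℤ} (h : ∀ v ∈ T, n v ≤ m v) : GG T m ≤ GG T n := fun y hy v hv => le_trans (by exact_mod_cast h v hv) (hy v hv)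

lemma FFPrime.rc_ne_one (v : FFPrime X) : v.rc ≠ 1 := by
  intro h
  rw [FFPrime.rc, AddSubgroup.relIndex_eq_one] at h
  have := h (mem_UU.mpr (by simpa using v.ord_one.ge) : (1 : X) ∈ _)
  rw [mem_UU, v.ord_one] at this
  norm_cast at this

end general

section powers
variable (p : ℕ) [Fact p.Prime] {X : Type} [Field X] [CharP X p]

lemma index_pow_p' {A : Type} [AddCommGroup A] [Module (ZMod p) A] [Finite A] : ∃ k, card A = p ^ k := by
  have h := Module.natCard_eq_pow_finrank (K := ZMod p) (V := A)
  rw [Nat.card_zmod] at h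
  exact ⟨_, h⟩

lemma index_pow_p {A : Type} [AddCommGroup A] (hA : ∀ a : A, p • a = 0) [Finite A] : ∃ k, card A = p ^ k :=
  @index_pow_p' p _ A _ (AddCommGroup.zmodModule hA) _

lemma relIndex_pow_p (H K : AddSubgroup X) (h : H.relIndex K ≠ 0) : ∃ k, H.relIndex K = p ^ k := by
  have : Finite (K ⧸ H.addSubgroupOf K) := by
    apply Nat.finite_of_card_ne_zero; exact h
  refine index_pow_p p (A := K ⧸ H.addSubgroupOf K) fun a => ?_
  induction a using QuotientAddGroup.induction_on with
  | H z =>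
    rw [← mk_nsmul]
    have : p • z = 0 := by ext; simp
    rw [this]; rfl
end powers

section F3
variable (p : ℕ) [Fact p.Prime] {X : Type} [Field X]

lemma indep_aux [Algebra (ZMod p) X] (U W : Submodule (ZMod p) X) (x : X) (hUx : ∀ y ∈ U, x * y ∈ W) (hWU : W ≤ U) (φ : RatFunc (ZMod p) →ₐ[ZMod p] X)
    (hφ : φ RatFunc.X = x) {ι : Type} [Fintype ι] (b : ι → X) (hb : ∀ i, b i ∈ U) (hind : ∀ c : ι → ZMod p, ∑ i, c i • b i ∈ W → ∀ i, c i = 0) : let _ := φ.toRingHom.toAlgebra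
    LinearIndependent (RatFunc (ZMod p)) b := by
  intro _
  have hsm : ∀ (r : RatFunc (ZMod p)) (y : X), r • y = φ r * y := fun r y => rfl
  have : IsScalarTower (ZMod p) (RatFunc (ZMod p)) X := .of_algHom φ
  let _ : Algebra (Polynomial (ZMod p)) X := ((algebraMap (RatFunc (ZMod p)) X).comp
    (algebraMap (Polynomial (ZMod p)) (RatFunc (ZMod p)))).toAlgebra
  have : IsScalarTower (Polynomial (ZMod p)) (RatFunc (ZMod p)) X := .of_algebraMap_eq fun _ => rfl
  rw [← LinearIndependent.iff_fractionRing (Polynomial (ZMod p)) (RatFunc (ZMod p))]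
  rw [Fintype.linearIndependent_iff]
  have hsm2 : ∀ (P : Polynomial (ZMod p)) (y : X), P • y = φ (algebraMap _ _ P) * y := fun r y => rfl
  have hC : ∀ (c : ZMod p) (y : X), (Polynomial.C c) • y = c • y := by
    intro c y
    rw [hsm2, RatFunc.algebraMap_C, ← RatFunc.algebraMap_eq_C, φ.commutes, smul_def]
  have hX : ∀ (P : Polynomial (ZMod p)) (y : X), (Polynomial.X * P) • y = x * P • y := by
    intro P y
    rw [hsm2, hsm2, map_mul, map_mul, RatFunc.algebraMap_X, hφ, mul_assoc]
  have hU : ∀ (P : Polynomial (ZMod p)) (y : X), y ∈ U → P • y ∈ U := by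
    intro P y hy
    induction P using Polynomial.induction_on' with
    | add P Q hP hQ => rw [add_smul]; exact U.add_mem hP hQ
    | monomial n c =>
      rw [← Polynomial.C_mul_X_pow_eq_monomial, mul_comm]
      induction n with
      | zero => rw [pow_zero, one_mul, hC]; exact U.smul_mem _ hy
      | succ n ih => rw [pow_succ', mul_assoc, hX]; exact hWU (hUx _ ih)
  have hx0 : x ≠ 0 := by
    rw [← hφ]; exact (map_ne_zero _).mpr RatFunc.X_ne_zero
  have key : ∀ (k : ℕ) (g : ι → Polynomial (ZMod p)), ∑ i, g i • b i = 0 →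
      ∀ i, (g i).coeff k = 0 := by
    intro k
    have h0 : ∀ (g : ι → Polynomial (ZMod p)), ∑ i, g i • b i = 0 → ∀ i, (g i).coeff 0 = 0 := by
      intro g hg
      apply hind
      have : ∑ i, (g i).coeff 0 • b i = - (x * ∑ i, (g i).divX • b i) := by
        rw [eq_neg_iff_add_eq_zero, mul_sum, ← Finset.sum_add_distrib, ← hg]
        refine sum_congr rfl fun i _ => ?_
        rw [← hX, ← hC, ← add_smul, add_comm, Polynomial.X_mul_divX_add]
      rw [this]
      exact W.neg_mem (hUx _ (U.sum_mem fun i _ => hU _ _ (hb i)))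
    induction k with
    | zero => exact h0
    | succ k ih =>
      intro g hg i
      rw [← Polynomial.coeff_divX]
      refine ih (fun i => (g i).divX) ?_ i
      have : x * ∑ i, (g i).divX • b i = 0 := by
        rw [← hg, mul_sum]
        refine sum_congr rfl fun i _ => ?_
        rw [← hX]
        congr 1
        conv_rhs => rw [← Polynomial.X_mul_divX_add (g i), h0 g hg i]
        simp
      exact (mul_eq_zero.mp this).resolve_left hx0
  intro g hg i
  ext k
  simpa using key k g hg i

lemma relIndex_le_aux [h : IsFF p X] [Algebra (ZMod p) X] (U W : AddSubgroup X) (x : X) (hUx : ∀ y ∈ U, x * y ∈ W) (hWU : W ≤ U) (φ : RatFunc (ZMod p) →ₐ[ZMod p] X)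
    (hφ : φ RatFunc.X = x) : let _ := φ.toRingHom.toAlgebra
    W.relIndex U ≠ 0 ∧ W.relIndex U ≤ p ^ (finrank (RatFunc (ZMod p)) X) := by
  intro _
  have hfin : Module.Finite (RatFunc (ZMod p)) X := IsFF.finite_hom p φ.toRingHom
  let U' : Submodule (ZMod p) X := AddSubgroup.toZModSubmodule p U
  let W' : Submodule (ZMod p) X := AddSubgroup.toZModSubmodule p W
  have hUU : ∀ y, y ∈ U' ↔ y ∈ U := fun y => by simp [U']
  have hWW : ∀ y, y ∈ W' ↔ y ∈ W := fun y => by simp [W']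
  let Q := U' ⧸ (W'.comap U'.subtype)
  have hrank : Module.rank (ZMod p) Q ≤ (finrank (RatFunc (ZMod p)) X : ℕ) := by
    apply rank_le
    intro s hs
    have := indep_aux p U' W' x (fun y hy => (hWW _).mpr (hUx y ((hUU _).mp hy)))
      (fun y hy => (hUU _).mpr (hWU ((hWW y).mp hy))) φ hφ
      (fun i : s => ((Submodule.Quotient.mk_surjective _ (i : Q)).choose : X))
      (fun i => Subtype.prop _) ?_
    · have h2 := this.fintype_card_le_finrank
      simpa using h2
    · intro c hc
      rw [Fintype.linearIndependent_iff] at hs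
      apply hs c
      have e : ∑ i, c i • (i : Q) = Submodule.Quotient.mk
          (∑ i : s, c i • (Submodule.Quotient.mk_surjective _ (i : Q)).choose) := by
        rw [← Submodule.mkQ_apply, map_sum]
        refine sum_congr rfl fun i _ => ?_
        rw [Submodule.mkQ_apply, Submodule.Quotient.mk_smul, (Submodule.Quotient.mk_surjective _ (i : Q)).choose_spec]
      rw [e, Submodule.Quotient.mk_eq_zero, Submodule.mem_comap]
      simpa using hc
  have hQf : Module.Finite (ZMod p) Q := by
    rw [← Module.rank_lt_aleph0_iff]
    exact hrank.trans_lt (Cardinal.nat_lt_aleph0 _)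
  have hQ2 : finrank (ZMod p) Q ≤ finrank (RatFunc (ZMod p)) X := by
    rw [← Module.finrank_eq_rank] at hrank
    exact_mod_cast hrank
  have hcard : W.relIndex U = card Q := rfl
  have h3 := Module.natCard_eq_pow_finrank (K := ZMod p) (V := Q)
  rw [Nat.card_zmod] at h3
  have hp := (Fact.out : p.Prime)
  rw [hcard, h3]
  exact ⟨(pow_pos hp.pos _).ne', Nat.pow_le_pow_right hp.pos hQ2⟩

lemma FFPrime.rc_ne_zero [h : IsFF p X] (v : FFPrime X) : v.rc ≠ 0 := by
  have := IsFF.charP p (X := X)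
  let _ := ZMod.algebra X p
  obtain ⟨x, hx, hv⟩ := v.exists_val_eq 1
  have ht := transcendental_of_val_ne p v hx (by omega)
  obtain ⟨φ, hφ⟩ := exists_ratFunc_hom p ht
  refine (relIndex_le_aux p (UU v 0) (UU v 1) x (fun y hy => ?_) (fun y hy => ?_) φ hφ).1
  · rw [mem_UU] at hy ⊢
    by_cases h0 : y = 0
    · simp [h0, v.ord_zero]
    rw [v.le_ord_iff h0] at hy
    rw [v.le_ord_iff (mul_ne_zero hx h0), v.val_mul hx h0]; omega
  · rw [mem_UU] at hy ⊢
    exact le_trans (by norm_cast) hy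

def FFPrime.deg (v : FFPrime X) : ℕ := Nat.log p v.rc

lemma FFPrime.rc_eq [IsFF p X] (v : FFPrime X) : v.rc = p ^ v.deg p := by
  have := IsFF.charP p (X := X)
  obtain ⟨k, hk⟩ := relIndex_pow_p p (UU v 1) (UU v 0) (v.rc_ne_zero p)
  change v.rc = p ^ k at hk
  rw [FFPrime.deg, hk, Nat.log_pow (Fact.out : p.Prime).one_lt]

lemma FFPrime.deg_pos [IsFF p X] (v : FFPrime X) : 0 < v.deg p := by
  rcases Nat.eq_zero_or_pos (v.deg p) with h | h
  · exact absurd (by rw [v.rc_eq p, h, pow_zero]) v.rc_ne_one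
  · exact h

def degN (E : FFPrime X →₀ ℕ) : ℕ := E.sum fun v n => n * v.deg p

lemma degN_add (E F : FFPrime X →₀ ℕ) : degN p (E + F) = degN p E + degN p F := Finsupp.sum_add_index' (by simp) (by intros; ring)

lemma degN_single (v : FFPrime X) (n : ℕ) : degN p (single v n) = n * v.deg p := by simp [degN]

lemma relIndex_GG [IsFF p X] (T : Set (FFPrime X)) (E : FFPrime X →₀ ℕ) : ∀ n : FFPrime X → ℤ, (GG T (fun v => n v + E v)).relIndex (GG T n) ≠ 0 ∧
    (GG T (fun v => n v + E v)).relIndex (GG T n) ≤ p ^ degN p E := by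
  have trans : ∀ E F : FFPrime X →₀ ℕ, (∀ n : FFPrime X → ℤ, (GG T (fun v => n v + E v)).relIndex (GG T n) ≠ 0 ∧
    (GG T (fun v => n v + E v)).relIndex (GG T n) ≤ p ^ degN p E) → (∀ n : FFPrime X → ℤ,
    (GG T (fun v => n v + F v)).relIndex (GG T n) ≠ 0 ∧
    (GG T (fun v => n v + F v)).relIndex (GG T n) ≤ p ^ degN p F) → (∀ n : FFPrime X → ℤ,
    (GG T (fun v => n v + (E + F) v)).relIndex (GG T n) ≠ 0 ∧
    (GG T (fun v => n v + (E + F) v)).relIndex (GG T n) ≤ p ^ degN p (E + F)) := by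
    intro E F hE hF n
    have h1 := hE n
    have h2 := hF (fun v => n v + E v)
    have e : (fun v => n v + ((E + F) v : ℕ)) = fun v => n v + (E v : ℤ) + (F v : ℤ) := by
      funext v; simp [add_assoc]
    rw [e, ← relIndex_mul_relIndex _ _ _
      (GG_anti T (m := fun v => n v + (E v : ℤ) + (F v : ℤ)) (n := fun v => n v + (E v : ℤ))
        fun v _ => by simp)
      (GG_anti T (m := fun v => n v + (E v : ℤ)) (n := n) fun v _ => by simp), degN_add, add_comm, pow_add]
    exact ⟨mul_ne_zero h2.1 h1.1, Nat.mul_le_mul h2.2 h1.2⟩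
  induction E using Finsupp.induction_linear with
  | zero => intro n; simp [relIndex_self, degN]
  | add E F hE hF => exact trans E F hE hF
  | single v m =>
    induction m with
    | zero => intro n; simp [relIndex_self, degN]
    | succ m ih =>
      rw [Finsupp.single_add]
      refine trans _ _ ih fun n => ?_
      have := relIndex_GG_step T n (v.rc_ne_zero p)
      rw [degN_single, one_mul, ← v.rc_eq p]
      exact this

lemma relIndex_GG_eq [IsFF p X] (T : Finset (FFPrime X)) (E : FFPrime X →₀ ℕ) (hE : E.support ⊆ T) : ∀ n : FFPrime X → ℤ,
    (GG (T : Set (FFPrime X)) (fun v => n v + E v)).relIndex (GG (T : Set (FFPrime X)) n) =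
      p ^ degN p E := by
  classical
  have trans : ∀ E F : FFPrime X →₀ ℕ, (∀ n : FFPrime X → ℤ, (GG (T : Set (FFPrime X)) (fun v => n v + E v)).relIndex (GG (T : Set (FFPrime X)) n) =
      p ^ degN p E) → (∀ n : FFPrime X → ℤ,
    (GG (T : Set (FFPrime X)) (fun v => n v + F v)).relIndex (GG (T : Set (FFPrime X)) n) =
      p ^ degN p F) → (∀ n : FFPrime X → ℤ,
    (GG (T : Set (FFPrime X)) (fun v => n v + (E + F) v)).relIndex (GG (T : Set (FFPrime X)) n) =
      p ^ degN p (E + F)) := by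
    intro E F hE hF n
    have h1 := hE n
    have h2 := hF (fun v => n v + E v)
    have e : (fun v => n v + ((E + F) v : ℕ)) = fun v => n v + (E v : ℤ) + (F v : ℤ) := by
      funext v; simp [add_assoc]
    rw [e, ← relIndex_mul_relIndex _ _ _
      (GG_anti _ (m := fun v => n v + (E v : ℤ) + (F v : ℤ)) (n := fun v => n v + (E v : ℤ))
        fun v _ => by simp)
      (GG_anti _ (m := fun v => n v + (E v : ℤ)) (n := n) fun v _ => by simp), degN_add, add_comm, pow_add, h1, h2]
  induction E using Finsupp.induction with
  | zero => intro n; simp [relIndex_self, degN]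
  | single_add v m E hv hm ih =>
    rw [Finsupp.support_single_add hv hm] at hE
    have hvT : v ∈ T := hE (by simp)
    refine trans _ _ ?_ (ih fun w hw => hE (by simp [hw]))
    clear ih hE hm
    induction m with
    | zero => intro n; simp [relIndex_self, degN]
    | succ m ih =>
      rw [Finsupp.single_add]
      refine trans _ _ ih fun n => ?_
      have := relIndex_GG_step_eq T n hvT
      rw [degN_single, one_mul, ← v.rc_eq p]
      exact this

lemma degN_zeros_le [IsFF p X] [Algebra (ZMod p) X] (x : X) (φ : RatFunc (ZMod p) →ₐ[ZMod p] X) (hφ : φ RatFunc.X = x) (E : FFPrime X →₀ ℕ) (hE : ∀ v ∈ E.support, (E v : ℤ) ≤ v.val x) :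
    let _ := φ.toRingHom.toAlgebra
    degN p E ≤ finrank (RatFunc (ZMod p)) X := by
  intro _
  have h1 := relIndex_GG_eq p E.support E subset_rfl (fun _ => 0)
  have hx : x ≠ 0 := by rw [← hφ]; exact (map_ne_zero _).mpr RatFunc.X_ne_zero
  have h2 := (relIndex_le_aux p (GG (E.support : Set (FFPrime X)) (fun _ => 0))
    (GG (E.support : Set (FFPrime X)) (fun v => 0 + E v)) x ?_ ?_ φ hφ).2
  · rw [h1] at h2
    exact (Nat.pow_le_pow_iff_right (Fact.out : p.Prime).one_lt).mp h2
  · intro y hy v hv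
    have := hy v hv
    by_cases h0 : y = 0
    · simp [h0, v.ord_zero]
    rw [v.le_ord_iff h0] at this
    rw [v.le_ord_iff (mul_ne_zero hx h0), v.val_mul hx h0]
    have := hE v hv; dsimp only at *; omega
  · exact GG_anti _ fun v _ => by simp

end F3

open Classical in
def FFPrime.infty (F : Type) [Field F] : FFPrime (RatFunc F) where
  ord x := if x = 0 then ⊤ else ((-x.intDegree : ℤ) : WithTop ℤ)
  ord_zero := by simp
  ord_ne_top := fun x hx => by simp [hx]
  ord_one := by simp
  ord_mul := fun x y => by
    by_cases hx : x = 0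
    · simp [hx]
    by_cases hy : y = 0
    · simp [hy]
    simp only [hx, hy, mul_eq_zero, or_self, if_false]
    rw [RatFunc.intDegree_mul hx hy]
    norm_cast; ring
  ord_add := fun x y => by
    by_cases hx : x = 0
    · simp [hx]
    by_cases hy : y = 0
    · simp [hy]
    by_cases hxy : x + y = 0
    · simp [hxy]
    have := RatFunc.intDegree_add_le hy hxy
    simp only [hx, hy, hxy, if_false]
    norm_cast
    omega
  ord_surj := fun n => by
    have h : ∀ m : ℕ, ((RatFunc.X : RatFunc F) ^ m).intDegree = m := by
      intro m
      induction m with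
      | zero => simp
      | succ m ih =>
        rw [pow_succ, RatFunc.intDegree_mul (pow_ne_zero _ RatFunc.X_ne_zero) RatFunc.X_ne_zero, ih]
        simp
    rcases le_total n 0 with hn | hn
    · refine ⟨RatFunc.X ^ n.natAbs, ?_⟩
      rw [if_neg (pow_ne_zero _ RatFunc.X_ne_zero), h]
      congr 1; omega
    · refine ⟨(RatFunc.X ^ n.natAbs)⁻¹, ?_⟩
      rw [if_neg (inv_ne_zero (pow_ne_zero _ RatFunc.X_ne_zero)), RatFunc.intDegree_inv, h]
      congr 1; omega

section
variable (p : ℕ) [Fact p.Prime] {X : Type} [Field X]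

lemma exists_pole [IsFF p X] [Algebra (ZMod p) X] {x : X} (ht : Transcendental (ZMod p) x) : ∃ w : FFPrime X, w.val x < 0 := by
  obtain ⟨φ, hφ⟩ := exists_ratFunc_hom p ht
  let _ := φ.toRingHom.toAlgebra
  have hfin : Module.Finite (RatFunc (ZMod p)) X := IsFF.finite_hom p φ.toRingHom
  obtain ⟨w, e, hw⟩ := (FFPrime.infty (ZMod p)).exists_over (L := X)
  refine ⟨w, ?_⟩
  rw [FFPrime.liesOverWith_iff] at hw
  obtain ⟨he, h⟩ := hw
  have h1 := h RatFunc.X RatFunc.X_ne_zero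
  have h2 : algebraMap (RatFunc (ZMod p)) X RatFunc.X = x := hφ
  have h3 : (FFPrime.infty (ZMod p)).val RatFunc.X = -1 := by
    apply FFPrime.val_eq_of_ord
    simp [FFPrime.infty, RatFunc.X_ne_zero]
  rw [h2, h3] at h1
  rw [h1];
  have : (0 : ℤ) < e := by exact_mod_cast he
  omega

lemma exists_pole' [IsFF p X] {x : X} (hx : x ≠ 0) {v : FFPrime X} (hv : v.val x ≠ 0) : ∃ w : FFPrime X, w.val x < 0 := by
  have := IsFF.charP p (X := X)
  let _ := ZMod.algebra X p
  exact exists_pole p (transcendental_of_val_ne p v hx hv)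

lemma finite_zeros [IsFF p X] {x : X} (hx : x ≠ 0) : {v : FFPrime X | 0 < v.val x}.Finite := by
  classical
  have := IsFF.charP p (X := X)
  let _ := ZMod.algebra X p
  by_cases hne : {v : FFPrime X | 0 < v.val x} = ∅
  · rw [hne]; exact Set.finite_empty
  obtain ⟨v, hv⟩ := Set.nonempty_iff_ne_empty.mpr hne
  obtain ⟨φ, hφ⟩ := exists_ratFunc_hom p (transcendental_of_val_ne p v hx (ne_of_gt hv))
  by_contra hinf
  let _ := φ.toRingHom.toAlgebra
  obtain ⟨T, hT, hTc⟩ := Set.Infinite.exists_subset_card_eq hinf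
    (finrank (RatFunc (ZMod p)) X + 1)
  let E : FFPrime X →₀ ℕ := Finsupp.indicator T (fun _ _ => 1)
  have hE1 : ∀ v ∈ T, E v = 1 := fun v hv => by simp [E, hv]
  have hsupp : E.support ⊆ T := Finsupp.support_indicator_subset _ _
  have h1 := degN_zeros_le p x φ hφ E (fun v hv => by
    rw [hE1 v (hsupp hv)]
    have : 0 < v.val x := hT (hsupp hv)
    exact_mod_cast this)
  have h2 : T.card ≤ degN p E := by
    rw [degN, Finsupp.sum_of_support_subset _ hsupp _ (by simp), Finset.card_eq_sum_ones]
    refine sum_le_sum fun v hv => ?_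
    rw [hE1 v hv, one_mul]; exact v.deg_pos p
  dsimp only at h1
  omega

lemma finite_supp [IsFF p X] {x : X} (hx : x ≠ 0) : {v : FFPrime X | v.val x ≠ 0}.Finite := by
  refine ((finite_zeros p hx).union (finite_zeros p (inv_ne_zero hx))).subset fun v hv => ?_
  have hv' : v.val x ≠ 0 := hv
  simp only [Set.mem_union, Set.mem_setOf_eq, v.val_inv hx]
  omega

open Classical in
def dv (x : X) : FDiv X := if h : (Function.support (fun v : FFPrime X => v.val x)).Finite
  then Finsupp.ofSupportFinite _ h else 0

lemma dv_apply [IsFF p X] {x : X} (hx : x ≠ 0) (v : FFPrime X) : dv x v = v.val x := by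
  have h : (Function.support (fun v : FFPrime X => v.val x)).Finite := finite_supp p hx
  rw [dv, dif_pos h]; rfl

lemma dv_mul [IsFF p X] {x y : X} (hx : x ≠ 0) (hy : y ≠ 0) : dv (x * y) = dv x + dv y := by
  ext v; rw [Finsupp.add_apply, dv_apply p hx, dv_apply p hy, dv_apply p (mul_ne_zero hx hy), v.val_mul hx hy]

lemma dv_inv [IsFF p X] {x : X} (hx : x ≠ 0) : dv x⁻¹ = - dv x := by
  ext v; rw [Finsupp.neg_apply, dv_apply p hx, dv_apply p (inv_ne_zero hx), v.val_inv hx]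

lemma dv_one [IsFF p X] : dv (1 : X) = 0 := by
  ext v; rw [dv_apply p one_ne_zero, v.val_one]; rfl

def degZ : (FDiv X) →+ ℤ where
  toFun D := D.sum fun v n => n * v.deg p
  map_zero' := by simp
  map_add' D D' := Finsupp.sum_add_index' (by simp) (by intros; ring)

lemma degZ_single (v : FFPrime X) (n : ℤ) : degZ p (single v n) = n * v.deg p := by
  change (single v n).sum (fun v n => n * (v.deg p : ℤ)) = _
  simp

def castD (E : FFPrime X →₀ ℕ) : FDiv X := E.mapRange (fun n : ℕ => (n : ℤ)) (by simp)

lemma castD_apply (E : FFPrime X →₀ ℕ) (v : FFPrime X) : castD E v = E v := by simp [castD]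

lemma degZ_castD (E : FFPrime X →₀ ℕ) : degZ p (castD E) = degN p E := by
  change (castD E).sum (fun v n => n * (v.deg p : ℤ)) = _
  rw [castD, Finsupp.sum_mapRange_index (by simp), degN, Finsupp.sum, Finsupp.sum]
  push_cast; rfl

lemma exists_castD {D D' : FDiv X} (h : D ≤ D') : ∃ E, D' = D + castD E := by
  refine ⟨(D' - D).mapRange Int.toNat (by simp), ?_⟩
  ext v
  rw [Finsupp.add_apply, castD_apply, Finsupp.mapRange_apply, Finsupp.sub_apply]
  have := h v
  omega

lemma degZ_nonneg {D : FDiv X} (h : 0 ≤ D) : 0 ≤ degZ p D := by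
  obtain ⟨E, rfl⟩ := exists_castD h
  rw [zero_add, degZ_castD]; positivity

def LL (D : FDiv X) : AddSubgroup X := GG Set.univ (fun v => - D v)

lemma mem_LL {D : FDiv X} {y : X} : y ∈ LL D ↔ ∀ v : FFPrime X, ((- D v : ℤ) : WithTop ℤ) ≤ v.ord y := by simp [LL, mem_GG]

lemma mem_LL_iff [IsFF p X] {D : FDiv X} {y : X} (hy : y ≠ 0) : y ∈ LL D ↔ 0 ≤ D + dv y := by
  rw [mem_LL]
  refine forall_congr' fun v => ?_
  rw [v.le_ord_iff hy, Finsupp.add_apply, dv_apply p hy]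
  change _ ↔ 0 ≤ _
  constructor <;> intro <;> omega

lemma LL_mono {D D' : FDiv X} (h : D ≤ D') : LL D ≤ LL D' := GG_anti _ fun v _ => neg_le_neg (h v)

lemma relIndex_LL [IsFF p X] (D : FDiv X) (E : FFPrime X →₀ ℕ) : (LL D).relIndex (LL (D + castD E)) ≠ 0 ∧ (LL D).relIndex (LL (D + castD E)) ≤ p ^ degN p E := by
  have := relIndex_GG p Set.univ E (fun v => - (D + castD E) v)
  have e : (GG Set.univ fun v => - (D + castD E) v + (E v : ℤ)) = LL D := by
    unfold LL; congr 1; funext v; rw [Finsupp.add_apply, castD_apply]; ring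
  rwa [e] at this

lemma LL_neg_bot [IsFF p X] {D : FDiv X} (h : D ≤ 0) (v : FFPrime X) (hv : D v < 0) : LL D = ⊥ := by
  rw [eq_bot_iff]
  intro y hy
  by_contra hy0
  have hy0 : y ≠ 0 := hy0
  rw [mem_LL_iff p hy0] at hy
  have h1 := hy v
  rw [Finsupp.add_apply, dv_apply p hy0] at h1
  change 0 ≤ _ at h1
  obtain ⟨w, hw⟩ := exists_pole' p hy0 (v := v) (by omega)
  have h2 := hy w
  rw [Finsupp.add_apply, dv_apply p hy0] at h2
  change 0 ≤ _ at h2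
  have := h w
  change D w ≤ 0 at this
  omega

lemma card_LL_ne [h : IsFF p X] (D : FDiv X) : card (LL D) ≠ 0 := by
  classical
  obtain ⟨v⟩ := h.ne
  let D0 : FDiv X := D ⊓ single v (-1)
  have h1 : D0 ≤ D := inf_le_left
  have h2 : D0 ≤ single v (-1) := inf_le_right
  have h3 : LL D0 = ⊥ := by
    refine LL_neg_bot p (h2.trans fun w => ?_) v ?_
    · change (single v (-1 : ℤ)) w ≤ 0
      rw [single_apply]; split_ifs <;> norm_num
    · have := h2 v
      simp at this; omega
  obtain ⟨E, hE⟩ := exists_castD h1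
  have h4 := (relIndex_LL p D0 E).1
  rw [← hE, h3, relIndex_bot_left] at h4
  exact h4

lemma finite_LL [h : IsFF p X] (D : FDiv X) : Finite (LL D) := Nat.finite_of_card_ne_zero (card_LL_ne p D)

def ell (D : FDiv X) : ℕ := Nat.log p (card (LL D))

lemma card_LL [h : IsFF p X] (D : FDiv X) : card (LL D) = p ^ ell p D := by
  have := IsFF.charP p (X := X)
  have h1 := card_LL_ne p D
  rw [← relIndex_bot_left] at h1
  obtain ⟨k, hk⟩ := relIndex_pow_p p _ _ h1
  rw [relIndex_bot_left] at hk
  rw [ell, hk, Nat.log_pow (Fact.out : p.Prime).one_lt]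

lemma ell_le [h : IsFF p X] {D D' : FDiv X} (hD : D ≤ D') : (ell p D' : ℤ) - ell p D ≤ degZ p D' - degZ p D := by
  obtain ⟨E, rfl⟩ := exists_castD hD
  have h1 := (relIndex_LL p D E).2
  have h2 := relIndex_mul_relIndex ⊥ (LL D) (LL (D + castD E)) bot_le (LL_mono hD)
  rw [relIndex_bot_left, relIndex_bot_left, card_LL p, card_LL p] at h2
  have h3 : p ^ ell p (D + castD E) ≤ p ^ (ell p D + degN p E) := by
    rw [← h2, pow_add]; exact Nat.mul_le_mul_left _ h1
  have h4 := (Nat.pow_le_pow_iff_right (Fact.out : p.Prime).one_lt).mp h3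
  rw [map_add, degZ_castD]
  push_cast [← Int.ofNat_le] at h4
  omega

lemma ell_add_dv [h : IsFF p X] (D : FDiv X) {x : X} (hx : x ≠ 0) : ell p (D + dv x) = ell p D := by
  unfold ell
  congr 1
  have h1 : (LL (D + dv x)).map (AddMonoidHom.mulLeft x) = LL D := by
    rw [LL, GG_map_mul _ _ hx, LL]; congr 1; funext v
    rw [Finsupp.add_apply, dv_apply p hx]; ring
  rw [← h1]
  exact Nat.card_congr ((LL (D + dv x)).equivMapOfInjective _ (mulLeft_inj hx)).toEquiv

def polar (x : X) : FDiv X := (dv x)⁻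

lemma polar_apply [IsFF p X] {x : X} (hx : x ≠ 0) (v : FFPrime X) : polar x v = max (- v.val x) 0 := by
  change max (- dv x) 0 v = _
  rw [← dv_apply p hx]; rfl
end

lemma ratFunc_pow_indep (F : Type) [Field F] (m : ℕ) : LinearIndependent F fun j : Fin (m + 1) => (RatFunc.X : RatFunc F) ^ (j : ℕ) := by
  have h2 := (Polynomial.basisMonomials F).linearIndependent.map'
      (toAlgHom F (Polynomial F) (RatFunc F)).toLinearMap
      (LinearMap.ker_eq_bot.mpr (IsFractionRing.injective (Polynomial F) (RatFunc F)))
  have h3 := h2.comp (fun j : Fin (m + 1) => (j : ℕ)) Fin.val_injective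
  have e : (fun j : Fin (m + 1) => (RatFunc.X : RatFunc F) ^ (j : ℕ)) =
      (((toAlgHom F (Polynomial F) (RatFunc F)).toLinearMap ∘
        (Polynomial.basisMonomials F)) ∘ fun j : Fin (m + 1) => (j : ℕ)) := by
    funext j
    simp [← Polynomial.X_pow_eq_monomial]
  rw [e]; exact h3

section
variable (p : ℕ) [Fact p.Prime] {X : Type} [Field X]

lemma polar_nonneg (x : X) : 0 ≤ polar x := negPart_nonneg _

lemma mem_LL_smul_polar [IsFF p X] {x : X} (hx : x ≠ 0) {b : X} {k m : ℕ} (hb : b ∈ LL (k • polar x)) : x ^ m * b ∈ LL ((m + k) • polar x) := by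
  rw [mem_LL] at hb ⊢
  intro v
  have h1 := hb v
  by_cases h0 : b = 0
  · simp [h0, v.ord_zero]
  have h2 := polar_apply p hx v
  rw [v.le_ord_iff h0] at h1
  rw [v.le_ord_iff (mul_ne_zero (pow_ne_zero _ hx) h0), v.val_mul (pow_ne_zero _ hx) h0, v.val_pow hx]
  rw [Finsupp.smul_apply, nsmul_eq_mul] at h1 ⊢
  push_cast
  have h3 : - v.val x ≤ polar x v := by rw [h2]; exact le_max_left _ _
  nlinarith [(by positivity : (0:ℤ) ≤ m)]

lemma exists_ell_ge [IsFF p X] [Algebra (ZMod p) X] (x : X) (φ : RatFunc (ZMod p) →ₐ[ZMod p] X) (hφ : φ RatFunc.X = x) : let _ := φ.toRingHom.toAlgebra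
    ∃ k : ℕ, ∀ m : ℕ, finrank (RatFunc (ZMod p)) X * (m + 1) ≤ ell p ((m + k) • polar x) := by
  intro _
  have hx : x ≠ 0 := by rw [← hφ]; exact (map_ne_zero _).mpr RatFunc.X_ne_zero
  have hfin : Module.Finite (RatFunc (ZMod p)) X := IsFF.finite_hom p φ.toRingHom
  have : IsScalarTower (ZMod p) (RatFunc (ZMod p)) X := .of_algHom φ
  let _ : Algebra (Polynomial (ZMod p)) X := ((algebraMap (RatFunc (ZMod p)) X).comp
    (algebraMap (Polynomial (ZMod p)) (RatFunc (ZMod p)))).toAlgebra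
  have : IsScalarTower (Polynomial (ZMod p)) (RatFunc (ZMod p)) X := .of_algebraMap_eq fun _ => rfl
  have halg : Algebra.IsAlgebraic (Polynomial (ZMod p)) X := by
    have h1 : Algebra.IsAlgebraic (Polynomial (ZMod p)) (RatFunc (ZMod p)) := IsLocalization.isAlgebraic _ (nonZeroDivisors (Polynomial (ZMod p)))
    have h2 : Algebra.IsAlgebraic (RatFunc (ZMod p)) X := inferInstance
    exact Algebra.IsAlgebraic.trans (Polynomial (ZMod p)) (RatFunc (ZMod p)) X
  have hmap : ∀ P : Polynomial (ZMod p), algebraMap (Polynomial (ZMod p)) X P = Polynomial.aeval x P := by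
    intro P
    have h2 : (algebraMap (Polynomial (ZMod p)) X) =
        ((Polynomial.aeval x : Polynomial (ZMod p) →ₐ[ZMod p] X) : Polynomial (ZMod p) →+* X) := by
      apply Polynomial.ringHom_ext
      · intro a
        change φ (algebraMap _ _ (Polynomial.C a)) = Polynomial.aeval x (Polynomial.C a)
        rw [Polynomial.aeval_C, RatFunc.algebraMap_C, ← RatFunc.algebraMap_eq_C, φ.commutes]
      · change φ (algebraMap _ _ (Polynomial.X)) = Polynomial.aeval x (Polynomial.X)
        rw [Polynomial.aeval_X, RatFunc.algebraMap_X, hφ]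
    rw [h2]; rfl
  have hpos : ∀ P : Polynomial (ZMod p), ∀ v : FFPrime X, 0 ≤ v.ord x →
      0 ≤ v.ord (algebraMap (Polynomial (ZMod p)) X P) := by
    intro P v hv
    rw [hmap, Polynomial.aeval_eq_sum_range]
    refine v.le_ord_sum _ _ fun i _ => ?_
    rw [smul_def]
    exact v.ord_mul_nonneg (v.nonneg_zmod p _) (v.ord_pow_nonneg hv _)
  have hInt : ∀ y : X, IsIntegral (Polynomial (ZMod p)) y → ∃ k : ℕ, y ∈ LL (k • polar x) := by
    intro y ⟨P, hP, hPy⟩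
    by_cases hy : y = 0
    · exact ⟨0, hy ▸ AddSubgroup.zero_mem _⟩
    have hnn : ∀ v : FFPrime X, 0 ≤ v.val x → 0 ≤ v.val y := by
      intro v hv
      rw [← v.ord_nonneg_iff hx] at hv
      rw [← v.ord_nonneg_iff hy]
      refine v.nonneg_of_integral (P.map (algebraMap _ X)) (hP.map _) (fun n => ?_) (by
        rw [eval_map]; exact hPy)
      rw [Polynomial.coeff_map]; exact hpos _ v hv
    obtain ⟨k, hk⟩ : ∃ k : ℕ, ∀ v ∈ (dv y).support, -(dv y v) ≤ k := by
      obtain ⟨N, hN⟩ := ((dv y).support.image (fun v => (-(dv y v)).toNat)).bddAbove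
      refine ⟨N, fun v hv => ?_⟩
      have h3 : (-(dv y v)).toNat ≤ N := hN (by classical exact Finset.mem_coe.mpr (mem_image_of_mem _ hv))
      omega
    refine ⟨k, mem_LL.mpr fun v => ?_⟩
    rw [v.le_ord_iff hy, Finsupp.smul_apply, nsmul_eq_mul, polar_apply p hx]
    by_cases hv : 0 ≤ v.val x
    · have := hnn v hv
      rw [max_eq_right (by omega)]; simpa using this
    · rw [max_eq_left (by omega)]
      by_cases hvs : v ∈ (dv y).support
      · have := hk v hvs
        rw [dv_apply p hy] at this
        push Not at hv
        nlinarith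
      · rw [Finsupp.notMem_support_iff, dv_apply p hy] at hvs
        rw [hvs]
        push Not at hv
        nlinarith
  let B := Module.finBasis (RatFunc (ZMod p)) X
  have hB : ∀ i, ∃ c : Polynomial (ZMod p), c ≠ 0 ∧ IsIntegral (Polynomial (ZMod p)) (c • B i) := by
    intro i
    obtain ⟨c, hc, h⟩ := (halg.isAlgebraic (B i)).exists_integral_multiple
    exact ⟨c, hc, h⟩
  choose c hc hcB using hB
  choose kk hkk using fun i => hInt _ (hcB i)
  have hc' : ∀ i, algebraMap (Polynomial (ZMod p)) (RatFunc (ZMod p)) (c i) ≠ 0 := fun i => by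
    rw [Ne, FaithfulSMul.algebraMap_eq_zero_iff]; exact hc i
  have hlin : LinearIndependent (RatFunc (ZMod p)) fun i => c i • B i := by
    have := B.linearIndependent.units_smul (fun i => Units.mk0 _ (hc' i))
    convert this using 1
    funext i
    change c i • B i = (algebraMap (Polynomial (ZMod p)) (RatFunc (ZMod p)) (c i)) • B i
    rw [algebraMap_smul]
  let k := ∑ i, kk i
  refine ⟨k, fun m => ?_⟩
  have hlin2 : LinearIndependent (ZMod p) fun j : Fin (m + 1) => (RatFunc.X : RatFunc (ZMod p)) ^ (j : ℕ) := by exact ratFunc_pow_indep _ m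
  have hlin3 := linearIndependent_smul hlin2 hlin
  let W : Submodule (ZMod p) X := AddSubgroup.toZModSubmodule p (LL ((m + k) • polar x))
  have hWm : ∀ y, y ∈ W ↔ y ∈ LL ((m + k) • polar x) := fun y => by simp [W]
  have hmem : ∀ ij : Fin (m + 1) × Fin (finrank (RatFunc (ZMod p)) X), (RatFunc.X : RatFunc (ZMod p)) ^ (ij.1 : ℕ) • (c ij.2 • B ij.2) ∈ W := by
    intro ij
    rw [hWm]
    have h1 := mem_LL_smul_polar p hx (m := ij.1) (hkk ij.2)
    have h2 : (RatFunc.X : RatFunc (ZMod p)) ^ (ij.1 : ℕ) • (c ij.2 • B ij.2) =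
        x ^ (ij.1 : ℕ) * (c ij.2 • B ij.2) := by
      change φ (RatFunc.X ^ (ij.1 : ℕ)) * _ = _
      rw [map_pow, hφ]
    rw [h2]
    refine LL_mono ?_ h1
    have h3 : kk ij.2 ≤ k := single_le_sum (f := kk) (fun _ _ => Nat.zero_le _) (mem_univ _)
    exact nsmul_le_nsmul_left (polar_nonneg x) (by have := ij.1.2; omega)
  have hlin4 : LinearIndependent (ZMod p) (fun ij => (⟨_, hmem ij⟩ : W)) := LinearIndependent.of_comp W.subtype hlin3
  have hWf : Finite W := finite_LL p ((m + k) • polar x)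
  have hc1 := hlin4.fintype_card_le_finrank
  rw [Fintype.card_prod, Fintype.card_fin, Fintype.card_fin, mul_comm] at hc1
  refine hc1.trans ?_
  have h3 := Module.natCard_eq_pow_finrank (K := ZMod p) (V := W)
  rw [Nat.card_zmod] at h3
  have h4 : card W = p ^ ell p ((m + k) • polar x) := card_LL p _
  rw [h4] at h3
  exact (Nat.pow_right_injective (Fact.out : p.Prime).two_le h3).ge

lemma finrank_le_deg_polar [IsFF p X] [Algebra (ZMod p) X] (x : X) (φ : RatFunc (ZMod p) →ₐ[ZMod p] X) (hφ : φ RatFunc.X = x) : let _ := φ.toRingHom.toAlgebra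
    (finrank (RatFunc (ZMod p)) X : ℤ) ≤ degZ p (polar x) := by
  intro _
  obtain ⟨k, hk⟩ := exists_ell_ge p x φ hφ
  by_contra hlt
  push Not at hlt
  set n := finrank (RatFunc (ZMod p)) X
  set d := degZ p (polar x)
  have h1 : ∀ m : ℕ, (n : ℤ) * (m + 1) ≤ ell p (0 : FDiv X) + (m + k) * d := by
    intro m
    have h2 : (0 : FDiv X) ≤ (m + k) • polar x := nsmul_nonneg (polar_nonneg x) _
    have h3 := ell_le p h2
    rw [map_nsmul, map_zero, nsmul_eq_mul] at h3
    have h4 := hk m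
    have h5 : (n : ℤ) * (m + 1) ≤ ell p ((m + k) • polar x) := by exact_mod_cast h4
    push_cast at h3
    linarith
  have hd : 0 ≤ d := degZ_nonneg p (polar_nonneg x)
  have := h1 (ell p (0 : FDiv X) + k * d.toNat)
  push_cast at this
  rw [Int.toNat_of_nonneg hd] at this
  nlinarith [(by positivity : (0:ℤ) ≤ k * d), (by positivity : (0:ℤ) ≤ ell p (0 : FDiv X))]

lemma degZ_dv_nonpos [IsFF p X] {x : X} (hx : x ≠ 0) : degZ p (dv x) ≤ 0 := by
  have := IsFF.charP p (X := X)
  let _ := ZMod.algebra X p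
  by_cases h : ∀ v : FFPrime X, v.val x = 0
  · have : dv x = 0 := by ext v; rw [dv_apply p hx, h v]; rfl
    rw [this, map_zero]
  push Not at h
  obtain ⟨v, hv⟩ := h
  obtain ⟨φ, hφ⟩ := exists_ratFunc_hom p (transcendental_of_val_ne p v hx hv)
  have h1 := finrank_le_deg_polar p x φ hφ
  obtain ⟨E, hE⟩ := exists_castD (posPart_nonneg (dv x))
  rw [zero_add] at hE
  have h2 := degN_zeros_le p x φ hφ E (fun v hv => by
    have h3 : (dv x)⁺ v = E v := by rw [hE, castD_apply]
    have h4 : (dv x)⁺ v = max (dv x v) 0 := rfl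
    rw [mem_support_iff] at hv
    rw [dv_apply p hx] at h4
    omega)
  dsimp only at h1 h2
  have h3 : dv x = (dv x)⁺ - polar x := (posPart_sub_negPart _).symm
  rw [h3, map_sub, hE, degZ_castD]
  have : (degN p E : ℤ) ≤ _ := Int.ofNat_le.mpr h2
  linarith

lemma degZ_dv [IsFF p X] {x : X} (hx : x ≠ 0) : degZ p (dv x) = 0 := by
  apply le_antisymm (degZ_dv_nonpos p hx)
  have := degZ_dv_nonpos p (inv_ne_zero hx)
  rw [dv_inv p hx, map_neg] at this
  linarith

lemma exists_transcendental_val [h : IsFF p X] : ∃ x : X, x ≠ 0 ∧ ∃ v : FFPrime X, v.val x ≠ 0 := by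
  obtain ⟨v⟩ := h.ne
  obtain ⟨x, hx, hv⟩ := v.exists_val_eq 1
  exact ⟨x, hx, v, by omega⟩

lemma exists_pow_congr [IsFF p X] (v : FFPrime X) {x : X} (hx : 0 ≤ v.ord x) : ∃ i j : ℕ, i < j ∧ j ≤ v.rc ∧ 0 < v.ord (x ^ j - x ^ i) := by
  have hf : Finite (UU v 0 ⧸ (UU v 1).addSubgroupOf (UU v 0)) := Nat.finite_of_card_ne_zero (v.rc_ne_zero p)
  have hmem : ∀ i : ℕ, x ^ i ∈ UU v 0 := fun i => mem_UU.mpr (v.ord_pow_nonneg hx i)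
  let f : Fin (v.rc + 1) → (UU v 0 ⧸ (UU v 1).addSubgroupOf (UU v 0)) := fun i => QuotientAddGroup.mk ⟨x ^ (i : ℕ), hmem i⟩
  have hnot : ¬ Injective f := by
    intro hinj
    have h1 := Nat.card_le_card_of_injective f hinj
    rw [Nat.card_fin] at h1
    have h2 : card (UU v 0 ⧸ (UU v 1).addSubgroupOf (UU v 0)) = v.rc := rfl
    omega
  have key : ∀ i j : Fin (v.rc + 1), f i = f j → 0 < v.ord (x ^ (j : ℕ) - x ^ (i : ℕ)) := by
    intro i j hij
    rw [QuotientAddGroup.eq, AddSubgroup.mem_addSubgroupOf] at hij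
    have : (-(x ^ (i : ℕ)) + x ^ (j : ℕ)) ∈ UU v 1 := hij
    rw [mem_UU, neg_add_eq_sub] at this
    exact lt_of_lt_of_le (by norm_cast) this
  rw [Injective] at hnot
  push Not at hnot
  obtain ⟨i, j, hij, hne⟩ := hnot
  rcases lt_or_gt_of_ne hne with h | h
  · exact ⟨i, j, h, by omega, key i j hij⟩
  · exact ⟨j, i, h, by omega, key j i hij.symm⟩

lemma pow_sub_pow_ne [IsFF p X] {x : X} (hx : x ≠ 0) {v : FFPrime X} (hv : v.val x ≠ 0) {i j : ℕ} (hij : i < j) : x ^ j - x ^ i ≠ 0 := by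
  intro h
  have h1 : x ^ j = x ^ i := sub_eq_zero.mp h
  have h2 := congrArg v.val h1
  rw [v.val_pow hx, v.val_pow hx] at h2
  have := mul_right_cancel₀ hv h2
  omega

lemma riemann_bound [IsFF p X] : ∃ B : ℤ, ∀ D : FDiv X, degZ p D - ell p D ≤ B := by
  have := IsFF.charP p (X := X)
  let _ := ZMod.algebra X p
  obtain ⟨x, hx, v0, hv0⟩ := exists_transcendental_val p (X := X)
  obtain ⟨φ, hφ⟩ := exists_ratFunc_hom p (transcendental_of_val_ne p v0 hx hv0)
  obtain ⟨k, hk⟩ := exists_ell_ge p x φ hφ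
  let _ := φ.toRingHom.toAlgebra
  have hdle : degZ p (polar x) ≤ finrank (RatFunc (ZMod p)) X := by
    obtain ⟨E, hE⟩ := exists_castD (posPart_nonneg (dv x))
    rw [zero_add] at hE
    have h2 := degN_zeros_le p x φ hφ E (fun v hv => by
      have h3 : (dv x)⁺ v = E v := by rw [hE, castD_apply]
      have h4 : (dv x)⁺ v = max (dv x v) 0 := rfl
      rw [mem_support_iff] at hv
      rw [dv_apply p hx] at h4
      omega)
    dsimp only at h2
    have h3 : dv x = (dv x)⁺ - polar x := (posPart_sub_negPart _).symm
    have h4 := degZ_dv p hx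
    rw [h3, map_sub, hE, degZ_castD] at h4
    have : (degN p E : ℤ) ≤ _ := Int.ofNat_le.mpr h2
    linarith
  set n := finrank (RatFunc (ZMod p)) X
  have hdom : ∀ D : FDiv X, ∃ g : X, g ≠ 0 ∧ ∃ m : ℕ, D ≤ (m + k) • polar x + dv g := by
    have hone : ∀ v : FFPrime X, ∃ g : X, g ≠ 0 ∧ ∃ m : ℕ, single v 1 ≤ m • polar x + dv g := by
      intro v
      by_cases hv : 0 ≤ v.val x
      · obtain ⟨i, j, hij, _, hpos⟩ := exists_pow_congr p v ((v.ord_nonneg_iff hx).mpr hv)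
        have hg := pow_sub_pow_ne p hx hv0 hij
        refine ⟨x ^ j - x ^ i, hg, j, fun w => ?_⟩
        rw [Finsupp.add_apply, Finsupp.smul_apply, nsmul_eq_mul, polar_apply p hx, dv_apply p hg]
        have hw : ((-(j * max (-w.val x) 0) : ℤ) : WithTop ℤ) ≤ w.ord (x ^ j - x ^ i) := by
          apply w.le_ord_sub
          · rw [w.le_ord_iff (pow_ne_zero _ hx), w.val_pow hx]
            nlinarith [le_max_left (-w.val x) 0]
          · rw [w.le_ord_iff (pow_ne_zero _ hx), w.val_pow hx]
            have h1 := le_max_left (-w.val x) 0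
            have h2 := le_max_right (-w.val x) 0
            have h3 : (i : ℤ) ≤ j := by exact_mod_cast hij.le
            have h4 : (0 : ℤ) ≤ i := by positivity
            nlinarith
        rw [w.le_ord_iff hg] at hw
        classical
        rw [single_apply]
        split_ifs with hvw
        · subst hvw
          rw [v.ord_pos_iff hg] at hpos
          rw [max_eq_right (by omega)]
          simp only [mul_zero, zero_add, nsmul_zero]; omega
        · linarith
      · refine ⟨1, one_ne_zero, 1, fun w => ?_⟩
        rw [one_smul, dv_one p, add_zero, polar_apply p hx]
        classical
        rw [single_apply]
        split_ifs with hvw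
        · subst hvw; exact le_max_of_le_left (by omega)
        · exact le_max_right _ _
    have hE : ∀ E : FFPrime X →₀ ℕ, ∃ g : X, g ≠ 0 ∧ ∃ m : ℕ, castD E ≤ m • polar x + dv g := by
      have hadd : ∀ D D' : FDiv X, (∃ g : X, g ≠ 0 ∧ ∃ m : ℕ, D ≤ m • polar x + dv g) →
          (∃ g : X, g ≠ 0 ∧ ∃ m : ℕ, D' ≤ m • polar x + dv g) →
          ∃ g : X, g ≠ 0 ∧ ∃ m : ℕ, D + D' ≤ m • polar x + dv g := by
        rintro D D' ⟨g, hg, m, h⟩ ⟨g', hg', m', h'⟩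
        refine ⟨g * g', mul_ne_zero hg hg', m + m', (add_le_add h h').trans (le_of_eq ?_)⟩
        rw [dv_mul p hg hg', add_smul]; abel
      have hz : ∃ g : X, g ≠ 0 ∧ ∃ m : ℕ, (0 : FDiv X) ≤ m • polar x + dv g := ⟨1, one_ne_zero, 0, by rw [dv_one p]; simp⟩
      intro E
      induction E using Finsupp.induction_linear with
      | zero =>
        have : castD (0 : FFPrime X →₀ ℕ) = 0 := by ext; simp [castD]
        rw [this]; exact hz
      | add E F hE hF =>
        have : castD (E + F) = castD E + castD F := by ext; simp [castD]
        rw [this]; exact hadd _ _ hE hF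
      | single v m =>
        induction m with
        | zero =>
          have : castD (single v 0) = 0 := by ext; simp [castD]
          rw [this]; exact hz
        | succ m ih =>
          have : castD (single v (m + 1)) = castD (single v m) + single v 1 := by
            unfold castD
            rw [Finsupp.mapRange_single, Finsupp.mapRange_single, ← Finsupp.single_add]; push_cast; rfl
          rw [this]; exact hadd _ _ ih (hone v)
    intro D
    obtain ⟨E, hE'⟩ := exists_castD (posPart_nonneg D)
    rw [zero_add] at hE'
    obtain ⟨g, hg, m, h⟩ := hE E
    refine ⟨g, hg, m, (le_posPart D).trans (hE' ▸ h.trans ?_)⟩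
    gcongr
    · exact polar_nonneg x
    · omega
  refine ⟨n * k, fun D => ?_⟩
  obtain ⟨g, hg, m, hD⟩ := hdom D
  have h1 := ell_le p hD
  rw [ell_add_dv p _ hg, map_add, degZ_dv p hg, add_zero, map_nsmul, nsmul_eq_mul] at h1
  have h2 : (n : ℤ) * (m + 1) ≤ ell p ((m + k) • polar x) := by exact_mod_cast hk m
  have h3 : (↑(m + k) : ℤ) * degZ p (polar x) ≤ (↑(m + k) : ℤ) * n := mul_le_mul_of_nonneg_left hdle (by positivity)
  push_cast at h1 h3
  nlinarith

lemma riemann [IsFF p X] : ∃ ρ n0 : ℤ, ∀ D : FDiv X, n0 ≤ degZ p D → (ell p D : ℤ) = degZ p D - ρ := by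
  obtain ⟨B, hB⟩ := riemann_bound p (X := X)
  obtain ⟨ρ, ⟨D0, hD0⟩, hρ⟩ := Int.exists_greatest_of_bdd
    (P := fun s => ∃ D : FDiv X, degZ p D - ell p D = s)
    ⟨B, by rintro _ ⟨D, rfl⟩; exact hB D⟩ ⟨_, 0, rfl⟩
  refine ⟨ρ, degZ p D0 + ρ + 1, fun D hD => ?_⟩
  apply le_antisymm
  swap
  · have := hρ _ ⟨D, rfl⟩; linarith
  have h1 := hρ _ ⟨D - D0, rfl⟩
  rw [map_sub] at h1
  have h2 : 0 < ell p (D - D0) := by omega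
  have h3 : 1 < card (LL (D - D0)) := by
    rw [card_LL p]; exact one_lt_pow h2.ne' (Fact.out : p.Prime).one_lt
  have := finite_LL p (D - D0)
  have h4 : Nontrivial (LL (D - D0)) := Finite.one_lt_card_iff_nontrivial.mp h3
  obtain ⟨⟨y, hy⟩, hy0⟩ := exists_ne (0 : LL (D - D0))
  have hy0 : y ≠ 0 := fun h => hy0 (Subtype.ext h)
  rw [mem_LL_iff p hy0] at hy
  have h5 : D0 ≤ D + dv y := by
    rw [← sub_nonneg]; convert hy using 1; abel
  have h6 := ell_le p h5
  rw [ell_add_dv p _ hy0, map_add, degZ_dv p hy0] at h6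
  linarith

lemma finite_deg_le [IsFF p X] (n : ℕ) : {v : FFPrime X | v.deg p ≤ n}.Finite := by
  obtain ⟨x, hx, v0, hv0⟩ := exists_transcendental_val p (X := X)
  have : {v : FFPrime X | v.deg p ≤ n} ⊆ {v | v.val x ≠ 0} ∪
      ⋃ j ∈ range (p ^ n + 1), ⋃ i ∈ range j, {v | v.val (x ^ j - x ^ i) ≠ 0} := by
    intro v hv
    by_cases h : v.val x = 0
    · right
      obtain ⟨i, j, hij, hj, hpos⟩ := exists_pow_congr p v ((v.ord_nonneg_iff hx).mpr h.ge)
      have hg := pow_sub_pow_ne p hx hv0 hij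
      simp only [Set.mem_iUnion, mem_range, Set.mem_setOf_eq]
      refine ⟨j, ?_, i, hij, ?_⟩
      · rw [v.rc_eq p] at hj
        have : p ^ v.deg p ≤ p ^ n := Nat.pow_le_pow_right (Fact.out : p.Prime).pos hv
        omega
      · rw [v.ord_pos_iff hg] at hpos; omega
    · exact Or.inl h
  refine Set.Finite.subset ((finite_supp p hx).union ?_) this
  refine Set.Finite.biUnion (Finset.finite_toSet _) fun j _ =>
    Set.Finite.biUnion (Finset.finite_toSet _) fun i hi => ?_
  exact finite_supp p (pow_sub_pow_ne p hx hv0 (by simpa using hi))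
end

section
variable (p : ℕ) [Fact p.Prime] {X : Type} [Field X]

lemma mul_deg_le_degN (E : FFPrime X →₀ ℕ) (v : FFPrime X) : E v * v.deg p ≤ degN p E := by
  classical
  by_cases hv : v ∈ E.support
  · exact single_le_sum (f := fun v => E v * v.deg p) (fun _ _ => Nat.zero_le _) hv
  · rw [Finsupp.notMem_support_iff] at hv; simp [hv]

lemma finite_effDiv [IsFF p X] (n : ℕ) : {E : FFPrime X →₀ ℕ | degN p E = n}.Finite := by
  classical
  refine Set.Finite.subset (Finset.finite_toSet
    (Finset.finsupp (finite_deg_le p (X := X) n).toFinset (fun _ => range (n + 1)))) ?_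
  intro E hE
  have hE : degN p E = n := hE
  rw [Finset.mem_coe, Finset.mem_finsupp_iff]
  have key : ∀ v, E v * v.deg p ≤ n := fun v => hE ▸ mul_deg_le_degN p E v
  refine ⟨fun v hv => ?_, fun v _ => ?_⟩
  · rw [Set.Finite.mem_toFinset]
    have h1 : 0 < E v := Nat.pos_of_ne_zero (mem_support_iff.mp hv)
    exact (Nat.le_mul_of_pos_left _ h1).trans (key v)
  · rw [mem_range]
    have := (Nat.le_mul_of_pos_right (E v) (v.deg_pos p)).trans (key v)
    omega

def effDiv [IsFF p X] (n : ℕ) : Finset (FFPrime X →₀ ℕ) := (finite_effDiv p (X := X) n).toFinset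

lemma mem_effDiv [IsFF p X] {n : ℕ} {E : FFPrime X →₀ ℕ} : E ∈ effDiv p n ↔ degN p E = n := by simp [effDiv]

def places [IsFF p X] (n : ℕ) : Finset (FFPrime X) := (finite_deg_le p (X := X) n).toFinset

lemma mem_places [IsFF p X] {n : ℕ} {v : FFPrime X} : v ∈ places p n ↔ v.deg p ≤ n := by simp [places]

def chi (χ : FFPrime X → ℂ) (E : FFPrime X →₀ ℕ) : ℂ := E.prod fun v k => χ v ^ k

lemma chi_add (χ : FFPrime X → ℂ) (E F : FFPrime X →₀ ℕ) : chi χ (E + F) = chi χ E * chi χ F := by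
  classical
  exact Finsupp.prod_add_index' (by simp) (by intros; rw [pow_add])

lemma chi_single (χ : FFPrime X → ℂ) (v : FFPrime X) (n : ℕ) : chi χ (single v n) = χ v ^ n := by simp [chi]

def aa [IsFF p X] (χ : FFPrime X → ℂ) (n : ℕ) : ℂ := ∑ E ∈ effDiv p n, chi χ E

def lam [IsFF p X] (χ : FFPrime X → ℂ) (n : ℕ) : ℂ := ∑ v ∈ places p n, ∑ m ∈ Icc 1 n, if m * v.deg p = n then (v.deg p : ℂ) * χ v ^ m else 0

lemma sum_effDiv_ge [IsFF p X] (χ : FFPrime X → ℂ) (n : ℕ) (v : FFPrime X) (m : ℕ) : (∑ E ∈ effDiv p n, if m ≤ E v then chi χ E else 0) =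
      if m * v.deg p ≤ n then χ v ^ m * aa p χ (n - m * v.deg p) else 0 := by
  classical
  split_ifs with h
  · rw [← sum_filter, aa, mul_sum]
    symm
    refine Finset.sum_bij (fun E _ => E + single v m) ?_ ?_ ?_ ?_
    · intro E hE
      rw [mem_effDiv] at hE
      rw [mem_filter, mem_effDiv, degN_add, degN_single, hE]
      simp; omega
    · intro E _ F _ h; exact add_right_cancel h
    · intro E hE
      rw [mem_filter, mem_effDiv] at hE
      have h1 : E - single v m + single v m = E := by
        ext w
        simp only [Finsupp.add_apply, Finsupp.tsub_apply, single_apply]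
        split_ifs with hw
        · subst hw; omega
        · omega
      refine ⟨E - single v m, ?_, h1⟩
      rw [mem_effDiv]
      have h2 := degN_add p (E - single v m) (single v m)
      rw [h1, degN_single] at h2
      omega
    · intro E _; rw [chi_add, chi_single, mul_comm]
  · refine sum_eq_zero fun E hE => if_neg fun hm => h ?_
    rw [mem_effDiv] at hE
    rw [← hE]
    exact (Nat.mul_le_mul_right _ hm).trans (mul_deg_le_degN p E v)

lemma degN_eq_sum [IsFF p X] (n : ℕ) {E : FFPrime X →₀ ℕ} (hE : degN p E = n) : n = ∑ v ∈ places p n, ∑ m ∈ Icc 1 n, if m ≤ E v then v.deg p else 0 := by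
  conv_lhs => rw [← hE]
  have key : ∀ v, E v * v.deg p ≤ n := fun v => hE ▸ mul_deg_le_degN p E v
  rw [degN, Finsupp.sum_of_support_subset (s := places p n)]
  · refine sum_congr rfl fun v _ => ?_
    rw [← sum_filter, sum_const, smul_eq_mul]
    congr 1
    have : Finset.filter (fun m => m ≤ E v) (Icc 1 n) = Icc 1 (E v) := by
      ext m
      simp only [mem_filter, mem_Icc]
      have := (Nat.le_mul_of_pos_right (E v) (v.deg_pos p)).trans (key v)
      omega
    rw [this, Nat.card_Icc]; omega
  · intro v hv
    rw [mem_places]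
    have h1 : 0 < E v := Nat.pos_of_ne_zero (mem_support_iff.mp hv)
    exact (Nat.le_mul_of_pos_left _ h1).trans (key v)
  · simp

lemma aa_rec [IsFF p X] (χ : FFPrime X → ℂ) (n : ℕ) : (n : ℂ) * aa p χ n = ∑ j ∈ Icc 1 n, lam p χ j * aa p χ (n - j) := by
  classical
  have h1 : (n : ℂ) * aa p χ n = ∑ v ∈ places p n, ∑ m ∈ Icc 1 n,
      if m * v.deg p ≤ n then (v.deg p : ℂ) * χ v ^ m * aa p χ (n - m * v.deg p) else 0 := by
    have h2 : ∀ v ∈ places p n, ∀ m ∈ Icc 1 n, (if m * v.deg p ≤ n then (v.deg p : ℂ) * χ v ^ m * aa p χ (n - m * v.deg p) else 0) =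
        ∑ E ∈ effDiv p n, if m ≤ E v then (v.deg p : ℂ) * chi χ E else 0 := by
      intro v _ m _
      have := sum_effDiv_ge p χ n v m
      have h3 := congrArg (fun z => (v.deg p : ℂ) * z) this
      simp only [mul_sum, mul_ite, mul_zero] at h3
      rw [h3]; simp only [mul_assoc]
    rw [sum_congr rfl fun v hv => sum_congr rfl (h2 v hv)]
    rw [sum_congr rfl fun v _ => sum_comm, sum_comm, aa, mul_sum]
    refine sum_congr rfl fun E hE => ?_
    rw [mem_effDiv] at hE
    have h4 := congrArg (fun k : ℕ => (k : ℂ)) (degN_eq_sum p n hE)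
    conv_lhs => rw [h4]
    push_cast
    rw [sum_mul]
    refine sum_congr rfl fun v _ => ?_
    rw [sum_mul]
    refine sum_congr rfl fun m _ => ?_
    rw [ite_mul, zero_mul]
  rw [h1]
  have h5 : ∀ j ∈ Icc 1 n, lam p χ j * aa p χ (n - j) = ∑ v ∈ places p n, ∑ m ∈ Icc 1 n,
      if m * v.deg p = j then (v.deg p : ℂ) * χ v ^ m * aa p χ (n - j) else 0 := by
    intro j hj
    rw [mem_Icc] at hj
    rw [lam, sum_mul]
    have h6 : places p j ⊆ places p (X := X) n := fun v hv => by
      rw [mem_places] at hv ⊢; omega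
    rw [← Finset.sum_subset h6]
    · refine sum_congr rfl fun v _ => ?_
      rw [sum_mul]
      rw [← Finset.sum_subset (Finset.Icc_subset_Icc_right hj.2)]
      · refine sum_congr rfl fun m _ => ?_
        rw [ite_mul, zero_mul]
      · intro m hm hm'
        rw [if_neg]
        rintro rfl
        apply hm'
        rw [mem_Icc] at hm ⊢
        exact ⟨hm.1, Nat.le_mul_of_pos_right m (v.deg_pos p)⟩
    · intro v hv hv'
      refine sum_eq_zero fun m hm => if_neg ?_
      rintro rfl
      apply hv'
      rw [mem_places]
      rw [mem_Icc] at hm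
      exact Nat.le_mul_of_pos_left _ hm.1
  rw [sum_congr rfl h5]
  conv_rhs => rw [sum_comm]
  refine sum_congr rfl fun v _ => ?_
  conv_rhs => rw [sum_comm]
  refine sum_congr rfl fun m hm => ?_
  rw [mem_Icc] at hm
  rw [Finset.sum_ite_eq]
  have : (m * v.deg p ∈ Icc 1 n) ↔ m * v.deg p ≤ n := by
    rw [mem_Icc]
    have := Nat.mul_pos hm.1 (v.deg_pos p)
    omega
  simp only [this]

lemma aa_zero [IsFF p X] (χ : FFPrime X → ℂ) : aa p χ 0 = 1 := by
  have : effDiv p 0 = {(0 : FFPrime X →₀ ℕ)} := by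
    ext E
    rw [mem_effDiv, mem_singleton]
    constructor
    · intro h
      ext v
      have := mul_deg_le_degN p E v
      rw [h] at this
      have := v.deg_pos p
      simp only [Finsupp.coe_zero, Pi.zero_apply]
      by_contra hne
      have := Nat.mul_pos (Nat.pos_of_ne_zero hne) this
      omega
    · rintro rfl; simp [degN]
  rw [aa, this, Finset.sum_singleton]; simp [chi]

end

section
variable {X : Type} [Field X]

lemma FFPrime.one_ord {v : FFPrime X} {f : X} (h : 0 < v.ord (f - 1)) : v.ord f = 0 := by
  have : f = 1 + (f - 1) := by ring
  rw [this, v.ord_add_eq_left (by rwa [v.ord_one]), v.ord_one]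

lemma FFPrime.one_ne {v : FFPrime X} {f : X} (h : 0 < v.ord (f - 1)) : f ≠ 0 := v.ne_zero_of_ord (n := 0) (FFPrime.one_ord h)

lemma FFPrime.one_val {v : FFPrime X} {f : X} (h : 0 < v.ord (f - 1)) : v.val f = 0 := v.val_eq_of_ord (n := 0) (FFPrime.one_ord h)

lemma FFPrime.ord_mul_pos {v : FFPrime X} {x y : X} (hx : 0 ≤ v.ord x) (hy : 0 < v.ord y) : 0 < v.ord (x * y) := by
  by_cases hy0 : y = 0
  · rw [hy0, mul_zero, v.ord_zero]; exact coe_lt_top 0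
  by_cases hx0 : x = 0
  · rw [hx0, zero_mul, v.ord_zero]; exact coe_lt_top 0
  rw [v.ord_nonneg_iff hx0] at hx
  rw [v.ord_pos_iff hy0] at hy
  rw [v.ord_pos_iff (mul_ne_zero hx0 hy0), v.val_mul hx0 hy0]; omega

lemma FFPrime.one_mul' {v : FFPrime X} {f g : X} (hf : 0 < v.ord (f - 1)) (hg : 0 < v.ord (g - 1)) : 0 < v.ord (f * g - 1) := by
  have : f * g - 1 = f * (g - 1) + (f - 1) := by ring
  rw [this]
  exact v.lt_ord_add (FFPrime.ord_mul_pos (FFPrime.one_ord hf).ge hg) hf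

lemma FFPrime.one_inv {v : FFPrime X} {f : X} (hf : 0 < v.ord (f - 1)) : 0 < v.ord (f⁻¹ - 1) := by
  have h0 := FFPrime.one_ne hf
  have : f⁻¹ - 1 = - (f⁻¹ * (f - 1)) := by field_simp; ring
  rw [this, v.ord_neg]
  exact FFPrime.ord_mul_pos (v.ord_inv_nonneg_of_le (FFPrime.one_ord hf).le) hf

end

section
variable (p : ℕ) [Fact p.Prime] {X : Type} [Field X]

def ray (T : Finset (FFPrime X)) : AddSubgroup (FDiv X) where
  carrier := {D | ∃ f : X, f ≠ 0 ∧ (∀ v ∈ T, 0 < v.ord (f - 1)) ∧ ∀ v ∉ T, D v = v.val f}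
  zero_mem' := ⟨1, one_ne_zero, fun v _ => by rw [sub_self, v.ord_zero]; exact coe_lt_top 0, fun v _ => by rw [v.val_one]; rfl⟩
  add_mem' := by
    rintro D D' ⟨f, hf, h1, h2⟩ ⟨g, hg, h3, h4⟩
    refine ⟨f * g, mul_ne_zero hf hg, fun v hv => FFPrime.one_mul' (h1 v hv) (h3 v hv), fun v hv => ?_⟩
    rw [v.val_mul hf hg, Finsupp.add_apply, h2 v hv, h4 v hv]
  neg_mem' := by
    rintro D ⟨f, hf, h1, h2⟩
    refine ⟨f⁻¹, inv_ne_zero hf, fun v hv => FFPrime.one_inv (h1 v hv), fun v hv => ?_⟩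
    rw [v.val_inv hf, Finsupp.neg_apply, h2 v hv]

open Classical in
def off (T : Finset (FFPrime X)) : (FDiv X) →+ (FDiv X) := Finsupp.filterAddHom (fun v => v ∉ T)

lemma off_apply (T : Finset (FFPrime X)) (D : FDiv X) (v : FFPrime X) (hv : v ∉ T) : off T D v = D v := by
  classical
  simp [off, Finsupp.filterAddHom, hv]

lemma off_apply' (T : Finset (FFPrime X)) (D : FDiv X) (v : FFPrime X) (hv : v ∈ T) : off T D v = 0 := by
  classical
  simp [off, Finsupp.filterAddHom, hv]

def dT (T : Finset (FFPrime X)) : (FDiv X) →+ ℤ := (degZ p).comp (off T)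

lemma dT_apply (T : Finset (FFPrime X)) (D : FDiv X) : dT p T D = degZ p (off T D) := rfl

lemma dT_single {T : Finset (FFPrime X)} {v : FFPrime X} (hv : v ∉ T) (n : ℤ) : dT p T (single v n) = n * v.deg p := by
  classical
  rw [dT_apply, ← degZ_single]; congr 1
  ext w
  by_cases hw : w ∈ T
  · rw [off_apply' T _ w hw, single_apply, if_neg]; rintro rfl; exact hv hw
  · rw [off_apply T _ w hw]

lemma off_eq_dv [IsFF p X] {T : Finset (FFPrime X)} {D : FDiv X} {f : X} (hf : f ≠ 0) (h1 : ∀ v ∈ T, 0 < v.ord (f - 1)) (h2 : ∀ v ∉ T, D v = v.val f) : off T D = dv f := by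
  ext v
  rw [dv_apply p hf]
  by_cases hv : v ∈ T
  · rw [off_apply' T D v hv, FFPrime.one_val (h1 v hv)]
  · rw [off_apply T D v hv, h2 v hv]

lemma dT_ray [IsFF p X] {T : Finset (FFPrime X)} {D : FDiv X} (hD : D ∈ ray T) : dT p T D = 0 := by
  obtain ⟨f, hf, h1, h2⟩ := hD
  rw [dT_apply, off_eq_dv p hf h1 h2, degZ_dv p hf]

lemma one_unique [IsFF p X] {T : Finset (FFPrime X)} (hT : T.Nonempty) {f g : X} (hf : f ≠ 0) (hg : g ≠ 0) (h1 : ∀ v ∈ T, 0 < v.ord (f - 1)) (h2 : ∀ v ∈ T, 0 < v.ord (g - 1))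
    (h : ∀ v : FFPrime X, v.val f = v.val g) : f = g := by
  obtain ⟨v, hv⟩ := hT
  by_contra hne
  have h3 : 0 < v.ord (f * g⁻¹ - 1) := FFPrime.one_mul' (h1 v hv) (FFPrime.one_inv (h2 v hv))
  have h0 : f * g⁻¹ - 1 ≠ 0 := by
    intro h; apply hne
    rw [sub_eq_zero] at h; field_simp at h; exact h
  rw [v.ord_pos_iff h0] at h3
  obtain ⟨w, hw⟩ := exists_pole' p h0 (v := v) (by omega)
  have h4 : 0 ≤ w.ord (f * g⁻¹ - 1) := by
    refine w.le_ord_sub ?_ w.ord_one.ge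
    rw [w.ord_nonneg_iff (mul_ne_zero hf (inv_ne_zero hg)), w.val_mul hf (inv_ne_zero hg), w.val_inv hg, h w]
    omega
  rw [w.ord_nonneg_iff h0] at h4
  omega

open Classical in
lemma exists_one_LL [IsFF p X] : ∃ ρ : ℤ, ∀ T : Finset (FFPrime X), ∃ n1 : ℤ, ∃ ET : FFPrime X →₀ ℕ, (∀ v, ET v = if v ∈ T then 1 else 0) ∧
    ∀ D : FDiv X, n1 ≤ degZ p D → (∀ v ∈ T, D v = 0) → (ell p (D - castD ET) : ℤ) = degZ p D - degN p ET - ρ ∧ ∃ f ∈ LL D, ∀ v ∈ T, 0 < v.ord (f - 1) := by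
  classical
  obtain ⟨ρ, n0, hR⟩ := riemann p (X := X)
  refine ⟨ρ, fun T => ?_⟩
  let ET : FFPrime X →₀ ℕ := Finsupp.indicator T (fun _ _ => 1)
  have hET : ∀ v, ET v = if v ∈ T then 1 else 0 := by
    intro v; simp [ET, Finsupp.indicator_apply]
  refine ⟨n0 + degN p ET, ET, hET, fun D hD hDT => ?_⟩
  have e1 : degZ p (D - castD ET) = degZ p D - degN p ET := by rw [map_sub, degZ_castD]
  have l1 := hR D (by omega)
  have l2 := hR (D - castD ET) (by omega)
  rw [e1] at l2
  refine ⟨l2, ?_⟩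
  have hsub : LL D ≤ GG (T : Set (FFPrime X)) (fun _ => 0) := by
    intro y hy v hv
    have := mem_LL.mp hy v
    rw [hDT v hv] at this; simpa using this
  have hinf : LL (D - castD ET) = LL D ⊓ GG (T : Set (FFPrime X)) (fun v => 0 + ET v) := by
    ext y
    rw [AddSubgroup.mem_inf, mem_LL, mem_LL, mem_GG]
    constructor
    · intro h
      refine ⟨fun v => le_trans ?_ (h v), fun v hv => le_trans ?_ (h v)⟩
      · rw [Finsupp.sub_apply, castD_apply]; exact_mod_cast (by omega)
      · rw [Finsupp.sub_apply, castD_apply, hDT v hv]; exact coe_le_coe.mpr (by omega)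
    · rintro ⟨h1, h2⟩ v
      rw [Finsupp.sub_apply, castD_apply]
      by_cases hv : v ∈ T
      · refine le_trans ?_ (h2 v hv)
        rw [hDT v hv]; exact coe_le_coe.mpr (by omega)
      · refine le_trans ?_ (h1 v)
        rw [hET]
        simp [hv]
  have r1 := relIndex_GG_eq p T ET (by intro v hv; rw [mem_support_iff, hET] at hv; by_contra h; exact hv (if_neg h)) (fun _ => 0)
  have r2 : (GG (T : Set (FFPrime X)) (fun v => 0 + ET v)).relIndex (LL D) = p ^ degN p ET := by
    rw [← AddSubgroup.inf_relIndex_left, ← hinf]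
    have hle : LL (D - castD ET) ≤ LL D := by rw [hinf]; exact inf_le_left
    have := relIndex_mul_relIndex ⊥ _ _ bot_le hle
    rw [relIndex_bot_left, relIndex_bot_left, card_LL p, card_LL p] at this
    have e : ell p D = ell p (D - castD ET) + degN p ET := by omega
    rw [e, pow_add] at this
    exact Nat.eq_of_mul_eq_mul_left (pow_pos (Fact.out : p.Prime).pos _) this
  have r3 : GG (T : Set (FFPrime X)) (fun _ => 0) ≤ LL D ⊔ GG (T : Set (FFPrime X)) (fun v => 0 + ET v) := by
    rw [← AddSubgroup.relIndex_eq_one]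
    have h1 := relIndex_mul_relIndex (GG (T : Set (FFPrime X)) (fun v => 0 + ET v))
      (LL D ⊔ GG (T : Set (FFPrime X)) (fun v => 0 + ET v)) (GG (T : Set (FFPrime X)) (fun _ => 0))
      le_sup_right (sup_le hsub (GG_anti _ (by intro v hv; omega)))
    rw [r1, AddSubgroup.relIndex_sup_right, r2] at h1
    have := pow_pos (Fact.out : p.Prime).pos (degN p ET)
    exact Nat.eq_of_mul_eq_mul_left this (by rw [h1, mul_one])
  have h1 : (1 : X) ∈ GG (T : Set (FFPrime X)) (fun _ => 0) := fun v _ => by simpa using v.ord_one.ge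
  obtain ⟨f, hf, g, hg, hfg⟩ := mem_sup.mp (r3 h1)
  refine ⟨f, hf, fun v hv => ?_⟩
  have : f - 1 = - g := by rw [← hfg]; ring
  rw [this, v.ord_neg, v.ord_pos_iff_one_le]
  have := hg v hv
  dsimp only at this
  rw [hET] at this
  simpa [hv] using this

def rayEff [IsFF p X] (T : Finset (FFPrime X)) (n : ℕ) (D : FDiv X) : Set (FFPrime X →₀ ℕ) :=
  {E | degN p E = n ∧ (∀ v ∈ T, E v = 0) ∧ castD E - D ∈ ray T}

lemma card_rayEff [IsFF p X] (T : Finset (FFPrime X)) (hT : T.Nonempty) : ∃ κ n1 : ℤ, ∀ (n : ℕ) (D : FDiv X), n1 ≤ n → dT p T D = n → ∃ k : ℕ, (k : ℤ) = n - κ ∧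
      (rayEff p T n D).ncard = p ^ k := by
  classical
  obtain ⟨ρ, h⟩ := exists_one_LL p (X := X)
  obtain ⟨n1, ET, hET, h⟩ := h T
  refine ⟨degN p ET + ρ, n1, fun n D hn hD => ?_⟩
  have hz : ∀ v ∈ T, off T D v = 0 := fun v hv => off_apply' T D v hv
  rw [dT_apply] at hD
  obtain ⟨he, f0, hf0, h01⟩ := h (off T D) (by omega) hz
  refine ⟨ell p (off T D - castD ET), by omega, ?_⟩
  rw [← card_LL p, ← Nat.card_coe_set_eq]
  symm
  obtain ⟨v0, hv0⟩ := hT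
  have hone : ∀ y ∈ LL (off T D - castD ET), (f0 + y ∈ LL (off T D)) ∧ ∀ v ∈ T, 0 < v.ord (f0 + y - 1) := by
    intro y hy
    refine ⟨add_mem hf0 (LL_mono ?_ hy), fun v hv => ?_⟩
    · intro v; rw [Finsupp.sub_apply, castD_apply]; omega
    · have : f0 + y - 1 = (f0 - 1) + y := by ring
      rw [this]
      refine v.lt_ord_add (h01 v hv) ?_
      rw [v.ord_pos_iff_one_le]
      have := mem_LL.mp hy v
      rw [Finsupp.sub_apply, castD_apply, hz v hv, hET] at this
      simpa [hv] using this
  have hE : ∀ y : LL (off T D - castD ET), ∃ E : FFPrime X →₀ ℕ, castD E = off T D + dv (f0 + y.1) := by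
    rintro ⟨y, hy⟩
    obtain ⟨h1, h2⟩ := hone y hy
    have h3 := FFPrime.one_ne (h2 v0 hv0)
    obtain ⟨E, hE⟩ := exists_castD ((mem_LL_iff p h3).mp h1)
    exact ⟨E, by rw [hE, zero_add]⟩
  choose EE hEE using hE
  refine Nat.card_congr (Equiv.ofBijective (fun y => (⟨EE y, ?_⟩ : rayEff p T n D)) ⟨?_, ?_⟩)
  · obtain ⟨h1, h2⟩ := hone y.1 y.2
    have h3 := FFPrime.one_ne (h2 v0 hv0)
    refine ⟨?_, fun v hv => ?_, ⟨f0 + y.1, h3, h2, fun v hv => ?_⟩⟩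
    · have := degZ_castD p (EE y)
      rw [hEE, map_add, degZ_dv p h3] at this; omega
    · have := castD_apply (EE y) v
      rw [hEE, Finsupp.add_apply, hz v hv, dv_apply p h3, FFPrime.one_val (h2 v hv)] at this
      omega
    · rw [hEE, Finsupp.sub_apply, Finsupp.add_apply, off_apply T D v hv, dv_apply p h3]; ring
  · intro y z hyz
    have hyz : EE y = EE z := congrArg Subtype.val hyz
    obtain ⟨-, h2⟩ := hone y.1 y.2
    have h3 := FFPrime.one_ne (h2 v0 hv0)
    obtain ⟨-, h2'⟩ := hone z.1 z.2
    have h3' := FFPrime.one_ne (h2' v0 hv0)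
    have h4 : dv (f0 + y.1) = dv (f0 + z.1) := by
      have h5 := hEE y; have h6 := hEE z
      rw [hyz, h6] at h5; exact (add_left_cancel h5).symm
    have := one_unique p ⟨v0, hv0⟩ h3 h3' h2 h2' (fun v => by rw [← dv_apply p h3, ← dv_apply p h3', h4])
    exact Subtype.ext (add_left_cancel this)
  · rintro ⟨E, hE1, hE2, g, hg0, hg1, hg2⟩
    have hEg : castD E = off T D + dv g := by
      ext v
      rw [Finsupp.add_apply, dv_apply p hg0]
      by_cases hv : v ∈ T
      · rw [castD_apply, hE2 v hv, hz v hv, FFPrime.one_val (hg1 v hv)]; rfl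
      · have := hg2 v hv
        rw [Finsupp.sub_apply] at this
        rw [off_apply T D v hv]; omega
    have hy : g - f0 ∈ LL (off T D - castD ET) := by
      have hgL : g ∈ LL (off T D) := by
        rw [mem_LL_iff p hg0, ← hEg]; intro v; rw [castD_apply]; exact Int.natCast_nonneg _
      have h1 := sub_mem hgL hf0
      rw [mem_LL] at h1 ⊢
      intro v
      rw [Finsupp.sub_apply, castD_apply, hET]
      by_cases hv : v ∈ T
      · have : g - f0 = (g - 1) - (f0 - 1) := by ring
        rw [this, hz v hv]
        simpa [hv] using v.ord_pos_iff_one_le.mp (v.lt_ord_sub (hg1 v hv) (h01 v hv))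
      · simpa [hv] using h1 v
    refine ⟨⟨g - f0, hy⟩, Subtype.ext ?_⟩
    have h5 := hEE ⟨g - f0, hy⟩
    rw [add_sub_cancel] at h5
    rw [← hEg] at h5
    ext v
    have := congrArg (fun F => F v) h5
    simp only [castD_apply] at this
    exact_mod_cast this
end

section
open Filter Topology

lemma tsum_poly_mul {l : ℕ → ℂ} {P Q : Polynomial ℂ} (h : PowerSeries.mk l * (Q : PowerSeries ℂ) = (P : PowerSeries ℂ)) {z : ℂ}
    (hs : Summable fun n => ‖l n * z ^ n‖) : (∑' n, l n * z ^ n) * Q.eval z = P.eval z := by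
  have key : ∀ R : Polynomial ℂ, Summable (fun n => ‖R.coeff n * z ^ n‖) ∧
      ∑' n, R.coeff n * z ^ n = R.eval z := by
    intro R
    have h0 : ∀ n ∉ range (R.natDegree + 1), R.coeff n * z ^ n = 0 := by
      intro n hn
      rw [mem_range, not_lt] at hn
      rw [Polynomial.coeff_eq_zero_of_natDegree_lt (by omega), zero_mul]
    refine ⟨summable_of_ne_finset_zero (s := range (R.natDegree + 1)) ?_, ?_⟩
    · intro n hn; rw [h0 n hn, norm_zero]
    · rw [tsum_eq_sum h0, Polynomial.eval_eq_sum_range]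
  rw [← (key Q).2, ← (key P).2, tsum_mul_tsum_eq_tsum_sum_antidiagonal_of_summable_norm hs (key Q).1]
  congr 1
  funext n
  have := congrArg (PowerSeries.coeff n) h
  rw [PowerSeries.coeff_mul, coeff_coe] at this
  rw [← this, sum_mul]
  refine sum_congr rfl fun ij hij => ?_
  rw [PowerSeries.coeff_mk, coeff_coe]
  rw [← Finset.HasAntidiagonal.mem_antidiagonal.mp hij, pow_add]; ring

lemma eventually_poly_ne {P : Polynomial ℂ} (hP : P ≠ 0) : ∀ᶠ z : ℝ in 𝓝[<] 1, P.eval (z : ℂ) ≠ 0 := by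
  have hf : {z : ℝ | P.eval (z : ℂ) = 0}.Finite := by
    refine Set.Finite.subset (Set.Finite.preimage (f := fun z : ℝ => (z : ℂ)) ?_ (P.roots.toFinset.finite_toSet)) ?_
    · exact Complex.ofReal_injective.injOn
    · intro z hz
      simp only [Set.mem_preimage, Finset.mem_coe, Multiset.mem_toFinset]
      exact (Polynomial.mem_roots hP).mpr hz
  have h1 : ({z : ℝ | P.eval (z : ℂ) = 0} \ {1})ᶜ ∈ 𝓝 (1 : ℝ) := (hf.subset Set.diff_subset).isClosed.compl_mem_nhds (by simp)
  have h2 : _ ∈ 𝓝[<] (1 : ℝ) := mem_nhdsWithin_of_mem_nhds h1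
  filter_upwards [h2, self_mem_nhdsWithin] with z hz hz1 h0
  exact hz ⟨h0, ne_of_lt hz1⟩

lemma poly_limit {P : Polynomial ℂ} (hP : P ≠ 0) : Tendsto (fun z : ℝ => (1 - (z : ℂ)) * (z * P.derivative.eval (z : ℂ)) / P.eval (z : ℂ)) (𝓝[<] 1)
      (𝓝 (- (P.rootMultiplicity 1 : ℂ))) := by
  obtain ⟨Q, hQ, hQ1⟩ := Polynomial.exists_eq_pow_rootMultiplicity_mul_and_not_dvd P hP 1
  set m := P.rootMultiplicity 1
  rw [Polynomial.dvd_iff_isRoot, IsRoot.def] at hQ1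
  have hQ0 : Q ≠ 0 := by rintro rfl; simp at hQ1
  have hd : (Polynomial.X - Polynomial.C 1) * P.derivative =
      Polynomial.C (m : ℂ) * P + (Polynomial.X - Polynomial.C 1) ^ (m + 1) * Q.derivative := by
    rw [hQ, Polynomial.derivative_mul, Polynomial.derivative_X_sub_C_pow]
    cases m with
    | zero => simp
    | succ k => simp only [Nat.add_sub_cancel, map_natCast]; ring
  have hcont : Continuous fun z : ℝ => (z : ℂ) := Complex.continuous_ofReal
  have h1 : Tendsto (fun z : ℝ => -((z : ℂ) * m) + (1 - (z : ℂ)) * z * Q.derivative.eval (z : ℂ) / Q.eval (z : ℂ)) (𝓝[<] 1)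
      (𝓝 (- (m : ℂ))) := by
    have h2 : ContinuousAt (fun z : ℝ => -((z : ℂ) * m) + (1 - (z : ℂ)) * z * Q.derivative.eval (z : ℂ) / Q.eval (z : ℂ)) 1 := by
      refine ContinuousAt.add (by fun_prop) (ContinuousAt.div ?_ ?_ (by simpa using hQ1))
      · exact ((by fun_prop : Continuous fun z : ℝ => (1 - (z : ℂ)) * z).mul (Q.derivative.continuous.comp hcont)).continuousAt
      · exact (Q.continuous.comp hcont).continuousAt
    have h3 := h2.tendsto
    simp only [Complex.ofReal_one, one_mul, sub_self, zero_mul, zero_div, add_zero] at h3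
    exact h3.mono_left nhdsWithin_le_nhds
  refine h1.congr' ?_
  filter_upwards [eventually_poly_ne hQ0, self_mem_nhdsWithin] with z hz hz1
  have hz1 : (z : ℂ) - 1 ≠ 0 := by
    rw [sub_ne_zero]; exact_mod_cast ne_of_lt hz1
  have e := congrArg (Polynomial.eval (z : ℂ)) hd
  have e2 := congrArg (Polynomial.eval (z : ℂ)) hQ
  simp only [Polynomial.eval_mul, Polynomial.eval_sub, Polynomial.eval_X, Polynomial.eval_C, Polynomial.eval_add, Polynomial.eval_pow] at e e2
  have hPz : P.eval (z : ℂ) ≠ 0 := by rw [e2]; exact mul_ne_zero (pow_ne_zero _ hz1) hz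
  rw [eq_div_iff hPz]
  have e3 : (1 - (z : ℂ)) * (z * P.derivative.eval (z : ℂ)) = - z * (((z : ℂ) - 1) * P.derivative.eval (z : ℂ)) := by ring
  rw [e3, e, add_mul]
  have e4 : (1 - (z : ℂ)) * z * Q.derivative.eval (z : ℂ) / Q.eval (z : ℂ) * P.eval (z : ℂ) =
     - z * (((z : ℂ) - 1) ^ (m + 1) * Q.derivative.eval (z : ℂ)) := by
    rw [e2]; field_simp; ring
  rw [e4]; ring

lemma analytic_main (b l : ℕ → ℂ) (hb0 : b 0 = 1) (hrec : ∀ n : ℕ, (n : ℂ) * b n = ∑ j ∈ Icc 1 n, l j * b (n - j)) (hl0 : l 0 = 0)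
    (δ : ℕ) (hδ : 0 < δ) (n1 : ℕ) (ξ : ℂ) (hs : ∀ n, n1 ≤ n → b (n + δ) = ξ * b n) (C : ℝ) (hl : ∀ n, ‖l n‖ ≤ C * n) :
    ∃ k : ℕ, Tendsto (fun z : ℝ => (1 - (z : ℂ)) * ∑' n, l n * (z : ℂ) ^ n) (𝓝[<] 1)
      (𝓝 ((if ξ = 1 then 1 else 0) - (k : ℂ))) ∧
      (ξ = 1 → ∑ n ∈ Finset.Ico n1 (n1 + δ), b n ≠ 0 → k = 0) := by
  classical
  let f : ℕ → ℂ := fun n => b n - if δ ≤ n then ξ * b (n - δ) else 0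
  let F : Polynomial ℂ := ∑ n ∈ range (n1 + δ), Polynomial.monomial n (f n)
  let E : Polynomial ℂ := 1 - Polynomial.C ξ * Polynomial.X ^ δ
  have hFc : ∀ n, F.coeff n = f n := by
    intro n
    simp only [F, Polynomial.finset_sum_coeff, Polynomial.coeff_monomial]
    rw [Finset.sum_ite_eq']
    split_ifs with h
    · rfl
    · rw [mem_range, not_lt] at h
      have := hs (n - δ) (by omega)
      rw [Nat.sub_add_cancel (by omega)] at this
      simp only [f]
      rw [if_pos (by omega), this, sub_self]
  have hEB : (E : PowerSeries ℂ) * PowerSeries.mk b = (F : PowerSeries ℂ) := by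
    ext n
    rw [coeff_coe, hFc]
    simp only [E, Polynomial.coe_sub, Polynomial.coe_one, Polynomial.coe_mul, Polynomial.coe_C, Polynomial.coe_pow,
      Polynomial.coe_X, sub_mul, one_mul, map_sub, PowerSeries.coeff_mk, mul_assoc, PowerSeries.coeff_C_mul,
      PowerSeries.coeff_X_pow_mul', f]
    split_ifs <;> simp
  have hLB : PowerSeries.X * PowerSeries.derivative ℂ (PowerSeries.mk b) = PowerSeries.mk l * PowerSeries.mk b := by
    ext n
    conv_rhs => rw [PowerSeries.coeff_mul]
    simp only [PowerSeries.coeff_mk]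
    rw [Finset.Nat.sum_antidiagonal_eq_sum_range_succ (fun i j => l i * b j), Finset.sum_range_succ', hl0, zero_mul, add_zero]
    have e : ∑ k ∈ range n, l (k + 1) * b (n - (k + 1)) = (n : ℂ) * b n := by
      rw [hrec, Finset.range_eq_Ico, Finset.sum_Ico_add' (fun j => l j * b (n - j)) 0 n 1]
      rfl
    rw [e]
    cases n with
    | zero => simp
    | succ n =>
      rw [PowerSeries.coeff_succ_X_mul, PowerSeries.coeff_derivative, PowerSeries.coeff_mk]; push_cast; ring
  have hF0 : F ≠ 0 := by
    intro h
    have := hFc 0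
    rw [h, Polynomial.coeff_zero] at this
    simp only [f] at this
    rw [if_neg (by omega), hb0] at this
    simp at this
  have hE0 : E ≠ 0 := by
    intro h
    have : E.coeff 0 = 1 := by simp [E, Polynomial.coeff_X_pow, hδ.ne]
    rw [h, Polynomial.coeff_zero] at this
    simp at this
  have hid : PowerSeries.mk l * ((F * E : Polynomial ℂ) : PowerSeries ℂ) =
      ((Polynomial.X * (F.derivative * E - F * E.derivative) : Polynomial ℂ) : PowerSeries ℂ) := by
    have hd := congrArg (PowerSeries.derivative ℂ) hEB
    rw [Derivation.leibniz, smul_eq_mul, smul_eq_mul, PowerSeries.derivative_coe, PowerSeries.derivative_coe] at hd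
    simp only [Polynomial.coe_mul, Polynomial.coe_sub, Polynomial.coe_X]
    rw [← hd, ← hEB]
    linear_combination (-(E : PowerSeries ℂ) * E) * hLB
  have hsum : ∀ z : ℝ, 0 < z → z < 1 → Summable fun n => ‖l n * (z : ℂ) ^ n‖ := by
    intro z hz0 hz1
    have h1 : Summable fun n : ℕ => (n : ℝ) ^ 1 * z ^ n := summable_pow_mul_geometric_of_norm_lt_one 1 (by rwa [Real.norm_of_nonneg hz0.le])
    refine Summable.of_nonneg_of_le (fun _ => norm_nonneg _) (fun n => ?_) (h1.mul_left C)
    rw [norm_mul, norm_pow, Complex.norm_real, Real.norm_of_nonneg hz0.le]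
    calc _ ≤ (C * n) * z ^ n := by gcongr; exact hl n
      _ = _ := by ring
  have hk_E : (E.rootMultiplicity 1 : ℂ) = if ξ = 1 then 1 else 0 := by
    split_ifs with h
    · have : E.rootMultiplicity 1 = 1 := by
        apply le_antisymm
        · by_contra hlt
          push Not at hlt
          have := (Polynomial.one_lt_rootMultiplicity_iff_isRoot hE0).mp hlt
          have h2 := this.2
          simp [E, h, Polynomial.derivative_X_pow] at h2
          omega
        · rw [Nat.succ_le_iff, Polynomial.rootMultiplicity_pos hE0]; simp [E, h]
      rw [this]; simp
    · rw [Polynomial.rootMultiplicity_eq_zero]; simp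
      simp only [E, IsRoot.def]
      simp [sub_eq_zero]; exact fun h' => h h'.symm
  refine ⟨F.rootMultiplicity 1, ?_, ?_⟩
  · rw [← hk_E]
    have hlim := (poly_limit hF0).sub (poly_limit hE0)
    have : -(F.rootMultiplicity 1 : ℂ) - -(E.rootMultiplicity 1 : ℂ) = (E.rootMultiplicity 1 : ℂ) - (F.rootMultiplicity 1 : ℂ) := by ring
    rw [this] at hlim
    refine hlim.congr' ?_
    have hpos : ∀ᶠ z : ℝ in 𝓝[<] 1, 0 < z := mem_nhdsWithin_of_mem_nhds (lt_mem_nhds one_pos)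
    filter_upwards [eventually_poly_ne hF0, eventually_poly_ne hE0, hpos, self_mem_nhdsWithin] with z hF hE hz0 hz1
    have := tsum_poly_mul hid (hsum z hz0 hz1)
    simp only [Polynomial.eval_mul, Polynomial.eval_sub, Polynomial.eval_X] at this
    have h2 : ∑' n, l n * (z : ℂ) ^ n = z * (F.derivative.eval (z : ℂ) * E.eval (z : ℂ) - F.eval (z : ℂ) * E.derivative.eval (z : ℂ)) / (F.eval (z : ℂ) * E.eval (z : ℂ)) := by
      rw [eq_div_iff (mul_ne_zero hF hE), this]
    rw [h2]
    field_simp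
  · intro hξ hne
    apply Polynomial.rootMultiplicity_eq_zero
    rw [IsRoot.def]
    refine fun h => hne (Eq.trans ?_ h)
    symm
    simp only [F, Polynomial.eval_finset_sum, Polynomial.eval_monomial, one_pow, mul_one, f]
    rw [sum_sub_distrib, hξ, sub_eq_iff_eq_add]
    have : ∑ x ∈ range (n1 + δ), (if δ ≤ x then 1 * b (x - δ) else 0) = ∑ x ∈ range n1, b x := by
      rw [add_comm, Finset.sum_range_add]
      rw [sum_eq_zero, zero_add]
      · refine sum_congr rfl fun x _ => ?_
        simp
      · intro x hx; rw [mem_range] at hx; rw [if_neg (by omega)]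
    rw [this, add_comm (Finset.sum _ _), Finset.range_eq_Ico, Finset.range_eq_Ico, Finset.sum_Ico_consecutive _ (by omega) (by omega)]

end

open Filter Topology

section
variable (p : ℕ) [Fact p.Prime] {X : Type} [Field X]

lemma castD_add (E F : FFPrime X →₀ ℕ) : castD (E + F) = castD E + castD F := by
  ext v; simp [castD_apply]

lemma castD_single (v : FFPrime X) (n : ℕ) : castD (single v n) = single v (n : ℤ) := by
  classical
  ext w; rw [castD_apply]; simp only [single_apply]; split_ifs <;> simp

abbrev Ray (T : Finset (FFPrime X)) : Type := (FDiv X) ⧸ ray T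

open Classical in
def chr (T : Finset (FFPrime X)) (ψ : AddChar (Ray T) ℂ) (v : FFPrime X) : ℂ := if v ∈ T then 0 else ψ (QuotientAddGroup.mk (single v 1))

open Classical in
lemma chi_chr (T : Finset (FFPrime X)) (ψ : AddChar (Ray T) ℂ) (E : FFPrime X →₀ ℕ) : chi (chr T ψ) E = if ∀ v ∈ T, E v = 0 then ψ (QuotientAddGroup.mk (castD E)) else 0 := by
  induction E using Finsupp.induction_linear with
  | zero =>
    have : castD (0 : FFPrime X →₀ ℕ) = 0 := by ext v; simp [castD_apply]
    simp [chi, this]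
  | add E F hE hF =>
    have h : (∀ v ∈ T, (E + F) v = 0) ↔ (∀ v ∈ T, E v = 0) ∧ (∀ v ∈ T, F v = 0) := by
      simp only [Finsupp.add_apply, Nat.add_eq_zero_iff]
      exact ⟨fun h => ⟨fun v hv => (h v hv).1, fun v hv => (h v hv).2⟩, fun h v hv => ⟨h.1 v hv, h.2 v hv⟩⟩
    rw [chi_add, hE, hF, castD_add, mk_add, AddChar.map_add_eq_mul]
    simp only [h]
    split_ifs with h1 h2 h3 h4 h5 <;> first | rfl | tauto | simp
  | single v n =>
    rw [chi_single, chr, castD_single]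
    by_cases hv : v ∈ T
    · rw [if_pos hv]
      rcases Nat.eq_zero_or_pos n with rfl | hn
      · simp
      · rw [zero_pow hn.ne', if_neg]
        intro h
        have := h v hv
        simp at this; omega
    · rw [if_neg hv, if_pos]
      · rw [← AddChar.map_nsmul_eq_pow, ← mk_nsmul, Finsupp.smul_single]; simp
      · intro w hw
        rw [single_apply, if_neg]; rintro rfl; exact hv hw

open Classical in
def clsN [IsFF p X] (T : Finset (FFPrime X)) (n : ℕ) : Finset (Ray T) :=
  ((effDiv p n).filter (fun E => ∀ v ∈ T, E v = 0)).image fun E => QuotientAddGroup.mk (castD E)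

lemma off_castD {T : Finset (FFPrime X)} {E : FFPrime X →₀ ℕ} (hE : ∀ v ∈ T, E v = 0) : off T (castD E) = castD E := by
  ext v
  by_cases hv : v ∈ T
  · rw [off_apply' T _ v hv, castD_apply, hE v hv]; rfl
  · rw [off_apply T _ v hv]

lemma aa_chr [IsFF p X] (T : Finset (FFPrime X)) (hT : T.Nonempty) : ∃ (κ : ℤ) (n1 : ℕ), ∀ n, n1 ≤ n → (∀ D, QuotientAddGroup.mk D ∈ clsN p T n ↔ dT p T D = n) ∧
      ∀ ψ : AddChar (Ray T) ℂ, aa p (chr T ψ) n = (p : ℂ) ^ (n - κ) * ∑ c ∈ clsN p T n, ψ c := by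
  classical
  obtain ⟨κ, n1, hc⟩ := card_rayEff p T hT
  refine ⟨κ, n1.toNat, fun n hn => ?_⟩
  have hmem : ∀ D, QuotientAddGroup.mk D ∈ clsN p T n ↔ dT p T D = n := by
    intro D
    simp only [clsN, mem_image, mem_filter, mem_effDiv]
    constructor
    · rintro ⟨E, ⟨hE1, hE2⟩, hE3⟩
      have h2 := dT_ray p (QuotientAddGroup.eq.mp hE3)
      rw [map_add, map_neg, dT_apply p T (castD E), off_castD hE2, degZ_castD] at h2
      omega
    · intro hD
      obtain ⟨k, -, hk⟩ := hc n D (by omega) hD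
      have hne : (rayEff p T n D).Nonempty := by
        by_contra h
        rw [Set.not_nonempty_iff_eq_empty] at h
        rw [h, Set.ncard_empty] at hk
        exact (pow_pos (Fact.out : p.Prime).pos k).ne hk
      obtain ⟨E, hE1, hE2, hE3⟩ := hne
      refine ⟨E, ⟨hE1, hE2⟩, ?_⟩
      rw [QuotientAddGroup.eq]
      have := neg_mem hE3
      rwa [neg_sub, sub_eq_neg_add] at this
  refine ⟨hmem, fun ψ => ?_⟩
  rw [aa]
  simp only [chi_chr]
  rw [← sum_filter]
  rw [← Finset.sum_fiberwise_of_maps_to (t := clsN p T n) (g := fun E => (QuotientAddGroup.mk (castD E) : Ray T))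
    (fun E hE => mem_image_of_mem _ hE), mul_sum]
  refine sum_congr rfl fun c hcc => ?_
  obtain ⟨D, rfl⟩ := mk_surjective c
  have hD := (hmem D).mp hcc
  obtain ⟨k, hk0, hk⟩ := hc n D (by omega) hD
  rw [sum_congr rfl (g := fun _ => ψ (QuotientAddGroup.mk D)) (fun E hE => by rw [(mem_filter.mp hE).2])]
  rw [sum_const, nsmul_eq_mul, ← hk0, zpow_natCast]
  congr 1
  rw [← Nat.cast_pow, ← hk]
  congr 1
  rw [← Set.ncard_coe_finset]
  congr 1
  ext E
  simp only [Finset.coe_filter, mem_filter, mem_effDiv, rayEff, Set.mem_setOf_eq]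
  rw [and_assoc]
  refine and_congr_right fun _ => and_congr_right fun _ => ?_
  rw [eq_comm, QuotientAddGroup.eq, sub_eq_neg_add]

lemma aa_shift [IsFF p X] (T : Finset (FFPrime X)) (hT : T.Nonempty) : ∃ n1 : ℕ, ∀ n, n1 ≤ n → ∀ (ψ : AddChar (Ray T) ℂ) (δ : ℕ) (D : FDiv X), dT p T D = δ →
      aa p (chr T ψ) (n + δ) / p ^ (n + δ) = ψ (QuotientAddGroup.mk D) * (aa p (chr T ψ) n / p ^ n) := by
  classical
  obtain ⟨κ, n1, h⟩ := aa_chr p T hT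
  refine ⟨n1, fun n hn ψ δ D hD => ?_⟩
  rw [(h n hn).2, (h (n + δ) (by omega)).2]
  have e : clsN p T (n + δ) = (clsN p T n).image (fun c => QuotientAddGroup.mk D + c) := by
    ext c
    obtain ⟨D1, rfl⟩ := mk_surjective c
    rw [(h (n + δ) (by omega)).1, mem_image]
    constructor
    · intro h1
      refine ⟨QuotientAddGroup.mk (D1 - D), ((h n hn).1 _).mpr ?_, ?_⟩
      · rw [map_sub, h1, hD]; push_cast; ring
      · rw [← mk_add]; congr 1; abel
    · rintro ⟨c, hc, hc2⟩
      obtain ⟨D2, rfl⟩ := mk_surjective c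
      rw [(h n hn).1] at hc
      rw [← mk_add] at hc2
      have h2 := dT_ray p (QuotientAddGroup.eq.mp hc2)
      rw [map_add, map_neg, map_add, hc, hD] at h2
      push_cast; linarith
  rw [e, sum_image (by intro a _ b _ hab; exact add_left_cancel hab)]
  simp only [AddChar.map_add_eq_mul]
  rw [← mul_sum]
  have hp : (p : ℂ) ≠ 0 := by exact_mod_cast (Fact.out : p.Prime).ne_zero
  have e2 : (p : ℂ) ^ (((n + δ : ℕ) : ℤ) - κ) = (p : ℂ) ^ ((n : ℤ) - κ) * (p : ℂ) ^ δ := by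
    rw [← zpow_natCast (p : ℂ) δ, ← zpow_add₀ hp]; congr 1; push_cast; ring
  rw [e2, pow_add]
  field_simp

lemma exists_notMem [IsFF p X] (T : Finset (FFPrime X)) : ∃ v : FFPrime X, v ∉ T := by
  by_cases hT : T.Nonempty
  · obtain ⟨x, hx0, hx⟩ := FFPrime.approx_val T (fun _ => 1) hT
    obtain ⟨v, hv⟩ := hT
    obtain ⟨w, hw⟩ := exists_pole' p hx0 (v := v) (by rw [hx v hv]; norm_num)
    refine ⟨w, fun h => ?_⟩
    rw [hx w h] at hw; omega
  · obtain ⟨x, _, v, _⟩ := exists_transcendental_val p (X := X)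
    rw [Finset.not_nonempty_iff_eq_empty] at hT
    exact ⟨v, by simp [hT]⟩

open scoped ComplexOrder in
lemma lam_bound [IsFF p X] (T : Finset (FFPrime X)) (hT : T.Nonempty) : ∃ C : ℝ, ∀ χ : FFPrime X → ℂ, (∀ v ∈ T, χ v = 0) → (∀ v, ‖χ v‖ ≤ 1) → ∀ n, ‖lam p χ n / p ^ n‖ ≤ C * n := by
  classical
  obtain ⟨n1, h1⟩ := aa_shift p T hT
  obtain ⟨v0, hv0⟩ := exists_notMem p T
  set χ0 := chr T (1 : AddChar (Ray T) ℂ) with hχ0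
  have hχzv : ∀ v, χ0 v = if v ∈ T then 0 else 1 := by
    intro v; rw [hχ0, chr]; split_ifs <;> simp
  have hχzp : ∀ v, 0 ≤ χ0 v := by intro v; rw [hχzv]; split_ifs <;> simp
  have ha : ∀ n, 0 ≤ aa p χ0 n := fun n => sum_nonneg fun E _ =>
    Finset.prod_nonneg fun v _ => pow_nonneg (hχzp v) _
  have hl : ∀ n, 0 ≤ lam p χ0 n := fun n => sum_nonneg fun v _ => sum_nonneg fun m _ => by
    split_ifs
    · exact mul_nonneg (by exact_mod_cast Nat.zero_le _) (pow_nonneg (hχzp v) _)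
    · exact le_rfl
  have hla : ∀ n, lam p χ0 n ≤ n * aa p χ0 n := by
    intro n
    rcases Nat.eq_zero_or_pos n with rfl | hn
    · simp [lam]
    rw [aa_rec]
    have := single_le_sum (f := fun j => lam p χ0 j * aa p χ0 (n - j)) (s := Icc 1 n)
      (fun j _ => mul_nonneg (hl j) (ha _)) (mem_Icc.mpr ⟨hn, le_rfl⟩)
    simpa [aa_zero] using this
  have hδ : 0 < v0.deg p := v0.deg_pos p
  set δ := v0.deg p
  let b : ℕ → ℝ := fun n => ‖aa p χ0 n / p ^ n‖
  have hb : ∀ n, n1 ≤ n → b (n + δ) = b n := by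
    intro n hn
    have := h1 n hn 1 δ (single v0 1) (by rw [dT_single p hv0, one_mul])
    simp only [b, hχ0]
    rw [this]; simp
  have hbC : ∀ n, b n ≤ ∑ i ∈ range (n1 + δ), b i := by
    intro n
    induction n using Nat.strong_induction_on with
    | _ n ih =>
      by_cases hn : n < n1 + δ
      · exact single_le_sum (f := b) (fun i _ => norm_nonneg _) (mem_range.mpr hn)
      · have := hb (n - δ) (by omega)
        rw [Nat.sub_add_cancel (by omega)] at this
        rw [this]; exact ih _ (by omega)
  refine ⟨∑ i ∈ range (n1 + δ), b i, fun χ hχ1 hχ2 n => ?_⟩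
  have hn1 : ‖lam p χ n‖ ≤ ‖lam p χ0 n‖ := by
    have : ‖lam p χ0 n‖ = (lam p χ0 n).re := by
      rw [Complex.norm_eq_sqrt_sq_add_sq, ← (nonneg_iff.mp (hl n)).2]
      simp [Real.sqrt_sq (nonneg_iff.mp (hl n)).1]
    rw [this, lam, lam, Complex.re_sum]
    refine (norm_sum_le _ _).trans (sum_le_sum fun v _ => ?_)
    rw [Complex.re_sum]
    refine (norm_sum_le _ _).trans (sum_le_sum fun m hm => ?_)
    rw [mem_Icc] at hm
    split_ifs
    · by_cases hv : v ∈ T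
      · rw [hχ1 v hv, hχzv, if_pos hv, zero_pow (by omega)]; simp
      · rw [hχzv, if_neg hv]
        simp only [one_pow, mul_one, norm_mul, Complex.norm_natCast, Complex.natCast_re, norm_pow]
        have := pow_le_one₀ (norm_nonneg _) (hχ2 v) (n := m)
        nlinarith [Nat.cast_nonneg (α := ℝ) (v.deg p)]
    · simp
  have hn2 : ‖lam p χ0 n‖ ≤ ‖(n : ℂ) * aa p χ0 n‖ := by
    have e1 : ∀ z : ℂ, 0 ≤ z → ‖z‖ = z.re := by
      intro z hz
      rw [Complex.norm_eq_sqrt_sq_add_sq, ← (nonneg_iff.mp hz).2]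
      simp [Real.sqrt_sq (nonneg_iff.mp hz).1]
    rw [e1 _ (hl n), e1 _ ((hl n).trans (hla n))]
    exact (Complex.le_def.mp (hla n)).1
  calc ‖lam p χ n / p ^ n‖ = ‖lam p χ n‖ / ‖(p : ℂ) ^ n‖ := norm_div _ _
    _ ≤ ‖(n : ℂ) * aa p χ0 n‖ / ‖(p : ℂ) ^ n‖ := by gcongr; exact hn1.trans hn2
    _ = b n * n := by rw [norm_mul, Complex.norm_natCast, mul_comm, mul_div_right_comm]; simp only [b, norm_div]
    _ ≤ _ := by gcongr; exact hbC n

def LamF [IsFF p X] (χ : FFPrime X → ℂ) (z : ℝ) : ℂ := (1 - (z : ℂ)) * ∑' n, lam p χ n / p ^ n * (z : ℂ) ^ n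

lemma lam_zero [IsFF p X] (χ : FFPrime X → ℂ) : lam p χ 0 = 0 := by simp [lam]

lemma lim_char [IsFF p X] (T : Finset (FFPrime X)) (hT : T.Nonempty) (ψ : AddChar (Ray T) ℂ) (hψ : ∀ c, ‖ψ c‖ = 1) : ∃ L : ℝ, Tendsto (LamF p (chr T ψ)) (𝓝[<] 1) (𝓝 (L : ℂ)) ∧
      (ψ = 1 → L = 1) ∧ (ψ ≠ 1 → L ≤ 0) := by
  classical
  obtain ⟨n1, h1⟩ := aa_shift p T hT
  obtain ⟨κ, n2, h2⟩ := aa_chr p T hT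
  obtain ⟨v0, hv0⟩ := exists_notMem p T
  obtain ⟨C, hC⟩ := lam_bound p T hT
  have hp : (p : ℂ) ≠ 0 := by exact_mod_cast (Fact.out : p.Prime).ne_zero
  have hδ0 : 0 < v0.deg p := v0.deg_pos p
  have hD0 : dT p T (single v0 1) = v0.deg p := by rw [dT_single p hv0, one_mul]
  have hch : ∃ (δ : ℕ) (D : FDiv X), 0 < δ ∧ dT p T D = δ ∧ (ψ ≠ 1 → ψ (QuotientAddGroup.mk D) ≠ 1) := by
    by_cases hψ1 : ψ = 1
    · exact ⟨_, _, hδ0, hD0, fun h => absurd hψ1 h⟩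
    obtain ⟨c, hc⟩ : ∃ c, ψ c ≠ 1 := by
      by_contra h; push Not at h; apply hψ1; ext c; rw [h c]; rfl
    by_cases hv : ψ (QuotientAddGroup.mk (single v0 1)) = 1
    · obtain ⟨D, rfl⟩ := mk_surjective c
      have hpos : 0 < dT p T (D + ((dT p T D).natAbs + 1) • single v0 1) := by
        rw [map_add, map_nsmul, hD0, nsmul_eq_mul]; push_cast
        have : (1 : ℤ) ≤ v0.deg p := by exact_mod_cast hδ0
        have h3 := neg_abs_le (dT p T D)
        have h4 := abs_nonneg (dT p T D)
        nlinarith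
      refine ⟨(dT p T (D + ((dT p T D).natAbs + 1) • single v0 1)).toNat, D + ((dT p T D).natAbs + 1) • single v0 1, by omega, by omega, fun _ => ?_⟩
      rw [mk_add, mk_nsmul, AddChar.map_add_eq_mul, AddChar.map_nsmul_eq_pow, hv, one_pow, mul_one]
      exact hc
    · exact ⟨_, _, hδ0, hD0, fun _ => hv⟩
  obtain ⟨δ, D, hδ, hD, hψD⟩ := hch
  have hval : ∀ v ∈ T, chr T ψ v = 0 := fun v hv => if_pos hv
  have hval2 : ∀ v, ‖chr T ψ v‖ ≤ 1 := by
    intro v; rw [chr]; split_ifs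
    · simp
    · exact (hψ _).le
  obtain ⟨k, hk1, hk2⟩ := analytic_main (fun n => aa p (chr T ψ) n / p ^ n) (fun n => lam p (chr T ψ) n / p ^ n)
    (by simp [aa_zero]) (by
      intro n
      have := aa_rec p (chr T ψ) n
      rw [← mul_div_assoc, this, Finset.sum_div]
      refine sum_congr rfl fun j hj => ?_
      rw [mem_Icc] at hj
      have : (p : ℂ) ^ n = p ^ j * p ^ (n - j) := by rw [← pow_add]; congr 1; omega
      rw [this]; field_simp) (by simp [lam_zero]) δ hδ (max n1 n2) (ψ (QuotientAddGroup.mk D))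
    (fun n hn => h1 n (by omega) ψ δ D hD) C (hC _ hval hval2)
  by_cases hψ1 : ψ = 1
  · have hone : ψ (QuotientAddGroup.mk D) = 1 := by rw [hψ1]; rfl
    have hk0 := hk2 hone (by
      have e : ∀ n ∈ Finset.Ico (max n1 n2) (max n1 n2 + δ), aa p (chr T ψ) n / p ^ n =
          (((p : ℝ) ^ (n - κ) * (clsN p T n).card / p ^ n : ℝ) : ℂ) := by
        intro n hn
        rw [Finset.mem_Ico] at hn
        rw [(h2 n (by omega)).2, hψ1]
        push_cast
        congr 1
        simp
      rw [sum_congr rfl e, ← Complex.ofReal_sum, Complex.ofReal_ne_zero]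
      have hp' : (0 : ℝ) < p := by exact_mod_cast (Fact.out : p.Prime).pos
      refine ne_of_gt (Finset.sum_pos' (fun n _ => by positivity) ?_)
      set m := max n1 n2
      have hm1 : m ≤ m + (δ - 1) - (m + (δ - 1)) % δ := by
        have := Nat.mod_lt (m + (δ - 1)) hδ; omega
      refine ⟨m + (δ - 1) - (m + (δ - 1)) % δ, Finset.mem_Ico.mpr ⟨hm1, by omega⟩, ?_⟩
      have hcard : 0 < (clsN p T (m + (δ - 1) - (m + (δ - 1)) % δ)).card := by
        rw [Finset.card_pos]
        refine ⟨QuotientAddGroup.mk (((m + (δ - 1)) / δ) • D), ((h2 _ (by omega)).1 _).mpr ?_⟩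
        rw [map_nsmul, hD, nsmul_eq_mul]
        have h3 := Nat.div_add_mod (m + (δ - 1)) δ
        have : m + (δ - 1) - (m + (δ - 1)) % δ = (m + (δ - 1)) / δ * δ := by
          rw [mul_comm]; omega
        rw [this]; push_cast; ring
      have : (0 : ℝ) < (clsN p T (m + (δ - 1) - (m + (δ - 1)) % δ)).card := by exact_mod_cast hcard
      positivity)
    refine ⟨1, ?_, fun _ => rfl, fun h => absurd hψ1 h⟩
    rw [if_pos hone, hk0] at hk1
    simp only [Nat.cast_zero, sub_zero] at hk1
    simp only [Complex.ofReal_one]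
    exact hk1
  · refine ⟨-(k : ℝ), ?_, fun h => absurd h hψ1, fun _ => by simp⟩
    rw [if_neg (hψD hψ1)] at hk1
    simp only [zero_sub] at hk1
    simp only [Complex.ofReal_neg, Complex.ofReal_natCast]
    exact hk1
end

open Filter Topology

section
variable (p : ℕ) [Fact p.Prime] {X Y : Type} [Field X] [Field Y]

open Classical in
def lamH [IsFF p X] (T : Finset (FFPrime X)) (H : AddSubgroup (FDiv X)) (n : ℕ) : ℕ := ∑ v ∈ places p n, ∑ m ∈ Icc 1 n,
    if v ∉ T ∧ m * v.deg p = n ∧ single v (m : ℤ) ∈ H then v.deg p else 0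

lemma idx_le [IsFF p X] [IsFF p Y] (T : Finset (FFPrime X)) (hT : T.Nonempty) (T' : Finset (FFPrime Y)) (hT' : T'.Nonempty)
    (H : AddSubgroup (FDiv X)) (hH : ray T ≤ H) (hfin : H.index ≠ 0) (N : ℕ) (hcmp : ∀ n, lamH p T' ⊤ n ≤ N * lamH p T H n) : H.index ≤ N := by
  classical
  let G := (FDiv X) ⧸ H
  have hFI : H.FiniteIndex := ⟨hfin⟩
  have hGf : Finite G := AddSubgroup.finite_quotient_of_finiteIndex
  let _ : Fintype G := Fintype.ofFinite G
  have hcard : Fintype.card G = H.index := by rw [← Nat.card_eq_fintype_card]; rfl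
  let π : Ray T →+ G := QuotientAddGroup.map (ray T) H (AddMonoidHom.id _) hH
  have hπ : ∀ D, π (QuotientAddGroup.mk D) = QuotientAddGroup.mk D := fun D => rfl
  let Ψ : AddChar G ℂ → AddChar (Ray T) ℂ := fun ψ => ψ.compAddMonoidHom π
  have hΨn : ∀ ψ c, ‖Ψ ψ c‖ = 1 := fun ψ c => AddChar.norm_apply ψ (π c)
  have hΨ1 : ∀ ψ, Ψ ψ = 1 ↔ ψ = 1 := by
    intro ψ
    constructor
    · intro h
      ext g
      obtain ⟨D, rfl⟩ := mk_surjective g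
      have := DFunLike.congr_fun h (QuotientAddGroup.mk D)
      exact this
    · rintro rfl; ext c; rfl
  choose L hL1 hL2 hL3 using fun ψ => lim_char p T hT (Ψ ψ) (hΨn ψ)
  obtain ⟨LM, hM1, hM2, -⟩ := lim_char p T' hT' (1 : AddChar (Ray T') ℂ) (by simp)
  have hM2 := hM2 rfl
  subst hM2
  have hsumL : ∑ ψ, L ψ ≤ 1 := by
    rw [← Finset.add_sum_erase _ _ (mem_univ (1 : AddChar G ℂ))]
    have h1 := hL2 1 ((hΨ1 1).mpr rfl)
    have h2 : ∑ ψ ∈ univ.erase (1 : AddChar G ℂ), L ψ ≤ 0 := Finset.sum_nonpos fun ψ hψ =>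
      hL3 ψ (fun h => (mem_erase.mp hψ).1 ((hΨ1 ψ).mp h))
    linarith
  have hlim := tendsto_finset_sum (univ) (fun ψ _ => hL1 ψ)
  have hlamM : ∀ n, lam p (chr T' (1 : AddChar (Ray T') ℂ)) n = (lamH p T' ⊤ n : ℂ) := by
    intro n
    rw [lam, lamH]
    push_cast
    refine sum_congr rfl fun v _ => sum_congr rfl fun m hm => ?_
    rw [mem_Icc] at hm
    rw [chr]
    by_cases h1 : m * v.deg p = n <;> by_cases h2 : v ∈ T' <;> simp [h1, h2, show m ≠ 0 by omega]
  have hlam : ∀ n, ∑ ψ, lam p (chr T (Ψ ψ)) n = (H.index * lamH p T H n : ℂ) := by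
    intro n
    simp only [lam]
    rw [sum_comm, lamH]
    push_cast
    rw [mul_sum]
    refine sum_congr rfl fun v _ => ?_
    rw [sum_comm, mul_sum]
    refine sum_congr rfl fun m hm => ?_
    rw [mem_Icc] at hm
    by_cases h1 : m * v.deg p = n
    swap
    · simp [h1]
    by_cases h2 : v ∈ T
    · simp [h1, h2, chr, show m ≠ 0 by omega]
    simp only [h1, h2, chr, if_true, if_false, true_and, not_false_eq_true]
    have h3 : ∀ ψ, Ψ ψ (QuotientAddGroup.mk (single v 1)) ^ m = ψ (QuotientAddGroup.mk (single v (m : ℤ))) := by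
      intro ψ
      rw [← AddChar.map_nsmul_eq_pow, ← mk_nsmul, Finsupp.smul_single]
      change ψ (π _) = _
      rw [hπ]; simp
    refine (sum_congr rfl fun ψ _ => congrArg (fun z => (v.deg p : ℂ) * z) (h3 ψ)).trans ?_
    rw [← mul_sum, AddChar.sum_apply_eq_ite, hcard]
    have h4 : ((QuotientAddGroup.mk (single v (m : ℤ)) : G) = 0) ↔ single v (m : ℤ) ∈ H := eq_zero_iff _
    by_cases h5 : single v (m : ℤ) ∈ H
    · rw [if_pos (h4.mpr h5), if_pos h5]; ring
    · rw [if_neg (fun h => h5 (h4.mp h)), if_neg h5]; ring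
  have hp : (0 : ℝ) < p := by exact_mod_cast (Fact.out : p.Prime).pos
  obtain ⟨C, hC⟩ := lam_bound p T hT
  obtain ⟨C', hC'⟩ := lam_bound p T' hT'
  have hsum : ∀ (l : ℕ → ℂ) (C : ℝ), (∀ n, ‖l n‖ ≤ C * n) → ∀ z : ℝ, 0 < z → z < 1 → Summable fun n => l n * (z : ℂ) ^ n := by
    intro l C hl z hz0 hz1
    have h1 : Summable fun n : ℕ => (n : ℝ) ^ 1 * z ^ n := summable_pow_mul_geometric_of_norm_lt_one 1 (by rwa [Real.norm_of_nonneg hz0.le])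
    refine Summable.of_norm (Summable.of_nonneg_of_le (fun _ => norm_nonneg _) (fun n => ?_) (h1.mul_left C))
    rw [norm_mul, norm_pow, Complex.norm_real, Real.norm_of_nonneg hz0.le]
    calc _ ≤ (C * n) * z ^ n := by gcongr; exact hl n
      _ = _ := by ring
  have hval : ∀ ψ, ∀ v ∈ T, chr T (Ψ ψ) v = 0 := fun ψ v hv => if_pos hv
  have hval2 : ∀ ψ v, ‖chr T (Ψ ψ) v‖ ≤ 1 := by
    intro ψ v; rw [chr]; split_ifs
    · simp
    · exact (hΨn ψ _).le
  have hvalM : ∀ v ∈ T', chr T' (1 : AddChar (Ray T') ℂ) v = 0 := fun v hv => if_pos hv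
  have hvalM2 : ∀ v, ‖chr T' (1 : AddChar (Ray T') ℂ) v‖ ≤ 1 := by
    intro v; rw [chr]; split_ifs <;> simp
  have hmain : ∀ z : ℝ, 0 < z → z < 1 →
      H.index * (LamF p (chr T' (1 : AddChar (Ray T') ℂ)) z).re ≤ N * (∑ ψ, LamF p (chr T (Ψ ψ)) z).re := by
    intro z hz0 hz1
    have sM := hsum _ C' (hC' _ hvalM hvalM2) z hz0 hz1
    have sL := fun ψ => hsum _ C (hC _ (hval ψ) (hval2 ψ)) z hz0 hz1
    have e1 : LamF p (chr T' (1 : AddChar (Ray T') ℂ)) z = (((1 - z) * ∑' n, (lamH p T' ⊤ n : ℝ) / p ^ n * z ^ n : ℝ) : ℂ) := by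
      rw [LamF]; push_cast; simp only [hlamM]
    have e2 : ∑ ψ, LamF p (chr T (Ψ ψ)) z = (((1 - z) * ∑' n, (H.index * lamH p T H n : ℝ) / p ^ n * z ^ n : ℝ) : ℂ) := by
      simp only [LamF]
      rw [← mul_sum, ← Summable.tsum_finsetSum (fun ψ _ => sL ψ)]
      push_cast
      simp only [← sum_mul, ← Finset.sum_div, hlam]
    have sM' : Summable fun n => (lamH p T' ⊤ n : ℝ) / p ^ n * z ^ n := by
      rw [← Complex.summable_ofReal]; push_cast; simpa only [hlamM] using sM
    have sL' : Summable fun n => (H.index * lamH p T H n : ℝ) / p ^ n * z ^ n := by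
      rw [← Complex.summable_ofReal]; push_cast
      have := summable_sum (s := univ) (fun ψ _ => sL ψ)
      simpa only [← sum_mul, ← Finset.sum_div, hlam] using this
    rw [e1, e2, ofReal_re, ofReal_re]
    have h5 : H.index * ∑' n, (lamH p T' ⊤ n : ℝ) / p ^ n * z ^ n ≤ N * ∑' n, (H.index * lamH p T H n : ℝ) / p ^ n * z ^ n := by
      rw [← tsum_mul_left, ← tsum_mul_left]
      refine Summable.tsum_le_tsum (fun n => ?_) (sM'.mul_left _) (sL'.mul_left _)
      have h6 : (lamH p T' ⊤ n : ℝ) ≤ N * lamH p T H n := by exact_mod_cast hcmp n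
      calc (H.index : ℝ) * ((lamH p T' ⊤ n : ℝ) / p ^ n * z ^ n) ≤ H.index * ((N * lamH p T H n : ℝ) / p ^ n * z ^ n) := by gcongr
        _ = _ := by ring
    have : 0 ≤ 1 - z := by linarith
    nlinarith
  have hre1 := (Complex.continuous_re.tendsto _).comp hM1
  have hre2 := (Complex.continuous_re.tendsto _).comp hlim
  have hpos : ∀ᶠ z : ℝ in 𝓝[<] 1, 0 < z := mem_nhdsWithin_of_mem_nhds (lt_mem_nhds one_pos)
  have hfinal := le_of_tendsto_of_tendsto (hre1.const_mul (H.index : ℝ)) (hre2.const_mul (N : ℝ)) (by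
    filter_upwards [hpos, self_mem_nhdsWithin] with z hz0 hz1
    exact hmain z hz0 hz1)
  rw [ofReal_re, ← Complex.ofReal_sum, ofReal_re, mul_one] at hfinal
  have : (H.index : ℝ) ≤ N := hfinal.trans (by nlinarith [Nat.cast_nonneg (α := ℝ) N])
  exact_mod_cast this
end

section
variable {C : Type*} [AddCommGroup C]

def nm (σ : C →+ C) (N : ℕ) : C →+ C where
  toFun x := ∑ j ∈ range N, σ^[j] x
  map_zero' := by simp [iterate_map_zero]
  map_add' x y := by simp only [iterate_map_add, Finset.sum_add_distrib]

lemma nm_apply (σ : C →+ C) (N : ℕ) (x : C) : nm σ N x = ∑ j ∈ range N, σ^[j] x := rfl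

lemma lemmaH (σ : C →+ C) (N : ℕ) (hN : 0 < N) (hσ : ∀ x, σ^[N] x = x) (deg : C →+ ℤ) (hdeg : ∀ x, deg (σ x) = deg x) (hdeg0 : deg ≠ 0) (hfin : Finite deg.ker)
    : (nm σ N).range.index ≠ 0 ∧ ((nm σ N).range.relIndex (σ - AddMonoidHom.id C).ker ≤ N → ∀ x : C, nm σ N x = 0 → ∃ y, x = σ y - y) := by
  classical
  have hdj : ∀ j x, deg (σ^[j] x) = deg x := by
    intro j
    induction j with
    | zero => intro x; rfl
    | succ j ih => intro x; rw [Function.iterate_succ_apply, ih, hdeg]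
  have hdn : ∀ x, deg (nm σ N x) = N * deg x := by
    intro x
    rw [nm_apply, map_sum]
    simp only [hdj]; simp
  have hnf : ∀ x, σ (nm σ N x) = nm σ N x := by
    intro x
    rw [nm_apply, map_sum]
    have h1 := Finset.sum_range_succ' (fun j => σ^[j] x) N
    rw [Finset.sum_range_succ] at h1
    rw [hσ, Function.iterate_zero_apply] at h1
    have h4 := add_right_cancel h1
    rw [h4]
    refine sum_congr rfl fun j _ => ?_
    rw [Function.iterate_succ_apply']
  have hcom : ∀ j x, σ^[j] (σ x) = σ (σ^[j] x) := by
    intro j x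
    rw [← Function.iterate_succ_apply, Function.iterate_succ_apply']
  set A := deg.ker with hA
  set R := (nm σ N).range
  set F := (σ - AddMonoidHom.id C).ker
  set Z := (nm σ N).ker
  have hRF : R ≤ F := by
    rintro _ ⟨y, rfl⟩
    rw [AddMonoidHom.mem_ker, AddMonoidHom.sub_apply, hnf]; simp
  have hZA : Z ≤ A := by
    intro y hy
    rw [AddMonoidHom.mem_ker] at hy ⊢
    have := hdn y
    rw [hy, map_zero] at this
    have hN' : (N : ℤ) ≠ 0 := by omega
    exact (mul_eq_zero.mp this.symm).resolve_left hN'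
  set I := (σ - AddMonoidHom.id C).range
  have hIZ : I ≤ Z := by
    rintro _ ⟨y, rfl⟩
    rw [AddMonoidHom.mem_ker, AddMonoidHom.sub_apply, map_sub]
    rw [nm_apply]
    simp only [hcom]
    rw [← map_sum, ← nm_apply, hnf]; simp
  have finZ : Finite Z := Finite.of_injective (AddSubgroup.inclusion hZA) (AddSubgroup.inclusion_injective hZA)
  have e1 : R.index = R.relIndex F * card I := by rw [← AddSubgroup.relIndex_mul_index hRF, AddSubgroup.index_ker]
  have e2 : R.relIndex A * (R ⊔ A).index = R.index := by rw [← AddSubgroup.relIndex_mul_index (le_sup_left : R ≤ R ⊔ A), AddSubgroup.relIndex_sup_left]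
  have e3 : R.relIndex A = card Z := by
    rw [← AddSubgroup.inf_relIndex_right]
    have h1 : R ⊓ A = A.map (nm σ N) := by
      ext y
      constructor
      · rintro ⟨⟨z, rfl⟩, h2⟩
        refine ⟨z, ?_, rfl⟩
        change deg _ = 0 at h2
        rw [hdn] at h2
        exact (mul_eq_zero.mp h2).resolve_left (by omega)
      · rintro ⟨z, hz, rfl⟩
        refine ⟨⟨z, rfl⟩, ?_⟩
        change deg _ = 0
        have hz : deg z = 0 := hz
        rw [hdn, hz, mul_zero]
    have h3 : A.map (nm σ N) ≤ A := h1 ▸ inf_le_right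
    have h4 := relIndex_mul_relIndex ⊥ (A.map (nm σ N)) A bot_le h3
    have h5 := relIndex_mul_relIndex ⊥ Z A bot_le hZA
    rw [AddSubgroup.relIndex_ker] at h5
    simp only [relIndex_bot_left] at h4 h5
    have : Finite (A.map (nm σ N)) := Finite.of_injective (AddSubgroup.inclusion h3) (AddSubgroup.inclusion_injective h3)
    rw [h1]
    have h6 : 0 < card (A.map (nm σ N)) := Nat.card_pos
    apply Nat.eq_of_mul_eq_mul_left h6
    rw [h4, ← h5, mul_comm]
  have e4 : (R ⊔ A).index = N := by
    have h1 : R ⊔ A = (R.map deg).comap deg := by rw [AddSubgroup.comap_map_eq]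
    rw [h1, AddSubgroup.index_comap]
    obtain ⟨d, hd⟩ := Int.subgroup_cyclic deg.range
    have hd0 : d ≠ 0 := by
      rintro rfl
      apply hdeg0
      ext y
      have : deg y ∈ deg.range := ⟨y, rfl⟩
      rw [hd] at this
      obtain ⟨k, hk⟩ := mem_closure_singleton.mp this
      simpa using hk.symm
    have h2 : deg.range = (⊤ : AddSubgroup ℤ).map (AddMonoidHom.mulLeft d) := by
      rw [hd]; ext z
      constructor
      · intro hz
        obtain ⟨k, rfl⟩ := mem_closure_singleton.mp hz
        exact ⟨k, trivial, by simp [mul_comm]⟩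
      · rintro ⟨k, -, rfl⟩
        exact mem_closure_singleton.mpr ⟨k, by simp [mul_comm]⟩
    have h3 : R.map deg = (AddSubgroup.zmultiples (N : ℤ)).map (AddMonoidHom.mulLeft d) := by
      ext z
      constructor
      · rintro ⟨_, ⟨y, rfl⟩, rfl⟩
        have : deg y ∈ deg.range := ⟨y, rfl⟩
        rw [h2] at this
        obtain ⟨k, -, hk⟩ := this
        refine ⟨k * N, ⟨k, by simp⟩, ?_⟩
        rw [hdn, ← hk]; simp; ring
      · rintro ⟨_, ⟨k, rfl⟩, rfl⟩
        have : (AddMonoidHom.mulLeft d) k ∈ deg.range := by rw [h2]; exact ⟨k, trivial, rfl⟩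
        obtain ⟨y, hy⟩ := this
        refine ⟨nm σ N y, ⟨y, rfl⟩, ?_⟩
        rw [hdn, hy]; simp; ring
    rw [h2, h3, AddSubgroup.relIndex_map_map_of_injective _ _ (fun a b h => mul_left_cancel₀ hd0 h),
      AddSubgroup.relIndex_top_right, Int.index_zmultiples]; simp
  have hZ0 : 0 < card Z := Nat.card_pos
  refine ⟨by rw [← e2, e3, e4]; positivity, fun hle x hx => ?_⟩
  have hfinal : card Z ≤ card I := by
    rw [e3, e4, e1] at e2
    have : card Z * N ≤ N * card I := by rw [e2]; exact Nat.mul_le_mul_right _ hle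
    rw [mul_comm] at this
    exact Nat.le_of_mul_le_mul_left this hN
  have hIZe : I = Z := by
    apply SetLike.coe_injective
    exact Set.eq_of_subset_of_ncard_le hIZ hfinal (Set.toFinite _)
  have : x ∈ I := by rw [hIZe]; exact hx
  obtain ⟨y, hy⟩ := this
  exact ⟨y, hy.symm⟩
end

section
variable (p : ℕ) [Fact p.Prime] {X : Type} [Field X]

lemma deg_polar [IsFF p X] [Algebra (ZMod p) X] {x : X} (hx : x ≠ 0) (φ : RatFunc (ZMod p) →ₐ[ZMod p] X) (hφ : φ RatFunc.X = x) : let _ := φ.toRingHom.toAlgebra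
    (finrank (RatFunc (ZMod p)) X : ℤ) = degZ p (polar x) := by
  intro _
  refine le_antisymm (finrank_le_deg_polar p x φ hφ) ?_
  obtain ⟨E, hE⟩ := exists_castD (posPart_nonneg (dv x))
  rw [zero_add] at hE
  have h2 := degN_zeros_le p x φ hφ E (fun v hv => by
    have h3 : (dv x)⁺ v = E v := by rw [hE, castD_apply]
    have h4 : (dv x)⁺ v = max (dv x v) 0 := rfl
    rw [mem_support_iff] at hv
    rw [dv_apply p hx] at h4
    omega)
  dsimp only at h2
  have h3 : dv x = (dv x)⁺ - polar x := (posPart_sub_negPart _).symm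
  have h4 := degZ_dv p hx
  rw [h3, map_sub, hE, degZ_castD] at h4
  have : (degN p E : ℤ) ≤ _ := Int.ofNat_le.mpr h2
  linarith

lemma exists_only_pole [IsFF p X] (v : FFPrime X) : ∃ x : X, x ≠ 0 ∧ v.val x < 0 ∧ ∀ w, w ≠ v → 0 ≤ w.val x := by
  classical
  obtain ⟨ρ, n0, h⟩ := riemann p (X := X)
  let n : ℕ := (n0.toNat + (ell p (0 : FDiv X) + ρ).toNat + 1)
  have hd := v.deg_pos p
  have h1 : degZ p (single v (n : ℤ)) = n * v.deg p := degZ_single p v n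
  have h4 : (n : ℤ) * 1 ≤ n * v.deg p := mul_le_mul_of_nonneg_left (by omega) (by omega)
  have h2 := h (single v (n : ℤ)) (by rw [h1]; omega)
  have h3 : ¬ LL (single v (n : ℤ)) ≤ LL 0 := by
    intro hle
    have h5 := finite_LL p (0 : FDiv X)
    have h6 : card (LL (single v (n : ℤ))) ≤ card (LL (0 : FDiv X)) := Nat.card_le_card_of_injective _ (AddSubgroup.inclusion_injective hle)
    rw [card_LL p, card_LL p] at h6
    have := (Nat.pow_le_pow_iff_right (Fact.out : p.Prime).one_lt).mp h6
    omega
  obtain ⟨x, hx1, hx2⟩ := SetLike.not_le_iff_exists.mp h3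
  have hx : x ≠ 0 := fun h => hx2 (h ▸ zero_mem _)
  rw [mem_LL_iff p hx] at hx1 hx2
  have key : ∀ w, w ≠ v → 0 ≤ w.val x := by
    intro w hw
    have := hx1 w
    rw [Finsupp.add_apply, dv_apply p hx, Finsupp.single_eq_of_ne hw] at this
    simpa using this
  refine ⟨x, hx, ?_, key⟩
  by_contra hc
  apply hx2
  intro w
  rw [Finsupp.add_apply, dv_apply p hx]
  by_cases hw : w = v
  · subst hw; simpa using hc
  · simpa using key w hw

variable {L M : Type} [Field L] [Field M] [Algebra L M]

def FFPrime.comap (w : FFPrime M) (g : M ≃ₐ[L] M) : FFPrime M where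
  ord x := w.ord (g x)
  ord_zero := by rw [map_zero, w.ord_zero]
  ord_ne_top x hx := w.ord_ne_top _ (by simpa using hx)
  ord_one := by rw [map_one, w.ord_one]
  ord_mul x y := by rw [map_mul, w.ord_mul]
  ord_add x y := by rw [map_add]; exact w.ord_add _ _
  ord_surj n := by
    obtain ⟨x, hx⟩ := w.ord_surj n
    exact ⟨g.symm x, by rwa [AlgEquiv.apply_symm_apply]⟩

lemma FFPrime.comap_ord (w : FFPrime M) (g : M ≃ₐ[L] M) (x : M) : (w.comap g).ord x = w.ord (g x) := rfl
lemma FFPrime.comap_val (w : FFPrime M) (g : M ≃ₐ[L] M) {x : M} (hx : x ≠ 0) : (w.comap g).val x = w.val (g x) :=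
  (w.comap g).val_eq_of_ord (by rw [w.comap_ord, w.ord_eq (by simpa using hx)])
lemma FFPrime.comap_comap (w : FFPrime M) (g h : M ≃ₐ[L] M) : (w.comap g).comap h = w.comap (g * h) := FFPrime.ext_ord fun _ => rfl
lemma FFPrime.comap_one (w : FFPrime M) : w.comap (1 : M ≃ₐ[L] M) = w := FFPrime.ext_ord fun _ => rfl

lemma FFPrime.rc_comap (w : FFPrime M) (g : M ≃ₐ[L] M) : (w.comap g).rc = w.rc := by
  have h : ∀ n, UU (w.comap g) n = (UU w n).comap (g : M →+ M) := fun n => by ext x; rw [mem_UU, AddSubgroup.mem_comap, mem_UU]; rfl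
  rw [FFPrime.rc, FFPrime.rc, h, h, AddSubgroup.relIndex_comap, AddSubgroup.map_comap_eq_self_of_surjective]
  exact g.surjective

lemma FFPrime.deg_comap [IsFF p M] (w : FFPrime M) (g : M ≃ₐ[L] M) : (w.comap g).deg p = w.deg p := by
  have h1 := (w.comap g).rc_eq p
  rw [w.rc_comap, w.rc_eq p] at h1
  exact (Nat.pow_right_injective (Fact.out : p.Prime).two_le h1).symm

def Unr (L M : Type) [Field L] [Field M] [Algebra L M] : Prop := ∀ w : FFPrime M, ∃ v : FFPrime L, ∀ x, w.ord (algebraMap L M x) = v.ord x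

def und (hU : Unr L M) (w : FFPrime M) : FFPrime L := (hU w).choose

lemma und_ord (hU : Unr L M) (w : FFPrime M) (x : L) : w.ord (algebraMap L M x) = (und hU w).ord x := (hU w).choose_spec x

lemma und_val (hU : Unr L M) (w : FFPrime M) {x : L} (hx : x ≠ 0) : w.val (algebraMap L M x) = (und hU w).val x :=
  w.val_eq_of_ord (by rw [und_ord hU, FFPrime.ord_eq _ hx])

lemma und_comap (hU : Unr L M) (w : FFPrime M) (g : M ≃ₐ[L] M) : und hU (w.comap g) = und hU w :=
  FFPrime.ext_ord fun x => by rw [← und_ord, ← und_ord, w.comap_ord, commutes]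

lemma und_surj [FiniteDimensional L M] (hU : Unr L M) (v : FFPrime L) : ∃ w, und hU w = v := by
  obtain ⟨w, hw⟩ := FFPrime.exists_over (L := M) v
  refine ⟨w, FFPrime.LiesOver.unique (w := w) (φ := algebraMap L M) ⟨1, FFPrime.liesOverWith_iff.mpr ⟨one_pos, fun x hx => ?_⟩⟩ hw⟩
  rw [und_val hU w hx]; simp

lemma finite_fib [IsFF p M] (hU : Unr L M) (v : FFPrime L) : {w | und hU w = v}.Finite := by
  obtain ⟨x, hx, hx1⟩ := v.exists_val_eq 1
  refine (finite_supp p (x := algebraMap L M x) (by simpa using hx)).subset ?_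
  rintro w rfl
  change w.val _ ≠ 0
  rw [und_val hU w hx, hx1]; exact one_ne_zero

def fib [IsFF p M] (hU : Unr L M) (v : FFPrime L) : Finset (FFPrime M) := (finite_fib p hU v).toFinset

lemma mem_fib [IsFF p M] {hU : Unr L M} {v : FFPrime L} {w : FFPrime M} : w ∈ fib p hU v ↔ und hU w = v := by simp [fib]

def conorm [IsFF p M] (hU : Unr L M) : (FFPrime L →₀ ℤ) →+ (FFPrime M →₀ ℤ) where
  toFun D := Finsupp.ofSupportFinite (fun w => D (und hU w)) (by
    classical
    refine (D.support.biUnion (fib p hU)).finite_toSet.subset ?_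
    intro w hw
    simp only [Finset.coe_biUnion, Set.mem_iUnion]
    exact ⟨und hU w, by simpa using hw, by simp [mem_fib]⟩)
  map_zero' := by ext w; simp [Finsupp.ofSupportFinite_coe]
  map_add' D D' := by ext w; simp [Finsupp.ofSupportFinite_coe]

lemma conorm_apply [IsFF p M] (hU : Unr L M) (D : FFPrime L →₀ ℤ) (w : FFPrime M) : conorm p hU D w = D (und hU w) := rfl

lemma conorm_single [IsFF p M] (hU : Unr L M) (v : FFPrime L) (n : ℤ) : conorm p hU (single v n) = ∑ w ∈ fib p hU v, single w n := by
  classical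
  ext w
  rw [conorm_apply, Finsupp.finsetSum_apply]
  simp only [single_apply]
  rw [Finset.sum_ite_eq' (fib p hU v) w]
  simp only [mem_fib, eq_comm]

lemma degZ_fib [FiniteDimensional L M] [IsFF p M] [IsFF p L] (hU : Unr L M) (v : FFPrime L) : ∑ w ∈ fib p hU v, (w.deg p : ℤ) = finrank L M * v.deg p := by
  classical
  obtain ⟨x, hx, hxv, hxw⟩ := exists_only_pole p v
  have := IsFF.charP p (X := L)
  let _ := ZMod.algebra L p
  have := IsFF.charP p (X := M)
  let _ := ZMod.algebra M p
  obtain ⟨φ, hφ⟩ := exists_ratFunc_hom p (transcendental_of_val_ne p v hx hxv.ne)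
  have hsc : IsScalarTower (ZMod p) L M := IsScalarTower.of_algebraMap_eq' (RingHom.ext_zmod _ _)
  let ι : L →ₐ[ZMod p] M := toAlgHom (ZMod p) L M
  have e1 := deg_polar p hx φ hφ
  have e2 := deg_polar p (x := algebraMap L M x) (by simpa using hx) (ι.comp φ) (by simp [hφ, ι])
  dsimp only at e1 e2
  have hpol : polar (algebraMap L M x) = conorm p hU (polar x) := by
    ext w
    rw [polar_apply p (by simpa using hx), conorm_apply, polar_apply p hx, und_val hU w hx]
  have hpolL : polar x = single v (- v.val x) := by
    ext w
    rw [polar_apply p hx]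
    by_cases hw : w = v
    · subst hw; simp; omega
    · rw [Finsupp.single_eq_of_ne hw]; have := hxw w hw; omega
  rw [hpol, hpolL, conorm_single, map_sum] at e2
  rw [hpolL] at e1
  simp only [degZ_single] at e1 e2
  rw [← mul_sum] at e2
  have e3 : @finrank (RatFunc (ZMod p)) M _ _ (ι.comp φ).toRingHom.toAlgebra.toModule
     = @finrank (RatFunc (ZMod p)) L _ _ φ.toRingHom.toAlgebra.toModule * finrank L M := by
    let _ := φ.toRingHom.toAlgebra
    let _ := (ι.comp φ).toRingHom.toAlgebra
    have : IsScalarTower (RatFunc (ZMod p)) L M := of_algebraMap_eq fun x => rfl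
    exact (Module.finrank_mul_finrank _ _ _).symm
  have h5 : (- v.val x) * ∑ w ∈ fib p hU v, (w.deg p : ℤ) = (- v.val x) * (finrank L M * v.deg p) := by
    rw [← e2, e3]; push_cast; rw [e1]; ring
  exact mul_left_cancel₀ (by omega) h5

lemma exists_comap' [FiniteDimensional L M] [IsGalois L M] (w w' : FFPrime M)
    (h : ∀ x : L, 0 < w.ord (algebraMap L M x) → 0 < w'.ord (algebraMap L M x)) : ∃ g : M ≃ₐ[L] M, w' = w.comap g := by
  classical
  by_contra hne
  push Not at hne
  have hdis : ∀ g h : M ≃ₐ[L] M, w.comap g ≠ w'.comap h := by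
    intro g h he
    apply hne (g * h⁻¹)
    rw [← w.comap_comap, he, w'.comap_comap, mul_inv_cancel, w'.comap_one]
  let T : Finset (FFPrime M) := (univ.image fun g : M ≃ₐ[L] M => w.comap g) ∪
    (univ.image fun g : M ≃ₐ[L] M => w'.comap g)
  obtain ⟨y, hy⟩ := FFPrime.approx T (fun u => if u ∈ (univ.image fun g : M ≃ₐ[L] M => w.comap g) then 0 else 1) 1
  have h1 : ∀ g : M ≃ₐ[L] M, 0 < w.ord (g y) := by
    intro g
    have hm : w.comap g ∈ (univ.image fun g : M ≃ₐ[L] M => w.comap g) := mem_image_of_mem _ (mem_univ g)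
    have := hy _ (Finset.mem_union_left _ hm)
    rw [if_pos hm, sub_zero, w.comap_ord] at this
    exact lt_of_lt_of_le (by exact_mod_cast one_pos) this
  have h2 : ∀ g : M ≃ₐ[L] M, w'.ord (g y) = 0 := by
    intro g
    have hm : w'.comap g ∈ (univ.image fun g : M ≃ₐ[L] M => w'.comap g) := mem_image_of_mem _ (mem_univ g)
    have := hy _ (Finset.mem_union_right _ hm)
    rw [if_neg, w'.comap_ord, map_sub, map_one] at this
    · exact FFPrime.one_ord (lt_of_lt_of_le (by exact_mod_cast one_pos) this)
    · intro hc
      obtain ⟨g', -, hg'⟩ := mem_image.mp hc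
      exact hdis g' g hg'
  have h3 := Algebra.norm_eq_prod_automorphisms L y
  have h4 : w'.ord (∏ g : M ≃ₐ[L] M, g y) = 0 := by
    refine Finset.prod_induction _ (fun z => w'.ord z = 0) (fun a b ha hb => by rw [w'.ord_mul, ha, hb, add_zero]) w'.ord_one fun g _ => h2 g
  have h5 : 0 < w.ord (∏ g : M ≃ₐ[L] M, g y) := by
    rw [← Finset.mul_prod_erase _ _ (mem_univ 1), mul_comm]
    refine FFPrime.ord_mul_pos ?_ (h1 1)
    exact Finset.prod_induction _ (fun z => 0 ≤ w.ord z) (fun a b ha hb => w.ord_mul_nonneg ha hb) w.ord_one.ge fun g _ => (h1 g).le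
  rw [← h3] at h4 h5
  exact absurd h4 (h _ h5).ne'

lemma exists_comap [FiniteDimensional L M] [IsGalois L M] (hU : Unr L M) (w w' : FFPrime M) (h : und hU w = und hU w') : ∃ g : M ≃ₐ[L] M, w' = w.comap g :=
  exists_comap' w w' fun x hx => by rwa [und_ord hU, ← h, ← und_ord hU]

lemma exists_fg [FiniteDimensional L M] [IsGalois L M] [IsFF p M] [IsFF p L] (hU : Unr L M) (v : FFPrime L) : ∃ f : ℕ, 0 < f ∧ f * (fib p hU v).card = finrank L M ∧
      (∀ w w' : FFPrime M, und hU w = v → und hU w' = v → card {g : M ≃ₐ[L] M // w'.comap g = w} = f) ∧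
      ∀ w, und hU w = v → w.deg p = f * v.deg p := by
  classical
  obtain ⟨w0, hw0⟩ := und_surj hU v
  let f := card {g : M ≃ₐ[L] M // w0.comap g = w0}
  have hf : 0 < f := by
    have : Nonempty {g : M ≃ₐ[L] M // w0.comap g = w0} := ⟨1, w0.comap_one⟩
    exact Nat.card_pos
  have h1 : ∀ w w' : FFPrime M, und hU w = v → und hU w' = v → card {g : M ≃ₐ[L] M // w'.comap g = w} = f := by
    intro w w' hw hw'
    obtain ⟨a, rfl⟩ := exists_comap hU w0 w (hw0.trans hw.symm)
    obtain ⟨b, rfl⟩ := exists_comap hU w0 w' (hw0.trans hw'.symm)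
    refine Nat.card_congr ((Equiv.mulRight a⁻¹).trans (Equiv.mulLeft b) |>.subtypeEquiv fun g => ?_)
    simp only [Equiv.trans_apply, Equiv.coe_mulRight, Equiv.coe_mulLeft, FFPrime.comap_comap]
    constructor
    · intro h
      rw [← mul_assoc, ← w0.comap_comap, h, w0.comap_comap, mul_inv_cancel, w0.comap_one]
    · intro h
      conv_rhs => rw [← h, FFPrime.comap_comap]
      congr 1; group
  have h2 : f * (fib p hU v).card = finrank L M := by
    rw [← IsGalois.card_aut_eq_finrank, Nat.card_eq_fintype_card, ← card_univ,
      Finset.card_eq_sum_card_fiberwise (f := fun g : M ≃ₐ[L] M => w0.comap g) (t := fib p hU v)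
      (fun g _ => by rw [Finset.mem_coe, mem_fib, und_comap, hw0])]
    rw [sum_congr rfl (g := fun _ => f) (fun w hw => ?_)]
    · simp [mul_comm]
    · rw [← h1 w w0 (mem_fib p |>.mp hw) hw0, Nat.card_eq_fintype_card, Fintype.card_subtype]
  refine ⟨f, hf, h2, h1, fun w hw => ?_⟩
  have h3 := degZ_fib p hU v
  have h4 : ∀ w' ∈ fib p hU v, (w'.deg p : ℤ) = w.deg p := by
    intro w' hw'
    obtain ⟨a, rfl⟩ := exists_comap hU w w' (hw.trans (mem_fib p |>.mp hw').symm)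
    rw [FFPrime.deg_comap]
  rw [sum_congr rfl h4, ← h2] at h3
  have hg : 0 < (fib p hU v).card := Finset.card_pos.mpr ⟨w0, mem_fib p |>.mpr hw0⟩
  simp only [sum_const, nsmul_eq_mul] at h3
  have h5 : (fib p hU v).card * w.deg p = (fib p hU v).card * (f * v.deg p) := by
    have : ((fib p hU v).card : ℤ) * w.deg p = (fib p hU v).card * (f * v.deg p) := by rw [h3]; push_cast; ring
    exact_mod_cast this
  exact Nat.eq_of_mul_eq_mul_left hg h5

lemma lam_cmp [FiniteDimensional L M] [IsGalois L M] [IsFF p M] [IsFF p L] (hU : Unr L M) (T : Finset (FFPrime L)) (T' : Finset (FFPrime M)) (hT : ∀ w, w ∈ T' ↔ und hU w ∈ T)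
    (H : AddSubgroup (FFPrime L →₀ ℤ)) (hH : ∀ (v : FFPrime L) (f : ℕ), f * (fib p hU v).card = finrank L M → single v (f : ℤ) ∈ H) (n : ℕ) :
    lamH p T' ⊤ n ≤ finrank L M * lamH p T H n := by
  classical
  rw [lamH, lamH]
  choose f hf0 hf1 hf2 hf3 using exists_fg p hU
  have hmaps : ∀ w ∈ places p (X := M) n, und hU w ∈ places p (X := L) n := by
    intro w hw
    rw [mem_places] at hw ⊢
    have := hf3 (und hU w) w rfl
    have := hf0 (und hU w)
    nlinarith
  rw [← Finset.sum_fiberwise_of_maps_to hmaps, mul_sum]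
  refine sum_le_sum fun v hv => ?_
  have hw1 : ∀ w ∈ (places p (X := M) n).filter (fun w => und hU w = v),
      (∑ m ∈ Icc 1 n, if w ∉ T' ∧ m * w.deg p = n ∧ single w (m : ℤ) ∈ (⊤ : AddSubgroup (FFPrime M →₀ ℤ)) then w.deg p else 0)
      ≤ f v * ∑ m ∈ Icc 1 n, if v ∉ T ∧ m * v.deg p = n ∧ single v (m : ℤ) ∈ H then v.deg p else 0 := by
    intro w hw
    obtain ⟨hw2, rfl⟩ := mem_filter.mp hw
    set v := und hU w
    rw [mul_sum, ← sum_filter]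
    have hd := hf3 v w rfl
    have hdp := v.deg_pos p
    have hinj : ∀ m ∈ Finset.filter (fun m => w ∉ T' ∧ m * w.deg p = n ∧ single w (m : ℤ) ∈ (⊤ : AddSubgroup (FFPrime M →₀ ℤ))) (Icc 1 n),
        m * f v ∈ Icc 1 n ∧ (v ∉ T ∧ (m * f v) * v.deg p = n ∧ single v ((m * f v : ℕ) : ℤ) ∈ H) := by
      intro m hm
      obtain ⟨hm1, hm2, hm3, -⟩ := mem_filter.mp hm
      rw [mem_Icc] at hm1
      rw [hd, ← mul_assoc] at hm3
      have h0 : 0 < m * f v := Nat.mul_pos (by omega) (hf0 v)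
      refine ⟨mem_Icc.mpr ⟨h0, by nlinarith⟩, fun h => hm2 ((hT w).mpr h), hm3, ?_⟩
      have h5 := H.nsmul_mem (hH v (f v) (hf1 v)) m
      rwa [Finsupp.smul_single, nsmul_eq_mul, ← Nat.cast_mul] at h5
    calc _ = ∑ m ∈ Finset.filter (fun m => w ∉ T' ∧ m * w.deg p = n ∧ single w (m : ℤ) ∈ (⊤ : AddSubgroup (FFPrime M →₀ ℤ))) (Icc 1 n),
          f v * (if v ∉ T ∧ (m * f v) * v.deg p = n ∧ single v ((m * f v : ℕ) : ℤ) ∈ H then v.deg p else 0) :=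
        sum_congr rfl fun m hm => by rw [if_pos (hinj m hm).2, hd]
      _ = ∑ m ∈ (Finset.filter (fun m => w ∉ T' ∧ m * w.deg p = n ∧ single w (m : ℤ) ∈ (⊤ : AddSubgroup (FFPrime M →₀ ℤ))) (Icc 1 n)).image (fun m => m * f v),
          f v * (if v ∉ T ∧ m * v.deg p = n ∧ single v (m : ℤ) ∈ H then v.deg p else 0) := by
        rw [sum_image]
        intro a _ b _ hab
        exact Nat.eq_of_mul_eq_mul_right (hf0 v) hab
      _ ≤ _ := by
        apply Finset.sum_le_sum_of_subset
        intro m hm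
        obtain ⟨m', hm', rfl⟩ := mem_image.mp hm
        exact (hinj m' hm').1
  refine (sum_le_sum hw1).trans ?_
  rw [sum_const, smul_eq_mul, ← hf1 v, ← mul_assoc, mul_comm (f v)]
  gcongr
  intro w hw
  exact (mem_fib p).mpr (mem_filter.mp hw).2
end

section
lemma sum_pow_gen {G : Type*} [Group G] [Fintype G] {A : Type*} [AddCommMonoid A] {g : G} (hg : ∀ x, x ∈ zpowers g) (F : G → A) : ∑ j ∈ range (card G), F (g ^ j) = ∑ x, F x := by
  classical
  rw [← IsCyclic.image_range_card hg, sum_image]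
  intro a ha b hb h
  rw [← orderOf_eq_card_of_forall_mem_zpowers hg] at ha hb
  exact pow_injOn_Iio_orderOf (by simpa using ha) (by simpa using hb) h

lemma prod_pow_gen {G : Type*} [Group G] [Fintype G] {A : Type*} [CommMonoid A] {g : G} (hg : ∀ x, x ∈ zpowers g) (F : G → A) : ∏ j ∈ range (card G), F (g ^ j) = ∏ x, F x := by
  classical
  rw [← IsCyclic.image_range_card hg, Finset.prod_image]
  intro a ha b hb h
  rw [← orderOf_eq_card_of_forall_mem_zpowers hg] at ha hb
  exact pow_injOn_Iio_orderOf (by simpa using ha) (by simpa using hb) h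

variable (p : ℕ) [Fact p.Prime] {L M : Type} [Field L] [Field M] [Algebra L M]

lemma FFPrime.val_prod (v : FFPrime M) {ι : Type*} (s : Finset ι) (f : ι → M) (hf : ∀ i ∈ s, f i ≠ 0) : v.val (∏ i ∈ s, f i) = ∑ i ∈ s, v.val (f i) := by
  classical
  induction s using induction_on with
  | empty => simp [v.val_one]
  | insert a s ha ih =>
    rw [Finset.prod_insert ha, sum_insert ha, v.val_mul (hf a (Finset.mem_insert_self _ _))
      (Finset.prod_ne_zero_iff.mpr fun i hi => hf i (mem_insert_of_mem hi)),
      ih fun i hi => hf i (mem_insert_of_mem hi)]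

def plEquiv (σ : M ≃ₐ[L] M) : FFPrime M ≃ FFPrime M where
  toFun w := w.comap σ⁻¹
  invFun w := w.comap σ
  left_inv w := by
    change (w.comap σ⁻¹).comap σ = w
    rw [w.comap_comap, inv_mul_cancel, w.comap_one]
  right_inv w := by
    change (w.comap σ).comap σ⁻¹ = w
    rw [w.comap_comap, mul_inv_cancel, w.comap_one]

def sg (σ : M ≃ₐ[L] M) : (FFPrime M →₀ ℤ) →+ (FFPrime M →₀ ℤ) := (Finsupp.domCongr (plEquiv σ)).toAddMonoidHom

lemma sg_apply (σ : M ≃ₐ[L] M) (D : FFPrime M →₀ ℤ) (w : FFPrime M) : sg σ D w = D (w.comap σ) := rfl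

lemma sg_iterate (σ : M ≃ₐ[L] M) (j : ℕ) : ∀ (D : FFPrime M →₀ ℤ) (w : FFPrime M), (sg σ)^[j] D w = D (w.comap (σ ^ j)) := by
  induction j with
  | zero => intro D w; rw [pow_zero, w.comap_one]; rfl
  | succ j ih => intro D w; rw [Function.iterate_succ_apply, ih, sg_apply, w.comap_comap, pow_succ]

lemma nm_sg (σ : M ≃ₐ[L] M) (N : ℕ) (D : FFPrime M →₀ ℤ) (w : FFPrime M) : nm (sg σ) N D w = ∑ j ∈ range N, D (w.comap (σ ^ j)) := by
  rw [nm_apply, Finsupp.finsetSum_apply]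
  exact sum_congr rfl fun j _ => sg_iterate σ j D w

variable [FiniteDimensional L M] [IsGalois L M]

lemma sum_comap_tele (σ : M ≃ₐ[L] M) (hσ : ∀ x, x ∈ zpowers σ) (D : FFPrime M → ℤ) (w : FFPrime M) :
    ∑ j ∈ range (finrank L M), (D ((w.comap (σ ^ j)).comap σ) - D (w.comap (σ ^ j))) = 0 := by
  simp only [FFPrime.comap_comap, ← pow_succ]
  rw [Finset.sum_range_sub (fun j => D (w.comap (σ ^ j))), ← IsGalois.card_aut_eq_finrank,
    ← orderOf_eq_card_of_forall_mem_zpowers hσ, pow_orderOf_eq_one, pow_zero, sub_self]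

lemma sg_ray (σ : M ≃ₐ[L] M) (T' : Finset (FFPrime M)) (hT' : ∀ w (g : M ≃ₐ[L] M), w.comap g ∈ T' ↔ w ∈ T') : ray T' ≤ (ray T').comap (sg σ) := by
  rintro D ⟨f, hf, h1, h2⟩
  refine ⟨σ f, by simpa using hf, fun w hw => ?_, fun w hw => ?_⟩
  · have := h1 _ ((hT' w σ).mpr hw)
    rwa [w.comap_ord, map_sub, map_one] at this
  · rw [sg_apply, h2 _ (fun h => hw ((hT' w σ).mp h)), w.comap_val σ hf]

lemma norm_eq_of_one [IsFF p M] (σ : M ≃ₐ[L] M) (T' : Finset (FFPrime M)) (hT0 : T'.Nonempty) (hT' : ∀ w (g : M ≃ₐ[L] M), w.comap g ∈ T' ↔ w ∈ T') {f c : M} (hf : f ≠ 0) (hc : c ≠ 0)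
    (h1 : ∀ w ∈ T', 0 < w.ord (f - 1)) (hc1 : ∀ w ∈ T', 0 < w.ord (c - 1)) (N : ℕ) (h2 : ∀ w ∉ T', ∑ j ∈ range N, (w.comap (σ ^ j)).val f = w.val c) : ∏ j ∈ range N, (σ ^ j) f = c := by
  have h0 : ∀ j ∈ range N, (σ ^ j) f ≠ 0 := fun j _ => (map_ne_zero_iff _ (σ ^ j).injective).mpr hf
  have h3 : ∀ w ∈ T', 0 < w.ord (∏ j ∈ range N, (σ ^ j) f - 1) := by
    intro w hw
    refine Finset.prod_induction _ (fun z => 0 < w.ord (z - 1)) (fun a b => FFPrime.one_mul') ?_ fun j _ => ?_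
    · rw [sub_self, w.ord_zero]; exact coe_lt_top 0
    · have := h1 _ ((hT' w (σ ^ j)).mpr hw)
      rwa [w.comap_ord, map_sub, map_one] at this
  refine one_unique p hT0 (Finset.prod_ne_zero_iff.mpr h0) hc h3 hc1 fun w => ?_
  by_cases hw : w ∈ T'
  · rw [FFPrime.one_val (h3 w hw), FFPrime.one_val (hc1 w hw)]
  · rw [w.val_prod _ _ h0, ← h2 w hw]
    exact sum_congr rfl fun j _ => (w.comap_val _ hf).symm

lemma norm_pow_gen (σ : M ≃ₐ[L] M) (hσ : ∀ x, x ∈ zpowers σ) (f : M) : ∏ j ∈ range (finrank L M), (σ ^ j) f = algebraMap L M (Algebra.norm L f) := by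
  rw [Algebra.norm_eq_prod_automorphisms, ← IsGalois.card_aut_eq_finrank]
  exact prod_pow_gen hσ (fun g => g f)

lemma FFPrime.natCast_ord_zero [IsFF p M] (w : FFPrime M) {n : ℕ} (hn : (n : M) ≠ 0) : w.ord (n : M) = 0 := by
  have := IsFF.charP p (X := M)
  let _ := ZMod.algebra M p
  have h := w.eq_zero_zmod p (c := (n : ZMod p)) (fun h => hn (by
    have := congrArg (algebraMap (ZMod p) M) h
    simpa using this))
  simpa using h

lemma h1_ray [IsFF p M] [IsFF p L] (hU : Unr L M) (σ : M ≃ₐ[L] M) (hσ : ∀ x, x ∈ zpowers σ) (hN : (finrank L M : M) ≠ 0) (v0 : FFPrime L) (D : FFPrime M →₀ ℤ)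
    (hD : sg σ D - D ∈ ray (fib p hU v0)) : ∃ D0 : FFPrime L →₀ ℤ, D - conorm p hU D0 ∈ ray (fib p hU v0) := by
  classical
  obtain ⟨f, hf, h1, h2⟩ := hD
  set T' := fib p hU v0
  have hT' : ∀ w (g : M ≃ₐ[L] M), w.comap g ∈ T' ↔ w ∈ T' := fun w g => by rw [mem_fib, mem_fib, und_comap]
  obtain ⟨w0, hw0⟩ := und_surj hU v0
  have hw0T : w0 ∈ T' := (mem_fib p).mpr hw0
  have hT0 : T'.Nonempty := ⟨w0, hw0T⟩
  have hone : ∀ w : FFPrime M, 0 < w.ord ((1 : M) - 1) := fun w => by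
    rw [sub_self, w.ord_zero]; exact coe_lt_top 0
  have hnf := norm_eq_of_one p σ T' hT0 hT' hf one_ne_zero h1 (fun w _ => hone w) (finrank L M) (by
    intro w hw
    rw [w.val_one, ← sum_comap_tele σ hσ D w]
    refine sum_congr rfl fun j _ => ?_
    rw [← h2 _ (fun h => hw ((hT' _ _).mp h))]; rfl)
  rw [norm_pow_gen σ hσ] at hnf
  have hnf1 : Algebra.norm L f = 1 := (algebraMap L M).injective (by rw [hnf, map_one])
  have hcyc : IsCyclic (M ≃ₐ[L] M) := ⟨σ, hσ⟩
  obtain ⟨y, hy⟩ := groupCohomology.exists_div_of_norm_eq_one hσ hnf1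
  have hy0 : (y : M) ≠ 0 := y.ne_zero
  have hσy0 : σ (y : M) ≠ 0 := by simpa using hy0
  obtain ⟨π, hπ, hπ1⟩ := v0.exists_val_eq (w0.val ((y : M)⁻¹))
  have hπM : algebraMap L M π ≠ 0 := by simpa using hπ
  let g : M := (y : M)⁻¹ / algebraMap L M π
  have hg0 : g ≠ 0 := div_ne_zero (inv_ne_zero hy0) hπM
  have hσg : σ g = f * g := by
    simp only [g, map_div₀, map_inv₀, commutes, ← hy]
    field_simp
  have hσgj : ∀ j : ℕ, ∀ w ∈ T', w.val ((σ ^ j) g) = w.val g := by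
    intro j
    induction j with
    | zero => intro w _; rw [pow_zero]; rfl
    | succ j ih =>
      intro w hw
      rw [pow_succ']
      change w.val (σ ((σ ^ j) g)) = _
      rw [← w.comap_val σ ((map_ne_zero_iff _ (σ ^ j).injective).mpr hg0), ih _ ((hT' w σ).mpr hw), w.comap_val σ hg0, hσg, w.val_mul hf hg0,
        FFPrime.one_val (h1 w hw), zero_add]
  have hg00 : w0.val g = 0 := by rw [w0.val_div (inv_ne_zero hy0) hπM, und_val hU w0 hπ, hw0, hπ1, sub_self]
  have hcycl : ∀ w w' : FFPrime M, und hU w = und hU w' → ∃ j : ℕ, w' = w.comap (σ ^ j) := by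
    intro w w' h
    obtain ⟨τ, hτ⟩ := exists_comap hU w w' h
    obtain ⟨j, hj⟩ := (mem_powers_iff_mem_zpowers (x := σ) (y := τ)).mpr (hσ τ)
    exact ⟨j, by rw [hτ, ← hj]⟩
  have hgT : ∀ w ∈ T', w.val g = 0 := by
    intro w hw
    obtain ⟨j, rfl⟩ := hcycl w0 w (hw0.trans ((mem_fib p).mp hw).symm)
    rw [w0.comap_val _ hg0, hσgj j w0 hw0T, hg00]
  have hgT' : ∀ w ∈ T', w.ord g = 0 := fun w hw => by rw [w.ord_eq hg0, hgT w hw]; rfl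
  have hcong : ∀ j : ℕ, ∀ w ∈ T', 0 < w.ord ((σ ^ j) g - g) := by
    intro j
    induction j with
    | zero => intro w _; rw [pow_zero]; change 0 < w.ord (g - g); rw [sub_self, w.ord_zero]; exact coe_lt_top 0
    | succ j ih =>
      intro w hw
      have e1 := ih _ ((hT' w σ).mpr hw)
      rw [w.comap_ord, map_sub] at e1
      have e2 : (σ ^ (j + 1)) g - g = (σ ((σ ^ j) g) - σ g) + g * (f - 1) := by
        rw [pow_succ']; change σ ((σ ^ j) g) - g = _; rw [hσg]; ring
      rw [e2]
      exact w.lt_ord_add e1 (FFPrime.ord_mul_pos (hgT' w hw).ge (h1 w hw))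
  let l : L := trace L M g / (finrank L M : L)
  have hl : algebraMap L M l - g = (finrank L M : M)⁻¹ * ∑ j ∈ range (finrank L M), ((σ ^ j) g - g) := by
    rw [sum_sub_distrib]
    have h5 : ∑ j ∈ range (finrank L M), (σ ^ j) g = algebraMap L M (trace L M g) := by
      rw [trace_eq_sum_automorphisms, ← IsGalois.card_aut_eq_finrank]
      exact sum_pow_gen hσ (fun τ => τ g)
    rw [h5]
    simp only [l, map_div₀, map_natCast, sum_const, Finset.card_range, nsmul_eq_mul]
    field_simp
  have hl1 : ∀ w ∈ T', 0 < w.ord (algebraMap L M l - g) := by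
    intro w hw
    rw [hl]
    refine FFPrime.ord_mul_pos ?_ ?_
    · have h6 := w.natCast_ord_zero p hN
      rw [w.ord_eq hN] at h6
      rw [w.ord_nonneg_iff (inv_ne_zero hN), w.val_inv hN]
      have : w.val (finrank L M : M) = 0 := by exact_mod_cast h6
      omega
    · exact w.lt_ord_sum _ _ (coe_lt_top 0) fun j _ => hcong j w hw
  have hlT : ∀ w ∈ T', w.ord (algebraMap L M l) = 0 := by
    intro w hw
    have : algebraMap L M l = g + (algebraMap L M l - g) := by ring
    rw [this, w.ord_add_eq_left (by rw [hgT' w hw]; exact hl1 w hw), hgT' w hw]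
  have hl0 : algebraMap L M l ≠ 0 := w0.ne_zero_of_ord (n := 0) (hlT w0 hw0T)
  have hl00 : l ≠ 0 := by rintro h; exact hl0 (by rw [h, map_zero])
  let k : M := g / algebraMap L M l
  have hk0 : k ≠ 0 := div_ne_zero hg0 hl0
  have hk1 : ∀ w ∈ T', 0 < w.ord (k - 1) := by
    intro w hw
    have e : k - 1 = (algebraMap L M l)⁻¹ * (- (algebraMap L M l - g)) := by
      simp only [k]; field_simp; ring
    rw [e]
    refine FFPrime.ord_mul_pos ?_ (by rw [w.ord_neg]; exact hl1 w hw)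
    have h6 := hlT w hw
    rw [w.ord_eq hl0] at h6
    rw [w.ord_nonneg_iff (inv_ne_zero hl0), w.val_inv hl0]
    have : w.val (algebraMap L M l) = 0 := by exact_mod_cast h6
    omega
  have hσk : σ k = f * k := by
    simp only [k, map_div₀, commutes, hσg]; ring
  let D' := D - dv k
  have hD'1 : ∀ w ∉ T', D' (w.comap σ) = D' w := by
    intro w hw
    have e1 := h2 w hw
    rw [Finsupp.sub_apply, sg_apply] at e1
    have e2 : (w.comap σ).val k = w.val f + w.val k := by rw [w.comap_val σ hk0, hσk, w.val_mul hf hk0]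
    change D (w.comap σ) - dv k (w.comap σ) = D w - dv k w
    rw [dv_apply p hk0, dv_apply p hk0, e2]; linarith
  have hD'2 : ∀ j : ℕ, ∀ w ∉ T', D' (w.comap (σ ^ j)) = D' w := by
    intro j
    induction j with
    | zero => intro w _; rw [pow_zero, w.comap_one]
    | succ j ih =>
      intro w hw
      rw [pow_succ', ← w.comap_comap, ih _ (fun h => hw ((hT' w σ).mp h)), hD'1 w hw]
  choose s hs using und_surj hU
  let D0 : FFPrime L →₀ ℤ := Finsupp.ofSupportFinite (fun v => D' (s v)) (by
    refine ((D'.support.image (und hU)).finite_toSet).subset fun v hv => ?_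
    rw [Finset.mem_coe, mem_image]
    exact ⟨s v, mem_support_iff.mpr hv, hs v⟩)
  refine ⟨D0, k, hk0, hk1, fun w hw => ?_⟩
  rw [Finsupp.sub_apply, conorm_apply]
  have e3 : D0 (und hU w) = D' (s (und hU w)) := rfl
  obtain ⟨j, hj⟩ := hcycl w (s (und hU w)) (hs _).symm
  rw [e3, hj, hD'2 j w hw]
  change D w - (D w - dv k w) = _
  rw [dv_apply p hk0]; ring
end

section
variable (p : ℕ) [Fact p.Prime] {L M : Type} [Field L] [Field M] [Algebra L M]

lemma dT_sg [IsFF p M] (σ : M ≃ₐ[L] M) (T' : Finset (FFPrime M)) (hT' : ∀ w (g : M ≃ₐ[L] M), w.comap g ∈ T' ↔ w ∈ T') (D : FFPrime M →₀ ℤ) : dT p T' (sg σ D) = dT p T' D := by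
  classical
  have hs : ∀ (w : FFPrime M) (n : ℤ), sg σ (single w n) = single (w.comap σ⁻¹) n := by
    intro w n
    exact Finsupp.equivMapDomain_single _ _ _
  induction D using Finsupp.induction_linear with
  | zero => rw [map_zero]
  | add a b ha hb => rw [map_add, map_add, map_add, ha, hb]
  | single w n =>
    rw [hs]
    by_cases hw : w ∈ T'
    · have h0 : ∀ u ∈ T', dT p T' (single u n) = 0 := by
        intro u hu
        rw [dT_apply]
        have : off T' (single u n) = 0 := by
          ext z
          by_cases hz : z ∈ T'
          · rw [off_apply' T' _ z hz]; rfl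
          · rw [off_apply T' _ z hz, single_apply, if_neg (by rintro rfl; exact hz hu)]; rfl
        rw [this, map_zero]
      rw [h0 _ hw, h0 _ ((hT' w _).mpr hw)]
    · rw [dT_single p hw, dT_single p (fun h => hw ((hT' w _).mp h)), w.deg_comap p]

lemma nm_single [FiniteDimensional L M] [IsGalois L M] [IsFF p M] [IsFF p L] (hU : Unr L M) (σ : M ≃ₐ[L] M) (hσ : ∀ x, x ∈ zpowers σ) (v : FFPrime L) (f : ℕ)
    (hf : f * (fib p hU v).card = finrank L M) : ∃ E, conorm p hU (single v (f : ℤ)) = nm (sg σ) (finrank L M) E := by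
  classical
  obtain ⟨f', hf'0, hf', hcard, -⟩ := exists_fg p hU v
  obtain ⟨w, hw⟩ := und_surj hU v
  have hpos : 0 < (fib p hU v).card := Finset.card_pos.mpr ⟨w, (mem_fib p).mpr hw⟩
  have hff : f = f' := Nat.eq_of_mul_eq_mul_right hpos (hf.trans hf'.symm)
  subst hff
  refine ⟨single w 1, ?_⟩
  ext w'
  rw [nm_sg, conorm_apply, ← IsGalois.card_aut_eq_finrank, sum_pow_gen hσ (fun g => single w (1 : ℤ) (w'.comap g))]
  simp only [single_apply]
  by_cases h : und hU w' = v
  · rw [if_pos h.symm]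
    have := hcard w w' hw h
    rw [Finset.sum_boole, ← this, Nat.card_eq_fintype_card, Fintype.card_subtype]
    congr 2
    ext g; simp [eq_comm]
  · rw [if_neg (fun h' => h h'.symm)]
    symm
    refine sum_eq_zero fun g _ => if_neg fun h' => h ?_
    rw [← und_comap hU w' g, ← h', hw]

lemma thmU_aux [FiniteDimensional L M] [IsGalois L M] [IsFF p M] [IsFF p L] (hU : Unr L M) (σ : M ≃ₐ[L] M) (hσ : ∀ x, x ∈ zpowers σ) (hN : (finrank L M : M) ≠ 0)
    {c : L} (hc : c ≠ 0) (v0 : FFPrime L) (hv0 : 0 < v0.ord (c - 1)) (E : FFPrime M →₀ ℤ)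
    (hE : ∀ w : FFPrime M, ∑ j ∈ range (finrank L M), E (w.comap (σ ^ j)) = w.val (algebraMap L M c)) : ∃ y : M, y ≠ 0 ∧ ∏ j ∈ range (finrank L M), (σ ^ j) y = algebraMap L M c := by
  classical
  set T' := fib p hU v0 with hT'def
  have hT' : ∀ w (g : M ≃ₐ[L] M), w.comap g ∈ T' ↔ w ∈ T' := fun w g => by rw [mem_fib, mem_fib, und_comap]
  obtain ⟨w0, hw0⟩ := und_surj hU v0
  have hw0T : w0 ∈ T' := (mem_fib p).mpr hw0
  have hT0 : T'.Nonempty := ⟨w0, hw0T⟩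
  have hcM : algebraMap L M c ≠ 0 := by simpa using hc
  let N := finrank L M
  have hNpos : 0 < N := Module.finrank_pos
  let σC : Ray T' →+ Ray T' := QuotientAddGroup.map _ _ (sg σ) (sg_ray σ T' hT')
  have hσC : ∀ D, σC (QuotientAddGroup.mk D) = QuotientAddGroup.mk (sg σ D) := fun D => rfl
  have hσCj : ∀ (j : ℕ) D, σC^[j] (QuotientAddGroup.mk D) = QuotientAddGroup.mk ((sg σ)^[j] D) := by
    intro j
    induction j with
    | zero => intro D; rfl
    | succ j ih => intro D; rw [Function.iterate_succ_apply, hσC, ih]; rfl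
  have hnm : ∀ D, nm σC N (QuotientAddGroup.mk D) = QuotientAddGroup.mk (nm (sg σ) N D) := by
    intro D
    rw [nm_apply, nm_apply]
    rw [sum_congr rfl fun j _ => hσCj j D]
    exact (map_sum (QuotientAddGroup.mk' (ray T')) _ _).symm
  have hord : σ ^ N = 1 := by
    change σ ^ finrank L M = 1
    rw [← IsGalois.card_aut_eq_finrank, ← orderOf_eq_card_of_forall_mem_zpowers hσ, pow_orderOf_eq_one]
  have hσN : ∀ x, σC^[N] x = x := by
    intro x
    obtain ⟨D, rfl⟩ := mk_surjective x
    rw [hσCj]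
    congr 1
    ext w
    rw [sg_iterate, hord, w.comap_one]
  let deg : Ray T' →+ ℤ := QuotientAddGroup.lift (ray T') (dT p T') fun D hD => dT_ray p hD
  have hdegmk : ∀ D, deg (QuotientAddGroup.mk D) = dT p T' D := fun D => rfl
  have hdeg : ∀ x, deg (σC x) = deg x := by
    intro x
    obtain ⟨D, rfl⟩ := mk_surjective x
    rw [hσC, hdegmk, hdegmk, dT_sg p σ T' hT']
  obtain ⟨u, hu⟩ := exists_notMem p T'
  have hudeg := u.deg_pos p
  have hdeg0 : deg ≠ 0 := by
    intro h
    have h1 : deg (QuotientAddGroup.mk (single u 1)) = 0 := by rw [h]; rfl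
    rw [hdegmk, dT_single p hu] at h1
    omega
  have hfin : Finite deg.ker := by
    obtain ⟨κ, n1, hn1⟩ := aa_chr p T' hT0
    have h2 := (hn1 (n1 * u.deg p) (Nat.le_mul_of_pos_right _ hudeg)).1
    refine Finite.of_injective (β := {x // x ∈ clsN p T' (n1 * u.deg p)})
      (fun x => ⟨x.1 + QuotientAddGroup.mk (single u (n1 : ℤ)), ?_⟩) ?_
    · obtain ⟨x, hx⟩ := x
      obtain ⟨D, rfl⟩ := mk_surjective x
      have hx' : dT p T' D = 0 := hx
      change QuotientAddGroup.mk (D + single u (n1 : ℤ)) ∈ _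
      rw [h2, map_add, hx', dT_single p hu]
      push_cast; ring
    · intro x y h
      simp only [Subtype.mk.injEq, add_left_inj] at h
      exact Subtype.ext h
  obtain ⟨hidx, hmain⟩ := lemmaH σC N hNpos hσN deg hdeg hdeg0 hfin
  let ψ : (FFPrime L →₀ ℤ) →+ Ray T' := (QuotientAddGroup.mk' (ray T')).comp (conorm p hU)
  have hψmk : ∀ D, ψ D = QuotientAddGroup.mk (conorm p hU D) := fun D => rfl
  have hψ : (σC - AddMonoidHom.id _).ker ≤ ψ.range := by
    intro x hx
    obtain ⟨D, rfl⟩ := mk_surjective x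
    have hx1 : σC (QuotientAddGroup.mk D) - QuotientAddGroup.mk D = 0 := hx
    have hx2 : sg σ D - D ∈ ray T' := (eq_zero_iff _).mp hx1
    obtain ⟨D0, hD0⟩ := h1_ray p hU σ hσ hN v0 D hx2
    refine ⟨D0, ?_⟩
    rw [hψmk, QuotientAddGroup.eq]
    rwa [neg_add_eq_sub]
  let H := (nm σC N).range.comap ψ
  have hHidx : H.index = (nm σC N).range.relIndex ψ.range := AddSubgroup.index_comap _ _
  have hHfin : H.index ≠ 0 := by
    rw [hHidx]
    intro h
    exact hidx (AddSubgroup.index_eq_zero_of_relIndex_eq_zero h)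
  have hle : H.index ≤ N := by
    refine idx_le p {v0} ⟨v0, Finset.mem_singleton_self _⟩ T' hT0 H ?_ hHfin N ?_
    · rintro D ⟨f, hf, h1, h2⟩
      change ψ D ∈ (nm σC N).range
      have : ψ D = 0 := by
        rw [hψmk, eq_zero_iff]
        refine ⟨algebraMap L M f, by simpa using hf, fun w hw => ?_, fun w hw => ?_⟩
        · have e : algebraMap L M f - 1 = algebraMap L M (f - 1) := by rw [map_sub, map_one]
          rw [e, und_ord hU]
          exact h1 _ (mem_singleton.mpr ((mem_fib p).mp hw))
        · rw [conorm_apply, und_val hU w hf]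
          exact h2 _ fun h => hw ((mem_fib p).mpr (mem_singleton.mp h))
      rw [this]; exact AddSubgroup.zero_mem _
    · intro n
      refine lam_cmp p hU {v0} T' (fun w => ?_) H ?_ n
      · rw [mem_singleton, mem_fib]
      · intro v f hf
        obtain ⟨E', hE'⟩ := nm_single p hU σ hσ v f hf
        exact ⟨QuotientAddGroup.mk E', by rw [hnm, hψmk, hE']⟩
  have hrel : (nm σC N).range.relIndex (σC - AddMonoidHom.id _).ker ≤ N := by
    refine le_trans (AddSubgroup.relIndex_le_of_le_right hψ ?_) (hHidx ▸ hle)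
    rw [← hHidx]; exact hHfin
  obtain ⟨Y, hY⟩ := hmain hrel (QuotientAddGroup.mk E) (by
    rw [hnm, eq_zero_iff]
    refine ⟨algebraMap L M c, hcM, fun w hw => ?_, fun w hw => ?_⟩
    · have e : algebraMap L M c - 1 = algebraMap L M (c - 1) := by rw [map_sub, map_one]
      rw [e, und_ord hU, (mem_fib p).mp hw]
      exact hv0
    · rw [nm_sg]; exact hE w)
  obtain ⟨D, rfl⟩ := mk_surjective Y
  have hY' : -(sg σ D - D) + E ∈ ray T' := by
    rw [← QuotientAddGroup.eq]; exact hY.symm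
  obtain ⟨y, hy, hy1, hy2⟩ := hY'
  refine ⟨y, hy, norm_eq_of_one p σ T' hT0 hT' hy hcM hy1 (fun w hw => ?_) N fun w hw => ?_⟩
  · have e : algebraMap L M c - 1 = algebraMap L M (c - 1) := by rw [map_sub, map_one]
    rw [e, und_ord hU, (mem_fib p).mp hw]
    exact hv0
  · rw [← hE w]
    have ht := sum_comap_tele σ hσ D w
    have : ∀ j ∈ range N, (w.comap (σ ^ j)).val y =
        E (w.comap (σ ^ j)) - (D ((w.comap (σ ^ j)).comap σ) - D (w.comap (σ ^ j))) := by
      intro j _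
      rw [← hy2 _ (fun h => hw ((hT' _ _).mp h))]
      rw [Finsupp.add_apply, Finsupp.neg_apply, Finsupp.sub_apply, sg_apply]
      ring
    rw [sum_congr rfl this, sum_sub_distrib, ht, sub_zero]

lemma exists_one_place [IsFF p L] {c : L} (hc : c ≠ 0) {v : FFPrime L} (hv : v.val c ≠ 0) : ∃ v0 : FFPrime L, 0 < v0.ord (c - 1) := by
  obtain ⟨w, hw⟩ := exists_pole' p hc hv
  have h1 : w.ord (c - 1) = w.val c := by
    rw [sub_eq_add_neg, w.ord_add_eq_left, w.ord_eq hc]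
    rw [w.ord_neg, w.ord_eq hc, w.ord_eq one_ne_zero, w.val_one]
    exact_mod_cast hw
  have hc1 : c - 1 ≠ 0 := w.ne_zero_of_ord h1
  have h2 : w.val (c - 1) ≠ 0 := by
    rw [w.val_eq_of_ord h1]; exact hw.ne
  obtain ⟨u, hu⟩ := exists_pole' p (inv_ne_zero hc1) (v := w) (by rw [w.val_inv hc1]; omega)
  refine ⟨u, (u.ord_pos_iff hc1).mpr ?_⟩
  rw [u.val_inv hc1] at hu; omega

lemma thmU [FiniteDimensional L M] [IsGalois L M] [IsFF p M] [IsFF p L] (hU : Unr L M) (σ : M ≃ₐ[L] M) (hσ : ∀ x, x ∈ zpowers σ) (hN : (finrank L M : M) ≠ 0)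
    {c : L} (hc : c ≠ 0) (E : FFPrime M →₀ ℤ) (hE : ∀ w : FFPrime M, ∑ j ∈ range (finrank L M), E (w.comap (σ ^ j)) = w.val (algebraMap L M c)) :
    ∃ y : M, y ≠ 0 ∧ ∏ j ∈ range (finrank L M), (σ ^ j) y = algebraMap L M c := by
  by_cases h : ∃ v : FFPrime L, v.val c ≠ 0
  · obtain ⟨v, hv⟩ := h
    obtain ⟨v0, hv0⟩ := exists_one_place p hc hv
    exact thmU_aux p hU σ hσ hN hc v0 hv0 E hE
  · push Not at h
    obtain ⟨t, ht, v, hv⟩ := exists_transcendental_val p (X := L)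
    have hNpos : 0 < finrank L M := Module.finrank_pos
    have htN : t ^ finrank L M ≠ 0 := pow_ne_zero _ ht
    have htM : algebraMap L M t ≠ 0 := by simpa using ht
    obtain ⟨v0, hv0⟩ := exists_one_place p (mul_ne_zero hc htN) (v := v) (by
      rw [v.val_mul hc htN, h, v.val_pow ht, zero_add]
      exact mul_ne_zero (by exact_mod_cast hNpos.ne') hv)
    obtain ⟨y, hy, hy1⟩ := thmU_aux p hU σ hσ hN (mul_ne_zero hc htN) v0 hv0 (E + dv (algebraMap L M t)) (by
      intro w
      have : ∀ j ∈ range (finrank L M), (E + dv (algebraMap L M t)) (w.comap (σ ^ j)) =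
          E (w.comap (σ ^ j)) + w.val (algebraMap L M t) := by
        intro j _
        rw [Finsupp.add_apply, dv_apply p htM, w.comap_val _ htM, commutes]
      rw [sum_congr rfl this, Finset.sum_add_distrib, hE, map_mul, map_pow, w.val_mul (by simpa using hc) (pow_ne_zero _ htM), w.val_pow htM]
      simp)
    refine ⟨y / algebraMap L M t, div_ne_zero hy htM, ?_⟩
    have : ∀ j ∈ range (finrank L M), (σ ^ j) (y / algebraMap L M t) = (σ ^ j) y / algebraMap L M t := by
      intro j _
      rw [map_div₀, commutes]
    rw [prod_congr rfl this, Finset.prod_div_distrib, hy1, map_mul, map_pow]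
    simp [htM]
end

section
variable (p : ℕ) [Fact p.Prime] {F M : Type} [Field F] [Field M] [Algebra F M]

structure Kum (F : Type) {M : Type} [Field F] [Field M] [Algebra F M] (n : ℕ) (a : F) (s : M) : Prop where
  pow : s ^ n = algebraMap F M a
  ne : a ≠ 0
  inj : ∀ g : M ≃ₐ[F] M, g s = s → g = 1
  root : ∃ ζ : F, IsPrimitiveRoot ζ n

lemma Kum.s_ne {n : ℕ} (hn : 0 < n) {a : F} {s : M} (h : Kum F n a s) : s ≠ 0 := by
  rintro rfl
  have := h.pow
  rw [zero_pow hn.ne', eq_comm, map_eq_zero] at this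
  exact h.ne this

lemma Kum.unr [FiniteDimensional F M] [IsGalois F M] [IsFF p M] [IsFF p F] {n : ℕ} (hn : 0 < n) (hnM : (n : M) ≠ 0) {a : F} {s : M}
    (h : Kum F n a s) (ha : ∀ v : FFPrime F, (n : ℤ) ∣ v.val a) : Unr F M := by
  classical
  intro w
  obtain ⟨v, e, hve⟩ := FFPrime.exists_under (K := F) w
  refine ⟨v, ?_⟩
  rw [FFPrime.liesOverWith_iff] at hve
  obtain ⟨he, hve⟩ := hve
  obtain ⟨k, hk⟩ := ha v
  obtain ⟨b, hb, hbk⟩ := v.exists_val_eq k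
  have hbM : algebraMap F M b ≠ 0 := by simpa using hb
  have hs0 := h.s_ne hn
  let s' := s / algebraMap F M b
  have hs'0 : s' ≠ 0 := div_ne_zero hs0 hbM
  have hs'n : s' ^ n = algebraMap F M (a / b ^ n) := by simp only [s', div_pow, h.pow, map_div₀, map_pow]
  have hgs' : ∀ g : M ≃ₐ[F] M, g s' ^ n = s' ^ n := by
    intro g; rw [← map_pow, hs'n, g.commutes]
  have hgs'0 : ∀ g : M ≃ₐ[F] M, g s' ≠ 0 := fun g => (map_ne_zero_iff _ g.injective).mpr hs'0
  have hvs : w.val s' = 0 := by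
    have h1 : w.val (s' ^ n) = 0 := by
      rw [hs'n, hve _ (div_ne_zero h.ne (pow_ne_zero _ hb)), v.val_div h.ne (pow_ne_zero _ hb), v.val_pow hb, hbk, hk]
      simp
    rw [w.val_pow hs'0] at h1
    rcases mul_eq_zero.mp h1 with h2 | h2
    · exact absurd h2 (by exact_mod_cast hn.ne')
    · exact h2
  have hvgs : ∀ g : M ≃ₐ[F] M, w.val (g s') = 0 := by
    intro g
    have h1 : w.val (g s' ^ n) = 0 := by rw [hgs', w.val_pow hs'0, hvs, mul_zero]
    rw [w.val_pow (hgs'0 g)] at h1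
    rcases mul_eq_zero.mp h1 with h2 | h2
    · exact absurd h2 (by exact_mod_cast hn.ne')
    · exact h2
  obtain ⟨y, hy0, hy⟩ := FFPrime.approx_val (univ.image fun g : M ≃ₐ[F] M => w.comap g) (fun _ => 1)
    ⟨w.comap 1, mem_image_of_mem _ (mem_univ _)⟩
  have hgy : ∀ g : M ≃ₐ[F] M, w.val (g y) = 1 := by
    intro g
    rw [← w.comap_val g hy0]
    exact hy _ (mem_image_of_mem _ (mem_univ _))
  have hgy0 : ∀ g : M ≃ₐ[F] M, g y ≠ 0 := fun g => (map_ne_zero_iff _ g.injective).mpr hy0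
  let t : ℕ → F := fun i => trace F M (y / s' ^ i)
  have ht : ∀ i, algebraMap F M (t i) = ∑ g : M ≃ₐ[F] M, g y / (g s') ^ i := by
    intro i
    simp only [t]
    rw [trace_eq_sum_automorphisms]
    exact sum_congr rfl fun g _ => by rw [map_div₀, map_pow]
  have hsum : (n : M) * y = ∑ i ∈ range n, s' ^ i * algebraMap F M (t i) := by
    simp only [ht, mul_sum]
    rw [sum_comm, sum_eq_single (1 : M ≃ₐ[F] M)]
    · have : ∀ i ∈ range n, s' ^ i * ((1 : M ≃ₐ[F] M) y / ((1 : M ≃ₐ[F] M) s') ^ i) = y := by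
        intro i _
        rw [AlgEquiv.one_apply, AlgEquiv.one_apply]; field_simp
      rw [sum_congr rfl this]; simp
    · intro g _ hg
      have h1 : ∀ i ∈ range n, s' ^ i * (g y / (g s') ^ i) = g y * (s' / g s') ^ i := by
        intro i _
        rw [div_pow]; ring
      rw [sum_congr rfl h1, ← mul_sum]
      have hne : s' / g s' ≠ 1 := by
        intro h2
        rw [div_eq_one_iff_eq (hgs'0 g)] at h2
        refine hg (h.inj g ?_)
        have : g s' = g s / algebraMap F M b := by rw [map_div₀, g.commutes]
        rw [this] at h2
        exact ((div_left_inj' hbM).mp h2).symm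
      rw [geom_sum_eq hne, div_pow, hgs', div_self (pow_ne_zero _ hs'0), sub_self, zero_div, mul_zero]
    · intro h; exact absurd (mem_univ _) h
  have htw : ∀ i, (e : ℤ) ≤ w.ord (s' ^ i * algebraMap F M (t i)) := by
    intro i
    by_cases ht0 : t i = 0
    · rw [ht0, map_zero, mul_zero, w.ord_zero]; exact le_top
    have htM : algebraMap F M (t i) ≠ 0 := by simpa using ht0
    have h1 : (1 : ℤ) ≤ w.ord (algebraMap F M (t i)) := by
      rw [ht]
      refine w.le_ord_sum _ _ fun g _ => ?_
      rw [w.le_ord_iff (div_ne_zero (hgy0 g) (pow_ne_zero _ (hgs'0 g))), w.val_div (hgy0 g) (pow_ne_zero _ (hgs'0 g)), w.val_pow (hgs'0 g), hgy, hvgs]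
      simp
    rw [w.le_ord_iff htM, hve _ ht0] at h1
    rw [w.le_ord_iff (mul_ne_zero (pow_ne_zero _ hs'0) htM), w.val_mul (pow_ne_zero _ hs'0) htM, w.val_pow hs'0, hvs, hve _ ht0, mul_zero, zero_add]
    have he' : (0 : ℤ) < e := by exact_mod_cast he
    have : 0 < v.val (t i) := by
      by_contra hcon
      push Not at hcon
      nlinarith
    nlinarith
  have hle : (e : ℤ) ≤ w.ord ((n : M) * y) := by
    rw [hsum]; exact w.le_ord_sum _ _ fun i _ => htw i
  rw [w.ord_mul, w.natCast_ord_zero p hnM, zero_add, w.le_ord_iff hy0] at hle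
  have h1 := hgy 1
  rw [AlgEquiv.one_apply] at h1
  rw [h1] at hle
  have he1 : e = 1 := by
    have : e ≤ 1 := by exact_mod_cast hle
    omega
  intro x
  by_cases hx : x = 0
  · rw [hx, map_zero, w.ord_zero, v.ord_zero]
  · rw [w.ord_eq (by simpa using hx), v.ord_eq hx, hve x hx, he1]; simp

lemma Kum.root_mem [FiniteDimensional F M] {n : ℕ} (hn : 0 < n) {a : F} {s : M} (h : Kum F n a s) {ζ : F} (hζ : IsPrimitiveRoot ζ n) (g : M ≃ₐ[F] M) :
    ∃ i < n, g s = algebraMap F M (ζ ^ i) * s := by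
  have hs0 := h.s_ne hn
  have h1 : (g s / s) ^ n = 1 := by
    rw [div_pow, ← map_pow, h.pow, g.commutes, div_self]
    simpa using h.ne
  have : NeZero n := ⟨hn.ne'⟩
  obtain ⟨i, hi, hi'⟩ := (hζ.map_of_injective (algebraMap F M).injective).eq_pow_of_pow_eq_one h1
  refine ⟨i, hi, ?_⟩
  rw [map_pow, hi', div_mul_cancel₀ _ hs0]

lemma Kum.cyc [FiniteDimensional F M] [IsGalois F M] {n : ℕ} (hn : 0 < n) {a : F} {s : M} (h : Kum F n a s) : ∃ σ : M ≃ₐ[F] M, (∀ x, x ∈ zpowers σ) ∧ finrank F M ∣ n := by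
  obtain ⟨ζ, hζ⟩ := h.root
  have hs0 := h.s_ne hn
  let f : (M ≃ₐ[F] M) →* M :=
    { toFun := fun g => g s / s
      map_one' := by rw [AlgEquiv.one_apply, div_self hs0]
      map_mul' := by
        intro g g'
        obtain ⟨i, -, hi⟩ := h.root_mem hn hζ g'
        rw [AlgEquiv.mul_apply, hi, map_mul, g.commutes]
        field_simp }
  have hf : Injective f := by
    intro g g' hgg
    have h1 : g s / s = g' s / s := hgg
    have h2 : g s = g' s := (div_left_inj' hs0).mp h1
    have h3 : (g'⁻¹ * g) = 1 := h.inj _ (by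
      rw [AlgEquiv.mul_apply, h2, ← AlgEquiv.mul_apply, inv_mul_cancel, AlgEquiv.one_apply])
    exact (inv_mul_eq_one.mp h3).symm
  have hc : IsCyclic (M ≃ₐ[F] M) := isCyclic_of_subgroup_isDomain f hf
  obtain ⟨σ, hσ⟩ := hc.exists_generator
  refine ⟨σ, hσ, ?_⟩
  rw [← IsGalois.card_aut_eq_finrank, ← orderOf_eq_card_of_forall_mem_zpowers hσ]
  refine orderOf_dvd_of_pow_eq_one (hf ?_)
  rw [map_pow, map_one]
  change (σ s / s) ^ n = 1
  rw [div_pow, ← map_pow, h.pow, σ.commutes, div_self]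
  simpa using h.ne

lemma FFPrime.val_root (w : FFPrime M) {x : M} {n : ℕ} (hn : 0 < n) (hx : x ^ n = 1) : w.val x = 0 := by
  have hx0 : x ≠ 0 := by rintro rfl; rw [zero_pow hn.ne'] at hx; exact zero_ne_one hx
  have h1 : w.val (x ^ n) = 0 := by rw [hx, w.val_one]
  rw [w.val_pow hx0] at h1
  rcases mul_eq_zero.mp h1 with h2 | h2
  · exact absurd h2 (by exact_mod_cast hn.ne')
  · exact h2

lemma FFPrime.root_sub [IsFF p M] (w : FFPrime M) {x : M} {n : ℕ} (hn : (n : M) ≠ 0) (hx : x ^ n = 1) (hx1 : x ≠ 1) : ¬ 0 < w.ord (x - 1) := by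
  intro h
  have hn0 : 0 < n := Nat.pos_of_ne_zero (by rintro rfl; simp at hn)
  have h1 : ∑ i ∈ range n, x ^ i = 0 := by rw [geom_sum_eq hx1, hx, sub_self, zero_div]
  have h2 : (n : M) = - ∑ i ∈ range n, (x ^ i - 1) := by
    rw [sum_sub_distrib, h1]; simp
  have h3 : 0 < w.ord (n : M) := by
    rw [h2, w.ord_neg]
    refine w.lt_ord_sum _ _ (coe_lt_top 0) fun i _ => ?_
    rw [← geom_sum_mul]
    refine FFPrime.ord_mul_pos ?_ h
    refine w.le_ord_sum _ _ fun j _ => w.ord_pow_nonneg ?_ _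
    have hx0 : x ≠ 0 := by rintro rfl; rw [zero_pow hn0.ne'] at hx; exact zero_ne_one hx
    rw [w.ord_nonneg_iff hx0, w.val_root hn0 hx]
  rw [w.natCast_ord_zero p hn] at h3
  exact lt_irrefl _ h3

lemma hnp [FiniteDimensional F M] [IsGalois F M] [IsFF p M] [IsFF p F] {n : ℕ} (hn : 0 < n)
    (hnM : (n : M) ≠ 0) {a : F} {s : M} (h : Kum F n a s) (ha : ∀ v : FFPrime F, (n : ℤ) ∣ v.val a) {c : F} (hc : c ≠ 0)
    (hloc : ∀ v : FFPrime F, (n : ℤ) ∣ v.val c ∨ n.Prime ∧ ∃ b, b ≠ 0 ∧ 0 < v.ord (a / b ^ n - 1)) : ∃ y : M, ∏ g : M ≃ₐ[F] M, g y = algebraMap F M c := by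
  classical
  have hU := h.unr p hn hnM ha
  obtain ⟨σ, hσ, hdvd⟩ := h.cyc hn
  obtain ⟨ζ, hζ⟩ := h.root
  have hs0 := h.s_ne hn
  have hcM : algebraMap F M c ≠ 0 := by simpa using hc
  have hNpos : 0 < finrank F M := Module.finrank_pos
  have hN : (finrank F M : M) ≠ 0 := by
    intro h0
    obtain ⟨k, hk⟩ := hdvd
    exact hnM (by rw [hk, Nat.cast_mul, h0, zero_mul])
  choose! b hb using fun v (hv : ¬ (n : ℤ) ∣ v.val c) => ((hloc v).resolve_left hv).2
  let E0 : FFPrime M → ℤ := fun w =>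
    if (finrank F M : ℤ) ∣ w.val (algebraMap F M c) then w.val (algebraMap F M c) / finrank F M
    else if 0 < w.ord (s / algebraMap F M (b (und hU w)) - 1) then w.val (algebraMap F M c) else 0
  let E : FFPrime M →₀ ℤ := Finsupp.ofSupportFinite E0 (by
    refine (finite_supp p hcM).subset fun w hw => ?_
    intro h0
    exact hw (by simp only [E0]; rw [h0]; simp))
  have hE : ∀ w, E w = E0 w := fun w => rfl
  have hwc : ∀ (w : FFPrime M) (g : M ≃ₐ[F] M), (w.comap g).val (algebraMap F M c) = w.val (algebraMap F M c) := by
    intro w g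
    rw [w.comap_val g hcM, g.commutes]
  obtain ⟨y, hy0, hy⟩ := thmU p hU σ hσ hN hc E (by
    intro w
    by_cases hw : (finrank F M : ℤ) ∣ w.val (algebraMap F M c)
    · have : ∀ j ∈ range (finrank F M), E (w.comap (σ ^ j)) = w.val (algebraMap F M c) / finrank F M := by
        intro j _
        rw [hE]
        simp only [E0, hwc]
        rw [if_pos hw]
      rw [sum_congr rfl this, sum_const, Finset.card_range, nsmul_eq_mul]
      exact Int.mul_ediv_cancel' hw
    · have hv : ¬ (n : ℤ) ∣ (und hU w).val c := by
        intro h1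
        rw [und_val hU w hc] at hw
        exact hw ((Int.natCast_dvd_natCast.mpr hdvd).trans h1)
      have hpr := ((hloc _).resolve_left hv).1
      obtain ⟨hb0, hb1⟩ := hb _ hv
      have hNn : finrank F M = n := by
        rcases (Nat.dvd_prime hpr).mp hdvd with h1 | h1
        · rw [h1] at hw; exact absurd (by simp) hw
        · exact h1
      set B := b (und hU w) with hB
      have hbM : algebraMap F M B ≠ 0 := by simpa using hb0
      set x := s / algebraMap F M B with hx
      have hx0 : x ≠ 0 := div_ne_zero hs0 hbM
      obtain ⟨i, hi, hi'⟩ := h.root_mem hn hζ σ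
      set η := ζ ^ i with hη
      have hηj : ∀ j, (σ ^ j) x = algebraMap F M (η ^ j) * x := by
        intro j
        induction j with
        | zero => simp
        | succ j ih =>
          rw [pow_succ', AlgEquiv.mul_apply, ih, map_mul, σ.commutes, hx, map_div₀, hi', σ.commutes, pow_succ', map_mul]
          simp only [map_pow, hη]; ring
      have hηn : η ^ n = 1 := by rw [hη, ← pow_mul, mul_comm, pow_mul, hζ.pow_eq_one, one_pow]
      have hη1 : η ≠ 1 := by
        intro h1
        have h2 : σ = 1 := h.inj σ (by rw [hi', h1, map_one, one_mul])
        have h3 : finrank F M = 1 := by rw [← IsGalois.card_aut_eq_finrank, ← orderOf_eq_card_of_forall_mem_zpowers hσ, h2, orderOf_one]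
        rw [hNn] at h3
        exact hpr.one_lt.ne' h3
      have hηp : IsPrimitiveRoot (algebraMap F M η) n := IsPrimitiveRoot.map_of_injective (IsPrimitiveRoot.iff_orderOf.mpr
          (orderOf_eq_prime (hp := ⟨hpr⟩) hηn hη1)) (algebraMap F M).injective
      have hEj : ∀ j ∈ range (finrank F M), E (w.comap (σ ^ j)) =
          if 0 < w.ord (algebraMap F M η ^ j * x - 1) then w.val (algebraMap F M c) else 0 := by
        intro j _
        rw [hE]
        simp only [E0, hwc]
        rw [if_neg hw, und_comap, ← hB, ← hx, w.comap_ord, map_sub, map_one, hηj, map_pow]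
      rw [sum_congr rfl hEj, hNn]
      have hxn : 0 < w.ord (x ^ n - 1) := by
        have : x ^ n - 1 = algebraMap F M (a / B ^ n - 1) := by rw [hx, div_pow, h.pow, map_sub, map_div₀, map_pow, map_one]
        rw [this, und_ord hU]; exact hb1
      have hex : ∃ j < n, 0 < w.ord (algebraMap F M η ^ j * x - 1) := by
        by_contra hcon
        push Not at hcon
        have h1 : (1 : M) ^ n - x ^ n = ∏ j ∈ range n, (1 - algebraMap F M η ^ j * x) := by
          have : NeZero n := ⟨hn.ne'⟩
          rw [hηp.pow_sub_pow_eq_prod_sub_mul 1 x hn]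
          symm
          refine Finset.prod_bij (fun j _ => algebraMap F M η ^ j) ?_ ?_ ?_ ?_
          · intro j _
            rw [Polynomial.mem_nthRootsFinset hn]
            rw [← pow_mul, mul_comm, pow_mul, hηp.pow_eq_one, one_pow]
          · intro j hj k hk hjk
            exact hηp.pow_inj (mem_range.mp hj) (mem_range.mp hk) hjk
          · intro z hz
            rw [Polynomial.mem_nthRootsFinset hn] at hz
            obtain ⟨j, hj, hjz⟩ := hηp.eq_pow_of_pow_eq_one hz
            exact ⟨j, mem_range.mpr hj, hjz⟩
          · intro j _; rfl
        have h2 : w.ord (∏ j ∈ range n, (1 - algebraMap F M η ^ j * x)) ≤ 0 := by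
          refine Finset.prod_induction _ (fun z => w.ord z ≤ 0) ?_ (by rw [w.ord_one]) ?_
          · intro z z' hz hz'
            rw [w.ord_mul]; exact add_nonpos hz hz'
          · intro j hj
            have := hcon j (mem_range.mp hj)
            rw [← w.ord_neg, neg_sub]; exact this
        rw [← h1, one_pow, ← w.ord_neg, neg_sub] at h2
        exact absurd hxn (not_lt.mpr h2)
      obtain ⟨j, hj, hj1⟩ := hex
      rw [sum_eq_single j, if_pos hj1]
      · intro k hk hkj
        rw [if_neg]
        intro hk1
        have hηM0 : algebraMap F M η ≠ 0 := hηp.ne_zero hn.ne'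
        have hjx : algebraMap F M η ^ j * x ≠ 0 := mul_ne_zero (pow_ne_zero _ hηM0) hx0
        have h3 := FFPrime.one_mul' hk1 (FFPrime.one_inv hj1)
        have h4 : algebraMap F M η ^ k * x * (algebraMap F M η ^ j * x)⁻¹ = algebraMap F M η ^ k / algebraMap F M η ^ j := by field_simp
        rw [h4] at h3
        refine w.root_sub p hnM ?_ ?_ h3
        · rw [div_pow, ← pow_mul, ← pow_mul, mul_comm k, mul_comm j, pow_mul, pow_mul, hηp.pow_eq_one]; simp
        · intro h5
          rw [div_eq_one_iff_eq (pow_ne_zero _ hηM0)] at h5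
          exact hkj (hηp.pow_inj (mem_range.mp hk) hj h5)
      · intro h5; exact absurd (mem_range.mpr hj) h5)
  refine ⟨y, ?_⟩
  rw [← hy, ← IsGalois.card_aut_eq_finrank]
  exact (prod_pow_gen hσ (fun g => g y)).symm
end

section
def expo (n : ℕ) (f : Fin n → (Fin 3 → Fin n)) (i : Fin 3) : ℕ := ∑ l, (f l i : ℕ)

open Classical in
def Phi {A : Type*} [CommRing A] (n : ℕ) (ζ : A) (U : Fin 3 → A) (y : (Fin 3 → Fin n) → A) (r : Fin 3 → Fin n) : A :=
  ∑ f ∈ univ.filter (fun f : Fin n → (Fin 3 → Fin n) => ∀ i, expo n f i % n = r i),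
    (∏ l, y (f l) * ζ ^ ((l : ℕ) * (f l 2 : ℕ))) * ∏ i, U i ^ (expo n f i / n)

open Classical in
def PP {A : Type*} [CommRing A] (n : ℕ) (ζ : A) (U : Fin 3 → A) (c : A) : Prop :=
  ∃ y : (Fin 3 → Fin n) → A, ∀ r, Phi n ζ U y r = if (∀ i, (r i : ℕ) = 0) then c else 0

lemma Phi_map {A B : Type*} [CommRing A] [CommRing B] (φ : A →+* B) (n : ℕ) (ζ : A) (U : Fin 3 → A) (y : (Fin 3 → Fin n) → A) (r : Fin 3 → Fin n) :
    φ (Phi n ζ U y r) = Phi n (φ ζ) (fun i => φ (U i)) (fun r => φ (y r)) r := by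
  simp only [Phi, map_sum, map_mul, map_prod, map_pow]

lemma PP_map {A B : Type*} [CommRing A] [CommRing B] (φ : A →+* B) {n : ℕ} {ζ : A} {U : Fin 3 → A} {c : A} (h : PP n ζ U c) : PP n (φ ζ) (fun i => φ (U i)) (φ c) := by
  obtain ⟨y, hy⟩ := h
  refine ⟨fun r => φ (y r), fun r => ?_⟩
  rw [← Phi_map, hy]
  split_ifs <;> simp

lemma Phi_id {A : Type*} [CommRing A] {n : ℕ} (hn : 0 < n) (ζ : A) (U : Fin 3 → A) (y : (Fin 3 → Fin n) → A) (z : Fin 3 → A) (hz : ∀ i, z i ^ n = U i) :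
    ∏ l : Fin n, ∑ r : Fin 3 → Fin n, y r * ζ ^ ((l : ℕ) * (r 2 : ℕ)) * ∏ i, z i ^ (r i : ℕ) =
      ∑ r, Phi n ζ U y r * ∏ i, z i ^ (r i : ℕ) := by
  classical
  rw [Finset.prod_univ_sum, Fintype.piFinset_univ]
  have h1 : ∀ f : Fin n → (Fin 3 → Fin n), (∏ l, (y (f l) * ζ ^ ((l : ℕ) * (f l 2 : ℕ)) * ∏ i, z i ^ (f l i : ℕ))) =
      (∏ l, y (f l) * ζ ^ ((l : ℕ) * (f l 2 : ℕ))) * (∏ i, U i ^ (expo n f i / n)) * ∏ i, z i ^ (expo n f i % n) := by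
    intro f
    have h2 : (∏ l, (y (f l) * ζ ^ ((l : ℕ) * (f l 2 : ℕ)) * ∏ i, z i ^ (f l i : ℕ))) =
        (∏ l, y (f l) * ζ ^ ((l : ℕ) * (f l 2 : ℕ))) * ∏ l, ∏ i, z i ^ (f l i : ℕ) := Finset.prod_mul_distrib
    have h3 : (∏ i, U i ^ (expo n f i / n)) * ∏ i, z i ^ (expo n f i % n) =
      ∏ i, (U i ^ (expo n f i / n) * z i ^ (expo n f i % n)) := Finset.prod_mul_distrib.symm
    rw [h2, mul_assoc, h3, Finset.prod_comm]
    congr 1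
    refine prod_congr rfl fun i _ => ?_
    rw [Finset.prod_pow_eq_pow_sum, ← hz, ← pow_mul, ← pow_add, Nat.div_add_mod]
    rfl
  simp only [Phi, sum_mul]
  rw [sum_congr rfl fun f _ => h1 f]
  rw [← Finset.sum_fiberwise_of_maps_to (s := univ) (t := univ)
    (g := fun (f : Fin n → (Fin 3 → Fin n)) => fun i => (⟨expo n f i % n, Nat.mod_lt _ hn⟩ : Fin n)) (fun _ _ => mem_univ _)]
  refine sum_congr rfl fun r _ => ?_
  refine sum_congr ?_ fun f hf => ?_
  · ext f
    simp only [mem_filter, mem_univ, true_and, funext_iff, Fin.ext_iff]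
  · simp only [mem_filter, mem_univ, true_and] at hf
    congr 1
    exact prod_congr rfl fun i _ => by rw [hf i]
end

section
variable {L M : Type} [Field L] [Field M] [Algebra L M]

lemma zeta_add {n : ℕ} [NeZero n] {ζ : M} (hζ : ζ ^ n = 1) (k l : ZMod n) : ζ ^ (k + l).val = ζ ^ k.val * ζ ^ l.val := by
  rw [ZMod.val_add, ← pow_add, ← pow_eq_pow_mod _ hζ]

lemma fourier_surj {n : ℕ} [NeZero n] {ζ : M} (hζ : IsPrimitiveRoot ζ n) (hn : (n : M) ≠ 0) (s : Fin 3 → M) (hs : ∀ i, s i ≠ 0) (Y : (Fin 3 → ZMod n) → M) (j : Fin 3 → ZMod n) :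
    ∑ r : Fin 3 → Fin n, (((n : M) ^ 3)⁻¹ * ∑ j', Y j' / ∏ i, (ζ ^ (j' i).val * s i) ^ (r i : ℕ)) *
      ∏ i, (ζ ^ (j i).val * s i) ^ (r i : ℕ) = Y j := by
  classical
  have hζ0 : ζ ≠ 0 := hζ.ne_zero (NeZero.ne n)
  have hz0 : ∀ (j : Fin 3 → ZMod n) i, ζ ^ (j i).val * s i ≠ 0 := fun j i => mul_ne_zero (pow_ne_zero _ hζ0) (hs i)
  have hgeo : ∀ k l : ZMod n, ∑ r : Fin n, (ζ ^ k.val / ζ ^ l.val) ^ (r : ℕ) = if k = l then (n : M) else 0 := by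
    intro k l
    split_ifs with h
    · rw [h, div_self (pow_ne_zero _ hζ0)]; simp
    · rw [Fin.sum_univ_eq_sum_range (fun r => (ζ ^ k.val / ζ ^ l.val) ^ r), geom_sum_eq]
      · rw [div_pow, ← pow_mul, ← pow_mul, mul_comm, mul_comm l.val, pow_mul, pow_mul, hζ.pow_eq_one]; simp
      · intro h1
        rw [div_eq_one_iff_eq (pow_ne_zero _ hζ0)] at h1
        exact h (ZMod.val_injective n (hζ.pow_inj (val_lt k) (val_lt l) h1))
  have h1 : ∀ r : Fin 3 → Fin n, (((n : M) ^ 3)⁻¹ * ∑ j', Y j' / ∏ i, (ζ ^ (j' i).val * s i) ^ (r i : ℕ)) *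
      ∏ i, (ζ ^ (j i).val * s i) ^ (r i : ℕ) =
      ∑ j', ((n : M) ^ 3)⁻¹ * Y j' * ∏ i, (ζ ^ (j i).val / ζ ^ (j' i).val) ^ (r i : ℕ) := by
    intro r
    rw [mul_assoc, sum_mul, mul_sum]
    refine sum_congr rfl fun j' _ => ?_
    rw [mul_assoc, div_mul_eq_mul_div, mul_div_assoc, ← Finset.prod_div_distrib]
    congr 2
    refine prod_congr rfl fun i _ => ?_
    rw [← div_pow]
    congr 1
    rw [mul_div_mul_right _ _ (hs i)]
  rw [sum_congr rfl fun r _ => h1 r, sum_comm]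
  have h2 : ∀ j', ∑ r : Fin 3 → Fin n, ((n : M) ^ 3)⁻¹ * Y j' * ∏ i, (ζ ^ (j i).val / ζ ^ (j' i).val) ^ (r i : ℕ) =
      if j' = j then Y j else 0 := by
    intro j'
    rw [← mul_sum]
    have := (Finset.prod_univ_sum (fun _ : Fin 3 => (univ : Finset (Fin n)))
      (fun i r => (ζ ^ (j i).val / ζ ^ (j' i).val) ^ (r : ℕ)))
    rw [Fintype.piFinset_univ] at this
    rw [← this]
    simp only [hgeo]
    split_ifs with h
    · subst h
      simp only [if_true, Finset.prod_const, card_univ, Fintype.card_fin]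
      field_simp
    · obtain ⟨i, hi⟩ := Function.ne_iff.mp h
      rw [Finset.prod_eq_zero (mem_univ i) (if_neg fun h => hi h.symm), mul_zero]
  rw [sum_congr rfl fun j' _ => h2 j']
  simp

lemma fourier_inj {n : ℕ} [NeZero n] {ζ : M} (hζ : IsPrimitiveRoot ζ n) (hn : (n : M) ≠ 0) (s : Fin 3 → M) (hs : ∀ i, s i ≠ 0) (φ ψ : (Fin 3 → Fin n) → M)
    (h : ∀ j : Fin 3 → ZMod n, ∑ r, φ r * ∏ i, (ζ ^ (j i).val * s i) ^ (r i : ℕ) =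
      ∑ r, ψ r * ∏ i, (ζ ^ (j i).val * s i) ^ (r i : ℕ)) : φ = ψ := by
  classical
  let T : ((Fin 3 → Fin n) → M) →ₗ[M] ((Fin 3 → ZMod n) → M) :=
    { toFun := fun φ j => ∑ r, φ r * ∏ i, (ζ ^ (j i).val * s i) ^ (r i : ℕ)
      map_add' := by intro a b; ext j; simp [add_mul, Finset.sum_add_distrib]
      map_smul' := by intro a b; ext j; simp [mul_sum, mul_assoc] }
  have hsurj : Function.Surjective T := fun Y => ⟨_, funext fun j => fourier_surj hζ hn s hs Y j⟩
  have hinj : Injective T := (LinearMap.injective_iff_surjective_of_finrank_eq_finrank (by simp [ZMod.card])).mpr hsurj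
  exact hinj (funext h)

lemma pp_of_equiv [FiniteDimensional L M] [IsGalois L M] {n : ℕ} [NeZero n] {ζ : L} (hζ : IsPrimitiveRoot ζ n)
    (hn : (n : M) ≠ 0) (U : Fin 3 → L) (s : Fin 3 → M) (hs : ∀ i, s i ≠ 0) (hU : ∀ i, s i ^ n = algebraMap L M (U i))
    (a : (M ≃ₐ[L] M) → (Fin 3 → ZMod n)) (ha : ∀ g i, g (s i) = algebraMap L M ζ ^ (a g i).val * s i) (Y : (Fin 3 → ZMod n) → M) (hY : ∀ g j, g (Y j) = Y (j + a g)) {c : L}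
    (hprod : ∀ j, ∏ l ∈ range n, Y (j + (Pi.single 2 (l : ZMod n) : Fin 3 → ZMod n)) = algebraMap L M c) : PP n ζ U c := by
  classical
  have hζM := hζ.map_of_injective (algebraMap L M).injective
  set ξ := algebraMap L M ζ with hξ
  have hadd := zeta_add (n := n) (ζ := ξ) hζM.pow_eq_one
  let y : (Fin 3 → Fin n) → M := fun r => (((n : M) ^ 3)⁻¹ * ∑ j', Y j' / ∏ i, (ξ ^ (j' i).val * s i) ^ (r i : ℕ))
  have hyY : ∀ j, ∑ r, y r * ∏ i, (ξ ^ (j i).val * s i) ^ (r i : ℕ) = Y j := fun j => fourier_surj hζM hn s hs Y j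
  have hgz : ∀ (g : M ≃ₐ[L] M) (j : Fin 3 → ZMod n) i, g (ξ ^ (j i).val * s i) = ξ ^ ((j + a g) i).val * s i := by
    intro g j i
    rw [map_mul, map_pow, hξ, g.commutes, ← hξ, ha, Pi.add_apply, hadd]; ring
  have hfix : ∀ r (g : M ≃ₐ[L] M), g (y r) = y r := by
    intro r g
    simp only [y]
    rw [map_mul, map_inv₀, map_pow, map_natCast, map_sum]
    congr 1
    rw [← Equiv.sum_comp (Equiv.addRight (a g)) (fun j' => Y j' / ∏ i, (ξ ^ (j' i).val * s i) ^ (r i : ℕ))]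
    refine sum_congr rfl fun j' _ => ?_
    rw [map_div₀, hY, map_prod]
    simp only [map_pow, hgz]
    rfl
  have hyL : ∀ r, ∃ x : L, algebraMap L M x = y r := by
    intro r
    exact (IsGalois.mem_range_algebraMap_iff_fixed (y r)).mpr (hfix r)
  choose x hx using hyL
  refine ⟨x, fun r => ?_⟩
  have hmain : (fun r => algebraMap L M (Phi n ζ U x r)) =
      fun r : Fin 3 → Fin n => algebraMap L M (if (∀ i, (r i : ℕ) = 0) then c else 0) := by
    refine fourier_inj hζM hn s hs _ _ fun j => ?_
    have hL := Phi_id (NeZero.pos n) ξ (fun i => algebraMap L M (U i)) (fun r => algebraMap L M (x r))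
      (fun i => ξ ^ (j i).val * s i) (fun i => by rw [mul_pow, hU, ← pow_mul, mul_comm (ZMod.val _), pow_mul, hζM.pow_eq_one, one_pow, one_mul])
    simp only [Phi_map, ← hξ]
    rw [← hL]
    have hR : ∑ r : Fin 3 → Fin n, algebraMap L M (if (∀ i, (r i : ℕ) = 0) then c else 0) *
        ∏ i, (ξ ^ (j i).val * s i) ^ (r i : ℕ) = algebraMap L M c := by
      rw [sum_eq_single (fun _ => (0 : Fin n))]
      · simp
      · intro r _ hr
        rw [if_neg, map_zero, zero_mul]
        intro h0
        exact hr (funext fun i => Fin.ext (by rw [h0 i]; simp))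
      · intro h; exact absurd (mem_univ _) h
    rw [hR, ← hprod j]
    rw [← Fin.prod_univ_eq_prod_range (fun l => Y (j + (Pi.single 2 (l : ZMod n) : Fin 3 → ZMod n)))]
    refine prod_congr rfl fun l _ => ?_
    rw [← hyY]
    refine sum_congr rfl fun r _ => ?_
    rw [hx, mul_assoc]
    congr 1
    rw [Fin.prod_univ_three, Fin.prod_univ_three]
    have e0 : (j + (Pi.single 2 ((l : ℕ) : ZMod n) : Fin 3 → ZMod n)) 0 = j 0 := by simp
    have e1 : (j + (Pi.single 2 ((l : ℕ) : ZMod n) : Fin 3 → ZMod n)) 1 = j 1 := by simp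
    have e2 : (j + (Pi.single 2 ((l : ℕ) : ZMod n) : Fin 3 → ZMod n)) 2 = j 2 + ((l : ℕ) : ZMod n) := by simp
    rw [e0, e1, e2, hadd, ZMod.val_natCast, Nat.mod_eq_of_lt l.2, pow_mul]
    rw [mul_pow _ (s 2), mul_pow _ (s 2), mul_pow]
    ring
  exact (algebraMap L M).injective (congrFun hmain r)
end

section
variable {L M : Type} [Field L] [Field M] [Algebra L M]

lemma prod_range_zmod {n : ℕ} [NeZero n] (F : ZMod n → M) : ∏ l ∈ range n, F (l : ZMod n) = ∏ x : ZMod n, F x := by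
  refine Finset.prod_bij' (fun l _ => (l : ZMod n)) (fun x _ => x.val) ?_ ?_ ?_ ?_ ?_
  · intro l _; exact mem_univ _
  · intro x _; exact mem_range.mpr (val_lt x)
  · intro l hl; exact ZMod.val_cast_of_lt (mem_range.mp hl)
  · intro x _; exact ZMod.natCast_zmod_val x
  · intro l _; rfl

open Classical in
lemma exists_equiv_Y [FiniteDimensional L M] {n : ℕ} [NeZero n] (a : (M ≃ₐ[L] M) → (Fin 3 → ZMod n)) (ha : ∀ g h, a (g * h) = a g + a h) (hinj : Injective a) (y : M) (c : L)
    (hy : ∏ τ ∈ (univ : Finset (M ≃ₐ[L] M)).filter (fun τ => a τ 0 = 0 ∧ a τ 1 = 0), τ y = algebraMap L M c) : ∃ Y : (Fin 3 → ZMod n) → M, (∀ g j, g (Y j) = Y (j + a g)) ∧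
      ∀ j, ∏ l ∈ range n, Y (j + (Pi.single 2 (l : ZMod n) : Fin 3 → ZMod n)) = algebraMap L M c := by
  have ha1 : a 1 = 0 := by have := ha 1 1; rw [mul_one] at this; simpa using this
  have hainv : ∀ g, a g⁻¹ = - a g := by
    intro g
    have := ha g⁻¹ g
    rw [inv_mul_cancel, ha1] at this
    exact eq_neg_of_add_eq_zero_left this.symm
  let H : AddSubgroup (Fin 3 → ZMod n) :=
    { carrier := Set.range a
      add_mem' := by rintro _ _ ⟨g, rfl⟩ ⟨h, rfl⟩; exact ⟨g * h, ha g h⟩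
      zero_mem' := ⟨1, ha1⟩
      neg_mem' := by rintro _ ⟨g, rfl⟩; exact ⟨g⁻¹, hainv g⟩ }
  let D : AddSubgroup (Fin 3 → ZMod n) :=
    { carrier := {j | j 0 = 0 ∧ j 1 = 0}
      add_mem' := by rintro x y ⟨h1, h2⟩ ⟨h3, h4⟩; simp [h1, h2, h3, h4]
      zero_mem' := by simp
      neg_mem' := by rintro x ⟨h1, h2⟩; simp [h1, h2] }
  let ρ : (Fin 3 → ZMod n) → (Fin 3 → ZMod n) := fun j => Quotient.out (QuotientAddGroup.mk j : (Fin 3 → ZMod n) ⧸ (H ⊔ D))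
  have hρ : ∀ j k, k ∈ H ⊔ D → ρ (j + k) = ρ j := by
    intro j k hk
    have : (QuotientAddGroup.mk (j + k) : (Fin 3 → ZMod n) ⧸ (H ⊔ D)) = QuotientAddGroup.mk j := by
      rw [QuotientAddGroup.eq]
      have : -(j + k) + j = -k := by abel
      rw [this]; exact neg_mem hk
    simp only [ρ, this]
  have hρm : ∀ j, - ρ j + j ∈ H ⊔ D := by
    intro j
    rw [← QuotientAddGroup.eq]
    exact QuotientAddGroup.out_eq' _
  have hHm : ∀ g, a g ∈ H ⊔ D := fun g => (le_sup_left : H ≤ H ⊔ D) ⟨g, rfl⟩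
  have hDm : ∀ j : Fin 3 → ZMod n, j 0 = 0 → j 1 = 0 → j ∈ H ⊔ D := fun j h1 h2 => (le_sup_right : D ≤ H ⊔ D) ⟨h1, h2⟩
  let Y : (Fin 3 → ZMod n) → M := fun j => if h : ∃ g, j = ρ j + a g then h.choose y else 1
  have hY1 : ∀ j g, j = ρ j + a g → Y j = g y := by
    intro j g hg
    have h : ∃ g, j = ρ j + a g := ⟨g, hg⟩
    have : h.choose = g := hinj (add_left_cancel (h.choose_spec.symm.trans hg))
    simp only [Y, dif_pos h, this]
  have hY2 : ∀ j, (¬ ∃ g, j = ρ j + a g) → Y j = 1 := fun j h => by simp only [Y, dif_neg h]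
  refine ⟨Y, ?_, ?_⟩
  · intro g j
    by_cases h : ∃ g, j = ρ j + a g
    · obtain ⟨g', hg'⟩ := h
      rw [hY1 j g' hg', hY1 (j + a g) (g * g')]
      · rfl
      · rw [hρ _ _ (hHm g), ha, add_comm (a g), ← add_assoc, ← hg']
    · rw [hY2 j h, hY2 (j + a g), map_one]
      rintro ⟨g', hg'⟩
      rw [hρ _ _ (hHm g)] at hg'
      refine h ⟨g⁻¹ * g', ?_⟩
      rw [ha, hainv, add_left_comm, ← hg']; abel
  · intro j
    rw [prod_range_zmod (fun l => Y (j + (Pi.single 2 l : Fin 3 → ZMod n)))]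
    obtain ⟨h, ⟨g0, rfl⟩, d, ⟨hd0, hd1⟩, hhd⟩ := mem_sup.mp (hρm j)
    have hj : j = ρ j + a g0 + Pi.single 2 (d 2) := by
      have : (Pi.single 2 (d 2) : Fin 3 → ZMod n) = d := by
        ext i; fin_cases i <;> simp [hd0, hd1]
      rw [this, add_assoc, hhd]; abel
    have h1 : ∀ l : ZMod n, Y (j + (Pi.single 2 l : Fin 3 → ZMod n)) =
        Y (ρ j + a g0 + (Pi.single 2 (d 2 + l) : Fin 3 → ZMod n)) := by
      intro l
      conv_lhs => rw [hj]
      rw [add_assoc, ← Pi.single_add]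
    rw [prod_congr rfl fun l _ => h1 l]
    have hsh := Equiv.prod_comp (Equiv.addLeft (d 2)) (fun l : ZMod n => Y (ρ j + a g0 + (Pi.single 2 l : Fin 3 → ZMod n)))
    simp only [Equiv.coe_addLeft] at hsh
    rw [hsh]
    have hc : algebraMap L M c = g0 (algebraMap L M c) := (g0.commutes c).symm
    rw [hc, ← hy, map_prod]
    rw [← Finset.prod_fiberwise_of_maps_to (s := univ.filter _) (t := univ) (g := fun τ => a τ 2) (fun _ _ => mem_univ _)]
    refine prod_congr rfl fun l _ => ?_
    have hρ' : ρ (ρ j + a g0 + (Pi.single 2 l : Fin 3 → ZMod n)) = ρ j := by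
      rw [hρ _ _ (hDm _ (by simp) (by simp)), hρ _ _ (hHm _)]
      have := hρ (ρ j) _ (hρm j)
      rw [add_neg_cancel_left] at this
      exact this.symm
    by_cases h : ∃ τ, a τ = Pi.single 2 l
    · obtain ⟨τ, hτ⟩ := h
      have : (univ.filter (fun τ : M ≃ₐ[L] M => a τ 0 = 0 ∧ a τ 1 = 0)).filter (fun τ => a τ 2 = l) = {τ} := by
        ext τ'
        simp only [mem_filter, mem_univ, true_and, mem_singleton]
        constructor
        · rintro ⟨⟨h1, h2⟩, h3⟩
          apply hinj
          rw [hτ]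
          ext i; fin_cases i <;> simp [h1, h2, h3]
        · rintro rfl
          rw [hτ]; simp
      rw [this, Finset.prod_singleton, hY1 _ (g0 * τ)]
      · rfl
      · rw [hρ', ha, hτ, add_assoc]
    · have : (univ.filter (fun τ : M ≃ₐ[L] M => a τ 0 = 0 ∧ a τ 1 = 0)).filter (fun τ => a τ 2 = l) = ∅ := by
        ext τ'
        simp only [mem_filter, mem_univ, true_and, Finset.notMem_empty, iff_false]
        rintro ⟨⟨h1, h2⟩, h3⟩
        refine h ⟨τ', ?_⟩
        ext i; fin_cases i <;> simp [h1, h2, h3]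
      rw [this, Finset.prod_empty, hY2]
      rintro ⟨g, hg⟩
      rw [hρ', add_assoc] at hg
      refine h ⟨g0⁻¹ * g, ?_⟩
      rw [ha, hainv, ← add_left_cancel hg]; abel
end

section
variable (p : ℕ) [Fact p.Prime] {L : Type} [Field L]

lemma solv [IsFF p L] {n : ℕ} (hn0 : 0 < n) (hn : (n : L) ≠ 0) {ζ : L} (hζ : IsPrimitiveRoot ζ n) (U : Fin 3 → L) (hU : ∀ i, U i ≠ 0) {c : L} (hc : c ≠ 0)
    (H : ∀ (F : Type) [Field F] [Algebra L F] [FiniteDimensional L F] (s1 s2 : F),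
      s1 ^ n = algebraMap L F (U 0) → s2 ^ n = algebraMap L F (U 1) → ∀ v : FFPrime F,
        (n : ℤ) ∣ v.val (algebraMap L F (U 2)) ∧ ((n : ℤ) ∣ v.val (algebraMap L F c) ∨
          n.Prime ∧ ∃ b : F, b ≠ 0 ∧ 0 < v.ord (algebraMap L F (U 2) / b ^ n - 1))) : PP n ζ U c := by
  classical
  have : NeZero n := ⟨hn0.ne'⟩
  let P : Polynomial L := ∏ i : Fin 3, (Polynomial.X ^ n - Polynomial.C (U i))
  let M := P.SplittingField
  have hPs := Polynomial.SplittingField.splits P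
  have hP0 : P ≠ 0 := (Polynomial.monic_prod_of_monic _ _ fun i _ => Polynomial.monic_X_pow_sub_C _ hn0.ne').ne_zero
  have hnM : (n : M) ≠ 0 := by
    have := (map_ne_zero_iff (algebraMap L M) (algebraMap L M).injective).mpr hn
    rwa [map_natCast] at this
  have hζM := hζ.map_of_injective (algebraMap L M).injective
  have hex : ∀ i, ∃ s : M, s ^ n = algebraMap L M (U i) := by
    intro i
    have hdvd : (Polynomial.X ^ n - Polynomial.C (U i)) ∣ P := Finset.dvd_prod_of_mem _ (mem_univ i)
    have hsp : ((Polynomial.X ^ n - Polynomial.C (U i)).map (algebraMap L M)).Splits :=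
      hPs.of_dvd (Polynomial.map_ne_zero hP0) (Polynomial.map_dvd _ hdvd)
    obtain ⟨s, hs⟩ := hsp.exists_eval_eq_zero (by
      rw [Polynomial.degree_map, Polynomial.degree_X_pow_sub_C hn0]
      exact_mod_cast hn0.ne')
    refine ⟨s, ?_⟩
    simpa [sub_eq_zero] using hs
  choose s hs using hex
  have hs0 : ∀ i, s i ≠ 0 := by
    intro i h
    have := hs i
    rw [h, zero_pow hn0.ne'] at this
    exact hU i ((map_eq_zero _).mp this.symm)
  have hroot : ∀ i (x : M), x ^ n = algebraMap L M (U i) → ∃ k < n, x = algebraMap L M ζ ^ k * s i := by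
    intro i x hx
    have : (x / s i) ^ n = 1 := by
      rw [div_pow, hx, hs, div_self]; exact (map_ne_zero _).mpr (hU i)
    obtain ⟨k, hk, hk'⟩ := hζM.eq_pow_of_pow_eq_one this
    exact ⟨k, hk, by rw [hk', div_mul_cancel₀ _ (hs0 i)]⟩
  have hrs : ∀ x ∈ P.rootSet M, ∃ i, x ^ n = algebraMap L M (U i) := by
    intro x hx
    rw [Polynomial.mem_rootSet] at hx
    have hx2 : ∏ i : Fin 3, Polynomial.aeval x (Polynomial.X ^ n - Polynomial.C (U i)) = 0 := (map_prod _ _ _).symm.trans hx.2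
    obtain ⟨i, _, hi⟩ := Finset.prod_eq_zero_iff.mp hx2
    refine ⟨i, ?_⟩
    simpa [sub_eq_zero] using hi
  have hsep : Algebra.IsSeparable L M := by
    have htop : adjoin L (P.rootSet M) = ⊤ := by
      apply IntermediateField.toSubalgebra_injective
      rw [IntermediateField.top_toSubalgebra]
      exact top_le_iff.mp ((Polynomial.SplittingField.adjoin_rootSet P).symm.le.trans (IntermediateField.algebra_adjoin_le_adjoin _ _))
    have h1 : Algebra.IsSeparable L (adjoin L (P.rootSet M)) := by
      rw [IntermediateField.isSeparable_adjoin_iff_isSeparable]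
      intro x hx
      obtain ⟨i, hi⟩ := hrs x hx
      refine Polynomial.Separable.of_dvd (Polynomial.separable_X_pow_sub_C (U i) hn (hU i)) (minpoly.dvd L x ?_)
      simp [hi]
    rw [htop] at h1
    exact Algebra.IsSeparable.of_algHom L _ (IntermediateField.topEquiv (F := L) (E := M)).symm.toAlgHom
  have hgal : IsGalois L M := ⟨⟩
  have hext : ∀ g h : M ≃ₐ[L] M, (∀ i, g (s i) = h (s i)) → g = h := by
    intro g h hgh
    have : (g : M →ₐ[L] M) = h := by
      refine AlgHom.ext_of_adjoin_eq_top (Polynomial.SplittingField.adjoin_rootSet P) ?_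
      intro x hx
      obtain ⟨i, hi⟩ := hrs x hx
      obtain ⟨k, _, rfl⟩ := hroot i x hi
      change g (algebraMap L M ζ ^ k * s i) = h (algebraMap L M ζ ^ k * s i)
      rw [map_mul, map_mul, map_pow, map_pow, g.commutes, h.commutes, hgh]
    ext x
    exact DFunLike.congr_fun this x
  have hga : ∀ (g : M ≃ₐ[L] M) i, ∃ k < n, g (s i) = algebraMap L M ζ ^ k * s i := fun g i =>
    hroot i _ (by rw [← map_pow, hs, g.commutes])
  choose k hk hgk using hga
  let a : (M ≃ₐ[L] M) → (Fin 3 → ZMod n) := fun g i => (k g i : ZMod n)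
  have hav : ∀ g i, (a g i).val = k g i := fun g i => ZMod.val_cast_of_lt (hk g i)
  have hag : ∀ g i, g (s i) = algebraMap L M ζ ^ (a g i).val * s i := by intro g i; rw [hav, hgk]
  have hadd : ∀ g h, a (g * h) = a g + a h := by
    intro g h
    ext i
    apply ZMod.val_injective n
    refine hζM.pow_inj (val_lt _) (val_lt _) (mul_right_cancel₀ (hs0 i) ?_)
    rw [← hag, Pi.add_apply, zeta_add hζM.pow_eq_one, AlgEquiv.mul_apply, hag h, map_mul, map_pow, commutes, hag g]
    ring
  have hinj : Injective a := by
    intro g h hgh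
    refine hext g h fun i => ?_
    rw [hag, hag, hgh]
  let F := adjoin L {s 0, s 1}
  have hs0F : s 0 ∈ F := subset_adjoin L _ (by simp)
  have hs1F : s 1 ∈ F := subset_adjoin L _ (by simp)
  have : IsFF p F := IsFF.of_finite (X := L) p F
  have : IsFF p M := IsFF.of_finite (X := L) p M
  have hzero : ∀ g i, a g i = 0 ↔ g (s i) = s i := by
    intro g i
    constructor
    · intro h; rw [hag, h]; simp
    · intro h
      apply ZMod.val_injective n
      refine hζM.pow_inj (val_lt _) (val_lt _) (mul_right_cancel₀ (hs0 i) ?_)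
      rw [← hag, h]; simp
  have hfix0 : ∀ g : M ≃ₐ[F] M, g (s 0) = s 0 := fun g => g.commutes (⟨s 0, hs0F⟩ : F)
  have hfix1 : ∀ g : M ≃ₐ[F] M, g (s 1) = s 1 := fun g => g.commutes (⟨s 1, hs1F⟩ : F)
  have hkum : Kum F n (algebraMap L F (U 2)) (s 2) := by
    refine ⟨?_, (map_ne_zero _).mpr (hU 2), ?_, ⟨algebraMap L F ζ, hζ.map_of_injective (algebraMap L F).injective⟩⟩
    · rw [hs, ← IsScalarTower.algebraMap_apply]
    · intro g hg
      have : g.restrictScalars L = 1 := by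
        refine hext _ _ fun i => ?_
        fin_cases i
        · exact hfix0 g
        · exact hfix1 g
        · exact hg
      ext x
      exact DFunLike.congr_fun this x
  have hH := H F ⟨s 0, hs0F⟩ ⟨s 1, hs1F⟩ (Subtype.ext (by simpa using hs 0)) (Subtype.ext (by simpa using hs 1))
  obtain ⟨y, hy⟩ := hnp p hn0 hnM hkum (fun v => (hH v).1) (c := algebraMap L F c) ((map_ne_zero _).mpr hc)
    (fun v => (hH v).2)
  obtain ⟨Y, hY1, hY2⟩ := exists_equiv_Y a hadd hinj y c (by
    rw [IsScalarTower.algebraMap_apply L F M, ← hy]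
    symm
    refine Finset.prod_bij (fun g _ => g.restrictScalars L) ?_ ?_ ?_ ?_
    · intro g _
      rw [mem_filter, hzero, hzero]
      exact ⟨mem_univ _, hfix0 g, hfix1 g⟩
    · intro g _ h _ hgh
      ext x
      exact DFunLike.congr_fun hgh x
    · intro τ hτ
      rw [mem_filter, hzero, hzero] at hτ
      have hF : F ≤ IntermediateField.fixedField (zpowers τ) := by
        rw [IntermediateField.adjoin_le_iff]
        rintro x hx ⟨g, m, rfl⟩
        have hx : τ x = x := by
          rcases hx with rfl | rfl
          · exact hτ.2.1
          · exact hτ.2.2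
        have : τ ∈ MulAction.stabilizer (M ≃ₐ[L] M) x := hx
        exact zpow_mem this m
      refine ⟨{ τ with commutes' := fun x => ?_ }, mem_univ _, ?_⟩
      · exact hF x.2 ⟨τ, Subgroup.mem_zpowers τ⟩
      · ext x; rfl
    · intro g _; rfl)
  exact pp_of_equiv hζ hnM U s hs0 hs a hag Y hY1 hY2
end

section
open Polynomial

lemma irr_of_prime_pow {κ : Type*} [Field κ] {q m : ℕ} (hq : q.Prime) {ζ : κ} (hζ : IsPrimitiveRoot ζ (q ^ m))
    {a : κ} (ha0 : a ≠ 0) (ha : ∀ b, b ^ q ≠ a) : Irreducible (X ^ (q ^ m) - C a : κ[X]) := by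
  have hn0 : 0 < q ^ m := pow_pos hq.pos _
  set n := q ^ m with hn
  let Ω := AlgebraicClosure κ
  obtain ⟨z, hz⟩ := IsAlgClosed.exists_pow_nat_eq (algebraMap κ Ω a) hn0
  have hz0 : z ≠ 0 := by
    rintro rfl
    rw [zero_pow hn0.ne'] at hz
    exact ha0 ((map_eq_zero _).mp hz.symm)
  have hInt : IsIntegral κ z := Algebra.IsIntegral.isIntegral z
  have hfd : FiniteDimensional κ (adjoin κ {z}) := adjoin.finiteDimensional hInt
  set d := finrank κ (adjoin κ {z}) with hd
  have hdm : (minpoly κ z).natDegree = d := (adjoin.finrank hInt).symm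
  have hdvd : minpoly κ z ∣ X ^ n - C a := minpoly.dvd κ z (by simp [hz])
  have hdeg : (X ^ n - C a : κ[X]).natDegree = n := natDegree_X_pow_sub_C
  have hmon : (X ^ n - C a : κ[X]).Monic := monic_X_pow_sub_C a hn0.ne'
  have hdn : d ≤ n := by rw [← hdm, ← hdeg]; exact natDegree_le_of_dvd hdvd hmon.ne_zero
  have hzd : ∃ b : κ, algebraMap κ Ω b = z ^ d := by
    let N := Algebra.norm κ (IntermediateField.AdjoinSimple.gen κ z)
    have hN : N ^ n = a ^ d := by
      rw [← map_pow]
      have : IntermediateField.AdjoinSimple.gen κ z ^ n = algebraMap κ _ a := by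
        apply Subtype.ext
        simpa using hz
      rw [this, Algebra.norm_algebraMap]
    have h1 : (algebraMap κ Ω N / z ^ d) ^ n = 1 := by
      rw [div_pow, ← map_pow, hN, ← pow_mul, mul_comm d, pow_mul, hz, map_pow, div_self]
      exact pow_ne_zero _ ((_root_.map_ne_zero _).mpr ha0)
    have : NeZero n := ⟨hn0.ne'⟩
    obtain ⟨i, _, hi⟩ := (hζ.map_of_injective (algebraMap κ Ω).injective).eq_pow_of_pow_eq_one h1
    have hζ0 : ζ ≠ 0 := hζ.ne_zero hn0.ne'
    refine ⟨N / ζ ^ i, ?_⟩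
    rw [map_div₀, map_pow, hi]
    have hN0 : algebraMap κ Ω N ≠ 0 := by
      intro h
      rw [h, zero_div, zero_pow hn0.ne'] at h1
      exact zero_ne_one h1
    exact div_div_cancel₀ hN0
  have hdeq : d = n := by
    by_contra hne
    have hlt : d < n := lt_of_le_of_ne hdn hne
    have hd0 : 0 < d := Module.finrank_pos
    obtain ⟨k, hk, hg⟩ := (Nat.dvd_prime_pow hq).mp (hn ▸ Nat.gcd_dvd_right d n : Nat.gcd d n ∣ q ^ m)
    have hkm : k < m := by
      by_contra h
      have h2 : k = m := by omega
      have h3 : Nat.gcd d n = n := by rw [hg, h2]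
      have := Nat.le_of_dvd hd0 (h3 ▸ Nat.gcd_dvd_left d n)
      omega
    obtain ⟨b, hb⟩ := hzd
    have hbz : z ^ (q ^ k) = algebraMap κ Ω (b ^ (Nat.gcdA d n) * a ^ (Nat.gcdB d n)) := by
      rw [map_mul, map_zpow₀, map_zpow₀, hb, ← hz, ← zpow_natCast, ← hg, Nat.gcd_eq_gcd_ab, zpow_add₀ hz0, zpow_mul, zpow_mul,
        zpow_natCast, zpow_natCast]
    refine ha ((b ^ (Nat.gcdA d n) * a ^ (Nat.gcdB d n)) ^ (q ^ (m - k - 1))) ((algebraMap κ Ω).injective ?_)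
    rw [← hz, map_pow, map_pow, ← hbz, ← pow_mul, ← pow_mul, ← pow_succ, ← pow_add]
    congr 2
    omega
  have heq : minpoly κ z = X ^ n - C a := by
    refine (Polynomial.eq_of_monic_of_dvd_of_natDegree_le (minpoly.monic hInt) hmon hdvd ?_).symm
    rw [hdeg, hdm, hdeq]
  rw [← heq]
  exact minpoly.irreducible hInt

lemma adj_unique {F : Type*} [Field F] {n : ℕ} (hn : 0 < n) (a : F) (w : Fin n → F)
    (h : ∑ k, algebraMap F (AdjoinRoot (X ^ n - C a)) (w k) * (AdjoinRoot.root (X ^ n - C a)) ^ (k : ℕ) = 0) : ∀ k, w k = 0 := by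
  set f : F[X] := X ^ n - C a with hf
  have hmon : f.Monic := monic_X_pow_sub_C a hn.ne'
  let Q : F[X] := ∑ k : Fin n, C (w k) * X ^ (k : ℕ)
  have hQ : AdjoinRoot.mk f Q = 0 := by
    rw [← h]
    simp only [Q, map_sum, map_mul, map_pow, AdjoinRoot.mk_X, AdjoinRoot.mk_C]
    rfl
  have hdvd : f ∣ Q := AdjoinRoot.mk_eq_zero.mp hQ
  have hdeg : Q.degree < f.degree := by
    rw [hf, degree_X_pow_sub_C hn]
    refine lt_of_le_of_lt (degree_sum_le _ _) ?_
    rw [Finset.sup_lt_iff (by exact WithBot.bot_lt_coe n)]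
    intro k _
    exact lt_of_le_of_lt (degree_C_mul_X_pow_le _ _) (by exact_mod_cast k.2)
  have hQ0 : Q = 0 := by
    by_contra hne
    exact absurd (Polynomial.degree_le_of_dvd hdvd hne) (not_le.mpr hdeg)
  intro k
  have := congrArg (fun P : F[X] => P.coeff k) hQ0
  simp only [Q, finset_sum_coeff, coeff_C_mul, coeff_X_pow, coeff_zero] at this
  rw [sum_eq_single k] at this
  · simpa using this
  · intro b _ hb
    rw [if_neg (fun h => hb (Fin.ext h.symm)), mul_zero]
  · intro h; exact absurd (mem_univ _) h
end

section
open Classical in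
def ext1 {A : Type*} [CommRing A] {n : ℕ} (Y : Fin n → A) : (Fin 3 → Fin n) → A := fun r => if (r 0 : ℕ) = 0 ∧ (r 1 : ℕ) = 0 then Y (r 2) else 0

open Classical in
def psi {A : Type*} [CommRing A] (n : ℕ) (ζ a : A) (Y : Fin n → A) (k : Fin n) : A :=
  ∑ r ∈ univ.filter (fun r : Fin 3 → Fin n => r 2 = k), Phi n ζ ![1, 1, a] (ext1 Y) r

open Classical in
lemma psi_map {A B : Type*} [CommRing A] [CommRing B] (φ : A →+* B) (n : ℕ) (ζ a : A) (Y : Fin n → A) (k : Fin n) : φ (psi n ζ a Y k) = psi n (φ ζ) (φ a) (fun k => φ (Y k)) k := by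
  simp only [psi, map_sum, Phi_map]
  refine sum_congr rfl fun r _ => ?_
  congr 1
  · ext i; fin_cases i <;> simp
  · ext r
    simp only [ext1]
    split_ifs <;> simp

lemma Phi_smul {A : Type*} [CommRing A] (n : ℕ) (ζ : A) (U : Fin 3 → A) (y : (Fin 3 → Fin n) → A) (π : A)
    (r : Fin 3 → Fin n) : Phi n ζ U (fun r => π * y r) r = π ^ n * Phi n ζ U y r := by
  classical
  simp only [Phi, mul_sum, mul_assoc]
  refine sum_congr rfl fun f _ => ?_
  rw [Finset.prod_mul_distrib]
  simp [mul_assoc]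

lemma psi_smul {A : Type*} [CommRing A] (n : ℕ) (ζ a : A) (Y : Fin n → A) (π : A) (k : Fin n) : psi n ζ a (fun k => π * Y k) k = π ^ n * psi n ζ a Y k := by
  classical
  simp only [psi, mul_sum, ← Phi_smul]
  refine sum_congr rfl fun r _ => ?_
  congr 1
  ext r
  simp only [ext1]
  split_ifs <;> simp

open Classical in
lemma sum_fib {A : Type*} [CommRing A] {n : ℕ} (g : (Fin 3 → Fin n) → A) (z : A) :
    ∑ r, g r * z ^ (r 2 : ℕ) = ∑ k : Fin n, (∑ r ∈ univ.filter (fun r : Fin 3 → Fin n => r 2 = k), g r) * z ^ (k : ℕ) := by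
  rw [← Finset.sum_fiberwise_of_maps_to (s := univ) (t := univ) (g := fun r : Fin 3 → Fin n => r 2)
    (fun _ _ => mem_univ _)]
  refine sum_congr rfl fun k _ => ?_
  rw [sum_mul]
  refine sum_congr rfl fun r hr => ?_
  rw [(mem_filter.mp hr).2]

lemma psi_id {A : Type*} [CommRing A] {n : ℕ} (hn : 0 < n) (ζ a : A) (Y : Fin n → A) (z : A) (hz : z ^ n = a) :
    ∏ l : Fin n, ∑ k, Y k * ζ ^ ((l : ℕ) * (k : ℕ)) * z ^ (k : ℕ) = ∑ k, psi n ζ a Y k * z ^ (k : ℕ) := by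
  classical
  have h := Phi_id hn ζ ![1, 1, a] (ext1 Y) ![1, 1, z] (by intro i; fin_cases i <;> simp [hz])
  simp only [Fin.prod_univ_three, Matrix.cons_val_zero, Matrix.cons_val_one, Matrix.cons_val, one_pow, one_mul] at h
  rw [sum_fib (fun r => Phi n ζ ![1, 1, a] (ext1 Y) r)] at h
  change _ = ∑ k, psi n ζ a Y k * z ^ (k : ℕ) at h
  rw [← h]
  refine prod_congr rfl fun l _ => ?_
  let i : Fin n → (Fin 3 → Fin n) := fun k => ![⟨0, hn⟩, ⟨0, hn⟩, k]
  rw [← Finset.sum_subset (Finset.subset_univ (univ.image i))]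
  · rw [sum_image]
    · refine sum_congr rfl fun k _ => ?_
      simp [i, ext1]
    · intro k _ k' _ h
      exact congrFun h 2
  · intro r _ hr
    have : ¬ ((r 0 : ℕ) = 0 ∧ (r 1 : ℕ) = 0) := by
      rintro ⟨h0, h1⟩
      apply hr
      rw [mem_image]
      refine ⟨r 2, mem_univ _, ?_⟩
      ext j
      fin_cases j <;> simp [i, h0, h1]
    simp [ext1, this]

lemma psi_ne {κ : Type*} [Field κ] {n : ℕ} (hn : 0 < n) {ζ a : κ} (hζ : ζ ≠ 0)
    (hirr : Irreducible (Polynomial.X ^ n - Polynomial.C a : Polynomial κ)) (Y : Fin n → κ) (hY : ∃ k, Y k ≠ 0) : ∃ k, psi n ζ a Y k ≠ 0 := by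
  by_contra hcon
  push Not at hcon
  have : Fact (Irreducible (Polynomial.X ^ n - Polynomial.C a : Polynomial κ)) := ⟨hirr⟩
  let A := AdjoinRoot (Polynomial.X ^ n - Polynomial.C a : Polynomial κ)
  let z : A := AdjoinRoot.root _
  have hz : z ^ n = algebraMap κ A a := by
    have := AdjoinRoot.isRoot_root (Polynomial.X ^ n - Polynomial.C a : Polynomial κ)
    simp [sub_eq_zero] at this
    exact this
  have h := psi_id hn (algebraMap κ A ζ) (algebraMap κ A a) (fun k => algebraMap κ A (Y k)) z hz
  simp only [← psi_map, hcon, map_zero, zero_mul, Finset.sum_const_zero] at h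
  obtain ⟨l, _, hl⟩ := Finset.prod_eq_zero_iff.mp h
  have h2 := adj_unique hn a (fun k => Y k * ζ ^ ((l : ℕ) * (k : ℕ))) (by
    rw [← hl]
    refine sum_congr rfl fun k _ => ?_
    rw [map_mul, map_pow])
  obtain ⟨k, hk⟩ := hY
  exact mul_ne_zero hk (pow_ne_zero _ hζ) (h2 k)

open Classical in
lemma psi_contract {E : Type*} [Field E] {n : ℕ} (hn : 0 < n) (ζ a x0 x1 : E) (y : (Fin 3 → Fin n) → E) (k : Fin n) :
    psi n ζ a (fun k => ∑ r ∈ univ.filter (fun r : Fin 3 → Fin n => r 2 = k), y r * (x0 ^ (r 0 : ℕ) * x1 ^ (r 1 : ℕ))) k = ∑ r ∈ univ.filter (fun r : Fin 3 → Fin n => r 2 = k),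
      Phi n ζ ![x0 ^ n, x1 ^ n, a] y r * (x0 ^ (r 0 : ℕ) * x1 ^ (r 1 : ℕ)) := by
  let A := AdjoinRoot (Polynomial.X ^ n - Polynomial.C a : Polynomial E)
  let z : A := AdjoinRoot.root _
  have hz : z ^ n = algebraMap E A a := by
    have := AdjoinRoot.isRoot_root (Polynomial.X ^ n - Polynomial.C a : Polynomial E)
    simp [sub_eq_zero] at this
    exact this
  set Y := (fun k => ∑ r ∈ univ.filter (fun r : Fin 3 → Fin n => r 2 = k), y r * (x0 ^ (r 0 : ℕ) * x1 ^ (r 1 : ℕ))) with hY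
  let φ := algebraMap E A
  have h1 := psi_id hn (φ ζ) (φ a) (fun k => φ (Y k)) z hz
  have h2 := Phi_id hn (φ ζ) ![φ (x0 ^ n), φ (x1 ^ n), φ a] (fun r => φ (y r)) ![φ x0, φ x1, z]
    (by intro i; fin_cases i <;> simp [hz, φ])
  simp only [Fin.prod_univ_three, Matrix.cons_val_zero, Matrix.cons_val_one, Matrix.cons_val] at h2
  have h3 : ∀ r, Phi n (φ ζ) ![φ (x0 ^ n), φ (x1 ^ n), φ a] (fun r => φ (y r)) r = φ (Phi n ζ ![x0 ^ n, x1 ^ n, a] y r) := by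
    intro r
    rw [Phi_map]
    congr 1
    ext i; fin_cases i <;> simp
  have h4 := sum_fib (fun r => φ (Phi n ζ ![x0 ^ n, x1 ^ n, a] y r * (x0 ^ (r 0 : ℕ) * x1 ^ (r 1 : ℕ)))) z
  have h5 : ∑ k, φ (psi n ζ a Y k) * z ^ (k : ℕ) = ∑ k, φ (∑ r ∈ univ.filter (fun r : Fin 3 → Fin n => r 2 = k),
      Phi n ζ ![x0 ^ n, x1 ^ n, a] y r * (x0 ^ (r 0 : ℕ) * x1 ^ (r 1 : ℕ))) * z ^ (k : ℕ) := by
    simp only [psi_map]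
    rw [← h1]
    simp only [map_sum φ]
    rw [← h4]
    simp only [map_mul, map_pow, ← h3] at h2 ⊢
    simp only [← mul_assoc] at h2 ⊢
    rw [← h2]
    refine prod_congr rfl fun l _ => ?_
    have h6 := sum_fib (fun r => φ (y r * (x0 ^ (r 0 : ℕ) * x1 ^ (r 1 : ℕ)))) (φ ζ ^ (l : ℕ) * z)
    simp only [← map_sum φ] at h6
    change _ = ∑ k, φ (Y k) * _ at h6
    simp only [mul_pow, ← pow_mul, ← mul_assoc] at h6
    rw [← h6]
    refine sum_congr rfl fun r _ => ?_
    simp only [map_mul, map_pow]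
    ring
  have h7 := adj_unique hn a (fun k => psi n ζ a Y k - ∑ r ∈ univ.filter (fun r : Fin 3 → Fin n => r 2 = k),
      Phi n ζ ![x0 ^ n, x1 ^ n, a] y r * (x0 ^ (r 0 : ℕ) * x1 ^ (r 1 : ℕ))) (by
    simp only [map_sub, sub_mul, sum_sub_distrib]
    rw [sub_eq_zero]
    simpa only [map_sub, φ] using h5)
  exact sub_eq_zero.mp (h7 k)
end

namespace FFVal
variable {X : Type} [Field X] (V : FFVal X)

def O : Subring X where
  carrier := {x | 0 ≤ V.ord x}
  mul_mem' hx hy := V.ord_mul_nonneg hx hy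
  one_mem' := by simp [V.ord_one]
  add_mem' hx hy := V.le_ord_add hx hy
  zero_mem' := by simp [V.ord_zero]
  neg_mem' {x} hx := by simpa [V.ord_neg] using hx

lemma ord_mul_pos {x y : X} (hx : 0 ≤ V.ord x) (hy : 0 < V.ord y) : 0 < V.ord (x * y) := by
  rw [V.ord_mul]; exact lt_of_lt_of_le hy (le_add_of_nonneg_left hx)

lemma ord_mul_le {x y : X} {n : WithTop ℚ} (hx : 0 ≤ V.ord x) (hy : n ≤ V.ord y) : n ≤ V.ord (x * y) := by
  rw [V.ord_mul]; exact le_add_of_nonneg_of_le hx hy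

def mI : Ideal V.O where
  carrier := {x | 0 < V.ord (x : X)}
  add_mem' hx hy := V.lt_ord_add hx hy
  zero_mem' := by simp [V.ord_zero]
  smul_mem' c x hx := by
    change 0 < V.ord ((c : X) * (x : X))
    exact V.ord_mul_pos c.2 hx

lemma mem_mI {x : V.O} : x ∈ V.mI ↔ 0 < V.ord (x : X) := Iff.rfl

lemma ord_inv_zero {x : X} (hx : V.ord x = 0) : V.ord x⁻¹ = 0 := by
  have hx0 : x ≠ 0 := V.ne_zero_of_ord (n := 0) hx
  rw [V.ord_eq (inv_ne_zero hx0), V.val_inv hx0, V.val_eq_of_ord (n := 0) hx]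
  simp

instance mI_max : V.mI.IsMaximal := by
  rw [Ideal.isMaximal_iff]
  refine ⟨by rw [mem_mI]; simp [V.ord_one], ?_⟩
  intro J x hJ hx hxJ
  rw [mem_mI, not_lt] at hx
  have hx0 : V.ord (x : X) = 0 := le_antisymm hx x.2
  have hxne : (x : X) ≠ 0 := V.ne_zero_of_ord (n := 0) hx0
  have := J.mul_mem_left (⟨(x : X)⁻¹, (V.ord_inv_zero hx0).ge⟩ : V.O) hxJ
  convert this
  apply Subtype.ext
  simp [hxne]

lemma pow_ord_zero {x : X} (hx : V.ord x = 0) (n : ℕ) : V.ord (x ^ n) = 0 := by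
  induction n with
  | zero => simp [V.ord_one]
  | succ n ih => rw [pow_succ, V.ord_mul, ih, hx, add_zero]

lemma one_unit {x : X} (hx : 0 < V.ord (x - 1)) : V.ord x = 0 := by
  have := V.ord_add_eq_left (x := 1) (y := x - 1) (by rwa [V.ord_one])
  rwa [add_sub_cancel, V.ord_one] at this

lemma newton {n : ℕ} (hn : V.ord (n : X) = 0) {u : X} (hu : 0 < V.ord (u - 1)) (B : ℚ) : ∃ x, 0 < V.ord (x - 1) ∧ (B : WithTop ℚ) < V.ord (x ^ n - u) := by
  by_cases hu1 : u = 1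
  · refine ⟨1, by simp [V.ord_zero], by simp [hu1, V.ord_zero]⟩
  have hu2 : u - 1 ≠ 0 := sub_ne_zero.mpr hu1
  obtain ⟨δ, hδ⟩ : ∃ δ, δ = V.val (u - 1) := ⟨_, rfl⟩
  have hδ0 : 0 < δ := hδ ▸ (V.ord_pos_iff hu2).mp hu
  have key : ∀ k : ℕ, ∃ x, 0 < V.ord (x - 1) ∧ (((k + 1) * δ : ℚ) : WithTop ℚ) ≤ V.ord (x ^ n - u) := by
    intro k
    induction k with
    | zero =>
      refine ⟨1, by simp [V.ord_zero], ?_⟩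
      rw [one_pow, V.ord_sub_comm, V.le_ord_iff hu2, hδ]; simp
    | succ k ih =>
      obtain ⟨x, hx, he⟩ := ih
      have hxu := V.one_unit hx
      have hx0 : x ≠ 0 := V.ne_zero_of_ord (n := 0) hxu
      have hn0 : (n : X) ≠ 0 := V.ne_zero_of_ord (n := 0) hn
      let h := ((n : X) * x ^ (n - 1))⁻¹ * (u - x ^ n)
      have hh : V.ord h = V.ord (x ^ n - u) := by
        rw [V.ord_mul, V.ord_inv_zero, zero_add, V.ord_sub_comm]
        rw [V.ord_mul, hn, V.pow_ord_zero hxu, add_zero]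
      have hk0 : (0 : ℚ) < (k + 1) * δ := by positivity
      have hhpos : 0 < V.ord h := by
        rw [hh]; refine lt_of_lt_of_le ?_ he; exact_mod_cast hk0
      refine ⟨x + h, ?_, ?_⟩
      · have : x + h - 1 = (x - 1) + h := by ring
        rw [this]; exact V.lt_ord_add hx hhpos
      · have hex := Polynomial.powAddExpansion (⟨x, hxu.ge⟩ : V.O) ⟨h, hhpos.le⟩ n
        obtain ⟨⟨k', hk'⟩, he'⟩ := hex
        have he'' : (x + h) ^ n = x ^ n + n * x ^ (n - 1) * h + k' * h ^ 2 := by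
          have := congrArg Subtype.val he'
          push_cast at this
          exact this
        have : (x + h) ^ n - u = k' * h ^ 2 := by
          rw [he'']
          simp only [h]
          rw [mul_inv_cancel_left₀ (mul_ne_zero hn0 (pow_ne_zero _ hx0))]
          ring
        rw [this]
        refine V.ord_mul_le hk' ?_
        rw [pow_two, V.ord_mul, hh]
        refine le_trans ?_ (add_le_add he he)
        rw [← WithTop.coe_add, coe_le_coe]
        push_cast
        have : (0 : ℚ) ≤ k * δ := by positivity
        nlinarith
  obtain ⟨k, hk⟩ := exists_nat_gt (B / δ)
  obtain ⟨x, hx, he⟩ := key k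
  refine ⟨x, hx, lt_of_lt_of_le ?_ he⟩
  rw [coe_lt_coe]
  rw [div_lt_iff₀ hδ0] at hk
  nlinarith

lemma cont_mul {x x' y y' : X} {D : WithTop ℚ} (hx : 0 ≤ V.ord x) (hy' : 0 ≤ V.ord y') (h1 : D ≤ V.ord (x - x')) (h2 : D ≤ V.ord (y - y')) : D ≤ V.ord (x * y - x' * y') := by
  have : x * y - x' * y' = x * (y - y') + y' * (x - x') := by ring
  rw [this]
  exact V.le_ord_add (V.ord_mul_le hx h2) (V.ord_mul_le hy' h1)

lemma cont_pow {x x' : X} {D : WithTop ℚ} (hx : 0 ≤ V.ord x) (hx' : 0 ≤ V.ord x') (h1 : D ≤ V.ord (x - x')) (n : ℕ) : D ≤ V.ord (x ^ n - x' ^ n) := by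
  induction n with
  | zero => simp [V.ord_zero]
  | succ n ih => rw [pow_succ, pow_succ]; exact V.cont_mul (V.ord_pow_nonneg hx n) hx' ih h1

lemma Phi_cont (n : ℕ) (ζ : X) (U U' : Fin 3 → X) (y : (Fin 3 → Fin n) → X) : ∃ C : ℚ, ∀ (U' : Fin 3 → X) (D : ℚ), (∀ i, 0 ≤ V.ord (U i)) → (∀ i, 0 ≤ V.ord (U' i)) →
      (∀ i, (D : WithTop ℚ) ≤ V.ord (U i - U' i)) → ∀ r, ((C + D : ℚ) : WithTop ℚ) ≤ V.ord (Phi n ζ U y r - Phi n ζ U' y r) := by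
  classical
  let coef : (Fin n → (Fin 3 → Fin n)) → X := fun f => ∏ l, y (f l) * ζ ^ ((l : ℕ) * (f l 2 : ℕ))
  obtain ⟨C, hC⟩ := Finite.exists_ge (fun f => V.val (coef f))
  refine ⟨C, fun U' D h1 h2 h3 r => ?_⟩
  simp only [Phi]
  rw [← sum_sub_distrib]
  refine V.le_ord_sum _ _ fun f _ => ?_
  rw [← mul_sub, V.ord_mul, WithTop.coe_add]
  refine add_le_add ?_ ?_
  · by_cases h0 : coef f = 0
    · have : V.ord (coef f) = ⊤ := by rw [h0, V.ord_zero]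
      simp only [coef] at this
      rw [this]; exact le_top
    · exact (V.le_ord_iff h0).mpr (hC f)
  · have hp := fun i => V.cont_pow (h1 i) (h2 i) (h3 i) (expo n f i / n)
    rw [Fin.prod_univ_three, Fin.prod_univ_three]
    refine V.cont_mul (V.ord_mul_nonneg (V.ord_pow_nonneg (h1 _) _) (V.ord_pow_nonneg (h1 _) _)) (V.ord_pow_nonneg (h2 _) _) ?_ (hp 2)
    exact V.cont_mul (V.ord_pow_nonneg (h1 _) _) (V.ord_pow_nonneg (h2 _) _) (hp 0) (hp 1)

lemma res_prim {n : ℕ} (hn0 : 0 < n) (hn : V.ord (n : X) = 0) {ζ : V.O} (hζ : IsPrimitiveRoot (ζ : X) n) : IsPrimitiveRoot (Ideal.Quotient.mk V.mI ζ) n := by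
  have hζO : ζ ^ n = 1 := Subtype.ext (by push_cast; exact hζ.pow_eq_one)
  refine ⟨by rw [← map_pow, hζO, map_one], fun l hl => ?_⟩
  apply hζ.dvd_of_pow_eq_one
  by_contra hne
  have h1 : ((ζ : X) ^ l) ^ n = 1 := by rw [← pow_mul, mul_comm, pow_mul, hζ.pow_eq_one, one_pow]
  have h2 : ∑ i ∈ range n, ((ζ : X) ^ l) ^ i = 0 := by
    rw [geom_sum_eq hne, h1]; simp
  have h3 : ∑ i ∈ range n, (ζ ^ l) ^ i = 0 := Subtype.ext (by push_cast; exact h2)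
  have h4 := congrArg (Ideal.Quotient.mk V.mI) h3
  simp only [map_sum, map_pow, map_pow, hl, one_pow, map_zero, sum_const, Finset.card_range, nsmul_eq_mul, mul_one] at h4
  have h5 : Ideal.Quotient.mk V.mI (n : V.O) = 0 := by rw [map_natCast]; exact h4
  rw [Ideal.Quotient.eq_zero_iff_mem, mem_mI] at h5
  push_cast at h5
  rw [hn] at h5
  exact lt_irrefl _ h5

lemma obstruct {q m : ℕ} (hq : q.Prime) (hn : V.ord ((q ^ m : ℕ) : X) = 0) {ζ : X} (hζ : IsPrimitiveRoot ζ (q ^ m))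
    (U : Fin 3 → X) (h0 : 0 < V.ord (U 0 - 1)) (h1 : 0 < V.ord (U 1 - 1)) (h2 : V.ord (U 2) = 0)
    (hnr : ∀ x, 0 ≤ V.ord x → ¬ 0 < V.ord (x ^ q - U 2)) {c : X} (hc : c ≠ 0) (h : PP (q ^ m) ζ U c) : ∃ π, π ≠ 0 ∧ V.val c = (q ^ m : ℕ) * V.val π := by
  classical
  have hn0 : 0 < q ^ m := pow_pos hq.pos _
  set n := q ^ m with hnn
  obtain ⟨y, hy⟩ := h
  have hζu : V.ord ζ = 0 := by
    have hz0 := hζ.ne_zero hn0.ne'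
    rw [V.ord_eq hz0, V.val_eq_zero_of_pow hn0.ne' hζ.pow_eq_one]; rfl
  obtain ⟨C, hC⟩ := V.Phi_cont n ζ U U y
  let D := V.val c - C + 1
  obtain ⟨x0, hx0, hx0'⟩ := V.newton hn h0 D
  obtain ⟨x1, hx1, hx1'⟩ := V.newton hn h1 D
  have hx0u := V.one_unit hx0
  have hx1u := V.one_unit hx1
  have hU0u := V.one_unit h0
  have hU1u := V.one_unit h1
  let U' : Fin 3 → X := ![x0 ^ n, x1 ^ n, U 2]
  have hcl := hC U' D
    (by
      intro i; fin_cases i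
      · exact hU0u.ge
      · exact hU1u.ge
      · exact h2.ge)
    (by
      intro i; fin_cases i
      · exact (V.pow_ord_zero hx0u n).ge
      · exact (V.pow_ord_zero hx1u n).ge
      · exact h2.ge)
    (by
      intro i; fin_cases i
      · change _ ≤ V.ord (U 0 - x0 ^ n); rw [V.ord_sub_comm]; exact hx0'.le
      · change _ ≤ V.ord (U 1 - x1 ^ n); rw [V.ord_sub_comm]; exact hx1'.le
      · change _ ≤ V.ord (U 2 - U 2); simp [V.ord_zero])
  have hCD : C + D = V.val c + 1 := by simp only [D]; ring
  rw [hCD] at hcl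
  let Y : Fin n → X := fun k => ∑ r ∈ univ.filter (fun r : Fin 3 → Fin n => r 2 = k), y r * (x0 ^ (r 0 : ℕ) * x1 ^ (r 1 : ℕ))
  have hcon := fun k => psi_contract hn0 ζ (U 2) x0 x1 y k
  change ∀ k, psi n ζ (U 2) Y k = _ at hcon
  let o : Fin n := ⟨0, hn0⟩
  have happ : ∀ k, ((V.val c + 1 : ℚ) : WithTop ℚ) ≤ V.ord (psi n ζ (U 2) Y k - if k = o then c else 0) := by
    intro k
    have hsum : (if k = o then c else 0) = ∑ r ∈ univ.filter (fun r : Fin 3 → Fin n => r 2 = k),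
        Phi n ζ U y r * (x0 ^ (r 0 : ℕ) * x1 ^ (r 1 : ℕ)) := by
      simp only [hy]
      split_ifs with hk
      · rw [sum_eq_single (fun _ => o)]
        · simp [o]
        · intro r _ hr
          rw [if_neg, zero_mul]
          intro h; exact hr (funext fun i => Fin.ext (h i))
        · intro h; exact absurd (mem_filter.mpr ⟨mem_univ (fun _ : Fin 3 => o), hk.symm⟩) h
      · symm
        refine sum_eq_zero fun r hr => ?_
        rw [if_neg, zero_mul]
        intro h
        exact hk ((mem_filter.mp hr).2.symm.trans (Fin.ext (h 2)))
    rw [hsum, hcon, ← sum_sub_distrib]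
    refine V.le_ord_sum _ _ fun r _ => ?_
    rw [← sub_mul, mul_comm]
    refine V.ord_mul_le ?_ ((V.ord_sub_comm _ _).symm ▸ hcl r)
    exact V.ord_mul_nonneg (V.ord_pow_nonneg hx0u.ge _) (V.ord_pow_nonneg hx1u.ge _)
  have hpc : V.ord (psi n ζ (U 2) Y o) = V.ord c := by
    have := happ o
    rw [if_pos rfl] at this
    have h3 := V.ord_add_eq_left (x := c) (y := psi n ζ (U 2) Y o - c) (lt_of_lt_of_le (by
      rw [V.ord_eq hc, coe_lt_coe]; linarith) this)
    rwa [add_sub_cancel] at h3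
  have hge : ∀ k, V.ord c ≤ V.ord (psi n ζ (U 2) Y k) := by
    intro k
    by_cases hk : k = o
    · rw [hk, hpc]
    · have := happ k
      rw [if_neg hk, sub_zero] at this
      refine le_trans ?_ this
      rw [V.ord_eq hc, coe_le_coe]; linarith
  have hYne : ∃ k, Y k ≠ 0 := by
    by_contra hcon
    push Not at hcon
    have hY0 : Y = fun k => 0 * Y k := by ext k; rw [hcon k, mul_zero]
    rw [hY0, psi_smul, zero_pow hn0.ne', zero_mul, V.ord_zero] at hpc
    exact V.ord_ne_top c hc hpc.symm
  have hne : Nonempty (Fin n) := ⟨o⟩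
  obtain ⟨k0, hk0⟩ := Finite.exists_min (fun k => V.ord (Y k))
  have hπ : Y k0 ≠ 0 := by
    obtain ⟨k, hk⟩ := hYne
    intro h
    have := hk0 k
    rw [h, V.ord_zero, top_le_iff] at this
    exact V.ord_ne_top _ hk this
  set π := Y k0 with hπdef
  let Y' : Fin n → X := fun k => Y k / π
  have hYY : Y = fun k => π * Y' k := by ext k; simp only [Y']; field_simp
  have hY'int : ∀ k, 0 ≤ V.ord (Y' k) := by
    intro k
    by_cases hk : Y k = 0
    · simp [Y', hk, V.ord_zero]
    · have : Y' k ≠ 0 := div_ne_zero hk hπ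
      rw [V.ord_nonneg_iff this, V.val_div hk hπ, sub_nonneg]
      have := hk0 k
      rwa [V.ord_eq hk, V.ord_eq hπ, coe_le_coe] at this
  have hpsi : ∀ k, psi n ζ (U 2) Y k = π ^ n * psi n ζ (U 2) Y' k := fun k => by rw [hYY, psi_smul]
  let ζO : V.O := ⟨ζ, hζu.ge⟩
  let aO : V.O := ⟨U 2, h2.ge⟩
  let YO : Fin n → V.O := fun k => ⟨Y' k, hY'int k⟩
  have hO : ∀ k, ((psi n ζO aO YO k : V.O) : X) = psi n ζ (U 2) Y' k := fun k => psi_map V.O.subtype n ζO aO YO k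
  let fκ : Field (V.O ⧸ V.mI) := Ideal.Quotient.field V.mI
  have hred : ∃ k, psi n (Ideal.Quotient.mk V.mI ζO) (Ideal.Quotient.mk V.mI aO) (fun k => Ideal.Quotient.mk V.mI (YO k)) k ≠ 0 := by
    have hprim := V.res_prim hn0 hn (ζ := ζO) hζ
    refine psi_ne hn0 (hprim.ne_zero hn0.ne') (irr_of_prime_pow hq hprim ?_ ?_) _ ⟨k0, ?_⟩
    · rw [Ne, Ideal.Quotient.eq_zero_iff_mem, mem_mI]
      change ¬ 0 < V.ord (U 2)
      rw [h2]; exact lt_irrefl _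
    · intro b
      obtain ⟨b, rfl⟩ := Ideal.Quotient.mk_surjective b
      rw [← map_pow, Ne, Ideal.Quotient.eq, mem_mI]
      exact hnr b b.2
    · rw [Ne, Ideal.Quotient.eq_zero_iff_mem, mem_mI]
      change ¬ 0 < V.ord (Y k0 / π)
      rw [div_self hπ, V.ord_one]; exact lt_irrefl _
  obtain ⟨k, hk⟩ := hred
  rw [← psi_map, Ne, Ideal.Quotient.eq_zero_iff_mem, mem_mI, hO, not_lt] at hk
  have hInt : ∀ k, 0 ≤ V.ord (psi n ζ (U 2) Y' k) := fun k => by rw [← hO]; exact (psi n ζO aO YO k).2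
  have hπn : V.ord (π ^ n) = ((n * V.val π : ℚ) : WithTop ℚ) := by rw [V.ord_eq (pow_ne_zero _ hπ), V.val_pow hπ]
  refine ⟨π, hπ, le_antisymm ?_ ?_⟩
  · have := hge k
    rw [hpsi, V.ord_mul, hπn, le_antisymm hk (hInt k), add_zero, V.ord_eq hc, coe_le_coe] at this
    exact this
  · have h5 := hpc
    rw [hpsi, V.ord_mul, hπn] at h5
    have : ((n * V.val π : ℚ) : WithTop ℚ) ≤ V.ord c := by
      rw [← h5]; exact le_add_of_nonneg_right (hInt o)
    rwa [V.ord_eq hc, coe_le_coe] at this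
end FFVal

section
variable {B E : Type} [Field B] [Field E] [Algebra B E] {d : ℕ} (b : Basis (Fin d) B E)

def EPol {σ : Type} (f : (σ → B) → E) : Prop := ∀ i, ∃ g : MvPolynomial σ B, ∀ x, b.repr (f x) i = MvPolynomial.eval x g

def BDef {σ : Type} (P : (σ → B) → Prop) : Prop := letI : FirstOrder.Ring.CompatibleRing B := FirstOrder.Ring.compatibleRingOfRing B
  Set.Definable (Set.univ : Set B) FirstOrder.Language.ring {x | P x}

namespace EPol
variable {σ τ : Type} {b} {f g : (σ → B) → E}

lemma const (c : E) : EPol b (fun _ : σ → B => c) := fun i => ⟨MvPolynomial.C (b.repr c i), fun x => by simp⟩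

lemma add (hf : EPol b f) (hg : EPol b g) : EPol b (fun x => f x + g x) := fun i => by
  obtain ⟨u, hu⟩ := hf i
  obtain ⟨v, hv⟩ := hg i
  exact ⟨u + v, fun x => by simp [hu, hv]⟩

lemma smul {h : (σ → B) → B} {u : MvPolynomial σ B} (hu : ∀ x, h x = MvPolynomial.eval x u) (c : E) :
    EPol b (fun x => h x • c) := fun i => ⟨u * MvPolynomial.C (b.repr c i), fun x => by simp [hu]⟩

lemma sum {ι : Type*} (s : Finset ι) {F : ι → (σ → B) → E} (h : ∀ i ∈ s, EPol b (F i)) : EPol b (fun x => ∑ i ∈ s, F i x) := by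
  classical
  induction s using induction_on with
  | empty => simpa using const (0 : E)
  | insert a s ha ih =>
    simp only [sum_insert ha]
    exact (h a (Finset.mem_insert_self _ _)).add (ih fun i hi => h i (mem_insert_of_mem hi))

lemma mul (hf : EPol b f) (hg : EPol b g) : EPol b (fun x => f x * g x) := by
  choose u hu using hf
  choose v hv using hg
  have : (fun x => f x * g x) = fun x => ∑ i, ∑ j, (b.repr (f x) i * b.repr (g x) j) • (b i * b j) := by
    funext x
    conv_lhs => rw [← b.sum_repr (f x), ← b.sum_repr (g x), Finset.sum_mul_sum]
    simp only [smul_mul_smul_comm]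
  rw [this]
  exact sum _ fun i _ => sum _ fun j _ => smul (u := u i * v j) (fun x => by simp [hu, hv]) _

lemma prod {ι : Type*} (s : Finset ι) {F : ι → (σ → B) → E} (h : ∀ i ∈ s, EPol b (F i)) : EPol b (fun x => ∏ i ∈ s, F i x) := by
  classical
  induction s using induction_on with
  | empty => simpa using const (1 : E)
  | insert a s ha ih =>
    simp only [Finset.prod_insert ha]
    exact (h a (Finset.mem_insert_self _ _)).mul (ih fun i hi => h i (mem_insert_of_mem hi))

lemma pow (hf : EPol b f) (n : ℕ) : EPol b (fun x => f x ^ n) := by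
  have := prod (range n) (F := fun _ => f) (fun _ _ => hf)
  simpa using this

lemma inl (hf : EPol b f) : EPol b (fun x : σ ⊕ τ → B => f (x ∘ Sum.inl)) := fun i => by
  obtain ⟨u, hu⟩ := hf i
  exact ⟨MvPolynomial.rename Sum.inl u, fun x => by rw [hu, MvPolynomial.eval_rename]⟩

lemma var {β : Type} (a : β) : EPol b (fun x : σ ⊕ (β × Fin d) → B => ∑ i, x (Sum.inr (a, i)) • b i) :=
  sum _ fun i _ => smul (u := MvPolynomial.X (Sum.inr (a, i))) (fun x => by simp) _

end EPol

namespace BDef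
variable {σ : Type} {P Q : (σ → B) → Prop}

lemma not (h : BDef P) : BDef (fun x => ¬ P x) := by
  let _ : FirstOrder.Ring.CompatibleRing B := FirstOrder.Ring.compatibleRingOfRing B
  exact Set.Definable.compl h

lemma and (h : BDef P) (h' : BDef Q) : BDef (fun x => P x ∧ Q x) := by
  let _ : FirstOrder.Ring.CompatibleRing B := FirstOrder.Ring.compatibleRingOfRing B
  exact Set.Definable.inter h h'

lemma or (h : BDef P) (h' : BDef Q) : BDef (fun x => P x ∨ Q x) := by
  let _ : FirstOrder.Ring.CompatibleRing B := FirstOrder.Ring.compatibleRingOfRing B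
  exact Set.Definable.union h h'

lemma imp (h : BDef P) (h' : BDef Q) : BDef (fun x => P x → Q x) := by simpa only [imp_iff_not_or] using h.not.or h'

lemma fin_all {ι : Type} [Finite ι] {R : ι → (σ → B) → Prop} (h : ∀ i, BDef (R i)) : BDef (fun x => ∀ i, R i x) := by
  let _ : FirstOrder.Ring.CompatibleRing B := FirstOrder.Ring.compatibleRingOfRing B
  have := Set.definable_iInter_of_finite (fun i => h i)
  unfold BDef
  convert! this using 1
  ext x; simp

lemma zero (u : MvPolynomial σ B) : BDef (fun x : σ → B => MvPolynomial.eval x u = 0) := by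
  let _ : FirstOrder.Ring.CompatibleRing B := FirstOrder.Ring.compatibleRingOfRing B
  have := (FirstOrder.Ring.mvPolynomial_zeroLocus_definable ({u} : Finset (MvPolynomial σ B))).mono (Set.subset_univ _)
  unfold BDef
  convert! this using 1
  ext x
  rw [MvPolynomial.zeroLocus_span]
  simp only [Set.mem_setOf_eq, Finset.coe_singleton, Set.mem_singleton_iff, forall_eq, MvPolynomial.aeval_eq_eval]

lemma eq {b : Basis (Fin d) B E} {f g : (σ → B) → E} (hf : EPol b f) (hg : EPol b g) : BDef (fun x => f x = g x) := by
  choose u hu using hf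
  choose v hv using hg
  have := fin_all fun i => zero (u i - v i)
  convert! this using 2 with x
  simp only [map_sub, ← hu, ← hv, sub_eq_zero]
  rw [← b.repr.injective.eq_iff, Finsupp.ext_iff]

lemma ne {b : Basis (Fin d) B E} {f g : (σ → B) → E} (hf : EPol b f) (hg : EPol b g) : BDef (fun x => f x ≠ g x) := (eq hf hg).not

lemma ex (b : Basis (Fin d) B E) [Finite σ] {β : Type} [Finite β] {P : (σ → B) → (β → E) → Prop}
    (h : BDef (fun x : σ ⊕ (β × Fin d) → B => P (x ∘ Sum.inl) (fun a => ∑ i, x (Sum.inr (a, i)) • b i))) : BDef (fun x => ∃ y, P x y) := by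
  let _ : FirstOrder.Ring.CompatibleRing B := FirstOrder.Ring.compatibleRingOfRing B
  have := Set.Definable.image_comp h Sum.inl
  unfold BDef
  convert! this using 1
  ext x
  simp only [Set.mem_image, Set.mem_setOf_eq]
  constructor
  · rintro ⟨y, hy⟩
    refine ⟨Sum.elim x (fun a => b.repr (y a.1) a.2), ?_, by funext; simp⟩
    simpa only [Sum.elim_inr, b.sum_repr, Sum.elim_comp_inl] using hy
  · rintro ⟨z, hz, rfl⟩
    exact ⟨_, hz⟩

lemma ex1 (b : Basis (Fin d) B E) [Finite σ] {P : (σ → B) → E → Prop} (h : BDef (fun x : σ ⊕ (Unit × Fin d) → B => P (x ∘ Sum.inl) (∑ i, x (Sum.inr ((), i)) • b i))) :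
    BDef (fun x => ∃ y, P x y) := by
  have := ex b (β := Unit) (P := fun x y => P x (y ())) h
  convert! this using 2 with x
  exact ⟨fun ⟨y, hy⟩ => ⟨fun _ => y, hy⟩, fun ⟨y, hy⟩ => ⟨_, hy⟩⟩

lemma all1 (b : Basis (Fin d) B E) [Finite σ] {P : (σ → B) → E → Prop} (h : BDef (fun x : σ ⊕ (Unit × Fin d) → B => P (x ∘ Sum.inl) (∑ i, x (Sum.inr ((), i)) • b i))) :
    BDef (fun x => ∀ y, P x y) := by
  have := (ex1 b (P := fun x y => ¬ P x y) h.not).not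
  simpa only [not_exists, not_not] using this

lemma pp {b : Basis (Fin d) B E} [Finite σ] (n : ℕ) (ζ : E) {u0 u1 u2 c : (σ → B) → E} (h0 : EPol b u0) (h1 : EPol b u1) (h2 : EPol b u2) (hc : EPol b c) :
    BDef (fun x => PP n ζ ![u0 x, u1 x, u2 x] (c x)) := by
  classical
  refine ex b (P := fun x y => ∀ r, Phi n ζ ![u0 x, u1 x, u2 x] y r = if (∀ i, (r i : ℕ) = 0) then c x else 0) ?_
  refine fin_all fun r => eq (b := b) ?_ ?_
  · unfold Phi
    refine EPol.sum _ fun f _ => EPol.mul (EPol.prod _ fun l _ => (EPol.var _).mul (EPol.const _))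
      (EPol.prod _ fun i _ => EPol.pow ?_ _)
    fin_cases i
    exacts [h0.inl, h1.inl, h2.inl]
  · split_ifs
    exacts [hc.inl, EPol.const _]

end BDef

def RR (Q : ℕ) (ζ θ t w : E) : Prop := ∃ u, u * (1 + t * w ^ Q) = (1 + t * w ^ Q) + 1 ∧ PP Q ζ ![u, 1, θ] (1 + t * w ^ Q)

def Good (q Q : ℕ) (ζ ζ' θ t x : E) : Prop := x = 0 ∨ ∀ w c u1 u2 : E, RR Q ζ' θ t w → c ≠ 0 → 1 + w ≠ 0 → u1 ≠ 0 → u2 ≠ 0 →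
    u1 * ((1 + w) * x ^ q) = (1 + w) * x ^ q + (1 + w) ^ 2 + 1 → u2 * (c * x ^ q) = c * x ^ q + c ^ 2 + 1 →
    PP q ζ ![u1, u2, 1 + w] c

lemma good_def [FiniteDimensional B E] (q Q : ℕ) (ζ ζ' θ t : E) : FODefinable {x : B | Good q Q ζ ζ' θ t (algebraMap B E x)} := by
  let b := Module.finBasis B E
  have hx : EPol b (fun x : Fin 1 → B => algebraMap B E (x 0)) := by
    have := EPol.smul (b := b) (h := fun x : Fin 1 → B => x 0) (u := MvPolynomial.X 0) (fun x => by simp) (1 : E)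
    simpa only [smul_def, mul_one] using this
  have : BDef (fun x : Fin 1 → B => Good q Q ζ ζ' θ t (algebraMap B E (x 0))) := by
    unfold Good
    refine (BDef.eq hx (EPol.const 0)).or ?_
    refine BDef.all1 b (BDef.all1 b (BDef.all1 b (BDef.all1 b ?_)))
    have hx4 := (((hx.inl (τ := Unit × Fin (finrank B E))).inl (τ := Unit × Fin (finrank B E))).inl (τ := Unit × Fin (finrank B E))).inl (τ := Unit × Fin (finrank B E))
    have hw := (((EPol.var (b := b) (σ := Fin 1) ()).inl (τ := Unit × Fin (finrank B E))).inl (τ := Unit × Fin (finrank B E))).inl (τ := Unit × Fin (finrank B E))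
    have hc := ((EPol.var (b := b) (σ := Fin 1 ⊕ (Unit × Fin (finrank B E))) ()).inl (τ := Unit × Fin (finrank B E))).inl (τ := Unit × Fin (finrank B E))
    have hu1 := (EPol.var (b := b) (σ := (Fin 1 ⊕ (Unit × Fin (finrank B E))) ⊕ (Unit × Fin (finrank B E))) ()).inl (τ := Unit × Fin (finrank B E))
    have hu2 := EPol.var (b := b) (σ := ((Fin 1 ⊕ (Unit × Fin (finrank B E))) ⊕ (Unit × Fin (finrank B E))) ⊕ (Unit × Fin (finrank B E))) ()
    have ha := (EPol.const 1).add hw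
    refine BDef.imp ?_ <| (BDef.ne hc (EPol.const 0)).imp <| (BDef.ne ha (EPol.const 0)).imp <|
      (BDef.ne hu1 (EPol.const 0)).imp <| (BDef.ne hu2 (EPol.const 0)).imp <|
      (BDef.eq (hu1.mul (ha.mul (hx4.pow q))) (((ha.mul (hx4.pow q)).add (ha.pow 2)).add (EPol.const 1))).imp <|
      (BDef.eq (hu2.mul (hc.mul (hx4.pow q))) (((hc.mul (hx4.pow q)).add (hc.pow 2)).add (EPol.const 1))).imp <|
      BDef.pp q ζ hu1 hu2 ha hc
    unfold RR
    refine BDef.ex1 b ?_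
    have hu := EPol.var (b := b) (σ := (((Fin 1 ⊕ (Unit × Fin (finrank B E))) ⊕ (Unit × Fin (finrank B E))) ⊕ (Unit × Fin (finrank B E))) ⊕ (Unit × Fin (finrank B E))) ()
    have hcc := (EPol.const 1).add ((EPol.const t).mul ((hw.inl (τ := Unit × Fin (finrank B E))).pow Q))
    exact (BDef.eq (hu.mul hcc) (hcc.add (EPol.const 1))).and (BDef.pp Q ζ' hu (EPol.const 1) (EPol.const θ) hcc)
  exact this

end

section
variable (p : ℕ) [Fact p.Prime] {X Y : Type} [Field X] [Field Y]

lemma FFPrime.toFFVal_pos {v : FFPrime X} {x : X} : 0 < v.toFFVal.ord x ↔ 0 < v.ord x := by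
  by_cases hx : x = 0
  · rw [hx, v.ord_zero, v.toFFVal.ord_zero]; simp
  · rw [v.toFFVal.ord_pos_iff hx, v.ord_pos_iff hx, v.toFFVal_val hx]; norm_cast

abbrev FFVal.kap (V : FFVal X) : Type := V.O ⧸ V.mI

instance FFVal.kapField (V : FFVal X) : Field V.kap := Ideal.Quotient.field _

lemma FFPrime.card_kap {w : FFPrime X} {n : ℕ} (h : w.HasResidueCard n) : card w.toFFVal.kap = n := by
  classical
  obtain ⟨s, hs, h1, h2, h3⟩ := h
  rw [← hs, ← Nat.card_eq_finsetCard]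
  symm
  refine Nat.card_congr (Equiv.ofBijective (fun x : s =>
    (Ideal.Quotient.mk w.toFFVal.mI ⟨x.1, FFPrime.toFFVal_nonneg.mpr (h1 _ x.2)⟩ : w.toFFVal.kap)) ⟨?_, ?_⟩)
  · rintro ⟨x, hx⟩ ⟨y, hy⟩ hxy
    rw [Ideal.Quotient.eq, FFVal.mem_mI] at hxy
    by_contra hne
    exact h2 x hx y hy (fun h => hne (Subtype.ext h)) (FFPrime.toFFVal_pos.mp hxy)
  · intro z
    obtain ⟨⟨z, hz⟩, rfl⟩ := Ideal.Quotient.mk_surjective z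
    obtain ⟨x, hx, hzx⟩ := h3 z (FFPrime.toFFVal_nonneg.mp hz)
    refine ⟨⟨x, hx⟩, ?_⟩
    rw [Ideal.Quotient.eq, FFVal.mem_mI]
    change 0 < w.toFFVal.ord (x - z)
    rw [FFVal.ord_sub_comm]
    exact FFPrime.toFFVal_pos.mpr hzx

lemma FFPrime.hasResidueCard [IsFF p X] (w : FFPrime X) : w.HasResidueCard w.rc := by
  classical
  have hf : Finite (UU w 0 ⧸ (UU w 1).addSubgroupOf (UU w 0)) := Nat.finite_of_card_ne_zero (w.rc_ne_zero p)
  have := Fintype.ofFinite (UU w 0 ⧸ (UU w 1).addSubgroupOf (UU w 0))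
  let o : (UU w 0 ⧸ (UU w 1).addSubgroupOf (UU w 0)) → X := fun a => (Quotient.out a : UU w 0)
  have key : ∀ a b, 0 < w.ord (o a - o b) → a = b := by
    intro a b h
    rw [← Quotient.out_eq' a, ← Quotient.out_eq' b]
    refine QuotientAddGroup.eq.mpr ?_
    rw [AddSubgroup.mem_addSubgroupOf, mem_UU, ← w.ord_neg]
    refine (FFPrime.ord_pos_iff_one_le ..).mp ?_
    convert h using 2
    change -(-o a + o b) = _
    ring
  have hinj : Injective o := fun a b h => key a b (by rw [h, sub_self, w.ord_zero]; exact coe_lt_top 0)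
  refine ⟨univ.image o, ?_, ?_, ?_, ?_⟩
  · rw [Finset.card_image_of_injective _ hinj, card_univ, ← Nat.card_eq_fintype_card]; rfl
  · intro x hx
    obtain ⟨a, -, rfl⟩ := mem_image.mp hx
    exact mem_UU.mp (Quotient.out a : UU w 0).2
  · intro x hx y hy hxy h
    obtain ⟨a, -, rfl⟩ := mem_image.mp hx
    obtain ⟨b, -, rfl⟩ := mem_image.mp hy
    exact hxy (by rw [key a b h])
  · intro z hz
    refine ⟨_, mem_image_of_mem _ (mem_univ (QuotientAddGroup.mk (⟨z, mem_UU.mpr hz⟩ : UU w 0))), ?_⟩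
    have := QuotientAddGroup.eq.mp (Quotient.out_eq' (QuotientAddGroup.mk (⟨z, mem_UU.mpr hz⟩ : UU w 0) :
      UU w 0 ⧸ (UU w 1).addSubgroupOf (UU w 0)))
    rw [AddSubgroup.mem_addSubgroupOf, mem_UU] at this
    have h2 := (FFPrime.ord_pos_iff_one_le ..).mpr this
    convert h2 using 2
    change _ = - o _ + z
    ring

lemma FFPrime.card_kap' [IsFF p X] (w : FFPrime X) : card w.toFFVal.kap = p ^ w.deg p := by rw [FFPrime.card_kap (w.hasResidueCard p), w.rc_eq p]

lemma FFPrime.pow_deg [IsFF p X] (w : FFPrime X) {x : X} (hx : 0 ≤ w.ord x) (m : ℕ) : 0 < w.ord (x ^ p ^ (w.deg p * m) - x) := by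
  have hc := w.card_kap' p
  have hp := (Fact.out : p.Prime).pos
  have : Finite w.toFFVal.kap := Nat.finite_of_card_ne_zero (by rw [hc]; positivity)
  have := Fintype.ofFinite w.toFFVal.kap
  let z : w.toFFVal.O := ⟨x, FFPrime.toFFVal_nonneg.mpr hx⟩
  have h := FiniteField.pow_card_pow m (Ideal.Quotient.mk w.toFFVal.mI z)
  rw [← Nat.card_eq_fintype_card, hc, ← pow_mul, ← map_pow] at h
  rw [Ideal.Quotient.eq, FFVal.mem_mI] at h
  exact FFPrime.toFFVal_pos.mp h

lemma kap_hom {V : FFVal X} {W : FFVal Y} (φ : X →+* Y) (h : ∀ x, 0 ≤ V.ord x → 0 ≤ W.ord (φ x)) (h' : ∀ x, 0 < V.ord x → 0 < W.ord (φ x)) : Nonempty (V.kap →+* W.kap) := by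
  refine ⟨Ideal.quotientMap W.mI (φ.restrict V.O W.O h) ?_⟩
  intro x hx
  exact h' _ hx

lemma FFPrime.LiesOver.deg_dvd [IsFF p X] [IsFF p Y] {w : FFPrime Y} {v : FFPrime X} {φ : X →+* Y} (h : w.LiesOver v φ) : ∃ f, 0 < f ∧ w.deg p = v.deg p * f := by
  obtain ⟨ψ⟩ := kap_hom (V := v.toFFVal) (W := w.toFFVal) φ
    (fun x hx => FFPrime.toFFVal_nonneg.mpr (h.ord_nonneg.mpr (FFPrime.toFFVal_nonneg.mp hx)))
    (fun x hx => FFPrime.toFFVal_pos.mpr (h.ord_pos.mpr (FFPrime.toFFVal_pos.mp hx)))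
  have hp := (Fact.out : p.Prime)
  have hw := w.card_kap' p
  have : Finite w.toFFVal.kap := Nat.finite_of_card_ne_zero (by rw [hw]; exact (pow_pos hp.pos _).ne')
  let _ := ψ.toAlgebra
  have := Module.natCard_eq_pow_finrank (K := v.toFFVal.kap) (V := w.toFFVal.kap)
  rw [hw, v.card_kap' p, ← pow_mul] at this
  have h2 := Nat.pow_right_injective hp.two_le this
  exact ⟨_, Nat.pos_of_ne_zero fun h0 => (w.deg_pos p).ne' (by rw [h2, h0, mul_zero]), h2⟩

lemma FFPrime.LiesOver.resDeg_mul [IsFF p X] [IsFF p Y] {w : FFPrime Y} {v : FFPrime X} {φ : X →+* Y} (h : w.LiesOver v φ) : w.deg p = v.deg p * w.resDeg v := by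
  obtain ⟨f, hf, hwf⟩ := h.deg_dvd p
  have hp := (Fact.out : p.Prime)
  have hex : ∃ f : ℕ, 0 < f ∧ ∃ m n : ℕ, 1 < m ∧ v.HasResidueCard m ∧ w.HasResidueCard n ∧ n = m ^ f :=
    ⟨f, hf, v.rc, w.rc, by rw [v.rc_eq p]; exact one_lt_pow (v.deg_pos p).ne' hp.one_lt, v.hasResidueCard p, w.hasResidueCard p,
      by rw [v.rc_eq p, w.rc_eq p, hwf, pow_mul]⟩
  have hs := hex.choose_spec
  rw [FFPrime.resDeg, dif_pos hex]
  obtain ⟨h0, m, n, h1, h2, h3, h4⟩ := hs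
  have e1 := FFPrime.card_kap h2
  have e2 := FFPrime.card_kap h3
  rw [FFPrime.card_kap' p] at e1 e2
  rw [← e1, ← e2, ← pow_mul] at h4
  exact Nat.pow_right_injective hp.two_le h4

end

section
variable (p q : ℕ) [Fact p.Prime] {K B : Type} [Field K] [Field B] [Algebra K B]

def QB (K : Type) {B : Type} [Field K] [Field B] [Algebra K B] (V : FFVal B) (C : ℕ) : Prop :=
  ∀ F : IntermediateField K B, FiniteDimensional K F → ∀ (w : FFPrime F) (v : FFPrime K),
    V.RestrictsTo w (algebraMap F B) → V.RestrictsTo v (algebraMap K B) →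
    (∀ e, w.LiesOverWith v (algebraMap K F) e → padicValNat q e ≤ C) ∧ padicValNat q (w.deg p) ≤ C

variable {p q}

lemma QB.mono {V : FFVal B} {C C' : ℕ} (h : QB p q K V C) (hC : C ≤ C') : QB p q K V C' :=
  fun F hF w v hw hv => ⟨fun e he => ((h F hF w v hw hv).1 e he).trans hC, (h F hF w v hw hv).2.trans hC⟩

lemma padic_le_of_dvd [Fact q.Prime] {a b : ℕ} (h : a ∣ b) (hb : b ≠ 0) : padicValNat q a ≤ padicValNat q b :=
  (padicValNat_dvd_iff_le hb).mp (pow_padicValNat_dvd.trans h)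

lemma FFVal.restrictsTo_lies {V : FFVal B} {F : IntermediateField K B} {w : FFPrime F} {v : FFPrime K}
    (hw : V.RestrictsTo w (algebraMap F B)) (hv : V.RestrictsTo v (algebraMap K B)) : w.LiesOver v (algebraMap K F) :=
  FFVal.liesOver_of_restrictsTo hw hv

lemma qb_of_bounded [Fact q.Prime] {F0 : Type} [Field F0] [IsFF p F0] [IsFF p K] [Algebra F0 K] [FiniteDimensional F0 K]
    [Algebra F0 B] [IsScalarTower F0 K B] (hqb : IsQBounded q F0 B) (V : FFVal B) : ∃ C, QB p q K V C := by
  obtain ⟨C0, hC0⟩ := hqb V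
  by_cases hv : ∃ v : FFPrime K, V.RestrictsTo v (algebraMap K B)
  swap
  · exact ⟨0, fun F hF w v _ h => (hv ⟨v, h⟩).elim⟩
  obtain ⟨v, hv⟩ := hv
  obtain ⟨v0, hv0⟩ := V.exists_restrictsTo_down (K := F0) _ v hv
  rw [← algebraMap_eq] at hv0
  refine ⟨C0 + padicValNat q (v0.deg p), fun F hF w v hw hv => ?_⟩
  have hfin : FiniteDimensional F0 F := FiniteDimensional.trans F0 K F
  have hff : IsFF p F := IsFF.of_finite (X := K) p F
  have hv0' : V.RestrictsTo v0 ((algebraMap K B).comp (algebraMap F0 K)) := by rwa [← algebraMap_eq]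
  obtain ⟨e0, he0⟩ := FFVal.liesOver_of_restrictsTo hv hv0'
  have hw0 : w.LiesOver v0 (algebraMap F0 F) := FFVal.liesOver_of_restrictsTo hw hv0
  obtain ⟨h1, h2⟩ := hC0 (F.restrictScalars F0) hfin v0 w hv0 hw
  have hs := hw0.ramIdx_spec
  constructor
  · intro e he
    have hc := he.comp he0
    rw [← algebraMap_eq] at hc
    have := hc.unique hs
    refine (padic_le_of_dvd ⟨e0, this.symm⟩ hs.1.ne').trans (h1.trans (Nat.le_add_right _ _))
  · have := hw0.resDeg_mul p
    rw [this, padicValNat.mul (v0.deg_pos p).ne', add_comm]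
    · exact Nat.add_le_add_right h2 _
    · intro h0
      rw [h0, mul_zero] at this
      exact (w.deg_pos p).ne' this

lemma qb_unif1 [Fact q.Prime] [IsFF p K] [Algebra.IsAlgebraic K B] (hb : ∀ V : FFVal B, ∃ C, QB p q K V C) (v : FFPrime K) (hcase : UniformlyQBoundedAt q B v ∨ IsGalois K B) :
    ∃ C, ∀ V : FFVal B, V.RestrictsTo v (algebraMap K B) → QB p q K V C := by
  rcases hcase with ⟨⟨C1, h1⟩, ⟨C2, h2⟩⟩ | hG
  · refine ⟨C1 + (C2 + padicValNat q (v.deg p)), fun V hV F hF w v' hw hv' => ?_⟩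
    have hff : IsFF p F := IsFF.of_finite (X := K) p F
    have hl := FFVal.restrictsTo_lies hw hV
    obtain rfl : v = v' := hl.unique (FFVal.restrictsTo_lies hw hv')
    constructor
    · intro e he
      rw [he.unique hl.ramIdx_spec]
      exact (h1 F hF w hl).trans (Nat.le_add_right _ _)
    · have := hl.resDeg_mul p
      rw [this, padicValNat.mul (v.deg_pos p).ne']
      · have := h2 F hF w hl
        omega
      · intro h0
        rw [h0, mul_zero] at this
        exact (w.deg_pos p).ne' this
  · obtain ⟨W0, hW0⟩ : ∃ W0 : FFVal B, W0.RestrictsTo v (algebraMap K B) := by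
      obtain ⟨π, hπ, hπ1⟩ := v.exists_val_eq (-1)
      obtain ⟨W, hW, _⟩ := exists_ext (B := B) v (algebraMap K B π) (by
        rintro ⟨P, hP, hc, hx⟩
        rw [Polynomial.aeval_algebraMap_apply, map_eq_zero] at hx
        have := v.nonneg_of_integral P hP hc hx
        rw [v.ord_nonneg_iff hπ] at this
        omega)
      exact ⟨W, FFVal.restrictsTo_of_ext hW⟩
    obtain ⟨C, hC⟩ := hb W0
    refine ⟨C, fun V hV F hF w v' hw hv' => ?_⟩
    have hff : IsFF p F := IsFF.of_finite (X := K) p F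
    have hl := FFVal.restrictsTo_lies hw hV
    obtain rfl : v = v' := hl.unique (FFVal.restrictsTo_lies hw hv')
    let F' := IntermediateField.normalClosure K F B
    have hFF : F ≤ F' := F.le_normalClosure
    have hfd : FiniteDimensional K F' := normalClosure.is_finiteDimensional K F B
    have hN : Normal K F' := normalClosure.normal K F B
    have hsep : Algebra.IsSeparable K F' := Algebra.isSeparable_tower_bot_of_isSeparable K F' B
    have hgal : IsGalois K F' := ⟨⟩
    have hff' : IsFF p F' := IsFF.of_finite (X := K) p F'
    obtain ⟨w', hw'⟩ := V.exists_restrictsTo_up (K := K) (L := F') (algebraMap F' B) v hV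
    obtain ⟨w0, hw0⟩ := W0.exists_restrictsTo_up (K := K) (L := F') (algebraMap F' B) v hW0
    have l1 := FFVal.restrictsTo_lies hw' hV
    have l2 := FFVal.restrictsTo_lies hw0 hW0
    obtain ⟨g, rfl⟩ := exists_comap' (L := K) w0 w' fun x hx => l1.ord_pos.mpr (l2.ord_pos.mp hx)
    obtain ⟨h1, h2⟩ := hC F' hfd w0 v hw0 hW0
    have l3 : (w0.comap g).LiesOver w (IntermediateField.inclusion hFF).toRingHom := FFVal.liesOver_of_restrictsTo hw' hw
    obtain ⟨e1, he1⟩ := l3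
    constructor
    · intro e he
      have := he1.comp he
      have h3 : w0.LiesOverWith v (algebraMap K F') (e1 * e) := by
        refine ⟨this.1, fun x => ?_⟩
        rw [← this.2 x]
        change _ = w0.ord (g (algebraMap K F' x))
        rw [g.commutes]
      exact (padic_le_of_dvd (Dvd.intro_left _ rfl) h3.1.ne').trans (h1 _ h3)
    · obtain ⟨f, -, hf⟩ := FFPrime.LiesOver.deg_dvd p ⟨e1, he1⟩
      rw [FFPrime.deg_comap] at hf
      exact (padic_le_of_dvd ⟨f, hf⟩ (w0.deg_pos p).ne').trans h2

lemma qb_unif [Fact q.Prime] [IsFF p K] [Algebra.IsAlgebraic K B] (hb : ∀ V : FFVal B, ∃ C, QB p q K V C) {S : Set (FFPrime K)}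
    (hS : S.Finite) (hcase : (∀ v ∈ S, UniformlyQBoundedAt q B v) ∨ IsGalois K B) : ∃ C, ∀ V : FFVal B, ∀ v ∈ S, V.RestrictsTo v (algebraMap K B) → QB p q K V C := by
  have h1 : ∀ v : FFPrime K, ∃ C, v ∈ S → ∀ V : FFVal B, V.RestrictsTo v (algebraMap K B) → QB p q K V C := by
    intro v
    by_cases hv : v ∈ S
    · obtain ⟨C, hC⟩ := qb_unif1 hb v (hcase.imp_left fun h => h v hv)
      exact ⟨C, fun _ => hC⟩
    · exact ⟨0, fun h => (hv h).elim⟩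
  choose C hC using h1
  refine ⟨∑ v ∈ hS.toFinset, C v, fun V v hv hV => (hC v hv V hV).mono ?_⟩
  exact single_le_sum (f := C) (fun _ _ => Nat.zero_le _) (hS.mem_toFinset.mpr hv)

end

section
variable (p : ℕ) [Fact p.Prime]

open Polynomial in
lemma ur {F L : Type} [Field F] [Field L] [Algebra F L] [FiniteDimensional F L] [IsGalois F L] [IsFF p L]
    {n : ℕ} (hn : (n : L) ≠ 0) {θ : L} (hθ : θ ^ n = 1) (hθt : Algebra.adjoin F {θ} = ⊤) (w : FFPrime L) {π : L} (hπ : π ≠ 0) :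
    ∃ P : F[X], w.ord π < w.ord (π - aeval θ P) ∧ ∀ i, w.ord π ≤ w.ord (algebraMap F L (P.coeff i)) := by
  classical
  have hn0 : 0 < n := Nat.pos_of_ne_zero (by rintro rfl; simp at hn)
  obtain ⟨m, hm⟩ : ∃ m, w.ord π = (m : ℤ) := ⟨_, w.ord_eq hπ⟩
  obtain ⟨x, hx⟩ := FFPrime.approx (univ.image fun g : L ≃ₐ[F] L => w.comap g) (fun v => if v = w then π else 0) (m + 1)
  have hm1 : (m : WithTop ℤ) < ((m + 1 : ℤ) : WithTop ℤ) := coe_lt_coe.mpr (by omega)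
  have hx1 : w.ord π < w.ord (x - π) := by
    have h1 := hx w (mem_image.mpr ⟨1, mem_univ _, w.comap_one⟩)
    rw [if_pos rfl] at h1
    exact hm ▸ lt_of_lt_of_le hm1 h1
  have hx2 : ∀ g : L ≃ₐ[F] L, (m : WithTop ℤ) ≤ w.ord (g x) := by
    intro g
    have h1 := hx (w.comap g) (mem_image_of_mem _ (mem_univ _))
    by_cases hg : w.comap g = w
    · rw [if_pos hg] at h1
      rw [← w.comap_ord, hg]
      rw [hg] at h1
      have := w.le_ord_add (n := (m : WithTop ℤ)) (hm1.le.trans h1) hm.ge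
      rwa [sub_add_cancel] at this
    · rw [if_neg hg, sub_zero] at h1
      exact hm1.le.trans h1
  obtain ⟨P0, hP0⟩ : ∃ P0 : F[X], aeval θ P0 = x := by
    have : x ∈ Algebra.adjoin F {θ} := hθt ▸ Algebra.mem_top
    rwa [Algebra.adjoin_singleton_eq_range_aeval] at this
  have hInt : IsIntegral F θ := Algebra.IsIntegral.isIntegral θ
  have hPx : aeval θ (P0 %ₘ minpoly F θ) = x := by rw [aeval_modByMonic_eq_self_of_root (minpoly.aeval F θ), hP0]
  refine ⟨P0 %ₘ minpoly F θ, by rw [hPx, w.ord_sub_comm]; exact hx1, fun i => ?_⟩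
  have hinj : Set.InjOn (fun g : L ≃ₐ[F] L => g θ) (univ : Finset (L ≃ₐ[F] L)) := by
    intro g _ h _ hgh
    have := AlgHom.ext_of_adjoin_eq_top (φ₁ := (g : L →ₐ[F] L)) (φ₂ := (h : L →ₐ[F] L)) hθt (by rintro _ rfl; exact hgh)
    exact AlgEquiv.ext fun y => DFunLike.congr_fun this y
  have hI := Lagrange.eq_interpolate_of_eval_eq (s := univ) (v := fun g : L ≃ₐ[F] L => g θ)
    (r := fun g => g x) (f := (P0 %ₘ minpoly F θ).map (algebraMap F L)) hinj (by
      refine (degree_map_le).trans_lt ((degree_modByMonic_lt _ (minpoly.monic hInt)).trans_le ?_)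
      rw [degree_eq_natDegree (minpoly.ne_zero hInt), card_univ, ← Nat.card_eq_fintype_card, IsGalois.card_aut_eq_finrank]
      exact_mod_cast minpoly.natDegree_le θ) (by
      intro g _
      rw [eval_map_algebraMap, ← hPx]
      exact (aeval_algHom_apply (g : L →ₐ[F] L) θ _))
  rw [← coeff_map, hI, Lagrange.interpolate_apply, finsetSum_coeff, hm]
  refine w.le_ord_sum _ _ fun g _ => ?_
  rw [coeff_C_mul]
  have hroot : ∀ g : L ≃ₐ[F] L, (g θ) ^ n = 1 := fun g => by rw [← map_pow, hθ, map_one]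
  have hθ0 : ∀ g : L ≃ₐ[F] L, g θ ≠ 0 := fun g h => by
    have := hroot g; rw [h, zero_pow hn0.ne'] at this; exact zero_ne_one this
  have hO : ∀ g : L ≃ₐ[F] L, g θ ∈ w.toFFVal.O := fun g => FFPrime.toFFVal_nonneg.mpr
    ((w.ord_nonneg_iff (hθ0 g)).mpr (w.val_root hn0 (hroot g)).ge)
  have key : Lagrange.basis univ (fun g : L ≃ₐ[F] L => g θ) g ∈ (mapRingHom w.toFFVal.O.subtype).range := by
    refine Subring.prod_mem _ fun h hh => ?_
    have hgh : g θ ≠ h θ := fun e => Finset.ne_of_mem_erase hh (hinj (by simp) (by simp) e.symm)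
    have hd : (g θ - h θ)⁻¹ ∈ w.toFFVal.O := by
      have h1 : g θ / h θ ≠ 1 := fun e => hgh ((div_eq_one_iff_eq (hθ0 h)).mp e)
      have h2 := w.root_sub p hn (x := g θ / h θ) (by rw [div_pow, hroot, hroot, div_one]) h1
      have h3 : g θ - h θ = h θ * (g θ / h θ - 1) := by field_simp [hθ0 h]
      refine FFPrime.toFFVal_nonneg.mpr ((w.ord_nonneg_iff (inv_ne_zero (sub_ne_zero.mpr hgh))).mpr ?_)
      rw [w.val_inv (sub_ne_zero.mpr hgh), h3, w.val_mul (hθ0 h) (sub_ne_zero.mpr h1), w.val_root hn0 (hroot h)]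
      rw [w.ord_pos_iff (sub_ne_zero.mpr h1)] at h2
      omega
    refine ⟨C ⟨_, hd⟩ * (X - C ⟨_, hO h⟩), ?_⟩
    simp [Lagrange.basisDivisor]
  obtain ⟨R, hR⟩ := key
  rw [← hR, coe_mapRingHom, coeff_map, w.ord_mul]
  exact le_add_of_le_of_nonneg (hx2 g) (FFPrime.toFFVal_nonneg.mp (R.coeff i).2)

lemma FFVal.RestrictsTo.lt_iff {X Y : Type} [Field X] [Field Y] {W : FFVal Y} {w : FFPrime X} {φ : X →+* Y}
    (h : W.RestrictsTo w φ) (x y : X) : W.ord (φ x) < W.ord (φ y) ↔ w.ord x < w.ord y := by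
  obtain ⟨c, hc, h⟩ := FFVal.restrictsTo_iff.mp h
  by_cases hx : x = 0
  · simp [hx, W.ord_zero, w.ord_zero]
  by_cases hy : y = 0
  · simp [hy, W.ord_zero, w.ord_zero, W.ord_eq ((_root_.map_ne_zero φ).mpr hx), w.ord_eq hx]
  rw [W.ord_eq ((_root_.map_ne_zero φ).mpr hx), W.ord_eq ((_root_.map_ne_zero φ).mpr hy), w.ord_eq hx, w.ord_eq hy,
    coe_lt_coe, coe_lt_coe, h x hx, h y hy, mul_lt_mul_iff_right₀ hc]
  norm_cast

open Polynomial in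
lemma ur_top (p : ℕ) [Fact p.Prime] {K B E : Type} [Field K] [Field B] [Field E] [Algebra K B] [Algebra B E] [Algebra K E]
    [IsScalarTower K B E] [Algebra.IsAlgebraic K B] [IsFF p K] [Algebra.IsAlgebraic B E] {n : ℕ} (hn : (n : E) ≠ 0) {θ : E} (hθ : IsPrimitiveRoot θ n)
    (hθt : Algebra.adjoin B {θ} = ⊤) (W : FFVal E) {v : FFPrime K} (hW : W.RestrictsTo v (algebraMap K E)) {π : E} (hπ : π ≠ 0) :
    ∃ P : B[X], W.ord π < W.ord (π - aeval θ P) ∧ ∀ i, W.ord π ≤ W.ord (algebraMap B E (P.coeff i)) := by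
  classical
  have hn0 : n ≠ 0 := by rintro rfl; simp at hn
  have : NeZero n := ⟨hn0⟩
  obtain ⟨P0, hP0⟩ : ∃ P0 : B[X], aeval θ P0 = π := by
    have : π ∈ Algebra.adjoin B {θ} := hθt ▸ Algebra.mem_top
    rwa [Algebra.adjoin_singleton_eq_range_aeval] at this
  let F : IntermediateField K B := adjoin K (P0.coeffs : Set B)
  have hF : FiniteDimensional K F := finiteDimensional_adjoin fun x _ => Algebra.IsIntegral.isIntegral x
  have : IsFF p F := IsFF.of_finite (X := K) p F
  have : Algebra.IsAlgebraic K E := Algebra.IsAlgebraic.trans K B E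
  have : Algebra.IsAlgebraic F E := Algebra.IsAlgebraic.tower_top (K := K) F
  let L := adjoin F {θ}
  have : FiniteDimensional F L := adjoin.finiteDimensional (Algebra.IsIntegral.isIntegral θ)
  have hcyc : IsCyclotomicExtension {n} F L := IsPrimitiveRoot.intermediateField_adjoin_isCyclotomicExtension F hθ
  have : IsFF p L := IsFF.of_finite (X := F) p L
  have : IsGalois F L := IsCyclotomicExtension.isGalois {n} F L
  let θ' : L := ⟨θ, IntermediateField.mem_adjoin_simple_self F θ⟩
  have hθ' : IsPrimitiveRoot θ' n := of_map_of_injective (f := algebraMap L E) hθ (algebraMap L E).injective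
  obtain ⟨Q, hQ⟩ : P0 ∈ lifts (algebraMap F B) := by
    rw [lifts_iff_coeff_lifts]
    intro k
    by_cases hk : P0.coeff k = 0
    · exact ⟨0, by rw [hk, map_zero]⟩
    · exact ⟨⟨_, subset_adjoin _ _ (coeff_mem_coeffs hk)⟩, rfl⟩
  obtain ⟨u, hu⟩ := W.exists_restrictsTo_up (K := K) (L := F) (algebraMap F E) v (by
    rwa [← algebraMap_eq])
  obtain ⟨w, hw⟩ := W.exists_restrictsTo_up (K := F) (L := L) (algebraMap L E) u (by
    rwa [← algebraMap_eq])
  have hev : ∀ R : F[X], algebraMap L E (aeval θ' R) = aeval θ (R.map (algebraMap F B)) := by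
    intro R
    rw [aeval_map_algebraMap, ← aeval_algebraMap_apply]
    rfl
  have hπ' : algebraMap L E (aeval θ' Q) = π := by
    rw [hev, ← hP0, ← hQ]; rfl
  obtain ⟨P, h1, h2⟩ := ur (F := F) (L := L) p (n := n) (by
    intro h
    apply hn
    have := congrArg (algebraMap L E) h
    simpa using this) hθ'.pow_eq_one
    (IsCyclotomicExtension.adjoin_primitive_root_eq_top hθ') w (π := aeval θ' Q) (by
      rintro h; rw [h, map_zero] at hπ'; exact hπ hπ'.symm)
  refine ⟨P.map (algebraMap F B), ?_, fun i => ?_⟩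
  · rw [← hev, ← hπ', ← map_sub]
    exact (hw.lt_iff _ _).mpr h1
  · rw [coeff_map, ← IsScalarTower.algebraMap_apply F B E, IsScalarTower.algebraMap_apply F L E, ← hπ', ← not_lt, hw.lt_iff, not_lt]
    exact h2 i

end

section
variable {p q : ℕ} [Fact p.Prime]

lemma FFVal.natCast_ord {X : Type} [Field X] (p : ℕ) [Fact p.Prime] [CharP X p] (V : FFVal X) {m : ℕ} (hm : (m : X) ≠ 0) : V.ord (m : X) = 0 := by
  have hp := (Fact.out : p.Prime)
  have h1 : (m : ZMod p) ≠ 0 := fun h => hm ((CharP.cast_eq_zero_iff X p m).mpr ((CharP.cast_eq_zero_iff (ZMod p) p m).mp h))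
  have h2 := congrArg (ZMod.castHom dvd_rfl X) (ZMod.pow_card_sub_one_eq_one h1)
  rw [map_pow, map_natCast, map_one] at h2
  rw [V.ord_eq hm, V.val_eq_zero_of_pow (by have := hp.two_le; omega) h2]
  rfl

lemma FFVal.RestrictsTo.pos_iff {X Y : Type} [Field X] [Field Y] {W : FFVal Y} {w : FFPrime X} {φ : X →+* Y} (h : W.RestrictsTo w φ) (x : X) : 0 < W.ord (φ x) ↔ 0 < w.ord x := by
  have := h.lt_iff 1 x
  rwa [map_one, W.ord_one, w.ord_one] at this

lemma FFVal.RestrictsTo.neg_iff {X Y : Type} [Field X] [Field Y] {W : FFVal Y} {w : FFPrime X} {φ : X →+* Y} (h : W.RestrictsTo w φ) (x : X) : W.ord (φ x) < 0 ↔ w.ord x < 0 := by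
  have := h.lt_iff x 1
  rwa [map_one, W.ord_one, w.ord_one] at this

lemma nt (hq : q.Prime) {a m f : ℕ} (ha : 0 < a) (h1 : q ∣ a - 1) (h2 : q ^ m ∣ a ^ f - 1) (hf : Nat.Coprime f q) : q ^ m ∣ a - 1 := by
  have key : ∀ b : ℕ, 0 < b → (q ^ m ∣ b - 1 ↔ (b : ZMod (q ^ m)) = 1) := by
    intro b hb
    rw [← CharP.cast_eq_zero_iff (ZMod (q ^ m)), Nat.cast_sub hb, Nat.cast_one, sub_eq_zero]
  rw [key _ ha]
  rw [key _ (by positivity), Nat.cast_pow] at h2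
  have h3 : (a : ZMod (q ^ m)) ^ (q ^ m) = 1 := by
    rw [← Nat.cast_pow, ← key _ (by positivity)]
    have := dvd_sub_pow_of_dvd_sub (R := ℤ) (p := q) (a := a) (b := 1) (by
      have := Int.natCast_dvd_natCast.mpr h1
      rwa [Nat.cast_sub ha, Nat.cast_one] at this) m
    rw [one_pow] at this
    have h4 : (((q ^ m : ℕ)) : ℤ) ∣ ((a ^ q ^ m - 1 : ℕ) : ℤ) := by
      rw [Nat.cast_sub (by exact Nat.one_le_pow _ _ ha)]
      push_cast
      exact (pow_dvd_pow _ (Nat.le_succ _)).trans this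
    exact_mod_cast h4
  have := pow_gcd_eq_one.mpr ⟨h2, h3⟩
  rwa [Nat.Coprime.pow_right _ hf, pow_one] at this

variable {K B E : Type} [Field K] [Field B] [Field E] [Algebra K B] [Algebra B E] [Algebra K E] [IsScalarTower K B E]

lemma FFVal.exists_pull {W : FFVal E} {v : FFPrime K} (hW : W.RestrictsTo v (algebraMap K E)) :
    ∃ V : FFVal B, (∀ x, V.ord x = W.ord (algebraMap B E x)) ∧ V.RestrictsTo v (algebraMap K B) := by
  refine ⟨{ ord := fun x => W.ord (algebraMap B E x), ord_zero := by rw [map_zero, W.ord_zero],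
            ord_ne_top := fun x hx => W.ord_ne_top _ ((map_ne_zero _).mpr hx)
            ord_one := by rw [map_one, W.ord_one]
            ord_mul := fun x y => by rw [map_mul, W.ord_mul]
            ord_add := fun x y => by rw [map_add]; exact W.ord_add _ _
            nontrivial := ?_ }, fun _ => rfl, ?_⟩
  · obtain ⟨x, hx, hx1⟩ := v.exists_val_eq 1
    have hx0 : algebraMap K E x ≠ 0 := (map_ne_zero _).mpr hx
    have := (hW.pos_iff x).mpr ((v.ord_pos_iff hx).mpr (by omega))
    rw [IsScalarTower.algebraMap_apply K B E] at this hx0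
    exact ⟨algebraMap K B x, this.ne', W.ord_ne_top _ hx0⟩
  · obtain ⟨c, hc, h⟩ := hW
    refine ⟨c, hc, fun x => ?_⟩
    rw [← h x, IsScalarTower.algebraMap_apply K B E]

variable (p q B) in
def QE (v : FFPrime K) (W : FFVal E) (C : ℕ) : Prop :=
  W.RestrictsTo v (algebraMap K E) ∧ ∀ V : FFVal B, (∀ x, V.ord x = W.ord (algebraMap B E x)) → QB p q K V C

variable [Algebra.IsAlgebraic K B]

lemma QE.level {v : FFPrime K} {W : FFVal E} {C : ℕ} (h : QE p q B v W C) (T : Finset B) : ∃ F : IntermediateField K B, FiniteDimensional K F ∧ (T : Set B) ⊆ F ∧ ∃ w : FFPrime F,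
      W.RestrictsTo w (algebraMap F E) ∧ (∃ e, w.LiesOverWith v (algebraMap K F) e ∧ padicValNat q e ≤ C) ∧
      padicValNat q (w.deg p) ≤ C := by
  have hF : FiniteDimensional K (adjoin K (T : Set B)) := finiteDimensional_adjoin fun x _ => Algebra.IsIntegral.isIntegral x
  refine ⟨adjoin K (T : Set B), hF, subset_adjoin _ _, ?_⟩
  obtain ⟨V, hV, hVv⟩ := FFVal.exists_pull (B := B) h.1
  obtain ⟨w, hw⟩ := V.exists_restrictsTo_up (K := K) (algebraMap (adjoin K (T : Set B)) B) v hVv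
  obtain ⟨e, he⟩ := FFVal.restrictsTo_lies hw hVv
  have := h.2 V hV _ hF w v hw hVv
  refine ⟨w, ?_, ⟨e, he, this.1 e he⟩, this.2⟩
  obtain ⟨c, hc, h⟩ := hw
  exact ⟨c, hc, fun x => by rw [← h x, hV]; rfl⟩

variable [IsFF p K] [Algebra.IsAlgebraic B E] {n : ℕ} {θ : E} {W : FFVal E} {v : FFPrime K} {C : ℕ}

open Polynomial in
lemma ram_bound [Fact q.Prime] (hn : (n : E) ≠ 0) (hθ : IsPrimitiveRoot θ n) (hθt : Algebra.adjoin B {θ} = ⊤)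
    (hW : QE p q B v W C) {x : K} (hx : x ≠ 0) (hvx : v.val x ≠ 0) {π : E} (hπ : π ≠ 0) {N : ℕ}
    (h : W.val (algebraMap K E x) = (q ^ N : ℕ) * W.val π) : N ≤ C + padicValNat q (v.val x).natAbs := by
  have hn0 : n ≠ 0 := by rintro rfl; simp at hn
  have hθ0 : θ ≠ 0 := hθ.ne_zero hn0
  have hθv : ∀ i, W.ord (θ ^ i) = 0 := fun i => W.pow_ord_zero (by
    rw [W.ord_eq hθ0, W.val_eq_zero_of_pow hn0 hθ.pow_eq_one]; rfl) i
  obtain ⟨P, h1, h2⟩ := ur_top p hn hθ hθt W hW.1 hπ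
  obtain ⟨i, hi⟩ : ∃ i, W.ord (algebraMap B E (P.coeff i)) = W.ord π := by
    by_contra! hne
    have h3 : W.ord π < W.ord (aeval θ P) := by
      rw [aeval_eq_sum_range]
      refine W.lt_ord_sum _ _ (lt_top_iff_ne_top.mpr (W.ord_ne_top _ hπ)) fun i _ => ?_
      rw [smul_def, W.ord_mul, hθv, add_zero]
      exact lt_of_le_of_ne (h2 i) (hne i).symm
    have := W.lt_ord_add h1 h3
    rw [sub_add_cancel] at this
    exact lt_irrefl _ this
  obtain ⟨F, hF, hT, w, hw, ⟨e, he, heC⟩, -⟩ := hW.level {P.coeff i}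
  let β : F := ⟨P.coeff i, hT (by simp)⟩
  have hβ : algebraMap F E β = algebraMap B E (P.coeff i) := rfl
  have hβ0 : β ≠ 0 := by
    intro h0
    rw [← hβ, h0, map_zero, W.ord_zero] at hi
    exact W.ord_ne_top _ hπ hi.symm
  obtain ⟨c, hc, hcw⟩ := FFVal.restrictsTo_iff.mp hw
  have hπβ : W.val π = c * w.val β := by rw [← hcw β hβ0, hβ, FFVal.val, FFVal.val, hi]
  have hx' : algebraMap K F x ≠ 0 := (_root_.map_ne_zero _).mpr hx
  have h4 := hcw _ hx'
  rw [← IsScalarTower.algebraMap_apply K F E, h, hπβ, (FFPrime.liesOverWith_iff.mp he).2 x hx] at h4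
  have h5 : ((q ^ N : ℕ) : ℤ) * w.val β = e * v.val x := by
    have : ((q ^ N : ℕ) : ℚ) * w.val β = e * v.val x := by
      have : c * (((q ^ N : ℕ) : ℚ) * w.val β) = c * (e * v.val x) := by
        push_cast at h4 ⊢; linarith
      exact mul_left_cancel₀ hc.ne' this
    exact_mod_cast this
  have h6 : q ^ N ∣ e * (v.val x).natAbs := by
    have := Int.natAbs_dvd_natAbs.mpr (Dvd.intro _ h5)
    rwa [Int.natAbs_mul, Int.natAbs_natCast, Int.natAbs_natCast] at this
  have hv0 : (v.val x).natAbs ≠ 0 := Int.natAbs_ne_zero.mpr hvx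
  have h7 := (padicValNat_dvd_iff_le (mul_ne_zero he.1.ne' hv0)).mp h6
  rw [padicValNat.mul he.1.ne' hv0] at h7
  omega

open Polynomial in
lemma res_bound [Fact q.Prime] {N : ℕ} (hN : 0 < N) (hθ : IsPrimitiveRoot θ (p ^ N - 1)) (hθt : Algebra.adjoin B {θ} = ⊤) (hqn : q ∣ p ^ N - 1) {k0 : ℕ} (hk0 : q ^ k0 ∣ p ^ N - 1)
    (hW : QE p q B v W C) {s : ℕ} (hs : C ≤ padicValNat q N + s) {x : E} (hx : 0 ≤ W.ord x) {j : ℕ} (h : 0 < W.ord (x ^ q ^ j - θ)) : q ^ (k0 + j) ∣ p ^ (N * q ^ s) - 1 := by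
  classical
  have hp := (Fact.out : p.Prime)
  have hq := (Fact.out : q.Prime)
  have hcK : CharP K p := IsFF.charP p
  have hcE : CharP E p := charP_of_injective_algebraMap (algebraMap K E).injective p
  have h1N : 1 < p ^ N := one_lt_pow hN.ne' hp.one_lt
  have hn0 : p ^ N - 1 ≠ 0 := by omega
  have hn : ((p ^ N - 1 : ℕ) : E) ≠ 0 := by
    rw [Nat.cast_sub h1N.le]
    simp [hN.ne']
  have hθ0 : θ ≠ 0 := hθ.ne_zero hn0
  have hθv1 : W.ord θ = 0 := by
    rw [W.ord_eq hθ0, W.val_eq_zero_of_pow hn0 hθ.pow_eq_one]; rfl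
  have hθv : ∀ i, W.ord (θ ^ i) = 0 := fun i => W.pow_ord_zero hθv1 i
  have hxj : W.ord (x ^ q ^ j) = 0 := by
    have := W.ord_add_eq_left (x := θ) (y := x ^ q ^ j - θ) (by rwa [hθv1])
    rwa [add_sub_cancel, hθv1] at this
  have hx0 : x ≠ 0 := by
    rintro rfl
    rw [zero_pow (pow_pos hq.pos j).ne', W.ord_zero] at hxj
    exact WithTop.top_ne_zero hxj
  have hxv : W.ord x = 0 := by
    have h1 := W.val_eq_of_ord (n := 0) hxj
    rw [W.val_pow hx0] at h1
    have h2 : W.val x = 0 := (mul_eq_zero.mp h1).resolve_left (by exact_mod_cast (pow_pos hq.pos j).ne')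
    rw [W.ord_eq hx0, h2]; rfl
  obtain ⟨P, h1, h2⟩ := ur_top p hn hθ hθt W hW.1 hx0
  rw [hxv] at h1
  simp only [hxv] at h2
  obtain ⟨F, hF, hT, w, hw, -, hwC⟩ := hW.level ((range (P.natDegree + 1)).image P.coeff)
  have hFF : IsFF p F := IsFF.of_finite (X := K) p F
  obtain ⟨a, f', hf', hfa⟩ := Nat.exists_eq_pow_mul_and_not_dvd (w.deg_pos p).ne' q hq.ne_one
  have haN : q ^ a ∣ N * q ^ s := by
    have : a ≤ C := by
      refine le_trans ?_ hwC
      exact (padicValNat_dvd_iff_le (w.deg_pos p).ne').mp ⟨f', hfa⟩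
    refine (pow_dvd_pow q (this.trans hs)).trans ?_
    rw [pow_add]
    exact mul_dvd_mul_right pow_padicValNat_dvd _
  set M := N * q ^ s with hM
  obtain ⟨r, hr⟩ := haN
  have hh : M * f' = w.deg p * r := by rw [hr, hfa]; ring
  have hf0 : f' ≠ 0 := by rintro rfl; simp at hf'
  have hθh : θ ^ p ^ (M * f') = θ := by
    have hd : p ^ N - 1 ∣ p ^ (M * f') - 1 := Nat.pow_sub_one_dvd_pow_sub_one p ⟨q ^ s * f', by rw [hM]; ring⟩
    obtain ⟨d, hd⟩ := hd
    have : p ^ (M * f') = (p ^ N - 1) * d + 1 := by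
      rw [← hd]; have := Nat.pos_of_ne_zero (pow_ne_zero (M * f') hp.ne_zero); omega
    rw [this, pow_succ, pow_mul, hθ.pow_eq_one, one_pow, one_mul]
  have hcong : 0 < W.ord (x ^ p ^ (M * f') - x) := by
    have e1 : x ^ p ^ (M * f') - x = (x - aeval θ P) ^ p ^ (M * f') + ((aeval θ P) ^ p ^ (M * f') - aeval θ P) - (x - aeval θ P) := by
      rw [sub_pow_char_pow]; ring
    have hpos : (p ^ (M * f')) ≠ 0 := pow_ne_zero _ hp.ne_zero
    rw [e1]
    refine W.lt_ord_sub (W.lt_ord_add ?_ ?_) h1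
    · obtain ⟨d, hd⟩ := Nat.exists_eq_succ_of_ne_zero hpos
      rw [hd, Nat.succ_eq_add_one, pow_succ]
      exact W.ord_mul_pos (W.ord_pow_nonneg h1.le d) h1
    · rw [aeval_eq_sum_range, sum_pow_char_pow, ← sum_sub_distrib]
      refine W.lt_ord_sum _ _ (coe_lt_top 0) fun i hi => ?_
      rw [smul_def, mul_pow, ← pow_mul, mul_comm i, pow_mul θ, hθh, ← sub_mul, W.ord_mul, hθv, add_zero]
      let β : F := ⟨P.coeff i, hT (by exact_mod_cast mem_image_of_mem _ hi)⟩
      have hβ : algebraMap F E β = algebraMap B E (P.coeff i) := rfl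
      rw [← hβ, ← map_pow, ← map_sub, hw.pos_iff, hh]
      refine w.pow_deg p ?_ r
      rw [← not_lt, ← hw.neg_iff, not_lt, hβ]
      exact h2 i
  let X : W.O := ⟨x, hxv.ge⟩
  let Θ : W.O := ⟨θ, hθv1.ge⟩
  have hΘ : IsPrimitiveRoot (Ideal.Quotient.mk W.mI Θ) (p ^ N - 1) := W.res_prim (Nat.pos_of_ne_zero hn0) (W.natCast_ord p hn) hθ
  have hXj : (Ideal.Quotient.mk W.mI X) ^ q ^ j = Ideal.Quotient.mk W.mI Θ := by
    rw [← map_pow, Ideal.Quotient.eq]; exact h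
  have hXh : (Ideal.Quotient.mk W.mI X : W.kap) ^ (p ^ (M * f') - 1) = 1 := by
    have h3 : (Ideal.Quotient.mk W.mI X : W.kap) ^ p ^ (M * f') = Ideal.Quotient.mk W.mI X := by
      change (Ideal.Quotient.mk W.mI X) ^ p ^ (M * f') = Ideal.Quotient.mk W.mI X
      rw [← map_pow, Ideal.Quotient.eq]; exact hcong
    have h4 : (Ideal.Quotient.mk W.mI X : W.kap) ≠ 0 := by
      intro h0
      have : X ∈ W.mI := Ideal.Quotient.eq_zero_iff_mem.mp h0
      exact absurd hxv (ne_of_gt this)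
    refine mul_right_cancel₀ h4 ?_
    rw [← pow_succ, Nat.sub_add_cancel (Nat.one_le_pow _ _ hp.pos), h3, one_mul]
  have ho := orderOf_dvd_of_pow_eq_one hXh
  set o := orderOf (Ideal.Quotient.mk W.mI X : W.kap) with hodef
  have hoj : o = (p ^ N - 1) * o.gcd (q ^ j) := by
    have h3 := hΘ.eq_orderOf
    rw [← hXj] at h3
    have h4 : p ^ N - 1 = o / o.gcd (q ^ j) := by
      rw [h3]
      exact orderOf_pow' (Ideal.Quotient.mk W.mI X) (pow_pos hq.pos j).ne'
    rw [h4, Nat.div_mul_cancel (Nat.gcd_dvd_left _ _)]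
  obtain ⟨i, hij, hi⟩ := (Nat.dvd_prime_pow hq).mp (Nat.gcd_dvd_right o (q ^ j))
  have hij' : i = j := by
    by_contra hne
    have hd : q ^ (i + 1) ∣ o.gcd (q ^ j) := by
      refine Nat.dvd_gcd ?_ (pow_dvd_pow q (by omega))
      rw [hoj, hi, pow_succ, mul_comm]
      exact mul_dvd_mul_right hqn _
    rw [hi] at hd
    exact absurd ((Nat.pow_dvd_pow_iff_le_right hq.one_lt).mp hd) (by omega)
  subst hij'
  have hfin : q ^ (k0 + i) ∣ (p ^ M) ^ f' - 1 := by
    rw [← pow_mul]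
    refine Dvd.dvd.trans ?_ ho
    rw [hoj, hi, pow_add]
    exact mul_dvd_mul_right hk0 _
  refine nt hq (pow_pos hp.pos M) ?_ hfin ((Nat.coprime_comm.mp ((Nat.Prime.coprime_iff_not_dvd hq).mpr hf')))
  exact hqn.trans (Nat.pow_sub_one_dvd_pow_sub_one p ⟨q ^ s, rfl⟩)

end

section
variable {p q : ℕ} [Fact p.Prime]

lemma cast_ne (p : ℕ) [Fact p.Prime] {X : Type} [Field X] [CharP X p] {N a : ℕ} (hN : 0 < N) (ha : a ∣ p ^ N - 1) : (a : X) ≠ 0 := by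
  have hp := (Fact.out : p.Prime)
  intro h
  have h1 := ((CharP.cast_eq_zero_iff X p a).mp h).trans ha
  have h2 := Nat.dvd_sub (dvd_pow_self p hN.ne') h1
  rw [Nat.sub_sub_self (Nat.one_le_pow _ _ hp.pos)] at h2
  exact hp.one_lt.ne' (Nat.dvd_one.mp h2)

lemma ord_root {X : Type} [Field X] (W : FFVal X) {n : ℕ} (hn : n ≠ 0) {θ : X} (hθ : θ ^ n = 1) : W.ord θ = 0 := by
  rw [W.ord_eq (by rintro rfl; rw [zero_pow hn] at hθ; exact zero_ne_one hθ), W.val_eq_zero_of_pow hn hθ]; rfl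

lemma RR_map {A A' : Type} [Field A] [Field A'] (φ : A →+* A') {Q : ℕ} {ζ θ t w : A} (h : RR Q ζ θ t w) : RR Q (φ ζ) (φ θ) (φ t) (φ w) := by
  obtain ⟨u, h1, h2⟩ := h
  refine ⟨φ u, by simpa using congrArg φ h1, ?_⟩
  convert! PP_map φ h2 using 1
  · funext i; fin_cases i <;> simp
  · simp

lemma rr_of {L : Type} [Field L] [IsFF p L] {Q : ℕ} (hQ0 : 0 < Q) (hQ : (Q : L) ≠ 0) {ζ θ t w : L}
    (hζ : IsPrimitiveRoot ζ Q) {n : ℕ} (hn : n ≠ 0) (hθ : θ ^ n = 1) (ht : t ≠ 0) (hw : w ≠ 0)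
    (hpole : ∃ v : FFPrime L, v.val t < 0) (h1 : ∀ v : FFPrime L, v.val t < 0 → 0 < v.val t + Q * v.val w) (h2 : ∀ v : FFPrime L, 0 < v.val t → 0 ≤ v.val w) : RR Q ζ θ t w := by
  have hwQ : t * w ^ Q ≠ 0 := mul_ne_zero ht (pow_ne_zero _ hw)
  have hval : ∀ v : FFPrime L, v.val (t * w ^ Q) = v.val t + Q * v.val w := fun v => by rw [v.val_mul ht (pow_ne_zero _ hw), v.val_pow hw]
  obtain ⟨v0, hv0⟩ := hpole
  have hv1 : 0 < v0.ord (t * w ^ Q) := (v0.ord_pos_iff hwQ).mpr (by rw [hval]; exact h1 v0 hv0)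
  have hcu := v0.ord_add_eq_left (x := 1) (y := t * w ^ Q) (by rwa [v0.ord_one])
  set c := 1 + t * w ^ Q with hcdef
  have hc : c ≠ 0 := by
    intro h0
    rw [h0, v0.ord_zero, v0.ord_one] at hcu
    exact WithTop.top_ne_zero hcu
  have hc1 : c + 1 ≠ 0 := by
    intro h0
    have h3 : t * w ^ Q = -((2 : ℕ) : L) := by push_cast; linear_combination h0
    have h20 : ((2 : ℕ) : L) ≠ 0 := by intro h; rw [h, neg_zero] at h3; exact hwQ h3
    rw [h3, v0.ord_neg, v0.natCast_ord_zero p h20] at hv1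
    exact lt_irrefl _ hv1
  have hθ0 : θ ≠ 0 := by rintro rfl; rw [zero_pow hn] at hθ; exact zero_ne_one hθ
  refine ⟨(c + 1) / c, by rw [← hcdef]; field_simp, ?_⟩
  refine solv p hQ0 hQ hζ _ (by intro i; fin_cases i <;> simp [hc, hc1, hθ0]) hc ?_
  intro F _ _ _ s1 s2 hs1 _ v
  change s1 ^ Q = algebraMap L F ((c + 1) / c) at hs1
  change (Q : ℤ) ∣ v.val (algebraMap L F θ) ∧ _
  have hi := (algebraMap L F).injective
  have hcF : algebraMap L F c ≠ 0 := (map_ne_zero _).mpr hc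
  have hc1F : algebraMap L F c + 1 ≠ 0 := by rw [← map_one (algebraMap L F), ← map_add]; exact (map_ne_zero _).mpr hc1
  refine ⟨by rw [v.val_root (Nat.pos_of_ne_zero hn) (by rw [← map_pow, hθ, map_one])]; exact dvd_zero _, Or.inl ?_⟩
  rcases lt_trichotomy (v.val (algebraMap L F c)) 0 with hlt | heq | hgt
  · obtain ⟨v', e, he⟩ := v.exists_under (K := L)
    obtain ⟨he0, he⟩ := FFPrime.liesOverWith_iff.mp he
    have h3 : v.val (algebraMap L F (t * w ^ Q)) = v.val (algebraMap L F c) := by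
      have h4 := v.ord_add_eq_left (x := algebraMap L F c) (y := -1) (by
        rw [v.ord_neg, v.ord_one]; exact (v.ord_neg_iff hcF).mpr hlt)
      have h5 : algebraMap L F c + -1 = algebraMap L F (t * w ^ Q) := by rw [hcdef]; simp
      rw [h5] at h4
      simp only [FFPrime.val, h4]
    rw [← h3, he _ hwQ, hval] at hlt ⊢
    have h6 : v'.val t + Q * v'.val w < 0 := by
      by_contra hcon
      have := mul_nonneg (Int.natCast_nonneg e) (not_lt.mp hcon)
      omega
    have h7 : v'.val t = 0 := by
      rcases lt_trichotomy (v'.val t) 0 with h | h | h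
      · exact absurd (h1 v' h) (by omega)
      · exact h
      · have := mul_nonneg (Int.natCast_nonneg Q) (h2 v' h); omega
    rw [h7, zero_add]
    exact ⟨e * v'.val w, by ring⟩
  · rw [heq]; exact dvd_zero _
  · have h3 : v.val (algebraMap L F c + 1) = 0 := by
      refine v.val_eq_of_ord (n := 0) ?_
      have := v.ord_add_eq_right (x := algebraMap L F c) (y := 1) (by rw [v.ord_one]; exact (v.ord_pos_iff hcF).mpr hgt)
      rw [this, v.ord_one]; rfl
    have hs0 : s1 ≠ 0 := by
      rintro rfl
      rw [zero_pow hQ0.ne'] at hs1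
      exact (div_ne_zero hc1 hc) (hi (by rw [← hs1, map_zero]))
    have h4 := congrArg v.val hs1
    rw [v.val_pow hs0, map_div₀, map_add, map_one, v.val_div hc1F hcF, h3] at h4
    exact ⟨-v.val s1, by linear_combination h4⟩

lemma dvd_of {F : Type} [Field F] (v : FFPrime F) {s a x : F} (hs : s ≠ 0) (ha : a ≠ 0) (hx0 : x ≠ 0)
    (hx : 0 ≤ v.ord x) (h : s ^ q * (a * x ^ q) = a * x ^ q + a ^ 2 + 1) : (q : ℤ) ∣ v.val a := by
  have hL : v.val (s ^ q * (a * x ^ q)) = q * v.val s + v.val a + q * v.val x := by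
    rw [v.val_mul (pow_ne_zero _ hs) (mul_ne_zero ha (pow_ne_zero _ hx0)), v.val_mul ha (pow_ne_zero _ hx0), v.val_pow hs, v.val_pow hx0]; ring
  have hxq : 0 ≤ v.ord (x ^ q) := v.ord_pow_nonneg hx q
  have hxv : 0 ≤ v.val (x ^ q) := (v.ord_nonneg_iff (pow_ne_zero _ hx0)).mp hxq
  have hax : a * x ^ q ≠ 0 := mul_ne_zero ha (pow_ne_zero _ hx0)
  have hav : v.val (a * x ^ q) = v.val a + v.val (x ^ q) := v.val_mul ha (pow_ne_zero _ hx0)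
  have ha2 : v.val (a ^ 2) = 2 * v.val a := by rw [v.val_pow ha]; rfl
  rcases lt_trichotomy (v.val a) 0 with hlt | heq | hgt
  · have h1 : v.ord (a ^ 2 + (a * x ^ q + 1)) = v.ord (a ^ 2) := by
      refine v.ord_add_eq_left (v.lt_ord_add ?_ ?_)
      · rw [v.ord_eq (pow_ne_zero _ ha), v.lt_ord_iff hax]; omega
      · rw [v.ord_one, v.ord_neg_iff (pow_ne_zero _ ha)]; omega
    have h2 : v.val (s ^ q * (a * x ^ q)) = 2 * v.val a := by
      rw [h, show a * x ^ q + a ^ 2 + 1 = a ^ 2 + (a * x ^ q + 1) by ring, ← ha2, FFPrime.val, h1, FFPrime.val]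
    exact ⟨v.val s + v.val x, by rw [hL] at h2; linear_combination -h2⟩
  · rw [heq]; exact dvd_zero _
  · have h1 : v.ord (1 + (a * x ^ q + a ^ 2)) = v.ord 1 := by
      refine v.ord_add_eq_left (v.lt_ord_add ?_ ?_) <;> rw [v.ord_one, v.ord_pos_iff (by positivity)] <;> omega
    have h2 : v.val (s ^ q * (a * x ^ q)) = 0 := by
      rw [h, show a * x ^ q + a ^ 2 + 1 = 1 + (a * x ^ q + a ^ 2) by ring]
      exact v.val_eq_of_ord (n := 0) (by rw [h1, v.ord_one]; rfl)
    exact ⟨-v.val s - v.val x, by rw [hL] at h2; linear_combination h2⟩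

lemma exists_ext' {L E : Type} [Field L] [Field E] [Algebra L E] [Algebra.IsAlgebraic L E] (v : FFPrime L) : ∃ W : FFVal E, W.RestrictsTo v (algebraMap L E) := by
  obtain ⟨π, hπ, hπ1⟩ := v.exists_val_eq (-1)
  obtain ⟨W, hW, _⟩ := exists_ext v (algebraMap L E π) (by
    rintro ⟨P, hP, hPn, hPx⟩
    rw [Polynomial.aeval_algebraMap_apply, map_eq_zero, aeval_def, Algebra.algebraMap_self, Polynomial.eval₂_id] at hPx
    have := (v.ord_nonneg_iff hπ).mp (v.nonneg_of_integral P hP hPn hPx)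
    omega)
  exact ⟨W, FFVal.restrictsTo_of_ext hW⟩

variable {K B E : Type} [Field K] [Field B] [Field E] [Algebra K B] [Algebra B E] [Algebra K E] [IsScalarTower K B E]
  [Algebra.IsAlgebraic K B] [IsFF p K] [Algebra.IsAlgebraic B E] {θ : E} {W : FFVal E} {v : FFPrime K} {C : ℕ}

lemma rr_pos [Fact q.Prime] {N : ℕ} (hN : 0 < N) (hθ : IsPrimitiveRoot θ (p ^ N - 1)) (hθt : Algebra.adjoin B {θ} = ⊤)
    (hqn : q ∣ p ^ N - 1) (hW : QE p q B v W C) (hs : C ≤ padicValNat q N) {N1 : ℕ} {ζ' : E}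
    (hζ' : IsPrimitiveRoot ζ' (q ^ N1)) {t : K} (ht : v.val t < 0) (hN1 : C + padicValNat q (v.val t).natAbs < N1) {w : E} (h : RR (q ^ N1) ζ' θ (algebraMap K E t) w) : 0 < W.ord w := by
  have hp := (Fact.out : p.Prime)
  have hq := (Fact.out : q.Prime)
  have hcE : CharP E p := by
    have : CharP K p := IsFF.charP p
    exact charP_of_injective_algebraMap (algebraMap K E).injective p
  have h1N : 1 < p ^ N := one_lt_pow hN.ne' hp.one_lt
  have hn0 : p ^ N - 1 ≠ 0 := by omega
  have ht0 : t ≠ 0 := by rintro rfl; simp [FFPrime.val, v.ord_zero] at ht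
  have ht0' : algebraMap K E t ≠ 0 := (map_ne_zero _).mpr ht0
  by_contra hcon
  have hw0 : w ≠ 0 := by rintro rfl; rw [W.ord_zero] at hcon; simp at hcon
  rw [W.ord_pos_iff hw0] at hcon
  have htv : W.val (algebraMap K E t) < 0 := (W.ord_neg_iff ht0').mp ((hW.1.neg_iff t).mpr ((v.ord_neg_iff ht0).mpr ht))
  have hc0 : algebraMap K E t * w ^ q ^ N1 ≠ 0 := mul_ne_zero ht0' (pow_ne_zero _ hw0)
  have hcv : W.val (algebraMap K E t * w ^ q ^ N1) = W.val (algebraMap K E t) + (q ^ N1 : ℕ) * W.val w := by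
    rw [W.val_mul ht0' (pow_ne_zero _ hw0), W.val_pow hw0]
  have hneg : W.val (algebraMap K E t * w ^ q ^ N1) < 0 := by
    rw [hcv]
    have := mul_nonneg (Nat.cast_nonneg (α := ℚ) (q ^ N1)) (neg_nonneg.mpr (not_lt.mp hcon))
    linarith
  have hc1 := W.ord_add_eq_right (x := 1) (y := algebraMap K E t * w ^ q ^ N1) (by
    rw [W.ord_one]; exact (W.ord_neg_iff hc0).mpr hneg)
  obtain ⟨u, hu, hPP⟩ := h
  set c := 1 + algebraMap K E t * w ^ q ^ N1 with hcdef
  have hc : c ≠ 0 := by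
    intro h0
    rw [h0, W.ord_zero] at hc1
    exact W.ord_ne_top _ hc0 hc1.symm
  have hcval : W.val c = W.val (algebraMap K E t * w ^ q ^ N1) := by simp only [FFVal.val, hc1]
  have hu1 : u - 1 = c⁻¹ := by field_simp; linear_combination hu
  obtain ⟨π, hπ, hπc⟩ := W.obstruct hq (W.natCast_ord p (by
      rw [Nat.cast_pow]; exact pow_ne_zero _ (cast_ne p hN hqn))) hζ' ![u, 1, θ]
    (by
      change 0 < W.ord (u - 1)
      rw [hu1, W.ord_pos_iff (inv_ne_zero hc), W.val_inv hc, hcval]; linarith)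
    (by simp [W.ord_zero]) (ord_root W hn0 hθ.pow_eq_one) (by
      intro x hx hxθ
      have h1 := res_bound (j := 1) hN hθ hθt hqn (pow_padicValNat_dvd (p := q) (n := p ^ N - 1)) hW (s := 0) hs hx
        (by rw [pow_one]; exact hxθ)
      rw [pow_zero, mul_one] at h1
      exact pow_succ_padicValNat_not_dvd hn0 h1) hc hPP
  have := ram_bound (cast_ne p hN dvd_rfl) hθ hθt hW ht0 ht.ne (π := π / w) (div_ne_zero hπ hw0) (N := N1) (by
    rw [W.val_div hπ hw0]
    rw [hcval, hcv] at hπc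
    linear_combination hπc)
  omega

end

section
variable {p q : ℕ} [Fact p.Prime]
variable {K B E : Type} [Field K] [Field B] [Field E] [Algebra K B] [Algebra B E] [Algebra K E] [IsScalarTower K B E]

lemma fin_adj [Algebra.IsAlgebraic K E] {T : Set E} (hT : T.Finite) : ∃ L : IntermediateField K E, FiniteDimensional K L ∧ ∀ y ∈ T, y ∈ L := by
  have := hT.to_subtype
  exact ⟨adjoin K T, finiteDimensional_adjoin fun x _ => Algebra.IsIntegral.isIntegral x, subset_adjoin _ _⟩

lemma good_of (p : ℕ) [Fact p.Prime] [IsFF p K] [Algebra.IsAlgebraic K E] [Fact q.Prime] {S : Set (FFPrime K)} {Q : ℕ} {ζ ζ' θ t : E} (hζ : IsPrimitiveRoot ζ q) (hqE : (q : E) ≠ 0)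
    (hR : ∀ (W : FFVal E) (v : FFPrime K), v ∈ S → W.RestrictsTo v (algebraMap K E) → ∀ w, RR Q ζ' θ t w → 0 < W.ord w)
    {x : B} (hx : x ∈ sIntegralClosure S B) : Good q Q ζ ζ' θ t (algebraMap B E x) := by
  have hq := (Fact.out : q.Prime)
  by_cases hx0 : algebraMap B E x = 0
  · exact Or.inl hx0
  refine Or.inr fun w c u1 u2 hw hc ha hu1 hu2 e1 e2 => ?_
  obtain ⟨L, hfd, hm⟩ := fin_adj (K := K) (Set.toFinite ({w, c, u1, u2, ζ, algebraMap B E x} : Set E))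
  have hFF : IsFF p L := IsFF.of_finite (X := K) p L
  obtain ⟨w', rfl⟩ : ∃ y : L, algebraMap L E y = w := ⟨⟨w, hm _ (by simp)⟩, rfl⟩
  obtain ⟨c', rfl⟩ : ∃ y : L, algebraMap L E y = c := ⟨⟨c, hm _ (by simp)⟩, rfl⟩
  obtain ⟨u1', rfl⟩ : ∃ y : L, algebraMap L E y = u1 := ⟨⟨u1, hm _ (by simp)⟩, rfl⟩
  obtain ⟨u2', rfl⟩ : ∃ y : L, algebraMap L E y = u2 := ⟨⟨u2, hm _ (by simp)⟩, rfl⟩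
  obtain ⟨ζL, hζL⟩ : ∃ y : L, algebraMap L E y = ζ := ⟨⟨ζ, hm _ (by simp)⟩, rfl⟩
  obtain ⟨x', hx'⟩ : ∃ y : L, algebraMap L E y = algebraMap B E x := ⟨⟨algebraMap B E x, hm _ (by simp)⟩, rfl⟩
  have hi := (algebraMap L E).injective
  rw [← hx'] at e1 e2 hx0
  rw [← hζL] at hζ ⊢
  have f1 : u1' * ((1 + w') * x' ^ q) = (1 + w') * x' ^ q + (1 + w') ^ 2 + 1 := hi (by simpa using e1)
  have f2 : u2' * (c' * x' ^ q) = c' * x' ^ q + c' ^ 2 + 1 := hi (by simpa using e2)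
  have ha' : 1 + w' ≠ 0 := fun h => ha (by rw [← map_one (algebraMap L E), ← map_add, h, map_zero])
  have hc' : c' ≠ 0 := fun h => hc (by rw [h, map_zero])
  have hu1' : u1' ≠ 0 := fun h => hu1 (by rw [h, map_zero])
  have hu2' : u2' ≠ 0 := fun h => hu2 (by rw [h, map_zero])
  have hx0' : x' ≠ 0 := fun h => hx0 (by rw [h, map_zero])
  suffices h : PP q ζL ![u1', u2', 1 + w'] c' by
    convert! PP_map (algebraMap L E) h using 1
    funext i; fin_cases i <;> simp
  refine solv p hq.pos (fun h => hqE (by rw [← map_natCast (algebraMap L E), h, map_zero]))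
    (of_map_of_injective hζ hi) _ (by intro i; fin_cases i <;> simp [hu1', hu2', ha']) hc' ?_
  intro F _ _ _ s1 s2 hs1 hs2 v
  change s1 ^ q = algebraMap L F u1' at hs1
  change s2 ^ q = algebraMap L F u2' at hs2
  change (q : ℤ) ∣ v.val (algebraMap L F (1 + w')) ∧ (_ ∨ _ ∧ ∃ b : F, b ≠ 0 ∧ 0 < v.ord (algebraMap L F (1 + w') / b ^ q - 1))
  obtain ⟨v', hv'⟩ := v.exists_under (K := L)
  obtain ⟨v'', hv''⟩ := v'.exists_under (K := K)
  by_cases hS : v'' ∈ S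
  · obtain ⟨W, hW⟩ := exists_ext' (E := E) v'
    obtain ⟨v2, hv2⟩ := W.exists_restrictsTo_down (K := K) _ v' hW
    obtain rfl := (FFVal.liesOver_of_restrictsTo hW hv2).unique hv''
    rw [← algebraMap_eq] at hv2
    have h1 := hR W _ hS hv2 _ hw
    have h3 : 0 < v.ord (algebraMap L F (1 + w') - 1) := by
      rw [map_add, map_one, add_sub_cancel_left]
      exact hv'.ord_pos.mpr ((hW.pos_iff w').mp h1)
    exact ⟨by rw [FFPrime.one_val h3]; exact dvd_zero _, Or.inr ⟨hq, 1, one_ne_zero, by simpa using h3⟩⟩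
  · have hxv : 0 ≤ v'.ord x' := by
      obtain ⟨P, hP, hPn, hPx⟩ := hx
      refine v'.nonneg_of_integral (P.map (algebraMap K L)) (hP.map _) (fun n => ?_) ?_
      · rw [Polynomial.coeff_map]; exact hv''.ord_nonneg.mpr (hPn n _ hS)
      · rw [Polynomial.eval_map_algebraMap]
        refine hi ?_
        rw [← Polynomial.aeval_algebraMap_apply, hx', Polynomial.aeval_algebraMap_apply, hPx, map_zero, map_zero]
    have hxF : 0 ≤ v.ord (algebraMap L F x') := hv'.ord_nonneg.mpr hxv
    have nz : ∀ y : L, y ≠ 0 → algebraMap L F y ≠ 0 := fun y hy => (map_ne_zero _).mpr hy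
    have ns : ∀ (s : F) (u : L), u ≠ 0 → s ^ q = algebraMap L F u → s ≠ 0 := by
      rintro s u hu hs rfl
      rw [zero_pow hq.ne_zero] at hs
      exact nz u hu hs.symm
    refine ⟨dvd_of v (s := s1) (ns _ _ hu1' hs1) (nz _ ha') (nz _ hx0') hxF ?_,
      Or.inl (dvd_of v (s := s2) (ns _ _ hu2' hs2) (nz _ hc') (nz _ hx0') hxF ?_)⟩
    · rw [hs1]; simpa using congrArg (algebraMap L F) f1
    · rw [hs2]; simpa using congrArg (algebraMap L F) f2

lemma exists_bad [Algebra.IsAlgebraic K B] {S : Set (FFPrime K)} {x : B} (hx : x ∉ sIntegralClosure S B) : ∃ v ∉ S, x ∉ valIntegralClosure v B := by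
  by_contra! hcon
  refine hx ⟨minpoly K x, minpoly.monic (Algebra.IsIntegral.isIntegral x), fun n v hv => ?_, minpoly.aeval K x⟩
  obtain ⟨P, hP, hPn, hPx⟩ := hcon v hv
  let O : ValuationSubring K :=
    { v.toFFVal.O with
      mem_or_inv_mem' := fun y => by
        by_cases hy : 0 ≤ v.toFFVal.ord y
        · exact Or.inl hy
        · exact Or.inr (v.toFFVal.ord_inv_nonneg_of_le (not_le.mp hy).le) }
  have hO : ∀ y : K, y ∈ O ↔ 0 ≤ v.ord y := fun y => FFPrime.toFFVal_nonneg
  let _ : Algebra O B := ((algebraMap K B).comp (algebraMap O K)).toAlgebra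
  have _ : IsScalarTower O K B := of_algebraMap_eq fun _ => rfl
  have hxi : IsIntegral O x := by
    obtain ⟨R, hR, -, hRm⟩ := Polynomial.lifts_and_natDegree_eq_and_monic (f := algebraMap O K) (p := P)
      ((Polynomial.lifts_iff_coeff_lifts _).mpr fun k => ⟨⟨_, (hO _).mpr (hPn k)⟩, rfl⟩) hP
    refine ⟨R, hRm, ?_⟩
    rw [← aeval_def, ← Polynomial.aeval_map_algebraMap K, hR, hPx]
  rw [minpoly.isIntegrallyClosed_eq_field_fractions' K hxi, Polynomial.coeff_map]
  exact (hO _).mp ((minpoly O x).coeff n).2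

end

section
variable {p q : ℕ} [Fact p.Prime]
variable {K B E : Type} [Field K] [Field B] [Field E] [Algebra K B] [Algebra B E] [Algebra K E] [IsScalarTower K B E]
  [Algebra.IsAlgebraic K B] [IsFF p K] [Algebra.IsAlgebraic B E] {θ : E} {W : FFVal E} {v : FFPrime K} {C : ℕ}

lemma exists_nonres [Fact q.Prime] {N : ℕ} (hN : 0 < N) (hθ : IsPrimitiveRoot θ (p ^ N - 1)) (hθt : Algebra.adjoin B {θ} = ⊤) (hqn : q ∣ p ^ N - 1) (hW : QE p q B v W C) :
    ∃ l, 0 ≤ W.ord l ∧ ∀ y, 0 ≤ W.ord y → ¬ 0 < W.ord (y ^ q - l) := by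
  have hp := (Fact.out : p.Prime)
  have hq := (Fact.out : q.Prime)
  have hn0 : p ^ N - 1 ≠ 0 := by have := one_lt_pow hN.ne' hp.one_lt; omega
  by_contra! hcon
  have key : ∀ j : ℕ, ∃ y, 0 ≤ W.ord y ∧ 0 < W.ord (y ^ q ^ j - θ) := by
    intro j
    induction j with
    | zero => exact ⟨θ, (ord_root W hn0 hθ.pow_eq_one).ge, by simp [W.ord_zero]⟩
    | succ j ih =>
      obtain ⟨l, hl, h1⟩ := ih
      obtain ⟨y, hy, h2⟩ := hcon l hl
      refine ⟨y, hy, ?_⟩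
      have h3 := W.cont_pow (W.ord_pow_nonneg hy q) hl le_rfl (q ^ j)
      rw [← pow_mul, ← pow_succ'] at h3
      have := W.lt_ord_add (lt_of_lt_of_le h2 h3) h1
      rwa [sub_add_sub_cancel] at this
  obtain ⟨y, hy, h⟩ := key (p ^ (N * q ^ C))
  have h1 := res_bound hN hθ hθt hqn (k0 := 0) (by simp) hW (s := C) (by omega) hy h
  have h2 := Nat.le_of_dvd (Nat.sub_pos_of_lt (one_lt_pow (by have := hq.pos; positivity) hp.one_lt)) h1
  have h3 := Nat.lt_pow_self hq.one_lt (n := 0 + p ^ (N * q ^ C))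
  omega

lemma exists_nonmul [Fact q.Prime] {N : ℕ} (hN : 0 < N) (hθ : IsPrimitiveRoot θ (p ^ N - 1))
    (hθt : Algebra.adjoin B {θ} = ⊤) (hW : QE p q B v W C) : ∃ c : E, c ≠ 0 ∧ ∀ π : E, π ≠ 0 → W.val c ≠ q * W.val π := by
  have hcE : CharP E p := by
    have : CharP K p := IsFF.charP p
    exact charP_of_injective_algebraMap (algebraMap K E).injective p
  by_contra! hcon
  obtain ⟨τ, hτ, hτ1⟩ := v.exists_val_eq 1
  have key : ∀ j : ℕ, ∃ π : E, π ≠ 0 ∧ W.val (algebraMap K E τ) = (q ^ j : ℕ) * W.val π := by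
    intro j
    induction j with
    | zero => exact ⟨algebraMap K E τ, (map_ne_zero _).mpr hτ, by simp⟩
    | succ j ih =>
      obtain ⟨π, hπ, h1⟩ := ih
      obtain ⟨π', hπ', h2⟩ := hcon π hπ
      exact ⟨π', hπ', by rw [h1, h2]; push_cast; ring⟩
  obtain ⟨π, hπ, h⟩ := key (C + padicValNat q (v.val τ).natAbs + 1)
  have := ram_bound (cast_ne p hN dvd_rfl) hθ hθt hW hτ (by omega) hπ h
  omega

lemma not_good [Fact q.Prime] {N : ℕ} (hN : 0 < N) (hθ : IsPrimitiveRoot θ (p ^ N - 1))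
    (hθt : Algebra.adjoin B {θ} = ⊤) (hqn : q ∣ p ^ N - 1) {Q : ℕ} (hQ0 : 0 < Q) (hQn : Q ∣ p ^ N - 1) {ζ ζ' : E}
    (hζ : IsPrimitiveRoot ζ q) (hζ' : IsPrimitiveRoot ζ' Q) {t : K} (ht : t ≠ 0) (hpole : ∃ v : FFPrime K, v.val t < 0)
    {S : Set (FFPrime K)} (hS : ∀ v, v ∉ S → 0 ≤ v.val t) (hQB : ∀ V : FFVal B, ∃ C, QB p q K V C) {x : B}
    (hx : x ∉ sIntegralClosure S B) : ¬ Good q Q ζ ζ' θ (algebraMap K E t) (algebraMap B E x) := by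
  classical
  have hp := (Fact.out : p.Prime)
  have hq := (Fact.out : q.Prime)
  have hcE : CharP E p := by
    have : CharP K p := IsFF.charP p
    exact charP_of_injective_algebraMap (algebraMap K E).injective p
  have hn0 : p ^ N - 1 ≠ 0 := by have := one_lt_pow hN.ne' hp.one_lt; omega
  have : Algebra.IsAlgebraic K E := Algebra.IsAlgebraic.trans K B E
  obtain ⟨v, hvS, hxv⟩ := exists_bad hx
  obtain ⟨W, hW, hWx⟩ := exists_ext v (algebraMap B E x) (by
    rintro ⟨P, hP, hPn, hPx⟩
    rw [Polynomial.aeval_algebraMap_apply, map_eq_zero] at hPx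
    exact hxv ⟨P, hP, hPn, hPx⟩)
  have hWv := FFVal.restrictsTo_of_ext hW
  obtain ⟨C, hQE⟩ : ∃ C, QE p q B v W C := by
    obtain ⟨V, hV, -⟩ := FFVal.exists_pull (B := B) hWv
    obtain ⟨C, hC⟩ := hQB V
    refine ⟨C, hWv, fun V' hV' => ?_⟩
    have : V' = V := by
      cases V'; cases V; congr; funext y; exact (hV' y).trans (hV y).symm
    rwa [this]
  generalize algebraMap B E x = x at hWx
  have hx0 : x ≠ 0 := by rintro rfl; rw [W.ord_zero] at hWx; simp at hWx
  obtain ⟨l, hl, hnr⟩ := exists_nonres hN hθ hθt hqn hQE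
  obtain ⟨c0, hc0, hnm⟩ := exists_nonmul hN hθ hθt hQE
  obtain ⟨w, hwR, hwl⟩ : ∃ w : E, RR Q ζ' θ (algebraMap K E t) w ∧ 0 < W.ord (1 + w - l) := by
    obtain ⟨L, hfd, hm⟩ := fin_adj (K := K) (Set.toFinite ({l, θ, ζ'} : Set E))
    have hFF : IsFF p L := IsFF.of_finite (X := K) p L
    have hcL : CharP L p := IsFF.charP p
    have hi := (algebraMap L E).injective
    obtain ⟨l', rfl⟩ : ∃ y : L, algebraMap L E y = l := ⟨⟨l, hm _ (by simp)⟩, rfl⟩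
    obtain ⟨θ', hθ'⟩ : ∃ y : L, algebraMap L E y = θ := ⟨⟨θ, hm _ (by simp)⟩, rfl⟩
    obtain ⟨ζL, hζL⟩ : ∃ y : L, algebraMap L E y = ζ' := ⟨⟨ζ', hm _ (by simp)⟩, rfl⟩
    have htE : algebraMap L E (algebraMap K L t) = algebraMap K E t := (IsScalarTower.algebraMap_apply K L E t).symm
    obtain ⟨w0, hw0⟩ := W.exists_restrictsTo_up (K := K) (algebraMap L E) v (by rwa [← algebraMap_eq])
    have ht' : algebraMap K L t ≠ 0 := (map_ne_zero _).mpr ht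
    generalize hteq : algebraMap K L t = t' at htE ht'
    have hfin := finite_supp p ht'
    have hw0t : 0 ≤ w0.val t' := by
      rw [← w0.ord_nonneg_iff ht', ← not_lt, ← hw0.neg_iff, htE, hWv.neg_iff, not_lt, v.ord_nonneg_iff ht]
      exact hS v hvS
    have hn1 : (1 : ℤ) ≤ 1 + ∑ v ∈ hfin.toFinset, |v.val t'| := by
      have := sum_nonneg (s := hfin.toFinset) (f := fun v => |v.val t'|) fun _ _ => abs_nonneg _
      omega
    obtain ⟨w, hw⟩ := FFPrime.approx (insert w0 hfin.toFinset) (fun v => if v = w0 then l' - 1 else 0)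
      (1 + ∑ v ∈ hfin.toFinset, |v.val t'|)
    have hwpos : 0 < w0.ord (w - (l' - 1)) := by
      have := hw w0 (Finset.mem_insert_self _ _)
      rw [if_pos rfl] at this
      exact lt_of_lt_of_le (coe_lt_coe.mpr (by omega : (0 : ℤ) < _)) this
    have hw00 : w ≠ 0 := by
      rintro rfl
      refine hnr 1 W.ord_one.ge ?_
      rw [one_pow, ← map_one (algebraMap L E), ← map_sub, hw0.pos_iff]
      rwa [show (0 : L) - (l' - 1) = 1 - l' by ring] at hwpos
    have hwv : ∀ v : FFPrime L, v.val t' ≠ 0 → v ≠ w0 → 1 + |v.val t'| ≤ v.val w := by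
      intro v hv hne
      have h1 := hw v (mem_insert_of_mem (hfin.mem_toFinset.mpr hv))
      rw [if_neg hne, sub_zero, v.le_ord_iff hw00] at h1
      have := single_le_sum (s := hfin.toFinset) (f := fun v => |v.val t'|) (fun _ _ => abs_nonneg _)
        (hfin.mem_toFinset.mpr hv)
      omega
    refine ⟨algebraMap L E w, ?_, ?_⟩
    · rw [← hζL, ← hθ', ← htE]
      refine RR_map _ (rr_of (p := p) hQ0 (cast_ne p hN hQn) (of_map_of_injective (hζL ▸ hζ') hi) hn0
        (hi (by rw [map_pow, hθ', hθ.pow_eq_one, map_one])) ht' hw00 ?_ ?_ ?_)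
      · obtain ⟨v1, hv1⟩ := hpole
        obtain ⟨w1, e, he⟩ := v1.exists_over (L := L)
        obtain ⟨he0, he⟩ := FFPrime.liesOverWith_iff.mp he
        refine ⟨w1, ?_⟩
        rw [← hteq, he t ht]
        exact mul_neg_of_pos_of_neg (by exact_mod_cast he0) hv1
      · intro v hv
        have h1 := hwv v hv.ne (by rintro rfl; omega)
        have h2 : (1 : ℤ) ≤ Q := by exact_mod_cast hQ0
        rw [abs_of_neg hv] at h1
        nlinarith
      · intro v hv
        by_cases hne : v = w0
        · subst hne
          rw [← v.ord_nonneg_iff hw00]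
          have h2 : 0 ≤ v.ord (l' - 1) := by
            rw [← not_lt, ← hw0.neg_iff, not_lt, map_sub, map_one]
            exact W.le_ord_sub hl W.ord_one.ge
          have := v.le_ord_add hwpos.le h2
          rwa [sub_add_cancel] at this
        · have := hwv v hv.ne' hne
          have := abs_nonneg (v.val t')
          omega
    · rw [← map_one (algebraMap L E), ← map_add, ← map_sub, hw0.pos_iff]
      rwa [show 1 + w - l' = w - (l' - 1) by ring]
  intro hgood
  have hnra : ∀ y, 0 ≤ W.ord y → ¬ 0 < W.ord (y ^ q - (1 + w)) := by
    intro y hy h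
    refine hnr y hy ?_
    have := W.lt_ord_add h hwl
    rwa [sub_add_sub_cancel] at this
  have ha0 : 0 ≤ W.ord (1 + w) := by
    have := W.le_ord_add hwl.le hl
    rwa [sub_add_cancel] at this
  have ha : W.ord (1 + w) = 0 := by
    refine le_antisymm (not_lt.mp fun h => hnra 0 (by simp [W.ord_zero]) ?_) ha0
    rwa [zero_pow hq.ne_zero, zero_sub, W.ord_neg]
  have hane : 1 + w ≠ 0 := W.ne_zero_of_ord (n := 0) ha
  rw [W.ord_neg_iff hx0] at hWx
  have hqpos : (0 : ℚ) < q := by exact_mod_cast hq.pos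
  have hr : 0 < -(q * W.val x) := by nlinarith
  have aux : ∀ d : E, d ≠ 0 → 0 ≤ W.ord d → W.val d < -(q * W.val x) →
      ∃ u, u ≠ 0 ∧ 0 < W.ord (u - 1) ∧ u * (d * x ^ q) = d * x ^ q + d ^ 2 + 1 := by
    intro d hd hd0 hdr
    have hdx : d * x ^ q ≠ 0 := mul_ne_zero hd (pow_ne_zero _ hx0)
    have h1 : 0 < W.ord ((d ^ 2 + 1) * (d * x ^ q)⁻¹) := by
      refine W.ord_mul_pos (W.le_ord_add (W.ord_pow_nonneg hd0 2) W.ord_one.ge) ?_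
      rw [W.ord_pos_iff (inv_ne_zero hdx), W.val_inv hdx, W.val_mul hd (pow_ne_zero _ hx0), W.val_pow hx0]
      linarith
    have h2 : 0 < W.ord (1 + (d ^ 2 + 1) * (d * x ^ q)⁻¹ - 1) := by rwa [add_sub_cancel_left]
    exact ⟨_, W.ne_zero_of_ord (n := 0) (W.one_unit h2), h2, by field_simp; ring⟩
  let m : ℤ := ⌊W.val c0 / -(q * W.val x)⌋
  have hc : c0 * x ^ ((q : ℤ) * m) ≠ 0 := mul_ne_zero hc0 (zpow_ne_zero _ hx0)
  have hcv : W.val (c0 * x ^ ((q : ℤ) * m)) = W.val c0 - m * -(q * W.val x) := by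
    rw [W.val_mul hc0 (zpow_ne_zero _ hx0), W.val_zpow hx0]; push_cast; ring
  obtain ⟨u1, hu1, hu1', e1⟩ := aux (1 + w) hane ha0 (by rwa [W.val_eq_of_ord (n := 0) ha])
  obtain ⟨u2, hu2, hu2', e2⟩ := aux _ hc
    ((W.ord_nonneg_iff hc).mpr (by rw [hcv]; exact Int.sub_floor_div_mul_nonneg _ hr))
    (by rw [hcv]; exact Int.sub_floor_div_mul_lt _ hr)
  have hPP := (hgood.resolve_left hx0) w _ u1 u2 hwR hc hane hu1 hu2 e1 e2
  rw [← pow_one q] at hPP hζ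
  obtain ⟨π, hπ, hπc⟩ := W.obstruct hq (m := 1) (W.natCast_ord p (by rw [pow_one]; exact cast_ne p hN hqn)) hζ
    ![u1, u2, 1 + w] hu1' hu2' ha hnra (by rwa [pow_one]) hPP
  refine hnm (π / x ^ m) (div_ne_zero hπ (zpow_ne_zero _ hx0)) ?_
  rw [W.val_div hπ (zpow_ne_zero _ hx0), W.val_zpow hx0]
  rw [pow_one, hcv] at hπc
  linear_combination hπc

end

section
variable {p q : ℕ} [Fact p.Prime]

lemma exists_poles {K : Type} [Field K] [IsFF p K] {S : Set (FFPrime K)} (hS : S.Finite) (hne : S.Nonempty) : ∃ t : K, t ≠ 0 ∧ (∀ v ∈ S, v.val t < 0) ∧ ∀ v, v ∉ S → 0 ≤ v.val t := by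
  classical
  choose f hf0 hf1 hf2 using fun v : FFPrime K => exists_only_pole p v
  have hS' : ∀ v, v ∈ hS.toFinset ↔ v ∈ S := fun v => hS.mem_toFinset
  have key : ∀ v ∈ S, v.ord (∑ u ∈ hS.toFinset, f u) = v.ord (f v) := by
    intro v hv
    rw [← Finset.add_sum_erase _ _ ((hS' v).mpr hv)]
    refine v.ord_add_eq_left (lt_of_lt_of_le ((v.ord_neg_iff (hf0 v)).mpr (hf1 v)) ?_)
    refine v.le_ord_sum _ _ fun u hu => (v.ord_nonneg_iff (hf0 u)).mpr (hf2 u v ?_)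
    exact (Finset.ne_of_mem_erase hu).symm
  have h0 : (∑ u ∈ hS.toFinset, f u) ≠ 0 := by
    obtain ⟨v, hv⟩ := hne
    intro h
    have := key v hv
    rw [h, v.ord_zero] at this
    exact v.ord_ne_top _ (hf0 v) this.symm
  refine ⟨_, h0, fun v hv => ?_, fun v hv => ?_⟩
  · rw [← v.ord_neg_iff h0, key v hv, v.ord_neg_iff (hf0 v)]; exact hf1 v
  · rw [← v.ord_nonneg_iff h0]
    refine v.le_ord_sum _ _ fun u hu => (v.ord_nonneg_iff (hf0 u)).mpr (hf2 u v ?_)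
    rintro rfl
    exact hv ((hS' _).mp hu)

lemma exists_cyc (B : Type) [Field B] (n : ℕ) [NeZero n] [NeZero (n : B)] : ∃ (E : Type) (_ : Field E) (_ : Algebra B E) (_ : FiniteDimensional B E) (θ : E),
      IsPrimitiveRoot θ n ∧ Algebra.adjoin B {θ} = ⊤ := by
  have hθ := IsCyclotomicExtension.zeta_spec n B (CyclotomicField n B)
  exact ⟨CyclotomicField n B, inferInstance, inferInstance, IsCyclotomicExtension.finiteDimensional {n} B (CyclotomicField n B), _, hθ,
    IsCyclotomicExtension.adjoin_primitive_root_eq_top hθ⟩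

lemma final_core {K B E : Type} [Field K] [Field B] [Field E] [Algebra K B] [Algebra B E] [Algebra K E]
    [IsScalarTower K B E] [IsFF p K] [Algebra.IsAlgebraic K B] [FiniteDimensional B E] [Fact q.Prime]
    {S : Set (FFPrime K)} (hne : S.Nonempty) (hb : ∀ V : FFVal B, ∃ C, QB p q K V C) {C : ℕ} (hC : ∀ V : FFVal B, ∀ v ∈ S, V.RestrictsTo v (algebraMap K B) → QB p q K V C)
    {t : K} (ht : t ≠ 0) (htS : ∀ v ∈ S, v.val t < 0) (htn : ∀ v, v ∉ S → 0 ≤ v.val t) {N N1 : ℕ} (hN : 0 < N)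
    (hN1 : ∀ v ∈ S, C + padicValNat q (v.val t).natAbs < N1) (hs : C ≤ padicValNat q N) (hqn : q ∣ p ^ N - 1) (hQn : q ^ N1 ∣ p ^ N - 1) {θ : E} (hθ : IsPrimitiveRoot θ (p ^ N - 1))
    (hθt : Algebra.adjoin B {θ} = ⊤) : FODefinable (sIntegralClosure S B) := by
  have hq := (Fact.out : q.Prime)
  have hp := (Fact.out : p.Prime)
  have h1N : 1 < p ^ N := one_lt_pow hN.ne' hp.one_lt
  have hn0 : 0 < p ^ N - 1 := by omega
  have hcE : CharP E p := by
    have : CharP K p := IsFF.charP p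
    exact charP_of_injective_algebraMap (algebraMap K E).injective p
  have hQ0 : 0 < q ^ N1 := pow_pos hq.pos _
  have hζ : IsPrimitiveRoot (θ ^ ((p ^ N - 1) / q)) q := hθ.pow hn0 (Nat.div_mul_cancel hqn).symm
  have hζ' : IsPrimitiveRoot (θ ^ ((p ^ N - 1) / q ^ N1)) (q ^ N1) := hθ.pow hn0 (Nat.div_mul_cancel hQn).symm
  have hBE : Algebra.IsAlgebraic B E := inferInstance
  have hKE : Algebra.IsAlgebraic K E := Algebra.IsAlgebraic.trans K B E
  have heq : sIntegralClosure S B = {x : B | Good q (q ^ N1) (θ ^ ((p ^ N - 1) / q)) (θ ^ ((p ^ N - 1) / q ^ N1)) θ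
      (algebraMap K E t) (algebraMap B E x)} := by
    ext x
    constructor
    · intro hx
      refine good_of p hζ (cast_ne p hN hqn) (fun W v hv hW w hw => ?_) hx
      refine rr_pos hN hθ hθt hqn (v := v) (C := C) ⟨hW, fun V hV => hC V v hv ?_⟩ hs hζ' (htS v hv) (hN1 v hv) hw
      obtain ⟨c, hc, h⟩ := hW
      exact ⟨c, hc, fun x => by rw [hV, ← IsScalarTower.algebraMap_apply]; exact h x⟩
    · intro hx
      by_contra hn
      obtain ⟨v, hv⟩ := hne
      exact not_good (p := p) hN hθ hθt hqn hQ0 hQn hζ hζ' ht ⟨v, htS v hv⟩ htn hb hn hx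
  rw [heq]
  exact good_def _ _ _ _ _ _

end

theorem statement3 (p q : ℕ) [Fact p.Prime] (hq : q.Prime) (hqp : q ≠ p)
    (K : Type) [Field K] [Algebra (RatFunc (ZMod p)) K]
    [FiniteDimensional (RatFunc (ZMod p)) K]
    (BK : Type) [Field BK] [Algebra K BK] [Algebra.IsAlgebraic K BK]
    [Algebra (RatFunc (ZMod p)) BK] [IsScalarTower (RatFunc (ZMod p)) K BK]
    (hqb : IsQBounded q (RatFunc (ZMod p)) BK)
    (S : Set (FFPrime K)) (hSfin : S.Finite) (hSne : S.Nonempty)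
    (hcase : (∀ v ∈ S, UniformlyQBoundedAt q BK v) ∨ IsGalois K BK) :
    FODefinable (sIntegralClosure S BK) := by
  have hqf : Fact q.Prime := ⟨hq⟩
  have hp := (Fact.out : p.Prime)
  have hK : IsFF p K := ⟨⟨algebraMap _ _, RingHom.finite_algebraMap.mpr inferInstance⟩, ⟨hSne.some⟩⟩
  have hF : IsFF p (RatFunc (ZMod p)) := ⟨⟨RingHom.id _, RingHom.Finite.id _⟩, by
    obtain ⟨v, _⟩ := FFPrime.exists_under (K := RatFunc (ZMod p)) hSne.some
    exact ⟨v⟩⟩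
  have hb : ∀ V : FFVal BK, ∃ C, QB p q K V C := fun V => qb_of_bounded hqb V
  obtain ⟨C, hC⟩ := qb_unif hb hSfin hcase
  obtain ⟨t, ht, htS, htn⟩ := exists_poles (p := p) hSfin hSne
  let N1 := C + ∑ v ∈ hSfin.toFinset, padicValNat q (v.val t).natAbs + 1
  have hN1 : ∀ v ∈ S, C + padicValNat q (v.val t).natAbs < N1 := by
    intro v hv
    have := single_le_sum (f := fun v : FFPrime K => padicValNat q (v.val t).natAbs)
      (fun _ _ => Nat.zero_le _) (hSfin.mem_toFinset.mpr hv)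
    simp only [N1]
    omega
  let N := (q ^ N1).totient * q ^ C
  have hN : 0 < N := Nat.mul_pos (Nat.totient_pos.mpr (pow_pos hq.pos _)) (pow_pos hq.pos _)
  have hs : C ≤ padicValNat q N := (padicValNat_dvd_iff_le hN.ne').mp (Dvd.intro_left _ rfl)
  have hQn : q ^ N1 ∣ p ^ N - 1 := by
    have hcop : p.Coprime (q ^ N1) := Nat.Coprime.pow_right _ ((Nat.coprime_primes hp hq).mpr hqp.symm)
    have h1 := (Nat.ModEq.pow_totient hcop).pow (q ^ C)
    rw [← pow_mul, one_pow] at h1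
    exact (Nat.modEq_iff_dvd' (Nat.one_le_pow _ _ hp.pos)).mp h1.symm
  have hqn : q ∣ p ^ N - 1 := (dvd_pow_self q (Nat.succ_ne_zero _)).trans hQn
  have h1N : 1 < p ^ N := one_lt_pow hN.ne' hp.one_lt
  have : CharP BK p := by
    have : CharP K p := IsFF.charP p
    exact charP_of_injective_algebraMap (algebraMap K BK).injective p
  have : NeZero (p ^ N - 1) := ⟨by omega⟩
  have : NeZero ((p ^ N - 1 : ℕ) : BK) := ⟨cast_ne p hN dvd_rfl⟩
  obtain ⟨E, _, _, _, θ, hθ, hθt⟩ := exists_cyc BK (p ^ N - 1)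
  let _ : Algebra K E := ((algebraMap BK E).comp (algebraMap K BK)).toAlgebra
  have : IsScalarTower K BK E := of_algebraMap_eq fun _ => rfl
  exact final_core hSne hb hC ht htS htn hN hN1 hs hqn hQn hθ hθt
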